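/- Let M be a compact topological n-manifold and let P be a natural number. Then there exists a constant C (depending on M and P alone) such that for every prime p ≤ P, every finite p-group G acting continuously and effectively on M has a characteristic subgroup H ≤ G of index at most C, containing the center Z(G), such that the set Stab(H,M) of stabilizer subgroups of the H-action is finite with |Stab(H,M)| ≤ C. -/

import Mathlib

open Topology

universe u v w

theorem rank_le_add_of_relation {k : Type*} [Field k] {P V W U : Type v}
    [AddCommGroup P] [Module k P] [AddCommGroup V] [Module k V]
    [AddCommGroup W] [Module k W] [AddCommGroup U] [Module k U]
    (f : P →ₗ[k] V) (hf : Function.Surjective f) (g : P →ₗ[k] W) (t : U →ₗ[k] V)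
    (h : ∀ q, g q = 0 → f q ∈ LinearMap.range t) :
    Module.rank k V ≤ Module.rank k U + Module.rank k W := by
  have h1 := Submodule.rank_quotient_add_rank (LinearMap.range t)
  have h2 : Module.rank k (V ⧸ LinearMap.range t) ≤ Module.rank k W := by
    let e : (P ⧸ LinearMap.ker g) →ₗ[k] (V ⧸ LinearMap.range t) :=
      (LinearMap.ker g).liftQ ((LinearMap.range t).mkQ ∘ₗ f) (by
        intro q hq
        simpa using h q hq)
    have he : Function.Surjective e := by
      intro x
      obtain ⟨y, rfl⟩ := Submodule.mkQ_surjective _ x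
      obtain ⟨q, rfl⟩ := hf y
      exact ⟨Submodule.Quotient.mk q, rfl⟩
    refine (LinearMap.rank_le_of_surjective e he).trans
      (LinearMap.rank_le_of_injective ((LinearMap.ker g).liftQ g le_rfl) ?_)
    rw [← LinearMap.ker_eq_bot]
    exact Submodule.ker_liftQ_eq_bot _ _ _ le_rfl
  rw [← h1, add_comm]
  exact add_le_add (rank_range_le t) h2

/-- Nonnegatively graded homological complexes with commuting automorphisms of order `p`. -/
structure Cpx (p : ℕ) [Fact p.Prime] (ι : Type) where
  X : ℕ → Type u
  [acg : ∀ j, AddCommGroup (X j)]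
  [mod : ∀ j, Module (ZMod p) (X j)]
  d : ∀ j, X (j + 1) →ₗ[ZMod p] X j
  dd : ∀ j x, d j (d (j + 1) x) = 0
  g : ι → ∀ j, Module.End (ZMod p) (X j)
  g_d : ∀ i j x, g i j (d j x) = d j (g i (j + 1) x)
  g_comm : ∀ i i' j x, g i j (g i' j x) = g i' j (g i j x)
  g_pow : ∀ i j, g i j ^ p = 1

attribute [instance] Cpx.acg Cpx.mod

namespace Cpx

variable {p : ℕ} [Fact p.Prime] {ι : Type}

def cyc (L : Cpx.{u} p ι) : ∀ N, Submodule (ZMod p) (L.X N)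
  | 0 => ⊤
  | N + 1 => LinearMap.ker (L.d N)

def bd (L : Cpx.{u} p ι) (N : ℕ) : Submodule (ZMod p) (L.X N) := LinearMap.range (L.d N)

theorem bd_le_cyc (L : Cpx.{u} p ι) (N : ℕ) : L.bd N ≤ L.cyc N := by
  rintro x ⟨y, rfl⟩
  cases N with
  | zero => trivial
  | succ N => exact L.dd N y

abbrev H (L : Cpx.{u} p ι) (N : ℕ) : Type u :=
  (L.cyc N) ⧸ ((L.bd N).comap (L.cyc N).subtype)

noncomputable def h (L : Cpx.{u} p ι) (N : ℕ) : Cardinal.{u} := Module.rank (ZMod p) (L.H N)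

/-- The homology vanishes in degree `N`. -/
def Acyc (L : Cpx.{u} p ι) (N : ℕ) : Prop := L.cyc N ≤ L.bd N

theorem Acyc.h_eq {L : Cpx.{u} p ι} {N : ℕ} (hL : L.Acyc N) : L.h N = 0 := by
  unfold h
  rw [rank_eq_zero_iff]
  intro x
  obtain ⟨y, rfl⟩ := Submodule.mkQ_surjective _ x
  refine ⟨1, one_ne_zero, ?_⟩
  rw [one_smul, Submodule.mkQ_apply, Submodule.Quotient.mk_eq_zero]
  exact hL y.2

theorem acyc_of_h {L : Cpx.{u} p ι} {N : ℕ} (hL : L.h N = 0) : L.Acyc N := by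
  intro x hx
  have := (rank_zero_iff_forall_zero.1 hL) (Submodule.Quotient.mk ⟨x, hx⟩)
  rwa [Submodule.Quotient.mk_eq_zero] at this

/-- Chain maps, commuting with the automorphisms. -/
structure Hom (A B : Cpx.{u} p ι) where
  f : ∀ j, A.X j →ₗ[ZMod p] B.X j
  f_d : ∀ j x, f j (A.d j x) = B.d j (f (j + 1) x)
  f_g : ∀ i j x, f j (A.g i j x) = B.g i j (f j x)

variable {A B C : Cpx.{u} p ι}

theorem Hom.map_cyc (f : Hom A B) (N : ℕ) {x : A.X N} (hx : x ∈ A.cyc N) :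
    f.f N x ∈ B.cyc N := by
  cases N with
  | zero => trivial
  | succ N =>
    change B.d N _ = 0
    rw [← f.f_d, show A.d N x = 0 from hx, map_zero]

theorem Hom.map_bd (f : Hom A B) (N : ℕ) {x : A.X N} (hx : x ∈ A.bd N) :
    f.f N x ∈ B.bd N := by
  obtain ⟨y, rfl⟩ := hx
  exact ⟨f.f _ y, (f.f_d _ _).symm⟩

/-- The map to homology of a linear map landing in cycles. -/
def toH {V : Type*} [AddCommGroup V] [Module (ZMod p) V] (B : Cpx.{u} p ι) (N : ℕ)
    (f : V →ₗ[ZMod p] B.X N) (hf : ∀ v, f v ∈ B.cyc N) : V →ₗ[ZMod p] B.H N :=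
  Submodule.mkQ _ ∘ₗ f.codRestrict (B.cyc N) hf

theorem toH_eq_zero {V : Type*} [AddCommGroup V] [Module (ZMod p) V] {B : Cpx.{u} p ι} {N : ℕ}
    {f : V →ₗ[ZMod p] B.X N} {hf : ∀ v, f v ∈ B.cyc N} {v : V} :
    B.toH N f hf v = 0 ↔ f v ∈ B.bd N := by
  simp [toH]

theorem toH_mem_range {V W : Type*} [AddCommGroup V] [Module (ZMod p) V]
    [AddCommGroup W] [Module (ZMod p) W] {B : Cpx.{u} p ι} {N : ℕ}
    {f : V →ₗ[ZMod p] B.X N} {hf : ∀ v, f v ∈ B.cyc N} {v : V}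
    {t : W →ₗ[ZMod p] B.X N} {ht : ∀ v, t v ∈ B.cyc N} (w : W) (hw : f v - t w ∈ B.bd N) :
    B.toH N f hf v = B.toH N t ht w := by
  exact (Submodule.Quotient.eq _).2 hw

theorem cycH_surjective (B : Cpx.{u} p ι) (N : ℕ) :
    Function.Surjective (B.toH N (B.cyc N).subtype (fun v => v.2)) := by
  intro x
  obtain ⟨y, rfl⟩ := Submodule.mkQ_surjective _ x
  exact ⟨y, rfl⟩

/-- General rank estimate for homology groups. -/
theorem h_le_add (A B C : Cpx.{u} p ι) (M N K : ℕ)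
    (t : A.cyc M →ₗ[ZMod p] B.X N) (ht : ∀ v, t v ∈ B.cyc N)
    (ht' : ∀ v : A.cyc M, (v : A.X M) ∈ A.bd M → t v ∈ B.bd N)
    (q : B.cyc N →ₗ[ZMod p] C.X K) (hq : ∀ v, q v ∈ C.cyc K)
    (hh : ∀ v : B.cyc N, q v ∈ C.bd K → ∃ a : A.cyc M, (v : B.X N) - t a ∈ B.bd N) :
    B.h N ≤ A.h M + C.h K := by
  refine rank_le_add_of_relation (B.toH N (B.cyc N).subtype (fun v => v.2))
    (cycH_surjective B N) (C.toH K q hq)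
    (Submodule.liftQ _ (B.toH N t ht) ?_) ?_
  · intro x hx
    rw [LinearMap.mem_ker, toH_eq_zero]
    exact ht' x hx
  · intro v hv
    rw [toH_eq_zero] at hv
    obtain ⟨a, ha⟩ := hh v hv
    refine ⟨Submodule.Quotient.mk a, ?_⟩
    rw [Submodule.liftQ_apply]
    exact (toH_mem_range a ha).symm

theorem h_le_of_surj (A B : Cpx.{u} p ι) (M N : ℕ)
    (t : A.cyc M →ₗ[ZMod p] B.X N) (ht : ∀ v, t v ∈ B.cyc N)
    (ht' : ∀ v : A.cyc M, (v : A.X M) ∈ A.bd M → t v ∈ B.bd N)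
    (hh : ∀ v ∈ B.cyc N, ∃ a : A.cyc M, v - t a ∈ B.bd N) : B.h N ≤ A.h M := by
  have := rank_le_add_of_relation (W := PUnit) (B.toH N (B.cyc N).subtype (fun v => v.2))
    (cycH_surjective B N) 0
    (Submodule.liftQ ((A.bd M).comap (A.cyc M).subtype) (B.toH N t ht) (by
      intro x hx
      rw [LinearMap.mem_ker, toH_eq_zero]
      exact ht' x hx)) (by
      intro v _
      obtain ⟨a, ha⟩ := hh v v.2
      exact ⟨Submodule.Quotient.mk a, (toH_mem_range a ha).symm⟩)
  simpa [h] using this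

/-- A short exact sequence of complexes. -/
structure SES (i : Hom A B) (q : Hom B C) : Prop where
  inj : ∀ j, Function.Injective (i.f j)
  surj : ∀ j, Function.Surjective (q.f j)
  exact : ∀ j x, q.f j x = 0 ↔ ∃ a, i.f j a = x

theorem SES.cyc_lift {i : Hom A B} {q : Hom B C} (s : SES i q) {N : ℕ} {a : A.X N}
    (ha : i.f N a ∈ B.cyc N) : a ∈ A.cyc N := by
  cases N with
  | zero => trivial
  | succ N =>
    refine s.inj N ?_
    rw [i.f_d, map_zero]
    exact ha

/-- If the quotient is acyclic one degree up, the map on homology is injective. -/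
theorem SES.inj_H {i : Hom A B} {q : Hom B C} (s : SES i q) {N : ℕ} (hC : C.Acyc (N + 1))
    {a : A.X N} (hab : i.f N a ∈ B.bd N) : a ∈ A.bd N := by
  obtain ⟨b, hb⟩ := hab
  have h1 : q.f (N + 1) b ∈ C.cyc (N + 1) := by
    change C.d N _ = 0
    rw [← q.f_d, hb, s.exact]
    exact ⟨a, rfl⟩
  obtain ⟨c, hc⟩ := hC h1
  obtain ⟨b', rfl⟩ := s.surj _ c
  rw [← q.f_d, ← sub_eq_zero, ← map_sub, s.exact] at hc
  obtain ⟨a', ha'⟩ := hc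
  refine ⟨-a', s.inj N ?_⟩
  rw [i.f_d, map_neg, ha', neg_sub, map_sub, B.dd, sub_zero, hb]

/-- If the quotient is acyclic, the map on homology is surjective. -/
theorem SES.surj_H {i : Hom A B} {q : Hom B C} (s : SES i q) {N : ℕ} (hC : C.Acyc N)
    {b : B.X N} (hb : b ∈ B.cyc N) : ∃ a ∈ A.cyc N, b - i.f N a ∈ B.bd N := by
  obtain ⟨c, hc⟩ := hC (q.map_cyc N hb)
  obtain ⟨b', rfl⟩ := s.surj _ c
  rw [← q.f_d, ← sub_eq_zero, ← map_sub, s.exact] at hc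
  obtain ⟨a, ha⟩ := hc
  have : i.f N (-a) = b - B.d N b' := by rw [map_neg, ha]; abel
  refine ⟨-a, s.cyc_lift (this ▸ sub_mem hb (B.bd_le_cyc N ⟨b', rfl⟩)), ?_⟩
  rw [this]
  exact ⟨b', by abel⟩

theorem h_zero_cpx_aux (A B : Cpx.{u} p ι) (N M : ℕ) (t : A.cyc M →ₗ[ZMod p] B.X N)
    (ht : ∀ v, t v ∈ B.cyc N) (hinj : ∀ v : A.cyc M, t v ∈ B.bd N → (v : A.X M) ∈ A.bd M) :
    A.h M ≤ B.h N := by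
  have := rank_le_add_of_relation (U := PUnit) (A.toH M (A.cyc M).subtype (fun v => v.2))
    (cycH_surjective A M) (B.toH N t ht) 0 (by
      intro v hv
      rw [toH_eq_zero] at hv
      have : A.toH M (A.cyc M).subtype (fun v => v.2) v = 0 := by
        exact toH_eq_zero.2 (hinj v hv)
      rw [this]; exact zero_mem _)
  simpa [h] using this

theorem SES.h_le_of_acyc {i : Hom A B} {q : Hom B C} (s : SES i q) {N : ℕ}
    (hC : C.Acyc (N + 1)) : A.h N ≤ B.h N :=
  h_zero_cpx_aux A B N N (i.f N ∘ₗ (A.cyc N).subtype) (fun v => i.map_cyc N v.2)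
    (fun _ hv => s.inj_H hC hv)

/-- If the total complex is acyclic, the homology of the quotient embeds in that of the
subcomplex. -/
theorem SES.h_le_shift {i : Hom A B} {q : Hom B C} (s : SES i q) {N : ℕ}
    (hB : B.Acyc (N + 1)) : C.h (N + 1) ≤ A.h N := by
  let P : Submodule (ZMod p) (B.X (N + 1) × A.X N) :=
    LinearMap.ker ((B.d N).coprod (-i.f N))
  have hP : ∀ v : P, i.f N v.1.2 = B.d N v.1.1 := by
    rintro ⟨v, hv⟩
    simp only [P, LinearMap.mem_ker, LinearMap.coprod_apply, LinearMap.neg_apply] at hv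
    exact (add_neg_eq_zero.1 hv).symm
  have := rank_le_add_of_relation (P := P) (U := PUnit)
    (C.toH (N + 1) (q.f (N + 1) ∘ₗ LinearMap.fst _ _ _ ∘ₗ P.subtype) (by
      intro v
      change C.d N (q.f (N + 1) v.1.1) = 0
      rw [← q.f_d, ← hP, s.exact]
      exact ⟨_, rfl⟩)) ?_
    (A.toH N (LinearMap.snd _ _ _ ∘ₗ P.subtype) (by
      intro v
      apply s.cyc_lift
      change i.f N v.1.2 ∈ _
      rw [hP]
      exact B.bd_le_cyc N ⟨_, rfl⟩)) 0 ?_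
  · simpa [h] using this
  · intro x
    obtain ⟨⟨c, hc⟩, rfl⟩ := Submodule.mkQ_surjective _ x
    obtain ⟨b, rfl⟩ := s.surj _ c
    have h1 : q.f N (B.d N b) = 0 := by rw [q.f_d]; exact hc
    rw [s.exact] at h1
    obtain ⟨a, ha⟩ := h1
    exact ⟨⟨(b, a), by simp [P, ha]⟩, rfl⟩
  · intro v hv
    rw [toH_eq_zero] at hv
    obtain ⟨a', ha'⟩ := hv
    have h2 : v.1.1 - i.f (N + 1) a' ∈ B.cyc (N + 1) := by
      change B.d N _ = 0
      rw [map_sub, ← i.f_d, ha', ← hP]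
      exact sub_self _
    have h3 := q.map_bd (N + 1) (hB h2)
    have h4 : C.toH (N + 1) (q.f (N + 1) ∘ₗ LinearMap.fst _ _ _ ∘ₗ P.subtype) (by
      intro v
      change C.d N (q.f (N + 1) v.1.1) = 0
      rw [← q.f_d, ← hP, s.exact]
      exact ⟨_, rfl⟩) v = 0 := by
      rw [toH_eq_zero]
      change q.f (N + 1) v.1.1 ∈ _
      rwa [map_sub, (s.exact (N + 1) _).2 ⟨a', rfl⟩, sub_zero] at h3
    rw [h4]
    exact zero_mem _

end Cpx

namespace Cpx

variable {p : ℕ} [Fact p.Prime] {ι : Type}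

/-- The operators `g - 1` and `1 + g + ⋯ + g ^ (p - 1)`, alternating with the parity. -/
noncomputable def rho (L : Cpx.{u} p ι) (i : ι) (n : ℕ) (j : ℕ) : Module.End (ZMod p) (L.X j) :=
  if Even n then L.g i j - 1 else ∑ m ∈ Finset.range p, L.g i j ^ m

theorem pow_comm {V W : Type*} [AddCommGroup V] [Module (ZMod p) V] [AddCommGroup W]
    [Module (ZMod p) W] (f : V →ₗ[ZMod p] W) (a : Module.End (ZMod p) V)
    (b : Module.End (ZMod p) W) (h : ∀ x, f (a x) = b (f x)) (m : ℕ) (x : V) :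
    f ((a ^ m) x) = (b ^ m) (f x) := by
  induction m generalizing x with
  | zero => rfl
  | succ m ih => rw [pow_succ, pow_succ, Module.End.mul_apply, Module.End.mul_apply, ih, h]

/-- A linear map intertwining the automorphisms intertwines the operators `rho`. -/
theorem rho_comm {V W : Cpx.{u} p ι} {i i' : ι} {j j' : ℕ} (f : V.X j →ₗ[ZMod p] W.X j')
    (h : ∀ x, f (V.g i j x) = W.g i' j' (f x)) (n : ℕ) (x : V.X j) :
    f (V.rho i n j x) = W.rho i' n j' (f x) := by
  unfold rho
  split_ifs
  · simp [h]
  · simp only [LinearMap.sum_apply, map_sum, pow_comm f _ _ h]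

theorem rho_d (L : Cpx.{u} p ι) (i : ι) (n j : ℕ) (x : L.X (j + 1)) :
    L.rho i n j (L.d j x) = L.d j (L.rho i n (j + 1) x) :=
  (rho_comm (L.d j) (fun x => (L.g_d i j x).symm) n x).symm

theorem rho_g (L : Cpx.{u} p ι) (i i' : ι) (n j : ℕ) (x : L.X j) :
    L.g i' j (L.rho i n j x) = L.rho i n j (L.g i' j x) :=
  rho_comm (L.g i' j) (fun x => L.g_comm i' i j x) n x

theorem rho_rho (L : Cpx.{u} p ι) (i : ι) (n j : ℕ) (x : L.X j) :
    L.rho i n j (L.rho i (n + 1) j x) = 0 := by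
  rw [← Module.End.mul_apply]
  unfold rho
  rcases Nat.even_or_odd n with h | h
  · rw [if_pos h, if_neg (by simpa [Nat.even_add_one] using h), mul_geom_sum, L.g_pow, sub_self]
    rfl
  · rw [if_neg (by simpa using h), if_pos (by simpa [Nat.even_add_one] using h), geom_sum_mul,
      L.g_pow, sub_self]
    rfl

theorem rho_of_trivial (L : Cpx.{u} p ι) {i : ι} {j : ℕ} (h : L.g i j = 1) (n : ℕ) :
    L.rho i n j = 0 := by
  unfold rho
  rw [h]
  split_ifs
  · exact sub_self _
  · simp only [one_pow, Finset.sum_const, Finset.card_range]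
    ext x
    simp [← Nat.cast_smul_eq_nsmul (ZMod p)]

/-- Tuples of chains of degree at most `N`. -/
abbrev TX (L : Cpx.{u} p ι) (N : ℕ) : Type u := ∀ j : Fin (N + 1), L.X j

/-- The total complex of the double complex computing the homology of the cyclic group
generated by `g i` with coefficients in `L`, with parity shift `b`. -/
noncomputable abbrev T (b : ℕ) (i : ι) (L : Cpx.{u} p ι) : Cpx.{u} p ι where
  X N := ∀ j : Fin (N + 1), L.X j
  d N := LinearMap.pi fun j : Fin (N + 1) => L.d j ∘ₗ LinearMap.proj j.succ +
    ((-1 : ZMod p) ^ (j : ℕ)) • (L.rho i (b + N - j) j ∘ₗ LinearMap.proj j.castSucc)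
  dd N F := by
    ext j
    have h1 : b + (N + 1) - (j + 1) = b + N - j := by omega
    have h2 : b + (N + 1) - j = b + N - j + 1 := by have := j.2; omega
    have h3 := L.dd j (F j.succ.succ)
    have h4 := L.rho_rho i (b + N - j) j (F j.castSucc.castSucc)
    have h5 := L.rho_d i (b + N - j) j (F j.succ.castSucc)
    simp only [LinearMap.pi_apply, LinearMap.add_apply, LinearMap.comp_apply,
      LinearMap.proj_apply, LinearMap.smul_apply, map_add, map_smul, Fin.val_succ,
      Fin.val_castSucc, h1, h2, Pi.zero_apply]
    erw [h3, h4, ← h5, smul_zero, add_zero, zero_add, pow_succ, mul_neg_one, neg_smul]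
    exact neg_add_cancel _
  g i' N := LinearMap.pi fun j : Fin (N + 1) => L.g i' j ∘ₗ LinearMap.proj j
  g_d i' N F := by
    ext j
    have h1 := L.g_d i' j (F j.succ)
    have h2 := L.rho_g i i' (b + N - j) j (F j.castSucc)
    simp only [LinearMap.pi_apply, LinearMap.add_apply, LinearMap.comp_apply,
      LinearMap.proj_apply, LinearMap.smul_apply, map_add, map_smul]
    erw [h1, h2]
    rfl
  g_comm i' i'' N F := by
    ext j
    exact L.g_comm i' i'' j (F j)
  g_pow i' N := by
    refine LinearMap.ext fun F => funext fun j => ?_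
    have := pow_comm (LinearMap.proj j : (∀ j : Fin (N + 1), L.X j) →ₗ[ZMod p] L.X j)
      (LinearMap.pi fun j : Fin (N + 1) => L.g i' j ∘ₗ LinearMap.proj j) (L.g i' j)
      (fun x => rfl) p F
    rw [L.g_pow] at this
    exact this

theorem T_d (b : ℕ) (i : ι) (L : Cpx.{u} p ι) (N : ℕ) (F : L.TX (N + 1))
    (j : Fin (N + 1)) : (T b i L).d N F j =
    L.d j (F j.succ) + ((-1 : ZMod p) ^ (j : ℕ)) • L.rho i (b + N - j) j (F j.castSucc) := rfl


theorem T_g (b : ℕ) (i i' : ι) (L : Cpx.{u} p ι) (N : ℕ) (F : L.TX N) (j : Fin (N + 1)) :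
    (T b i L).g i' N F j = L.g i' j (F j) := rfl

/-- Truncation of a tuple. -/
def tr (L : Cpx.{u} p ι) {N M : ℕ} (h : N ≤ M) : L.TX M →ₗ[ZMod p] L.TX N :=
  LinearMap.pi fun j => LinearMap.proj (⟨j, by omega⟩ : Fin (M + 1))

theorem tr_apply (L : Cpx.{u} p ι) {N M : ℕ} (h : N ≤ M) (F : L.TX M) (j : Fin (N + 1)) :
    L.tr h F j = F ⟨j, by omega⟩ := rfl

theorem tr_d (L : Cpx.{u} p ι) (i : ι) {N M b b' : ℕ} (h : N ≤ M) (hb : b + M = b' + N)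
    (F : L.TX (M + 1)) :
    L.tr h ((T b i L).d M F) = (T b' i L).d N (L.tr (Nat.succ_le_succ h) F) := by
  refine funext fun j => ?_
  rw [tr_apply, T_d, T_d, hb]
  rfl

theorem tr_cyc (L : Cpx.{u} p ι) (i : ι) {N M b b' : ℕ} (h : N ≤ M) (hb : b + M = b' + N)
    {F : L.TX M} (hF : F ∈ (T b i L).cyc M) : L.tr h F ∈ (T b' i L).cyc N := by
  cases N with
  | zero => trivial
  | succ N =>
    obtain ⟨M, rfl⟩ : ∃ M', M = M' + 1 := ⟨M - 1, by omega⟩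
    change (T b' i L).d N _ = 0
    rw [← tr_d (b := b) L i (Nat.le_of_succ_le_succ h) (by omega),
      show (T b i L).d M F = 0 from hF]
    exact map_zero _

theorem tr_bd (L : Cpx.{u} p ι) (i : ι) {N M b b' : ℕ} (h : N ≤ M) (hb : b + M = b' + N)
    {F : L.TX M} (hF : F ∈ (T b i L).bd M) : L.tr h F ∈ (T b' i L).bd N := by
  obtain ⟨w, rfl⟩ := hF
  exact ⟨_, (tr_d L i h hb w).symm⟩

/-- Extension of a tuple by zero. -/
def ext0 (L : Cpx.{u} p ι) {N : ℕ} (M : ℕ) (w : L.TX N) : L.TX M :=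
  fun j => if h : (j : ℕ) < N + 1 then w ⟨j, h⟩ else 0

theorem tr_ext0 (L : Cpx.{u} p ι) {N M : ℕ} (h : N ≤ M) (w : L.TX N) :
    L.tr h (L.ext0 M w) = w := by
  ext j
  rw [tr_apply, ext0]
  exact dif_pos j.2

/-- The tuple with a single entry in the top degree. -/
def top (L : Cpx.{u} p ι) (N : ℕ) : L.X N →ₗ[ZMod p] L.TX N :=
  LinearMap.single (ZMod p) (fun j : Fin (N + 1) => L.X j) (Fin.last N)

theorem top_last (L : Cpx.{u} p ι) (N : ℕ) (x : L.X N) : L.top N x (Fin.last N) = x :=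
  Pi.single_eq_same (M := fun j : Fin (N + 1) => L.X j) _ _

theorem top_of_lt (L : Cpx.{u} p ι) {N : ℕ} (x : L.X N) (j : Fin (N + 1)) (h : (j : ℕ) < N) :
    L.top N x j = 0 :=
  Pi.single_eq_of_ne (M := fun j : Fin (N + 1) => L.X j) (by
    intro e
    rw [e] at h
    exact absurd h (lt_irrefl _)) _

theorem eq_top_of_tr (L : Cpx.{u} p ι) {N : ℕ} (F : L.TX (N + 1))
    (h : L.tr (Nat.le_succ N) F = 0) : F = L.top (N + 1) (F (Fin.last (N + 1))) := by
  ext j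
  rcases Nat.lt_or_ge j (N + 1) with hj | hj
  · rw [top_of_lt _ _ _ hj]
    exact congrFun h ⟨j, hj⟩
  · obtain rfl : j = Fin.last (N + 1) := Fin.ext (le_antisymm (Nat.le_of_lt_succ j.2) hj)
    rw [top_last]

theorem T_d_top (L : Cpx.{u} p ι) (b : ℕ) (i : ι) (N : ℕ) (x : L.X (N + 1)) :
    (T b i L).d N (L.top (N + 1) x) = L.top N (L.d N x) := by
  refine funext fun j => ?_
  rw [T_d, top_of_lt L x j.castSucc j.2, map_zero, smul_zero, add_zero]
  rcases Nat.lt_or_ge j N with hj | hj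
  · rw [top_of_lt _ _ _ hj, top_of_lt L x j.succ (by simpa using hj), map_zero]
  · obtain rfl : j = Fin.last N := Fin.ext (le_antisymm (Nat.le_of_lt_succ j.2) hj)
    rw [top_last]
    exact congrArg (L.d N) (top_last L (N + 1) x)

theorem top_cyc (L : Cpx.{u} p ι) (b : ℕ) (i : ι) {N : ℕ} {x : L.X N} (hx : x ∈ L.cyc N) :
    L.top N x ∈ (T b i L).cyc N := by
  cases N with
  | zero => trivial
  | succ N =>
    change (T b i L).d N _ = 0
    rw [T_d_top, show L.d N x = 0 from hx]
    exact map_zero _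

theorem top_bd (L : Cpx.{u} p ι) (b : ℕ) (i : ι) {N : ℕ} {x : L.X N} (hx : x ∈ L.bd N) :
    L.top N x ∈ (T b i L).bd N := by
  obtain ⟨y, rfl⟩ := hx
  exact ⟨_, T_d_top L b i N y⟩

theorem cyc_of_top (L : Cpx.{u} p ι) (b : ℕ) (i : ι) {N : ℕ} {x : L.X N}
    (hx : L.top N x ∈ (T b i L).cyc N) : x ∈ L.cyc N := by
  cases N with
  | zero => trivial
  | succ N =>
    have h1 : (T b i L).d N (L.top (N + 1) x) = 0 := hx
    rw [T_d_top] at h1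
    have := congrFun h1 (Fin.last N)
    rwa [top_last] at this

theorem h_T_succ (L : Cpx.{u} p ι) (b : ℕ) (i : ι) (N : ℕ) :
    (T b i L).h (N + 1) ≤ L.h (N + 1) + (T (b + 1) i L).h N := by
  refine h_le_add L (T b i L) (T (b + 1) i L) (N + 1) (N + 1) N
    (L.top (N + 1) ∘ₗ (L.cyc (N + 1)).subtype) (fun v => top_cyc L b i v.2)
    (fun v hv => top_bd L b i hv)
    (L.tr (Nat.le_succ N) ∘ₗ ((T b i L).cyc (N + 1)).subtype)
    (fun v => tr_cyc L i (Nat.le_succ N) (by omega) v.2) ?_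
  rintro ⟨v, hv⟩ ⟨w, hw⟩
  let D : L.TX (N + 1) := (T b i L).d (N + 1) (L.ext0 (N + 2) w)
  have h1 : L.tr (Nat.le_succ N) (v - D) = 0 := by
    rw [map_sub, tr_d (b := b) (b' := b + 1) L i _ (by omega), tr_ext0, sub_eq_zero]
    exact hw.symm
  have h2 := eq_top_of_tr L _ h1
  have h3 : v - D ∈ (T b i L).cyc (N + 1) := sub_mem hv (bd_le_cyc _ _ ⟨_, rfl⟩)
  rw [h2] at h3
  refine ⟨⟨_, cyc_of_top L b i h3⟩, ?_⟩
  have h4 : v - L.top (N + 1) ((v - D) (Fin.last (N + 1))) = D := by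
    rw [← h2, sub_sub_cancel]
  change v - L.top (N + 1) ((v - D) (Fin.last (N + 1))) ∈ _
  rw [h4]
  exact ⟨_, rfl⟩

theorem h_T_zero (L : Cpx.{u} p ι) (b : ℕ) (i : ι) : (T b i L).h 0 ≤ L.h 0 := by
  refine h_le_of_surj L (T b i L) 0 0
    (L.top 0 ∘ₗ (L.cyc 0).subtype) (fun v => top_cyc L b i v.2)
    (fun v hv => top_bd L b i hv) (fun v _ => ⟨⟨v 0, trivial⟩, ?_⟩)
  have : v - L.top 0 (v 0) = 0 := by
    rw [sub_eq_zero]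
    refine funext fun j => ?_
    obtain rfl : j = Fin.last 0 := Fin.ext (by omega)
    exact (top_last L 0 _).symm
  change v - L.top 0 (v 0) ∈ _
  rw [this]
  exact zero_mem _

theorem h_T_le (L : Cpx.{u} p ι) (b : ℕ) (i : ι) (N : ℕ) :
    (T b i L).h N ≤ ∑ j ∈ Finset.range (N + 1), L.h j := by
  induction N generalizing b with
  | zero => simpa using h_T_zero L b i
  | succ N ih =>
    rw [Finset.sum_range_succ, add_comm (∑ j ∈ Finset.range (N + 1), L.h j)]
    exact (h_T_succ L b i N).trans (add_le_add le_rfl (ih _))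

end Cpx

theorem rank_pi_fin {k : Type*} [Field k] {n : ℕ} (V : Fin n → Type u)
    [∀ i, AddCommGroup (V i)] [∀ i, Module k (V i)] :
    Module.rank k (∀ i, V i) = ∑ i, Module.rank k (V i) := by
  induction n with
  | zero => simp
  | succ n ih =>
    rw [Fin.sum_univ_succ, ← ih, ← rank_prod', (Fin.consLinearEquiv k V).rank_eq]

namespace Cpx

variable {p : ℕ} [Fact p.Prime] {ι : Type}

theorem cyc_T_of_trivial (L : Cpx.{u} p ι) {i : ι} (hL : ∀ j, L.g i j = 1) (b : ℕ) {N : ℕ}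
    {F : L.TX N} (hF : F ∈ (T b i L).cyc N) (j : Fin (N + 1)) : F j ∈ L.cyc j := by
  obtain ⟨j, hj⟩ := j
  cases j with
  | zero => trivial
  | succ j =>
    obtain ⟨N, rfl⟩ : ∃ M, N = M + 1 := ⟨N - 1, by omega⟩
    have h1 := congrFun (show (T b i L).d N F = 0 from hF) ⟨j, by omega⟩
    rw [T_d, rho_of_trivial L (hL _), LinearMap.zero_apply, smul_zero, add_zero] at h1
    exact h1

theorem T_cyc_of_trivial (L : Cpx.{u} p ι) {i : ι} (hL : ∀ j, L.g i j = 1) (b : ℕ) {N : ℕ}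
    {F : L.TX N} (hF : ∀ j : Fin (N + 1), F j ∈ L.cyc j) : F ∈ (T b i L).cyc N := by
  cases N with
  | zero => trivial
  | succ N =>
    refine (funext fun j => ?_ : (T b i L).d N F = 0)
    rw [T_d, rho_of_trivial L (hL _), LinearMap.zero_apply, smul_zero, add_zero]
    exact hF j.succ

theorem bd_T_of_trivial (L : Cpx.{u} p ι) {i : ι} (hL : ∀ j, L.g i j = 1) (b : ℕ) {N : ℕ}
    {F : L.TX N} : F ∈ (T b i L).bd N ↔ ∀ j : Fin (N + 1), F j ∈ L.bd j := by
  constructor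
  · rintro ⟨w, rfl⟩ j
    rw [T_d, rho_of_trivial L (hL _), LinearMap.zero_apply, smul_zero, add_zero]
    exact ⟨_, rfl⟩
  · intro h
    have h' : ∀ j : Fin (N + 1), ∃ w, L.d j w = F j := h
    choose w hw using h'
    refine ⟨fun j => if h : (j : ℕ) = 0 then 0 else
      Eq.mp (by congr 1; simp; omega) (w ⟨j - 1, by omega⟩), funext fun j => ?_⟩
    rw [T_d, rho_of_trivial L (hL _), LinearMap.zero_apply, smul_zero, add_zero]
    rw [dif_neg (by simp)]
    exact hw j

theorem sum_h_le_T (L : Cpx.{u} p ι) {i : ι} (hL : ∀ j, L.g i j = 1) (b : ℕ) (N : ℕ) :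
    ∑ j ∈ Finset.range (N + 1), L.h j ≤ (T b i L).h N := by
  let f : (T b i L).H N →ₗ[ZMod p] (∀ j : Fin (N + 1), L.H j) :=
    Submodule.liftQ _ (LinearMap.pi fun j : Fin (N + 1) =>
      L.toH j (LinearMap.proj j ∘ₗ ((T b i L).cyc N).subtype)
        (fun v => cyc_T_of_trivial L hL b v.2 j)) (by
      intro x hx
      refine funext fun j => ?_
      refine toH_eq_zero.2 ?_
      exact (bd_T_of_trivial L hL b).1 hx j)
  have hf : Function.Surjective f := by
    intro y
    have : ∀ j : Fin (N + 1), ∃ x : L.cyc j, Submodule.Quotient.mk x = y j :=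
      fun j => Submodule.mkQ_surjective _ (y j)
    choose x hx using this
    refine ⟨Submodule.Quotient.mk ⟨fun j => (x j).1, T_cyc_of_trivial L hL b fun j => (x j).2⟩, ?_⟩
    exact funext fun j => hx j
  have h1 := LinearMap.rank_le_of_surjective f hf
  rw [Finset.sum_range (fun j => L.h j)]
  rw [rank_pi_fin] at h1
  exact h1

/-- Functoriality of `T`. -/
noncomputable def Hom.T {A B : Cpx.{u} p ι} (f : Hom A B) (b : ℕ) (i : ι) :
    Hom (T b i A) (T b i B) where
  f N := LinearMap.pi fun j : Fin (N + 1) => f.f j ∘ₗ LinearMap.proj j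
  f_d N F := by
    refine funext fun j => ?_
    have h1 := f.f_d j (F j.succ)
    have h2 := rho_comm (f.f j) (f.f_g i j) (b + N - j) (F j.castSucc)
    change f.f j (A.d j (F j.succ) + ((-1 : ZMod p) ^ (j : ℕ)) • A.rho i (b + N - j) j (F j.castSucc)) =
      B.d j (f.f _ (F j.succ)) + ((-1 : ZMod p) ^ (j : ℕ)) • B.rho i (b + N - j) j (f.f _ (F j.castSucc))
    rw [map_add, map_smul, h1, h2]
  f_g i' N F := funext fun j => f.f_g i' j (F j)

theorem SES.T {A B C : Cpx.{u} p ι} {f : Hom A B} {q : Hom B C} (s : SES f q) (b : ℕ) (i : ι) :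
    SES (f.T b i) (q.T b i) where
  inj _ _ _ h := funext fun k => s.inj k (congrFun h k)
  surj _ y := by
    choose x hx using fun k => s.surj _ (y k)
    exact ⟨x, funext hx⟩
  exact j x := by
    constructor
    · intro h
      choose a ha using fun k => (s.exact _ (x k)).1 (congrFun h k)
      exact ⟨a, funext ha⟩
    · rintro ⟨a, rfl⟩
      exact funext fun k => (s.exact _ _).2 ⟨a k, rfl⟩

/-- Iterated total complexes. -/
noncomputable def TT : List ι → Cpx.{u} p ι → Cpx.{u} p ι
  | [], L => L
  | i :: l, L => TT l (T 0 i L)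

noncomputable def Hom.TT {A B : Cpx.{u} p ι} (f : Hom A B) :
    (l : List ι) → Hom (TT l A) (TT l B)
  | [] => f
  | i :: l => (f.T 0 i).TT l

theorem SES.TT {A B C : Cpx.{u} p ι} {f : Hom A B} {q : Hom B C} (s : SES f q) (l : List ι) :
    SES (f.TT l) (q.TT l) := by
  induction l generalizing A B C with
  | nil => exact s
  | cons i l ih => exact ih (s.T 0 i)

/-- The operator of partial sums. -/
noncomputable def Sop (f : ℕ → Cardinal.{u}) (N : ℕ) : Cardinal.{u} :=
  ∑ j ∈ Finset.range (N + 1), f j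

theorem Sop_mono {f g : ℕ → Cardinal.{u}} (h : ∀ j, f j ≤ g j) (N : ℕ) : Sop f N ≤ Sop g N :=
  Finset.sum_le_sum fun j _ => h j

theorem Sop_iter_mono {f g : ℕ → Cardinal.{u}} (h : ∀ j, f j ≤ g j) (r N : ℕ) :
    Sop^[r] f N ≤ Sop^[r] g N := by
  induction r generalizing f g with
  | zero => exact h N
  | succ r ih => exact ih (Sop_mono h)

theorem h_TT_le (L : Cpx.{u} p ι) (l : List ι) (N : ℕ) :
    (TT l L).h N ≤ Sop^[l.length] L.h N := by
  induction l generalizing L with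
  | nil => exact le_rfl
  | cons i l ih => exact (ih _).trans (Sop_iter_mono (h_T_le L 0 i) _ _)

theorem T_trivial (L : Cpx.{u} p ι) (hL : ∀ i j, L.g i j = 1) (b : ℕ) (i i' : ι) (N : ℕ) :
    (T b i L).g i' N = 1 := by
  refine LinearMap.ext fun F => funext fun j => ?_
  rw [T_g, hL]
  rfl

theorem le_h_TT (L : Cpx.{u} p ι) (hL : ∀ i j, L.g i j = 1) (l : List ι) (N : ℕ) :
    Sop^[l.length] L.h N ≤ (TT l L).h N := by
  induction l generalizing L with
  | nil => exact le_rfl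
  | cons i l ih =>
    exact (Sop_iter_mono (sum_h_le_T L (hL i) 0) _ _).trans (ih _ (T_trivial L hL 0 i))

end Cpx

namespace Cpx

variable {p : ℕ} [Fact p.Prime] {ι : Type}

theorem rho_even (L : Cpx.{u} p ι) (i : ι) {n : ℕ} (hn : Even n) (j : ℕ) :
    L.rho i n j = L.g i j - 1 := if_pos hn

theorem rho_odd (L : Cpx.{u} p ι) (i : ι) {n : ℕ} (hn : ¬ Even n) (j : ℕ) :
    L.rho i n j = ∑ m ∈ Finset.range p, L.g i j ^ m := if_neg hn

/-- A contraction witnessing that the complex is induced with respect to `g i`. -/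
structure Ctr (L : Cpx.{u} p ι) (i : ι) where
  e : ∀ j, Module.End (ZMod p) (L.X j)
  sum : ∀ j, ∑ m ∈ Finset.range p, L.g i j ^ m * e j * L.g i j ^ (p - m) = 1
  comm : ∀ i' j, i' ≠ i → L.g i' j * e j = e j * L.g i' j

/-- The submodule `P` is stable under the operators of degree zero. -/
def Stb (L : Cpx.{u} p ι) {i : ι} (c : L.Ctr i) (j : ℕ) (P : Submodule (ZMod p) (L.X j)) : Prop :=
  (∀ x ∈ P, L.g i j x ∈ P) ∧ ∀ x ∈ P, c.e j x ∈ P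

theorem stb_pow {L : Cpx.{u} p ι} {i : ι} {c : L.Ctr i} {j : ℕ}
    {P : Submodule (ZMod p) (L.X j)} (h : L.Stb c j P) (m : ℕ) {x : L.X j} (hx : x ∈ P) :
    (L.g i j ^ m) x ∈ P := by
  induction m with
  | zero => exact hx
  | succ m ih => rw [pow_succ', Module.End.mul_apply]; exact h.1 _ ih

theorem rho_exact {L : Cpx.{u} p ι} {i : ι} {c : L.Ctr i} {j : ℕ}
    {P : Submodule (ZMod p) (L.X j)} (h : L.Stb c j P) (n : ℕ) {x : L.X j} (hx : x ∈ P)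
    (h0 : L.rho i n j x = 0) : ∃ z ∈ P, x = L.rho i (n + 1) j z := by
  have hsum := LinearMap.congr_fun (c.sum j) x
  rw [LinearMap.sum_apply, Module.End.one_apply] at hsum
  by_cases hn : Even n
  · rw [rho_even L i hn, LinearMap.sub_apply, Module.End.one_apply, sub_eq_zero] at h0
    refine ⟨c.e j x, h.2 _ hx, ?_⟩
    rw [rho_odd L i (by simpa [Nat.even_add_one] using hn), LinearMap.sum_apply]
    refine hsum.symm.trans (Finset.sum_congr rfl fun m _ => ?_)
    have : ∀ k : ℕ, (L.g i j ^ k) x = x := by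
      intro k
      induction k with
      | zero => rfl
      | succ k ih => rw [pow_succ', Module.End.mul_apply, ih, h0]
    rw [Module.End.mul_apply, Module.End.mul_apply, this]
  · rw [rho_odd L i hn, LinearMap.sum_apply] at h0
    refine ⟨∑ m ∈ Finset.range p, ∑ q ∈ Finset.range m,
      (L.g i j ^ q) (c.e j ((L.g i j ^ (p - m)) x)), ?_, ?_⟩
    · exact Submodule.sum_mem _ fun m _ => Submodule.sum_mem _ fun q _ =>
        stb_pow h _ (h.2 _ (stb_pow h _ hx))
    · rw [rho_even L i (by simpa [Nat.even_add_one] using hn)]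
      have key : ∀ (m : ℕ) (y : L.X j), (L.g i j - 1) (∑ q ∈ Finset.range m, (L.g i j ^ q) y) =
          (L.g i j ^ m) y - y := by
        intro m y
        have := LinearMap.congr_fun (mul_geom_sum (L.g i j) m) y
        rw [Module.End.mul_apply, LinearMap.sum_apply] at this
        exact this
      rw [map_sum]
      rw [Finset.sum_congr rfl fun m _ => key m _, Finset.sum_sub_distrib, ← map_sum]
      have h2 : ∑ m ∈ Finset.range p, (L.g i j ^ (p - m)) x = 0 := by
        rw [← Finset.sum_range_reflect]
        refine Eq.trans (Finset.sum_congr rfl fun m hm => ?_ :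
          _ = ∑ m ∈ Finset.range p, (L.g i j ^ (m + 1)) x) ?_
        · have := Finset.mem_range.1 hm
          congr 2
          omega
        · have h3 := Finset.sum_range_succ (fun m => (L.g i j ^ m) x) p
          rw [Finset.sum_range_succ' (fun m => (L.g i j ^ m) x) p, L.g_pow, pow_zero, h0,
            zero_add] at h3
          exact add_eq_right.1 h3
      rw [h2, map_zero, sub_zero]
      exact hsum.symm

/-- The tuple with a single nonzero entry. -/
def sng (L : Cpx.{u} p ι) (N : ℕ) (j : Fin (N + 1)) (x : L.X j) : L.TX N := Pi.single j x

theorem sng_same (L : Cpx.{u} p ι) (N : ℕ) (j : Fin (N + 1)) (x : L.X j) :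
    L.sng N j x j = x := Pi.single_eq_same (M := fun j : Fin (N + 1) => L.X j) _ _

theorem sng_ne (L : Cpx.{u} p ι) (N : ℕ) (j k : Fin (N + 1)) (x : L.X j) (h : (k : ℕ) ≠ j) :
    L.sng N j x k = 0 :=
  Pi.single_eq_of_ne (M := fun j : Fin (N + 1) => L.X j) (fun e => h (congrArg _ e)) _

theorem sng_mem (L : Cpx.{u} p ι) (N : ℕ) (j : Fin (N + 1)) (x : L.X j)
    (P : ∀ j, Submodule (ZMod p) (L.X j)) (hx : x ∈ P j) (k : Fin (N + 1)) :
    L.sng N j x k ∈ P k := by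
  by_cases h : k = j
  · subst h
    rwa [sng_same]
  · rw [sng_ne _ _ _ _ _ fun e => h (Fin.ext e)]
    exact zero_mem _

theorem rho_mem {L : Cpx.{u} p ι} {i : ι} {c : L.Ctr i} {j : ℕ}
    {P : Submodule (ZMod p) (L.X j)} (h : L.Stb c j P) (n : ℕ) {x : L.X j} (hx : x ∈ P) :
    L.rho i n j x ∈ P := by
  by_cases hn : Even n
  · rw [rho_even L i hn]
    exact sub_mem (h.1 _ hx) hx
  · rw [rho_odd L i hn, LinearMap.sum_apply]
    exact Submodule.sum_mem _ fun m _ => stb_pow h m hx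

theorem T_d_mem {L : Cpx.{u} p ι} {i : ι} {c : L.Ctr i} {P : ∀ j, Submodule (ZMod p) (L.X j)}
    (h : ∀ j, L.Stb c j (P j)) (hd : ∀ j, ∀ x ∈ P (j + 1), L.d j x ∈ P j) (b : ℕ) {N : ℕ}
    {W : L.TX (N + 1)} (hW : ∀ j : Fin (N + 2), W j ∈ P j) (j : Fin (N + 1)) :
    (T b i L).d N W j ∈ P j := by
  rw [T_d]
  exact add_mem (hd _ _ (hW j.succ)) (Submodule.smul_mem _ _ (rho_mem (h _) _ (hW j.castSucc)))

theorem ind_descend {L : Cpx.{u} p ι} {i : ι} {c : L.Ctr i}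
    {P : ∀ j, Submodule (ZMod p) (L.X j)}
    (h : ∀ j, L.Stb c j (P j)) (hd : ∀ j, ∀ x ∈ P (j + 1), L.d j x ∈ P j) {N : ℕ} (m : ℕ) :
    ∀ (_ : m ≤ N + 1) (F : L.TX (N + 1)), (∀ j : Fin (N + 2), F j ∈ P j) →
      (T 0 i L).d N F = 0 → (∀ j : Fin (N + 2), m ≤ (j : ℕ) → F j = 0) →
      ∃ W : L.TX (N + 2), (∀ j : Fin (N + 3), W j ∈ P j) ∧ F = (T 0 i L).d (N + 1) W := by
  induction m with
  | zero =>
    intro _ F _ _ hF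
    refine ⟨0, fun j => zero_mem _, ?_⟩
    rw [map_zero]
    exact funext fun j => hF j (Nat.zero_le _)
  | succ m ih =>
    intro hm F hFP hdF hF
    have h1 := congrFun hdF ⟨m, by omega⟩
    rw [T_d, hF _ (by simp), map_zero, zero_add] at h1
    have h2 : L.rho i (0 + N - m) m (F ⟨m, by omega⟩) = 0 := by
      have h1' : ((-1 : ZMod p) ^ m) • L.rho i (0 + N - m) m (F ⟨m, by omega⟩) = 0 := h1
      rcases smul_eq_zero.1 h1' with h | h
      · exact absurd h (pow_ne_zero _ (neg_ne_zero.2 one_ne_zero))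
      · exact h
    obtain ⟨z, hz, hz2⟩ := rho_exact (h m) _ (hFP ⟨m, by omega⟩) h2
    let W : L.TX (N + 2) := L.sng (N + 2) ⟨m, by omega⟩ (((-1 : ZMod p) ^ m) • z)
    have hWP : ∀ j : Fin (N + 3), W j ∈ P j :=
      sng_mem L _ _ _ P (Submodule.smul_mem _ _ hz)
    obtain ⟨V, hVP, hV⟩ := ih (by omega) (F - (T 0 i L).d (N + 1) W)
      (fun j => sub_mem (hFP j) (T_d_mem h hd 0 hWP j))
      (by
        have := (T 0 i L).dd N W
        rw [map_sub, hdF, this, sub_zero]) (by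
        intro j hj
        change F j - (T 0 i L).d (N + 1) W j = 0
        rw [T_d]
        rw [show W j.succ = 0 from sng_ne L _ _ j.succ _ (by simp; omega), map_zero, zero_add]
        rcases hj.eq_or_lt with hj | hj
        · obtain ⟨j, hj'⟩ := j
          dsimp only at hj
          subst hj
          have : W (Fin.castSucc ⟨m, hj'⟩) = ((-1 : ZMod p) ^ m) • z := sng_same L _ _ _
          rw [this, map_smul, smul_smul, ← mul_pow]
          have e : 0 + (N + 1) - m = 0 + N - m + 1 := by omega
          simp only [mul_neg, mul_one, neg_neg, one_pow, one_smul]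
          rw [e, ← hz2, sub_self]
        · rw [show W j.castSucc = 0 from sng_ne L _ _ j.castSucc _ (by simp; omega), map_zero, smul_zero, hF j hj, sub_zero])
    refine ⟨V + W, fun j => add_mem (hVP j) (hWP j), ?_⟩
    have := (T 0 i L).d (N + 1) |>.map_add V W
    rw [this, ← hV, sub_add_cancel]

/-- If the complex is induced and the invariants have no homology above degree `c`, then the
total complex has no homology above degree `c`. -/
theorem ind_T {L : Cpx.{u} p ι} {i : ι} {c : L.Ctr i} {P : ∀ j, Submodule (ZMod p) (L.X j)}
    (h : ∀ j, L.Stb c j (P j)) (hd : ∀ j, ∀ x ∈ P (j + 1), L.d j x ∈ P j) {N : ℕ}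
    (hP : ∀ x ∈ P (N + 1), L.g i (N + 1) x = x → L.d N x = 0 →
      ∃ y ∈ P (N + 2), L.g i (N + 2) y = y ∧ L.d (N + 1) y = x)
    (F : L.TX (N + 1)) (hFP : ∀ j : Fin (N + 2), F j ∈ P j) (hF : (T 0 i L).d N F = 0) :
    ∃ W : L.TX (N + 2), (∀ j : Fin (N + 3), W j ∈ P j) ∧ F = (T 0 i L).d (N + 1) W := by
  have h1 := congrFun hF (Fin.last N)
  rw [T_d] at h1
  let x : L.X (N + 1) := F (Fin.last (N + 1))
  have hx : x ∈ P (N + 1) := hFP (Fin.last (N + 1))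
  have h1' : L.d N x + ((-1 : ZMod p) ^ N) • L.rho i (0 + N - N) N
      (F (Fin.castSucc (Fin.last N))) = 0 := h1
  rw [show 0 + N - N = 0 by omega] at h1'
  have h2 : L.d N (L.rho i 1 (N + 1) x) = 0 := by
    rw [← rho_d, eq_neg_of_add_eq_zero_left h1', map_neg, map_smul]
    have : L.rho i 1 N (L.rho i 2 N (F (Fin.castSucc (Fin.last N)))) = 0 := rho_rho L i 1 N _
    rw [rho_even L i (by decide : Even 2), ← rho_even L i (by decide : Even 0)] at this
    have this' : L.rho i 1 N (L.rho i 0 N (F (Fin.castSucc (Fin.last N)))) = 0 := this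
    erw [this', smul_zero, neg_zero]
  have inv : ∀ j (y : L.X j), L.rho i 0 j y = 0 ↔ L.g i j y = y := by
    intro j y
    rw [rho_even L i (by decide : Even 0), LinearMap.sub_apply, Module.End.one_apply, sub_eq_zero]
  obtain ⟨y, hy, hgy, hdy⟩ := hP _ (rho_mem (h _) 1 hx) ((inv _ _).1 (rho_rho L i 0 _ x)) h2
  obtain ⟨w, hw, hw'⟩ := rho_exact (h _) 0 hy ((inv _ _).2 hgy)
  obtain ⟨w', hw'P, hw'2⟩ := rho_exact (h (N + 1)) 1 (sub_mem hx (hd _ _ hw)) (by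
    rw [map_sub, rho_d, ← hw', hdy, sub_self])
  let W : L.TX (N + 2) := L.sng (N + 2) (Fin.last _) w +
    L.sng (N + 2) ⟨N + 1, by omega⟩ (((-1 : ZMod p) ^ (N + 1)) • w')
  have hWP : ∀ j : Fin (N + 3), W j ∈ P j := fun j =>
    add_mem (sng_mem L _ _ _ P hw _) (sng_mem L _ _ _ P (Submodule.smul_mem _ _ hw'P) _)
  obtain ⟨V, hVP, hV⟩ := ind_descend h hd (N + 1) le_rfl (F - (T 0 i L).d (N + 1) W)
    (fun j => sub_mem (hFP j) (T_d_mem h hd 0 hWP j))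
    (by
      have := (T 0 i L).dd N W
      rw [map_sub, hF, this, sub_zero]) (by
      intro j hj
      obtain rfl : j = Fin.last (N + 1) := Fin.ext (by have := j.2; simp; omega)
      have key : (T 0 i L).d (N + 1) W (Fin.last (N + 1)) = F (Fin.last (N + 1)) := by
        rw [T_d]
        have e1 : W (Fin.last (N + 1)).succ = w := by
          change L.sng (N + 2) (Fin.last _) w (Fin.last _) +
            L.sng (N + 2) ⟨N + 1, _⟩ _ (Fin.last _) = w
          rw [sng_same, sng_ne _ _ _ _ _ (by simp)]
          exact add_zero w
        have e2 : W (Fin.last (N + 1)).castSucc = ((-1 : ZMod p) ^ (N + 1)) • w' := by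
          change L.sng (N + 2) (Fin.last _) w (⟨N + 1, _⟩) +
            L.sng (N + 2) ⟨N + 1, _⟩ _ ⟨N + 1, _⟩ = _
          rw [sng_same, sng_ne _ _ _ _ _ (by simp), zero_add]
        rw [e1, e2, map_smul, smul_smul]
        change L.d (N + 1) w + ((-1 : ZMod p) ^ (N + 1) * (-1 : ZMod p) ^ (N + 1)) •
          L.rho i (0 + (N + 1) - (N + 1)) (N + 1) w' = x
        have e : 0 + (N + 1) - (N + 1) = 0 := by omega
        rw [e, rho_even L i (by decide : Even 0), ← mul_pow]
        simp only [mul_neg, mul_one, neg_neg, one_pow, one_smul]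
        rw [rho_even L i (by decide : Even (1 + 1))] at hw'2
        exact (sub_eq_iff_eq_add'.1 hw'2).symm
      exact sub_eq_zero.2 key.symm)
  refine ⟨V + W, fun j => add_mem (hVP j) (hWP j), ?_⟩
  have := (T 0 i L).d (N + 1) |>.map_add V W
  rw [this, ← hV, sub_add_cancel]

/-- Joint invariants. -/
def inv (L : Cpx.{u} p ι) (l : List ι) (j : ℕ) : Submodule (ZMod p) (L.X j) where
  carrier := {x | ∀ i ∈ l, L.g i j x = x}
  add_mem' hx hy i hi := by rw [map_add, hx i hi, hy i hi]
  zero_mem' i _ := map_zero _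
  smul_mem' c x hx i hi := by rw [map_smul, hx i hi]

theorem inv_d (L : Cpx.{u} p ι) (l : List ι) (j : ℕ) {x : L.X (j + 1)} (hx : x ∈ L.inv l (j + 1)) :
    L.d j x ∈ L.inv l j := fun i hi => by rw [L.g_d, hx i hi]

noncomputable def Ctr.total {L : Cpx.{u} p ι} {i : ι} (c : L.Ctr i) (b : ℕ) (i₀ : ι) :
    (T b i₀ L).Ctr i where
  e N := LinearMap.pi fun j : Fin (N + 1) => c.e j ∘ₗ LinearMap.proj j
  sum N := by
    refine LinearMap.ext fun F => funext fun j => ?_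
    rw [LinearMap.sum_apply, Finset.sum_apply]
    have hp : ∀ (m : ℕ) (F : L.TX N), ((T b i₀ L).g i N ^ m) F j = (L.g i j ^ m) (F j) := by
      intro m F
      induction m with
      | zero => rfl
      | succ m ih =>
        rw [pow_succ', pow_succ', Module.End.mul_apply, Module.End.mul_apply, ← ih]
        rfl
    have h2 := LinearMap.congr_fun (c.sum j) (F j)
    rw [LinearMap.sum_apply] at h2
    refine Eq.trans (Finset.sum_congr rfl fun m _ => ?_) h2
    simp only [Module.End.mul_apply]
    rw [hp, ← hp (p - m) F]
    rfl
  comm i' N hi' := LinearMap.ext fun F => funext fun j =>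
    LinearMap.congr_fun (c.comm i' j hi') (F j)

theorem ind_TT (l : List ι) (hl : l.Nodup) (L : Cpx.{u} p ι) (C : ∀ i ∈ l, Nonempty (L.Ctr i))
    (c : ℕ) (hP : ∀ N, c ≤ N → ∀ x ∈ L.inv l (N + 1), L.d N x = 0 →
      ∃ y ∈ L.inv l (N + 2), L.d (N + 1) y = x) (N : ℕ) (hN : c ≤ N) :
    (TT l L).Acyc (N + 1) := by
  induction l generalizing L with
  | nil =>
    intro x hx
    obtain ⟨y, _, hy⟩ := hP N hN x (fun i hi => absurd hi List.not_mem_nil) hx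
    exact ⟨y, hy⟩
  | cons i l ih =>
    obtain ⟨hil, hl⟩ := List.nodup_cons.1 hl
    refine ih hl (T 0 i L) (fun i' hi' => ?_) ?_
    · obtain ⟨e⟩ := C i' (List.mem_cons_of_mem _ hi')
      exact ⟨e.total 0 i⟩
    · intro N hN F hFi hF
      obtain ⟨c₀⟩ := C i List.mem_cons_self
      have stb : ∀ j, L.Stb c₀ j (L.inv l j) := by
        refine fun j => ⟨fun x hx i' hi' => ?_, fun x hx i' hi' => ?_⟩
        · rw [L.g_comm, hx i' hi']
        · have := LinearMap.congr_fun (c₀.comm i' j fun h => hil (h ▸ hi')) x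
          rw [Module.End.mul_apply, Module.End.mul_apply, hx i' hi'] at this
          exact this
      obtain ⟨W, hW, hW'⟩ := ind_T (P := L.inv l) stb (fun j x hx => L.inv_d l j hx) (N := N) (by
        intro x hx hgx hdx
        obtain ⟨y, hy, hy'⟩ := hP N hN x (fun i' hi' => by
          rcases List.mem_cons.1 hi' with rfl | h
          · exact hgx
          · exact hx i' h) hdx
        exact ⟨y, fun i' hi' => hy i' (List.mem_cons_of_mem _ hi'), hy i List.mem_cons_self, hy'⟩)
        F (fun j i' hi' => congrFun (hFi i' hi') j) hF
      exact ⟨W, fun i' hi' => funext fun j => hW j i' hi', hW'.symm⟩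

end Cpx

namespace Cpx

variable {p : ℕ} [Fact p.Prime] {ι : Type}

theorem step_low (L : Cpx.{u} p ι) (b : ℕ) (i : ι) {M : ℕ} (F : L.TX M) (n : ℕ)
    (hn : n ≤ M + 1) (hL : ∀ j < n, L.Acyc j)
    (hF : ∀ j : Fin (M + 1), (j : ℕ) < n →
      ∀ G : L.TX M, (∀ k : Fin (M + 1), (k : ℕ) < j → G k = 0) →
      (∃ V, G = F - (T b i L).d M V) → G j ∈ L.cyc j) :
    ∃ V : L.TX (M + 1), ∀ k : Fin (M + 1), (k : ℕ) < n → (F - (T b i L).d M V) k = 0 := by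
  induction n with
  | zero => exact ⟨0, fun k hk => absurd hk (Nat.not_lt_zero _)⟩
  | succ n ih =>
    obtain ⟨V, hV⟩ := ih (by omega) (fun j hj => hL j (by omega))
      (fun j hj => hF j (by omega))
    let j : Fin (M + 1) := ⟨n, by omega⟩
    have h1 := hF j (Nat.lt_succ_self n) _ hV ⟨V, rfl⟩
    obtain ⟨v, hv⟩ := hL n (Nat.lt_succ_self n) h1
    refine ⟨V + L.sng (M + 1) ⟨n + 1, by omega⟩ v, fun k hk => ?_⟩
    have h2 : F - (T b i L).d M (V + L.sng (M + 1) ⟨n + 1, by omega⟩ v) =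
        (F - (T b i L).d M V) - (T b i L).d M (L.sng (M + 1) ⟨n + 1, by omega⟩ v) := by
      have := (T b i L).d M |>.map_add V (L.sng (M + 1) ⟨n + 1, by omega⟩ v)
      rw [this, sub_sub]
    rw [h2]
    have h3 : (T b i L).d M (L.sng (M + 1) ⟨n + 1, by omega⟩ v) k =
        L.d k (L.sng (M + 1) ⟨n + 1, by omega⟩ v k.succ) := by
      rw [T_d, sng_ne L (M + 1) ⟨n + 1, _⟩ k.castSucc v (by simp; omega), map_zero, smul_zero,
        add_zero]
    refine sub_eq_zero.2 ?_
    rw [h3]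
    rcases Nat.lt_succ_iff_lt_or_eq.1 hk with h | h
    · rw [hV k h, sng_ne L (M + 1) ⟨n + 1, _⟩ k.succ v (by simp; omega), map_zero]
    · obtain ⟨k, hk'⟩ := k
      dsimp only at h
      subst h
      have : L.sng (M + 1) ⟨k + 1, by omega⟩ v (Fin.succ ⟨k, hk'⟩) = v := sng_same L _ _ _
      rw [this]
      exact hv.symm

/-- The homology is one-dimensional, concentrated in degree `d`, and spanned by `o`. -/
structure Conc (L : Cpx.{u} p ι) (d : ℕ) (o : L.X d) : Prop where
  acyc : ∀ j, j ≠ d → L.Acyc j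
  cyc : o ∈ L.cyc d
  nbd : o ∉ L.bd d
  span : ∀ z ∈ L.cyc d, ∃ c : ZMod p, z - c • o ∈ L.bd d

theorem g_cyc (L : Cpx.{u} p ι) (i : ι) {N : ℕ} {x : L.X N} (hx : x ∈ L.cyc N) :
    L.g i N x ∈ L.cyc N := by
  cases N with
  | zero => trivial
  | succ N =>
    have hx' : L.d N x = 0 := hx
    exact (by rw [← L.g_d, hx', map_zero] : L.d N (L.g i (N + 1) x) = 0)

theorem g_bd (L : Cpx.{u} p ι) (i : ι) {N : ℕ} {x : L.X N} (hx : x ∈ L.bd N) :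
    L.g i N x ∈ L.bd N := by
  obtain ⟨y, rfl⟩ := hx
  exact ⟨_, (L.g_d i N y).symm⟩

theorem Conc.g_sub {L : Cpx.{u} p ι} {d : ℕ} {o : L.X d} (h : L.Conc d o) (i : ι) {z : L.X d}
    (hz : z ∈ L.cyc d) : L.g i d z - z ∈ L.bd d := by
  obtain ⟨l, hl⟩ := h.span _ (L.g_cyc i h.cyc)
  have hp : ∀ m : ℕ, (L.g i d ^ m) o - l ^ m • o ∈ L.bd d := by
    intro m
    induction m with
    | zero => simp
    | succ m ih =>
      have h2 := add_mem (L.g_bd i ih) (Submodule.smul_mem _ (l ^ m) hl)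
      rw [pow_succ', Module.End.mul_apply]
      convert h2 using 1
      rw [map_sub, map_smul, smul_sub, smul_smul, pow_succ]
      abel
  have h1 : l = 1 := by
    have h2 := hp p
    rw [L.g_pow, ZMod.pow_card, Module.End.one_apply] at h2
    by_contra hne
    have h3 : (1 - l) • o ∈ L.bd d := by rwa [sub_smul, one_smul]
    exact h.nbd ((Submodule.smul_mem_iff _ (sub_ne_zero.2 (Ne.symm hne))).1 h3)
  subst h1
  obtain ⟨c, hc⟩ := h.span z hz
  have h4 := sub_mem (add_mem (L.g_bd i hc) (Submodule.smul_mem _ c hl)) hc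
  convert h4 using 1
  rw [map_sub, map_smul, one_smul, smul_sub]
  abel

theorem Conc.rho_mem {L : Cpx.{u} p ι} {d : ℕ} {o : L.X d} (h : L.Conc d o) (i : ι) (n : ℕ)
    {z : L.X d} (hz : z ∈ L.cyc d) : L.rho i n d z ∈ L.bd d := by
  by_cases hn : Even n
  · rw [rho_even L i hn]
    exact h.g_sub i hz
  · rw [rho_odd L i hn, LinearMap.sum_apply]
    have hp : ∀ m : ℕ, (L.g i d ^ m) z - z ∈ L.bd d ∧ (L.g i d ^ m) z ∈ L.cyc d := by
      intro m
      induction m with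
      | zero => exact ⟨by simp, hz⟩
      | succ m ih =>
        rw [pow_succ', Module.End.mul_apply]
        refine ⟨?_, L.g_cyc i ih.2⟩
        have := add_mem (h.g_sub i ih.2) ih.1
        rwa [sub_add_sub_cancel] at this
    have h2 : ∑ m ∈ Finset.range p, (L.g i d ^ m) z =
        ∑ m ∈ Finset.range p, ((L.g i d ^ m) z - z) := by
      rw [Finset.sum_sub_distrib, Finset.sum_const, Finset.card_range, ← Nat.cast_smul_eq_nsmul
        (ZMod p), CharP.cast_eq_zero, zero_smul, sub_zero]
    rw [h2]
    exact Submodule.sum_mem _ fun m _ => (hp m).1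

theorem Conc.bd_of_T {L : Cpx.{u} p ι} {d : ℕ} {o : L.X d} (h : L.Conc d o) (b : ℕ) (i : ι)
    {N : ℕ} {s : L.TX N} (hs : s ∈ (T b i L).bd N) (hd : d < N + 1)
    (hlow : ∀ k : Fin (N + 1), (k : ℕ) < d → s k = 0) : s ⟨d, hd⟩ ∈ L.bd d := by
  obtain ⟨W, rfl⟩ := hs
  have key : ∀ (j : ℕ) (hj : j < N + 2) (_ : j ≤ d) (G : L.TX (N + 1)),
      (∀ k : Fin (N + 2), (k : ℕ) < j → G k = 0) → (T b i L).d N G = (T b i L).d N W →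
      G ⟨j, hj⟩ ∈ L.cyc j := by
    intro j hj hjd G hG hGW
    cases j with
    | zero => trivial
    | succ j =>
      have h1 := congrFun hGW ⟨j, by omega⟩
      rw [hlow ⟨j, by omega⟩ (Nat.lt_of_succ_le hjd), T_d] at h1
      rw [hG (Fin.castSucc ⟨j, _⟩) (Nat.lt_succ_self j), map_zero, smul_zero, add_zero] at h1
      exact h1
  have hdd : ∀ V, (T b i L).d N (W - (T b i L).d (N + 1) V) = (T b i L).d N W := by
    intro V
    have := (T b i L).dd N V
    rw [map_sub, this, sub_zero]
  obtain ⟨V, hV⟩ := L.step_low b i W d (by omega) (fun j hj => h.acyc j hj.ne) (by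
    rintro j hj G hG ⟨V, rfl⟩
    exact key j j.2 hj.le _ hG (hdd V))
  have h1 := key d (by omega) le_rfl _ hV (hdd V)
  have h2 := congrFun (hdd V) ⟨d, hd⟩
  change (T b i L).d N W ⟨d, hd⟩ ∈ _
  rw [← h2, T_d]
  exact add_mem ⟨_, rfl⟩ (Submodule.smul_mem _ _ (h.rho_mem i _ h1))

theorem T_cyc_apply (L : Cpx.{u} p ι) (b : ℕ) (i : ι) {N : ℕ} {s : L.TX N}
    (hs : s ∈ (T b i L).cyc N) (j : ℕ) (hj : j < N) :
    L.d j (s ⟨j + 1, by omega⟩) + ((-1 : ZMod p) ^ j) •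
      L.rho i (b + N - 1 - j) j (s ⟨j, by omega⟩) = 0 := by
  cases N with
  | zero => exact absurd hj (Nat.not_lt_zero _)
  | succ N => exact congrFun (show (T b i L).d N s = 0 from hs) ⟨j, hj⟩

theorem Conc.exists_cyc {L : Cpx.{u} p ι} {d : ℕ} {o : L.X d} (h : L.Conc d o) (b : ℕ) (i : ι)
    (m : ℕ) : ∃ s ∈ (T b i L).cyc (d + m), (∀ k : Fin (d + m + 1), (k : ℕ) < d → s k = 0) ∧
      s ⟨d, by omega⟩ = o := by
  induction m generalizing b with
  | zero =>
    exact ⟨L.top d o, L.top_cyc b i h.cyc, fun k hk => L.top_of_lt _ _ hk, L.top_last d o⟩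
  | succ m ih =>
    obtain ⟨s, hs, hs0, hso⟩ := ih (b + 1)
    have h0 : L.rho i b (d + m) (s (Fin.last (d + m))) ∈ L.bd (d + m) := by
      cases m with
      | zero =>
        have : s (Fin.last (d + 0)) = o := hso
        rw [this]
        exact h.rho_mem i b h.cyc
      | succ m =>
        refine h.acyc _ (by omega) ?_
        have h1 := congrFun (show (T (b + 1) i L).d (d + m) s = 0 from hs) (Fin.last (d + m))
        rw [T_d] at h1
        have h1' : L.d (d + m) (s (Fin.last (d + (m + 1)))) = -(((-1 : ZMod p) ^ (d + m)) •
          L.rho i (b + 1 + (d + m) - (d + m)) (d + m) (s (Fin.castSucc (Fin.last (d + m))))) :=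
          eq_neg_of_add_eq_zero_left h1
        rw [Nat.add_sub_cancel] at h1'
        change L.d (d + m) (L.rho i b (d + m + 1) (s (Fin.last (d + (m + 1))))) = 0
        rw [← rho_d, h1', map_neg, map_smul, rho_rho, smul_zero, neg_zero]
    obtain ⟨y, hy⟩ := h0
    have hy' : L.d (d + m) y = L.rho i b (d + m) (s (Fin.last (d + m))) := hy
    let y' : L.X (d + m + 1) := -(((-1 : ZMod p) ^ (d + m)) • y)
    let F : L.TX (d + m + 1) := L.ext0 (d + m + 1) s + L.top (d + m + 1) y'
    have hF1 : ∀ j (hj : j < d + m + 1), F ⟨j, by omega⟩ = s ⟨j, hj⟩ := by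
      intro j hj
      have h1 : L.top (d + m + 1) y' ⟨j, by omega⟩ = 0 := L.top_of_lt _ _ hj
      have h2 : L.ext0 (d + m + 1) s ⟨j, by omega⟩ = s ⟨j, hj⟩ := dif_pos hj
      change L.ext0 (d + m + 1) s ⟨j, _⟩ + L.top (d + m + 1) y' ⟨j, _⟩ = _
      rw [h1, h2, add_zero]
    have hF2 : F (Fin.last (d + m + 1)) = y' := by
      have h1 := L.top_last (d + m + 1) y'
      have h2 : L.ext0 (d + m + 1) s (Fin.last (d + m + 1)) = 0 :=
        dif_neg (by simp)
      change L.ext0 (d + m + 1) s (Fin.last _) + L.top (d + m + 1) y' (Fin.last _) = _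
      rw [h1, h2]
      exact zero_add y'
    refine ⟨F, ?_, fun k hk => ?_, ?_⟩
    · refine (funext fun j => ?_ : (T b i L).d (d + m) F = 0)
      obtain ⟨j, hj⟩ := j
      rw [T_d]
      have e1 := hF1 j hj
      rcases Nat.lt_succ_iff_lt_or_eq.1 hj with hjm | rfl
      · have e2 := hF1 (j + 1) (by omega)
        change L.d j (F ⟨j + 1, by omega⟩) + ((-1 : ZMod p) ^ j) •
          L.rho i (b + (d + m) - j) j (F ⟨j, by omega⟩) = 0
        rw [e1, e2]
        have h1 := T_cyc_apply L (b + 1) i hs j hjm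
        have e : b + (d + m) - j = b + 1 + (d + m) - 1 - j := by omega
        rw [e]
        exact h1
      · change L.d (d + m) (F (Fin.last (d + m + 1))) + ((-1 : ZMod p) ^ (d + m)) •
          L.rho i (b + (d + m) - (d + m)) (d + m) (F ⟨d + m, by omega⟩) = 0
        rw [hF2, e1, map_neg, map_smul, hy', Nat.add_sub_cancel]
        exact neg_add_cancel _
    · obtain ⟨k, hk'⟩ := k
      have hk : k < d := hk
      rw [hF1 k (by omega)]
      exact hs0 _ hk
    · exact (hF1 d (by omega)).trans hso

end Cpx

namespace Cpx

/-- Kronecker delta. -/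
noncomputable def dl (a : ℕ) : ℕ → Cardinal.{u} := fun j => if j = a then 1 else 0

theorem Sop_dl (a N : ℕ) : Sop (dl.{u} a) N = if a ≤ N then 1 else 0 := by
  unfold Sop dl
  rw [Finset.sum_ite_eq' (Finset.range (N + 1)) a (fun _ => (1 : Cardinal))]
  simp

theorem Sop_natCast (f : ℕ → ℕ) (N : ℕ) :
    Sop (fun j => (f j : Cardinal.{u})) N = ((∑ j ∈ Finset.range (N + 1), f j : ℕ) : Cardinal.{u}) := by
  unfold Sop
  push_cast
  rfl

theorem Sop_iter_one (r N : ℕ) :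
    Sop^[r] (fun _ => (1 : Cardinal.{u})) N = ((N + r).choose r : ℕ) := by
  induction r generalizing N with
  | zero => simp
  | succ r ih =>
    rw [Function.iterate_succ_apply', show Sop^[r] (fun _ => (1 : Cardinal.{u})) =
      fun N => (((N + r).choose r : ℕ) : Cardinal.{u}) from funext ih, Sop_natCast]
    congr 1
    exact Nat.sum_range_add_choose N r

theorem Sop_iter_le_mul {g : ℕ → Cardinal.{u}} {c : Cardinal.{u}} (r N : ℕ)
    (hg : ∀ j ≤ N, g j ≤ c) : Sop^[r] g N ≤ c * Sop^[r] (fun _ => 1) N := by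
  induction r generalizing N with
  | zero => simpa using hg N le_rfl
  | succ r ih =>
    rw [Function.iterate_succ_apply', Function.iterate_succ_apply']
    unfold Sop
    rw [Finset.mul_sum]
    refine Finset.sum_le_sum fun j hj => ih j fun i hi => hg i ?_
    have := Finset.mem_range.1 hj
    omega

theorem Sop_le_Sop (f : ℕ → Cardinal.{u}) {j N : ℕ} (h : j ≤ N) : Sop f j ≤ Sop f N :=
  Finset.sum_le_sum_of_subset (Finset.range_mono (Nat.succ_le_succ h))

theorem rank_bound {f : ℕ → Cardinal.{u}} {r N B : ℕ}
    (h : Sop^[r] (dl.{u} 0) (N + 1) ≤ Sop^[r] f N) (hB : Sop f N ≤ B) : r ≤ B * (N + 1) := by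
  cases r with
  | zero => exact Nat.zero_le _
  | succ r =>
    rw [Function.iterate_succ_apply, Function.iterate_succ_apply,
      show Sop (dl.{u} 0) = fun _ => 1 from funext fun N => by rw [Sop_dl, if_pos (Nat.zero_le _)],
      Sop_iter_one] at h
    have h2 := h.trans (Sop_iter_le_mul r N fun j hj => (Sop_le_Sop f hj).trans hB)
    rw [Sop_iter_one] at h2
    have h3 : (N + 1 + r).choose r ≤ B * (N + r).choose r := by exact_mod_cast h2
    have h4 : (N + r + 1) * (N + r).choose N = (N + r + 1).choose (N + 1) * (N + 1) :=
      Nat.add_one_mul_choose_eq _ _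
    rw [show N + 1 + r = N + r + 1 by omega, ← Nat.choose_symm_of_eq_add
      (show N + r + 1 = (N + 1) + r by omega), ← Nat.choose_symm_of_eq_add
      (show N + r = N + r by omega)] at h3
    have hpos : 0 < (N + r).choose N := Nat.choose_pos (by omega)
    have h5 : (N + r + 1) * (N + r).choose N ≤ (B * (N + 1)) * (N + r).choose N := by
      rw [h4]
      nlinarith
    have h6 := Nat.le_of_mul_le_mul_right h5 hpos
    omega

theorem Sop_two_dl (a t : ℕ) : Sop^[2] (dl.{u} a) (a + t) = ((t + 1 : ℕ) : Cardinal.{u}) := by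
  rw [Function.iterate_succ_apply, Function.iterate_one]
  rw [show Sop (dl.{u} a) = fun N => ((if a ≤ N then 1 else 0 : ℕ) : Cardinal.{u}) from
    funext fun N => by rw [Sop_dl]; split_ifs <;> simp, Sop_natCast]
  congr 1
  rw [Finset.sum_ite, Finset.sum_const_zero, add_zero, Finset.sum_const, smul_eq_mul, mul_one]
  have : (Finset.range (a + t + 1)).filter (fun N => a ≤ N) = Finset.Ico a (a + t + 1) := by
    ext x
    simp
    omega
  rw [this, Nat.card_Ico]
  omega

theorem le_of_Sop_two {a b N : ℕ} (ha : a ≤ N) (hb : b ≤ N)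
    (h : Sop^[2] (dl.{u} a) N ≤ Sop^[2] (dl.{u} b) N) : b ≤ a := by
  obtain ⟨t, rfl⟩ := Nat.exists_eq_add_of_le ha
  obtain ⟨s, hs⟩ := Nat.exists_eq_add_of_le hb
  rw [Sop_two_dl, hs, Sop_two_dl] at h
  have : t + 1 ≤ s + 1 := by exact_mod_cast h
  omega

variable {p : ℕ} [Fact p.Prime] {ι : Type}

theorem Conc.h_eq {L : Cpx.{u} p ι} {d : ℕ} {o : L.X d} (h : L.Conc d o) : L.h = dl d := by
  funext j
  unfold dl
  split_ifs with hj
  · subst hj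
    let x : L.H j := Submodule.Quotient.mk ⟨o, h.cyc⟩
    refine rank_eq_one_iff.2 ⟨x, ?_, fun w => ?_⟩
    · intro h0
      exact h.nbd ((Submodule.Quotient.mk_eq_zero ((L.bd j).comap (L.cyc j).subtype)).1 h0)
    · obtain ⟨z, rfl⟩ := Submodule.mkQ_surjective _ w
      obtain ⟨c, hc⟩ := h.span z z.2
      refine ⟨c, ?_⟩
      refine Eq.symm ((Submodule.Quotient.eq _).2 ?_)
      exact hc
  · exact (h.acyc j hj).h_eq

theorem sum_dl_le (d N : ℕ) : ∑ j ∈ Finset.range (N + 1), dl.{u} d j ≤ 1 := by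
  have := Sop_dl.{u} d N
  unfold Sop at this
  rw [this]
  split_ifs <;> simp

/-- A complex with total homology of rank one in degrees `≤ N` and none above is concentrated. -/
theorem exists_conc (L : Cpx.{u} p ι) (N : ℕ)
    (h1 : ∀ M, N ≤ M → ∑ j ∈ Finset.range (M + 1), L.h j ≤ 1)
    (h2 : ∃ j, ∃ o ∈ L.cyc j, o ∉ L.bd j) : ∃ d, ∃ o, L.Conc d o := by
  obtain ⟨d, o, hc, hb⟩ := h2
  have hd : 1 ≤ L.h d := by
    rw [Cardinal.one_le_iff_ne_zero]
    exact fun h => hb (acyc_of_h h hc)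
  have ho : ∀ j, j ≠ d → L.Acyc j := by
    intro j hj
    refine acyc_of_h ?_
    have h3 := h1 (N + j + d) (by omega)
    rw [← Finset.add_sum_erase _ _ (Finset.mem_range.2 (show d < N + j + d + 1 by omega)),
      ← Finset.add_sum_erase _ _ (Finset.mem_erase.2 ⟨hj, Finset.mem_range.2
        (show j < N + j + d + 1 by omega)⟩)] at h3
    by_contra h0
    have h4 := add_le_add hd ((Cardinal.one_le_iff_ne_zero.2 h0).trans
      (self_le_add_right (L.h j) _)) |>.trans h3
    have h5 : ((2 : ℕ) : Cardinal) ≤ ((1 : ℕ) : Cardinal) := by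
      rw [Nat.cast_ofNat, Nat.cast_one, ← one_add_one_eq_two]
      exact h4
    exact absurd (Nat.cast_le.1 h5) (by decide)
  refine ⟨d, o, ho, hc, hb, fun z hz => ?_⟩
  have h3 : L.h d ≤ 1 := by
    refine le_trans ?_ (h1 (N + d) (by omega))
    exact Finset.single_le_sum (f := L.h) (fun _ _ => zero_le) (Finset.mem_range.2 (by omega))
  obtain ⟨v, hv⟩ := rank_le_one_iff.1 h3
  obtain ⟨r, hr⟩ := hv (Submodule.Quotient.mk ⟨o, hc⟩)
  obtain ⟨t, ht⟩ := hv (Submodule.Quotient.mk ⟨z, hz⟩)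
  have hr0 : r ≠ 0 := by
    rintro rfl
    rw [zero_smul] at hr
    exact hb ((Submodule.Quotient.mk_eq_zero ((L.bd d).comap (L.cyc d).subtype)).1 hr.symm)
  refine ⟨t * r⁻¹, ?_⟩
  have h4 : (Submodule.Quotient.mk ⟨z, hz⟩ : L.H d) =
      Submodule.Quotient.mk ((t * r⁻¹) • ⟨o, hc⟩) := by
    rw [Submodule.Quotient.mk_smul, ← hr, ← ht, smul_smul, mul_assoc, inv_mul_cancel₀ hr0, mul_one]
  exact (Submodule.Quotient.eq ((L.bd d).comap (L.cyc d).subtype)).1 h4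

end Cpx

/-- Arbitrary functions on tuples of points. -/
abbrev Fn (p : ℕ) (M : Type*) (j : ℕ) := (Fin (j + 1) → M) → ZMod p

namespace Fn

variable {p : ℕ} {M : Type*}

/-- The coboundary. -/
def d {j : ℕ} : Fn p M j →ₗ[ZMod p] Fn p M (j + 1) where
  toFun f s := ∑ i : Fin (j + 2), (-1) ^ (i : ℕ) * f (s ∘ i.succAbove)
  map_add' f g := by
    funext s
    simp [mul_add, Finset.sum_add_distrib]
  map_smul' c f := by
    funext s
    simp only [Pi.smul_apply, smul_eq_mul, RingHom.id_apply, Finset.mul_sum]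
    exact Finset.sum_congr rfl fun i _ => by ring

theorem d_apply {j : ℕ} (f : Fn p M j) (s : Fin (j + 2) → M) :
    d f s = ∑ i : Fin (j + 2), (-1) ^ (i : ℕ) * f (s ∘ i.succAbove) := rfl

/-- Evaluation with a fixed first vertex. -/
def con (x : M) {j : ℕ} (f : Fn p M (j + 1)) : Fn p M j := fun s => f (Fin.cons x s)

theorem cons_comp_zero {j : ℕ} (x : M) (s : Fin (j + 1) → M) :
    (Fin.cons x s : Fin (j + 2) → M) ∘ (0 : Fin (j + 2)).succAbove = s := by
  funext i
  simp

theorem cons_comp_succ {j : ℕ} (x : M) (s : Fin (j + 2) → M) (i : Fin (j + 2)) :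
    (Fin.cons x s : Fin (j + 3) → M) ∘ i.succ.succAbove = Fin.cons x (s ∘ i.succAbove) := by
  funext k
  refine Fin.cases ?_ (fun k => ?_) k
  · simp
  · simp

theorem d_cons {j : ℕ} (x : M) (f : Fn p M (j + 1)) (s : Fin (j + 2) → M) :
    d f (Fin.cons x s) = f s - d (con x f) s := by
  rw [d_apply, Fin.sum_univ_succ, cons_comp_zero, d_apply]
  simp only [cons_comp_succ, Fin.val_succ, con, Fin.val_zero, pow_zero, one_mul]
  rw [sub_eq_add_neg, ← Finset.sum_neg_distrib]
  congr 1
  exact Finset.sum_congr rfl fun i _ => by ring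

theorem d_cons_zero (x : M) (f : Fn p M 0) (s : Fin 1 → M) :
    d f (Fin.cons x s) = f s - f (fun _ => x) := by
  rw [d_apply, Fin.sum_univ_two, cons_comp_zero]
  have : (Fin.cons x s : Fin 2 → M) ∘ (1 : Fin 2).succAbove = fun _ => x := by
    funext i
    fin_cases i
    rfl
  rw [this]
  simp [sub_eq_add_neg]

theorem d_d {j : ℕ} (f : Fn p M j) : d (d f) = 0 := by
  induction j with
  | zero =>
    funext s
    rw [← Fin.cons_self_tail s, d_cons]
    have : con (s 0) (d f) = f - fun _ => f (fun _ => s 0) := by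
      funext t
      exact d_cons_zero _ _ _
    rw [this, map_sub]
    have h2 : d (fun _ => f (fun _ => s 0) : Fn p M 0) = 0 := by
      funext t
      rw [d_apply, Fin.sum_univ_two]
      simp
    rw [h2]
    simp
  | succ j ih =>
    funext s
    rw [← Fin.cons_self_tail s, d_cons]
    have : con (s 0) (d f) = f - d (con (s 0) f) := by
      funext t
      exact d_cons _ _ _
    rw [this, map_sub, ih]
    simp

/-- Pullback along a self-map. -/
def pull (a : M → M) {j : ℕ} : Fn p M j →ₗ[ZMod p] Fn p M j where
  toFun f s := f (a ∘ s)
  map_add' _ _ := rfl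
  map_smul' _ _ := rfl

theorem pull_apply (a : M → M) {j : ℕ} (f : Fn p M j) (s : Fin (j + 1) → M) :
    pull a f s = f (a ∘ s) := rfl

theorem pull_d (a : M → M) {j : ℕ} (f : Fn p M j) : pull a (d f) = d (pull a f) := rfl

open Classical in
/-- Restriction to a set of tuples. -/
noncomputable def cut {j : ℕ} (S : Set (Fin (j + 1) → M)) : Fn p M j →ₗ[ZMod p] Fn p M j where
  toFun f s := if s ∈ S then f s else 0
  map_add' f g := by
    funext s
    by_cases h : s ∈ S <;> simp [h]
  map_smul' c f := by
    funext s
    by_cases h : s ∈ S <;> simp [h]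

theorem cut_of_mem {j : ℕ} {S : Set (Fin (j + 1) → M)} (f : Fn p M j) {s : Fin (j + 1) → M}
    (h : s ∈ S) : cut S f s = f s := if_pos h

theorem cut_of_notMem {j : ℕ} {S : Set (Fin (j + 1) → M)} (f : Fn p M j) {s : Fin (j + 1) → M}
    (h : s ∉ S) : cut S f s = 0 := if_neg h

theorem cut_eq_zero {j : ℕ} (S : Set (Fin (j + 1) → M)) {f : Fn p M j} {s : Fin (j + 1) → M}
    (h : f s = 0) : cut S f s = 0 := by
  by_cases hs : s ∈ S
  · rw [cut_of_mem f hs, h]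
  · exact cut_of_notMem f hs

/-- Tuples with first entry in `B`. -/
def fst (B : Set M) (j : ℕ) : Set (Fin (j + 1) → M) := {s | s 0 ∈ B}

variable [TopologicalSpace M]

/-- `f` vanishes on the tuples of points of `X` close to `x`. -/
def Van (X : Set M) {j : ℕ} (f : Fn p M j) (x : M) : Prop :=
  ∃ V ∈ 𝓝[X] x, ∀ s, (∀ i, s i ∈ V) → f s = 0

theorem Van.of_imp {X : Set M} {j : ℕ} {f f' : Fn p M j} {x : M} (h : Van X f x)
    (hf : ∀ s, f s = 0 → f' s = 0) : Van X f' x := by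
  obtain ⟨V, hV, h⟩ := h
  exact ⟨V, hV, fun s hs => hf s (h s hs)⟩

theorem Van.imp₂ {X : Set M} {j : ℕ} {f g f' : Fn p M j} {x : M} (h : Van X f x) (hg : Van X g x)
    (hf : ∀ s, f s = 0 → g s = 0 → f' s = 0) : Van X f' x := by
  obtain ⟨V, hV, h⟩ := h
  obtain ⟨W, hW, hg⟩ := hg
  exact ⟨V ∩ W, Filter.inter_mem hV hW, fun s hs =>
    hf s (h s fun i => (hs i).1) (hg s fun i => (hs i).2)⟩

theorem Van.zero (X : Set M) (j : ℕ) (x : M) : Van X (0 : Fn p M j) x :=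
  ⟨Set.univ, Filter.univ_mem, fun _ _ => rfl⟩

theorem Van.add {X : Set M} {j : ℕ} {f g : Fn p M j} {x : M} (hf : Van X f x) (hg : Van X g x) :
    Van X (f + g) x := hf.imp₂ hg fun s h1 h2 => by simp [h1, h2]

theorem Van.sub {X : Set M} {j : ℕ} {f g : Fn p M j} {x : M} (hf : Van X f x) (hg : Van X g x) :
    Van X (f - g) x := hf.imp₂ hg fun s h1 h2 => by simp [h1, h2]

theorem Van.neg {X : Set M} {j : ℕ} {f : Fn p M j} {x : M} (hf : Van X f x) :
    Van X (-f) x := hf.of_imp fun s h1 => by simp [h1]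

theorem Van.smul {X : Set M} {j : ℕ} {f : Fn p M j} {x : M} (c : ZMod p) (hf : Van X f x) :
    Van X (c • f) x := hf.of_imp fun s h1 => by simp [h1]

theorem Van.d {X : Set M} {j : ℕ} {f : Fn p M j} {x : M} (hf : Van X f x) : Van X (Fn.d f) x := by
  obtain ⟨V, hV, h⟩ := hf
  refine ⟨V, hV, fun s hs => ?_⟩
  rw [d_apply]
  exact Finset.sum_eq_zero fun i _ => by rw [h (s ∘ i.succAbove) fun k => hs _, mul_zero]

theorem Van.mono {X Y : Set M} (hXY : Y ⊆ X) {j : ℕ} {f : Fn p M j} {x : M} (hf : Van X f x) :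
    Van Y f x := by
  obtain ⟨V, hV, h⟩ := hf
  exact ⟨V, nhdsWithin_mono x hXY hV, h⟩

theorem van_of_notMem {X : Set M} (hX : IsClosed X) {j : ℕ} (f : Fn p M j) {x : M} (hx : x ∉ X) :
    Van X f x := by
  refine ⟨∅, ?_, fun s hs => absurd (hs 0) (Set.notMem_empty _)⟩
  rw [Filter.empty_mem_iff_bot, ← notMem_closure_iff_nhdsWithin_eq_bot, hX.closure_eq]
  exact hx

theorem van_iff {X : Set M} {j : ℕ} {f : Fn p M j} {x : M} :
    Van X f x ↔ ∃ V, IsOpen V ∧ x ∈ V ∧ ∀ s, (∀ i, s i ∈ V ∧ s i ∈ X) → f s = 0 := by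
  constructor
  · rintro ⟨V, hV, h⟩
    obtain ⟨O, hO, hxO, hOV⟩ := mem_nhdsWithin.1 hV
    exact ⟨O, hO, hxO, fun s hs => h s fun i => hOV (hs i)⟩
  · rintro ⟨V, hV, hxV, h⟩
    exact ⟨V ∩ X, mem_nhdsWithin.2 ⟨V, hV, hxV, le_rfl⟩, fun s hs => h s hs⟩

theorem isOpen_van (X : Set M) {j : ℕ} (f : Fn p M j) : IsOpen {x | Van X f x} := by
  rw [isOpen_iff_mem_nhds]
  intro x hx
  obtain ⟨V, hV, hxV, h⟩ := van_iff.1 hx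
  exact Filter.mem_of_superset (hV.mem_nhds hxV) fun y hy => van_iff.2 ⟨V, hV, hy, h⟩

theorem Van.pull {X : Set M} {a : M → M} (ha : ContinuousOn a X) (hX : Set.MapsTo a X X)
    {j : ℕ} {f : Fn p M j} {x : M} (hx : x ∈ X) (hf : Van X f (a x)) : Van X (Fn.pull a f) x := by
  obtain ⟨V, hV, h⟩ := hf
  exact ⟨a ⁻¹' V, (ha x hx).tendsto_nhdsWithin hX hV, fun s hs => h _ hs⟩

/-- Functions supported in `U`, restricted to `X`. -/
def K (p : ℕ) (X U : Set M) (j : ℕ) : Submodule (ZMod p) (Fn p M j) where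
  carrier := {f | ∀ x ∉ U, Van X f x}
  add_mem' hf hg x hx := (hf x hx).add (hg x hx)
  zero_mem' x _ := Van.zero X j x
  smul_mem' c _ hf x hx := (hf x hx).smul c

theorem K_of_imp {X U : Set M} {j : ℕ} {f f' : Fn p M j} (hf : f ∈ K p X U j)
    (h : ∀ s, f s = 0 → f' s = 0) : f' ∈ K p X U j := fun x hx => (hf x hx).of_imp h

theorem d_mem_K {X U : Set M} {j : ℕ} {f : Fn p M j} (hf : f ∈ K p X U j) :
    d f ∈ K p X U (j + 1) := fun x hx => (hf x hx).d

theorem K_mono {X Y U V : Set M} (hX : IsClosed X) (hXY : Y ⊆ X) (hUV : ∀ x ∈ X, x ∈ U → x ∈ V)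
    (j : ℕ) : K p X U j ≤ K p Y V j := by
  intro f hf x hx
  by_cases hxX : x ∈ X
  · exact (hf x fun h => hx (hUV x hxX h)).mono hXY
  · exact (van_of_notMem hX f hxX).mono hXY

theorem K_empty_le {X U : Set M} {j : ℕ} : K p X ∅ j ≤ K p X U j :=
  fun _ hf x _ => hf x (Set.notMem_empty _)

theorem cut_mem_K {X U : Set M} {j : ℕ} {f : Fn p M j} (S : Set (Fin (j + 1) → M))
    (hf : f ∈ K p X U j) : cut S f ∈ K p X U j := K_of_imp hf fun _ h => cut_eq_zero S h

theorem van_cut_sub {X B : Set M} {j : ℕ} (f : Fn p M j) {x : M} (hB : B ∈ 𝓝[X] x) :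
    Van X (cut (fst B j) f - f) x :=
  ⟨B, hB, fun s hs => by
    rw [Pi.sub_apply, cut_of_mem f (show s ∈ fst B j from hs 0), sub_self]⟩

theorem van_cut {X B : Set M} {j : ℕ} (f : Fn p M j) {x : M} (hB : Bᶜ ∈ 𝓝[X] x) :
    Van X (cut (fst B j) f) x :=
  ⟨Bᶜ, hB, fun s hs => cut_of_notMem f (show s ∉ fst B j from hs 0)⟩

/-- Extension by zero. -/
theorem exists_ext {X Y U : Set M} {j : ℕ} {f : Fn p M j} (hf : f ∈ K p Y U j) :
    cut {s | ∀ i, s i ∈ Y} f ∈ K p X U j ∧ f - cut {s | ∀ i, s i ∈ Y} f ∈ K p Y ∅ j := by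
  constructor
  · intro x hx
    obtain ⟨V, hV, hxV, h⟩ := van_iff.1 (hf x hx)
    refine van_iff.2 ⟨V, hV, hxV, fun s hs => ?_⟩
    by_cases hsY : s ∈ {s : Fin (j + 1) → M | ∀ i, s i ∈ Y}
    · rw [cut_of_mem f hsY]
      exact h s fun i => ⟨(hs i).1, hsY i⟩
    · exact cut_of_notMem f hsY
  · intro x _
    refine van_iff.2 ⟨Set.univ, isOpen_univ, trivial, fun s hs => ?_⟩
    rw [Pi.sub_apply, cut_of_mem f (show s ∈ {s : Fin (j + 1) → M | ∀ i, s i ∈ Y} from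
      fun i => (hs i).2), sub_self]

end Fn

namespace Fn

variable {p : ℕ} {M : Type*} {E : Type*} [Group E]

/-- Functions invariant under an action. -/
def inv (p : ℕ) (θ : E →* Equiv.Perm M) (j : ℕ) : Submodule (ZMod p) (Fn p M j) where
  carrier := {f | ∀ g, pull (θ g) f = f}
  add_mem' hf hg a := by rw [map_add, hf, hg]
  zero_mem' _ := rfl
  smul_mem' c _ hf a := by rw [map_smul, hf]

theorem d_mem_inv {θ : E →* Equiv.Perm M} {j : ℕ} {f : Fn p M j} (hf : f ∈ inv p θ j) :
    d f ∈ inv p θ (j + 1) := fun g => by rw [pull_d, hf]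

theorem mem_inv_one {j : ℕ} (f : Fn p M j) : f ∈ inv p (1 : E →* Equiv.Perm M) j :=
  fun _ => rfl

theorem cut_mem_inv {θ : E →* Equiv.Perm M} {j : ℕ} {f : Fn p M j} (hf : f ∈ inv p θ j)
    {S : Set (Fin (j + 1) → M)} (hS : ∀ g s, s ∈ S ↔ θ g ∘ s ∈ S) : cut S f ∈ inv p θ j := by
  intro g
  funext s
  have := congrFun (hf g) s
  rw [pull_apply] at this ⊢
  by_cases h : s ∈ S
  · rw [cut_of_mem f h, cut_of_mem f ((hS g s).1 h), this]
  · rw [cut_of_notMem f h, cut_of_notMem f fun h' => h ((hS g s).2 h')]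

/-- The largest invariant subset. -/
def core (θ : E →* Equiv.Perm M) (B : Set M) : Set M := {x | ∀ g, θ g x ∈ B}

theorem core_subset (θ : E →* Equiv.Perm M) (B : Set M) : core θ B ⊆ B := fun x hx => by
  simpa using hx 1

theorem mem_core_iff (θ : E →* Equiv.Perm M) (B : Set M) (g : E) (x : M) :
    x ∈ core θ B ↔ θ g x ∈ core θ B := by
  constructor
  · intro h a
    rw [← Equiv.Perm.mul_apply, ← map_mul]
    exact h _
  · intro h a
    have := h (a * g⁻¹)
    rwa [← Equiv.Perm.mul_apply, ← map_mul, inv_mul_cancel_right] at this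

variable [TopologicalSpace M]

/-- An action by homeomorphisms of a subset. -/
structure Acts (θ : E →* Equiv.Perm M) (X : Set M) : Prop where
  maps : ∀ g, Set.MapsTo (θ g) X X
  cont : ∀ g, ContinuousOn (θ g) X

theorem Acts.one (X : Set M) : Acts (1 : E →* Equiv.Perm M) X :=
  ⟨fun _ _ h => h, fun _ => continuousOn_id⟩

theorem Acts.pull_mem_K {θ : E →* Equiv.Perm M} {X U : Set M} (hθ : Acts θ X) (hX : IsClosed X)
    {g : E} (hU : ∀ x ∈ X, θ g x ∈ U → x ∈ U) {j : ℕ} {f : Fn p M j} (hf : f ∈ K p X U j) :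
    pull (θ g) f ∈ K p X U j := by
  intro x hx
  by_cases hxX : x ∈ X
  · exact (hf _ fun h => hx (hU x hxX h)).pull (hθ.cont g) (hθ.maps g) hxX
  · exact van_of_notMem hX _ hxX

variable [Finite E]

theorem Acts.core_mem {θ : E →* Equiv.Perm M} {X : Set M} (hθ : Acts θ X) {B : Set M} {x : M}
    (hx : x ∈ X) (hB : ∀ g, B ∈ 𝓝[X] (θ g x)) : core θ B ∈ 𝓝[X] x := by
  have : core θ B = ⋂ g, θ g ⁻¹' B := by
    ext y
    simp [core]
  rw [this]
  exact (Filter.iInter_mem).2 fun g =>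
    (hθ.cont g x hx).tendsto_nhdsWithin (hθ.maps g) (hB g)

variable [CompactSpace M] [T2Space M]

theorem Acts.exists_sep {θ : E →* Equiv.Perm M} {X A C : Set M} (hθ : Acts θ X) (hA : IsClosed A)
    (hC : IsClosed C) (hAX : A ⊆ X) (hAθ : ∀ x ∈ A, ∀ g, θ g x ∈ A) (hAC : Disjoint A C) :
    ∃ B : Set M, (∀ g x, x ∈ B ↔ θ g x ∈ B) ∧ (∀ x ∈ A, B ∈ 𝓝[X] x) ∧ ∀ x ∈ C, Bᶜ ∈ 𝓝 x := by
  obtain ⟨U, V, hU, hV, hAU, hCV, hUV⟩ := normal_separation hA hC hAC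
  refine ⟨core θ U, mem_core_iff θ U, fun x hx => hθ.core_mem (hAX hx) fun g =>
    mem_nhdsWithin_of_mem_nhds (hU.mem_nhds (hAU (hAθ x hx g))), fun x hx => ?_⟩
  refine Filter.mem_of_superset (hV.mem_nhds (hCV hx)) fun y hy hy' => ?_
  exact Set.disjoint_left.1 hUV (core_subset θ U hy') hy

variable {θ : E →* Equiv.Perm M} {X Y : Set M}

/-- Germs of invariant cocycles along closed subsets of `Y` extend. -/
def Extends (p : ℕ) (θ : E →* Equiv.Perm M) (X Y : Set M) (j : ℕ) : Prop :=
  ∀ A, IsClosed A → A ⊆ Y → ∀ f ∈ K p Y ∅ j ⊓ inv p θ j, (∀ x ∈ A, Van X (d f) x) →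
    ∃ e ∈ K p Y ∅ j ⊓ inv p θ j, d e = 0 ∧ ∀ x ∈ A, Van X (f - e) x

omit [CompactSpace M] [T2Space M] [Finite E] in
theorem extends_zero (hYX : Y ⊆ X) : Extends p θ X Y 0 := by
  intro A hA hAY f hf hd
  refine ⟨0, zero_mem _, map_zero _, fun x hx => ?_⟩
  obtain ⟨V, hV, hxV, h⟩ := van_iff.1 (hd x hx)
  obtain ⟨W, hW, hxW, h'⟩ := van_iff.1 (hf.1 x (Set.notMem_empty _))
  refine van_iff.2 ⟨V, hV, hxV, fun s hs => ?_⟩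
  have h1 := h (Fin.cons x s) fun i => Fin.cases ⟨hxV, hYX (hAY hx)⟩ (fun k => hs k) i
  rw [d_cons_zero, h' (fun _ => x) fun _ => ⟨hxW, hAY hx⟩] at h1
  simpa using h1

omit [CompactSpace M] [T2Space M] in
theorem Acts.exists_local (hθ : Acts θ X) (hYX : Y ⊆ X) (hfix : ∀ x ∈ Y, ∀ g, θ g x = x)
    {j : ℕ} {f : Fn p M (j + 1)} (hf : f ∈ K p Y ∅ (j + 1) ⊓ inv p θ (j + 1)) {y : M} (hy : y ∈ Y)
    (hd : Van X (d f) y) :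
    ∃ u ∈ K p Y ∅ j ⊓ inv p θ j, ∃ O, IsOpen O ∧ y ∈ O ∧ ∀ x ∈ O, Van X (f - d u) x := by
  obtain ⟨V, hV, hyV, h⟩ := van_iff.1 hd
  obtain ⟨W, hW, hyW, h'⟩ := van_iff.1 (hf.1 y (Set.notMem_empty _))
  set C := core θ (V ∩ W) with hC
  have hCV : C ⊆ V ∩ W := core_subset _ _
  have hCy : C ∈ 𝓝[X] y := hθ.core_mem (hYX hy) fun g => by
    rw [hfix y hy]
    exact mem_nhdsWithin_of_mem_nhds ((hV.inter hW).mem_nhds ⟨hyV, hyW⟩)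
  obtain ⟨O, hO, hyO, hOC⟩ := mem_nhdsWithin.1 hCy
  refine ⟨cut {s | ∀ i, s i ∈ C} (con y f), ⟨?_, cut_mem_inv ?_ ?_⟩, O, hO, hyO, ?_⟩
  · intro x _
    refine van_iff.2 ⟨Set.univ, isOpen_univ, trivial, fun s hs => ?_⟩
    by_cases hsC : s ∈ {s : Fin (j + 1) → M | ∀ i, s i ∈ C}
    · rw [cut_of_mem _ hsC]
      exact h' _ fun i => Fin.cases ⟨hyW, hy⟩ (fun k => ⟨(hCV (hsC k)).2, (hs k).2⟩) i
    · exact cut_of_notMem _ hsC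
  · intro g
    funext s
    have := congrFun (hf.2 g) (Fin.cons y s)
    rw [pull_apply] at this ⊢
    have hc : (θ g ∘ (Fin.cons y s : Fin (j + 2) → M)) = Fin.cons y (θ g ∘ s) := by
      funext i
      refine Fin.cases ?_ (fun k => ?_) i
      · simpa using hfix y hy g
      · simp
    rw [hc] at this
    exact this
  · intro g s
    exact forall_congr' fun i => mem_core_iff θ _ g _
  · intro x hx
    refine van_iff.2 ⟨O, hO, hx, fun s hs => ?_⟩
    have h1 : d (cut {s | ∀ i, s i ∈ C} (con y f)) s = d (con y f) s := by
      rw [d_apply, d_apply]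
      refine Finset.sum_congr rfl fun i _ => ?_
      rw [cut_of_mem]
      exact fun k => hOC (hs _)
    rw [Pi.sub_apply, h1, ← d_cons]
    exact h _ fun i => Fin.cases ⟨hyV, hYX hy⟩ (fun k => ⟨(hCV (hOC (hs k))).1, (hs k).2⟩) i

theorem Acts.glue (hθ : Acts θ X) (hYX : Y ⊆ X) (hfix : ∀ x ∈ Y, ∀ g, θ g x = x) {j : ℕ}
    (ih : Extends p θ X Y j) {f : Fn p M (j + 1)} {A₁ A₂ : Set M} (h₁ : IsClosed A₁)
    (h₂ : IsClosed A₂) (hA₁ : A₁ ⊆ Y)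
    (e₁ : ∃ u ∈ K p Y ∅ j ⊓ inv p θ j, ∀ x ∈ A₁, Van X (f - d u) x)
    (e₂ : ∃ u ∈ K p Y ∅ j ⊓ inv p θ j, ∀ x ∈ A₂, Van X (f - d u) x) :
    ∃ u ∈ K p Y ∅ j ⊓ inv p θ j, ∀ x ∈ A₁ ∪ A₂, Van X (f - d u) x := by
  obtain ⟨u₁, hu₁, k₁⟩ := e₁
  obtain ⟨u₂, hu₂, k₂⟩ := e₂
  obtain ⟨e, he, hde, hv⟩ := ih (A₁ ∩ A₂) (h₁.inter h₂) (Set.inter_subset_left.trans hA₁)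
    (u₁ - u₂) (sub_mem hu₁ hu₂) fun x hx => by
      have := (k₂ x hx.2).sub (k₁ x hx.1)
      rwa [sub_sub_sub_cancel_left, ← map_sub] at this
  set D := u₁ - u₂ - e with hD
  have hO := isOpen_van X D
  obtain ⟨B, hB, hB₁, hB₂⟩ := hθ.exists_sep (A := A₁ \ {x | Van X D x})
    (C := A₂ \ {x | Van X D x}) (h₁.sdiff hO) (h₂.sdiff hO)
    (Set.sdiff_subset.trans (hA₁.trans hYX)) (fun x hx g => by rwa [hfix x (hA₁ hx.1)])
    (Set.disjoint_left.2 fun x hx hx' => hx.2 (hv x ⟨hx.1, hx'.1⟩))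
  have hDm : D ∈ K p Y ∅ j ⊓ inv p θ j := sub_mem (sub_mem hu₁ hu₂) he
  refine ⟨u₂ + e + cut (fst B j) D, add_mem (add_mem hu₂ he)
    ⟨cut_mem_K _ hDm.1, cut_mem_inv hDm.2 fun g s => hB g _⟩, ?_⟩
  rintro x (hx | hx)
  · have hs : f - d (u₂ + e + cut (fst B j) D) = (f - d u₁) - d (cut (fst B j) D - D) := by
      rw [hD]
      simp only [map_sub, map_add]
      abel
    rw [hs]
    refine (k₁ x hx).sub (Van.d ?_)
    by_cases hxO : Van X D x
    · exact (hxO.of_imp fun s h => cut_eq_zero _ h).sub hxO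
    · exact van_cut_sub D (hB₁ x ⟨hx, hxO⟩)
  · have hs : f - d (u₂ + e + cut (fst B j) D) = (f - d u₂) - d (cut (fst B j) D) := by
      simp only [map_add, hde]
      abel
    rw [hs]
    refine (k₂ x hx).sub (Van.d ?_)
    by_cases hxO : Van X D x
    · exact hxO.of_imp fun s h => cut_eq_zero _ h
    · exact van_cut D (mem_nhdsWithin_of_mem_nhds (hB₂ x ⟨hx, hxO⟩))

theorem Acts.patch_of_extends (hθ : Acts θ X) (hYX : Y ⊆ X) (hfix : ∀ x ∈ Y, ∀ g, θ g x = x)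
    {j : ℕ} (ih : Extends p θ X Y j) {A : Set M} (hA : IsClosed A) (hAY : A ⊆ Y)
    {f : Fn p M (j + 1)} (hf : f ∈ K p Y ∅ (j + 1) ⊓ inv p θ (j + 1))
    (hd : ∀ x ∈ A, Van X (d f) x) :
    ∃ u ∈ K p Y ∅ j ⊓ inv p θ j, ∀ x ∈ A, Van X (f - d u) x := by
  have key : ∃ u ∈ K p Y ∅ j ⊓ inv p θ j, ∀ x ∈ A ∩ closure A, Van X (f - d u) x := by
    refine hA.isCompact.induction_on
      (p := fun s => ∃ u ∈ K p Y ∅ j ⊓ inv p θ j, ∀ x ∈ A ∩ closure s, Van X (f - d u) x)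
      ⟨0, zero_mem _, by simp⟩ ?_ ?_ ?_
    · rintro s t hst ⟨u, hu, h⟩
      exact ⟨u, hu, fun x hx => h x ⟨hx.1, closure_mono hst hx.2⟩⟩
    · intro s t hs ht
      rw [closure_union, Set.inter_union_distrib_left]
      exact hθ.glue hYX hfix ih (hA.inter isClosed_closure) (hA.inter isClosed_closure)
        (Set.inter_subset_left.trans hAY) hs ht
    · intro y hy
      obtain ⟨u, hu, O, hO, hyO, h⟩ := hθ.exists_local hYX hfix hf (hAY hy) (hd y hy)
      obtain ⟨t, ht, htc, htO⟩ := exists_mem_nhds_isClosed_subset (hO.mem_nhds hyO)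
      exact ⟨t, mem_nhdsWithin_of_mem_nhds ht, u, hu, fun x hx => h x (htO (by
        rw [← htc.closure_eq]; exact hx.2))⟩
  rwa [hA.closure_eq, Set.inter_self] at key

theorem Acts.extends (hθ : Acts θ X) (hYX : Y ⊆ X) (hfix : ∀ x ∈ Y, ∀ g, θ g x = x) (j : ℕ) :
    Extends p θ X Y j := by
  induction j with
  | zero => exact extends_zero hYX
  | succ j ih =>
    intro A hA hAY f hf hd
    obtain ⟨u, hu, h⟩ := hθ.patch_of_extends hYX hfix ih hA hAY hf hd
    exact ⟨d u, ⟨d_mem_K hu.1, d_mem_inv hu.2⟩, d_d u, h⟩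

/-- Relatively open subsets. -/
def ROpen (X U : Set M) : Prop := ∀ x ∈ X, x ∈ U → U ∈ 𝓝[X] x

omit [CompactSpace M] [T2Space M] in
theorem ROpen.isClosed_diff {U : Set M} (hX : IsClosed X) (hU : ROpen X U) :
    IsClosed (X \ U) := by
  rw [← isOpen_compl_iff, isOpen_iff_mem_nhds]
  intro x hx
  by_cases hxX : x ∈ X
  · have hxU : x ∈ U := by
      by_contra h
      exact hx ⟨hxX, h⟩
    have := mem_nhdsWithin_iff_eventually.1 (hU x hxX hxU)
    filter_upwards [this] with y hy hy'
    exact hy'.2 (hy hy'.1)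
  · filter_upwards [hX.isOpen_compl.mem_nhds hxX] with y hy hy'
    exact hy hy'.1

theorem Acts.patch (hθ : Acts θ X) (hX : IsClosed X) (hY : IsClosed Y) (hYX : Y ⊆ X)
    (hfix : ∀ x ∈ Y, ∀ g, θ g x = x) {U : Set M} (hU : ROpen X U) {j : ℕ} {f : Fn p M (j + 1)}
    (hf : f ∈ K p Y ∅ (j + 1) ⊓ inv p θ (j + 1)) (hfU : f ∈ K p X U (j + 1))
    (hd : ∀ x ∈ Y, Van X (d f) x) :
    ∃ v ∈ K p Y ∅ j ⊓ inv p θ j, v ∈ K p X U j ∧ ∀ x ∈ Y, Van X (f - d v) x := by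
  obtain ⟨u, hu, h⟩ :=
    hθ.patch_of_extends hYX hfix (hθ.extends hYX hfix j) hY le_rfl hf hd
  have hYU : Y \ U = Y ∩ (X \ U) := by
    ext x
    exact ⟨fun h => ⟨h.1, hYX h.1, h.2⟩, fun h => ⟨h.1, h.2.2⟩⟩
  have hc := hU.isClosed_diff hX
  obtain ⟨e, he, hde, hv⟩ := hθ.extends hYX hfix j (Y \ U) (by rw [hYU]; exact hY.inter hc)
    Set.sdiff_subset u hu fun x hx => by
      simpa using (hfU x hx.2).sub (h x hx.1)
  have hO := isOpen_van X (u - e)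
  obtain ⟨B, hB, hB₁, hB₂⟩ := hθ.exists_sep (A := Y \ {x | Van X (u - e) x})
    (C := X \ U) (hY.sdiff hO) hc (Set.sdiff_subset.trans hYX)
    (fun x hx g => by rwa [hfix x hx.1])
    (Set.disjoint_left.2 fun x hx hx' => hx.2 (hv x ⟨hx.1, hx'.2⟩))
  have hm : u - e ∈ K p Y ∅ j ⊓ inv p θ j := sub_mem hu he
  refine ⟨cut (fst B j) (u - e), ⟨cut_mem_K _ hm.1, cut_mem_inv hm.2 fun g s => hB g _⟩, ?_, ?_⟩
  · intro x hx
    by_cases hxX : x ∈ X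
    · exact van_cut _ (mem_nhdsWithin_of_mem_nhds (hB₂ x ⟨hxX, hx⟩))
    · exact van_of_notMem hX _ hxX
  · intro x hx
    have hs : f - d (cut (fst B j) (u - e)) = (f - d u) - d (cut (fst B j) (u - e) - (u - e)) := by
      simp only [map_sub, hde]
      abel
    rw [hs]
    refine (h x hx).sub (Van.d ?_)
    by_cases hxO : Van X (u - e) x
    · exact (hxO.of_imp fun s h => cut_eq_zero _ h).sub hxO
    · exact van_cut_sub _ (hB₁ x ⟨hx, hxO⟩)

end Fn

namespace Fn

variable {p : ℕ} {M : Type*} {E : Type*} [Group E] [TopologicalSpace M]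

theorem ROpen.inter {X U V : Set M} (hU : ROpen X U) (hV : ROpen X V) : ROpen X (U ∩ V) :=
  fun x hx h => Filter.inter_mem (hU x hx h.1) (hV x hx h.2)

theorem ROpen.union {X U V : Set M} (hU : ROpen X U) (hV : ROpen X V) : ROpen X (U ∪ V) := by
  rintro x hx (h | h)
  · exact Filter.mem_of_superset (hU x hx h) Set.subset_union_left
  · exact Filter.mem_of_superset (hV x hx h) Set.subset_union_right

theorem ropen_of_isOpen {X U : Set M} (hU : IsOpen U) : ROpen X U :=
  fun _ _ h => mem_nhdsWithin_of_mem_nhds (hU.mem_nhds h)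

theorem inf_mem_K {X U V : Set M} {j : ℕ} {f : Fn p M j} (hU : f ∈ K p X U j)
    (hV : f ∈ K p X V j) : f ∈ K p X (U ∩ V) j := fun x hx => by
  by_cases h : x ∈ U
  · exact hV x fun h' => hx ⟨h, h'⟩
  · exact hU x h

theorem K_le_sup {X U V : Set M} (hUV : U ⊆ V) (j : ℕ) : K p X U j ≤ K p X V j :=
  fun _ hf x hx => hf x fun h => hx (hUV h)

/-- Vanishing of the invariant cohomology of `X` above degree `c` with supports in invariant
open subsets of `U`. -/
def Exc (p : ℕ) (θ : E →* Equiv.Perm M) (X : Set M) (c : ℕ) (U : Set M) : Prop :=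
  ∀ U' ⊆ U, ROpen X U' → (∀ g x, x ∈ U' ↔ θ g x ∈ U') → ∀ j, c ≤ j →
    ∀ f ∈ K p X U' (j + 1) ⊓ inv p θ (j + 1), d f ∈ K p X ∅ (j + 2) →
      ∃ u ∈ K p X U' j ⊓ inv p θ j, f - d u ∈ K p X ∅ (j + 1)

/-- Cohomological dimension at most `c`. -/
def CD (p : ℕ) (c : ℕ) (X : Set M) : Prop :=
  ∀ U, ROpen X U → ∀ j, c ≤ j → ∀ f ∈ K p X U (j + 1), d f ∈ K p X ∅ (j + 2) →
    ∃ u ∈ K p X U j, f - d u ∈ K p X ∅ (j + 1)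

theorem cd_of_exc {c : ℕ} {X : Set M} (h : Exc p (1 : Unit →* Equiv.Perm M) X c Set.univ) :
    CD p c X := by
  intro U hU j hj f hf hd
  obtain ⟨u, hu, h⟩ := h U (Set.subset_univ _) hU (fun _ _ => Iff.rfl) j hj f
    ⟨hf, mem_inv_one f⟩ hd
  exact ⟨u, hu.1, h⟩

theorem exc_empty (θ : E →* Equiv.Perm M) (X : Set M) (c : ℕ) : Exc p θ X c ∅ := by
  intro U' hU' _ _ j _ f hf _
  rw [Set.subset_empty_iff.1 hU'] at hf ⊢
  exact ⟨0, zero_mem _, by simpa using hf.1⟩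

variable [CompactSpace M] [T2Space M]

theorem CD.of_closed {c : ℕ} {X Y : Set M} (hX : IsClosed X) (hY : IsClosed Y) (hYX : Y ⊆ X)
    (h : CD p c X) : CD p c Y := by
  intro U hU j hj f hf hd
  set U' := U ∩ Y ∪ Yᶜ with hU'
  have hUU : ∀ x ∈ Y, x ∈ U' → x ∈ U := by
    rintro x hx (h | h)
    · exact h.1
    · exact absurd hx h
  have hU'o : ROpen X U' := by
    intro x _ hxU
    by_cases hxY : x ∈ Y
    · obtain ⟨O, hO, hxO, hOU⟩ := mem_nhdsWithin.1 (hU x hxY (hUU x hxY hxU))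
      refine mem_nhdsWithin.2 ⟨O, hO, hxO, fun y hy => ?_⟩
      by_cases hyY : y ∈ Y
      · exact Or.inl ⟨hOU ⟨hy.1, hyY⟩, hyY⟩
      · exact Or.inr hyY
    · exact mem_nhdsWithin_of_mem_nhds
        (Filter.mem_of_superset (hY.isOpen_compl.mem_nhds hxY) Set.subset_union_right)
  obtain ⟨hf₁, hff⟩ := exists_ext (X := X) hf
  set f₁ := cut {s | ∀ i, s i ∈ Y} f with hf₁_def
  have hf₁U : f₁ ∈ K p X U' (j + 1) := by
    have : f₁ ∈ K p X (U ∩ Y) (j + 1) := by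
      refine inf_mem_K hf₁ fun x hx => ?_
      refine van_iff.2 ⟨Yᶜ, hY.isOpen_compl, hx, fun s hs => ?_⟩
      exact cut_of_notMem f fun h => (hs 0).1 (h 0)
    exact K_le_sup Set.subset_union_left _ this
  have hdf₁ : d f₁ ∈ K p Y ∅ (j + 2) := by
    have := sub_mem hd (d_mem_K hff)
    rwa [← map_sub, sub_sub_cancel] at this
  have hθ := Acts.one (E := Unit) X
  obtain ⟨v, hv, hvU, hv'⟩ := hθ.patch hX hY hYX (fun _ _ _ => rfl) hU'o
    ⟨hdf₁, mem_inv_one _⟩ (d_mem_K hf₁U) fun x _ => by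
      rw [d_d]
      exact Van.zero _ _ _
  have h1 : d (f₁ - v) ∈ K p X Yᶜ (j + 2) := fun x hx => by
    rw [map_sub]
    exact hv' x (Set.notMem_compl_iff.1 hx)
  obtain ⟨w, hw, hw'⟩ := h Yᶜ (ropen_of_isOpen hY.isOpen_compl) (j + 1) (by omega) _ h1
    (by rw [d_d]; exact zero_mem _)
  have hwY : w ∈ K p Y ∅ (j + 1) := by
    intro x _
    by_cases hxY : x ∈ Y
    · exact (hw x fun h => h hxY).mono hYX
    · exact van_of_notMem hY _ hxY
  obtain ⟨u, hu, hu'⟩ := h U' hU'o j hj (f₁ - v - w)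
    (sub_mem (sub_mem hf₁U hvU) (K_le_sup Set.subset_union_right _ hw))
    (by rw [map_sub]; exact hw')
  refine ⟨u, fun x hx => ?_, ?_⟩
  · by_cases hxY : x ∈ Y
    · exact (hu x fun h => hx (hUU x hxY h)).mono hYX
    · exact van_of_notMem hY _ hxY
  · have : f - d u = (f - f₁) + (f₁ - v - w - d u) + v + w := by abel
    rw [this]
    exact add_mem (add_mem (add_mem hff (K_mono hX hYX (fun x _ h => h) _ hu')) hv.1) hwY

variable {θ : E →* Equiv.Perm M} {X Y : Set M}

omit [CompactSpace M] [T2Space M] in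
theorem Acts.van_iff_of_inv (hθ : Acts θ X) {j : ℕ} {f : Fn p M j} (hf : f ∈ inv p θ j)
    {x : M} (hx : x ∈ X) (g : E) : Van X f x ↔ Van X f (θ g x) := by
  constructor
  · intro h
    have h1 : (θ g⁻¹) (θ g x) = x := by
      rw [← Equiv.Perm.mul_apply, ← map_mul]
      simp
    rw [← h1] at h
    have := h.pull (hθ.cont g⁻¹) (hθ.maps g⁻¹) (hθ.maps g hx)
    rwa [hf] at this
  · intro h
    have := h.pull (hθ.cont g) (hθ.maps g) hx
    rwa [hf] at this

variable [Finite E]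

theorem Exc.union (hθ : Acts θ X) (hX : IsClosed X) {c : ℕ} {U₁ U₂ : Set M}
    (ho₁ : ROpen X U₁) (ho₂ : ROpen X U₂) (hi₁ : ∀ g x, x ∈ U₁ ↔ θ g x ∈ U₁)
    (hi₂ : ∀ g x, x ∈ U₂ ↔ θ g x ∈ U₂) (h₁ : Exc p θ X c U₁) (h₂ : Exc p θ X c U₂) :
    Exc p θ X c (U₁ ∪ U₂) := by
  intro U hU hUo hUi j hj f hf hd
  set S := X \ {x | Van X f x} with hS
  have hSc : IsClosed S := hX.sdiff (isOpen_van X f)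
  have hSU : S ⊆ U := fun x hx => by
    by_contra h
    exact hx.2 (hf.1 x h)
  have hSi : ∀ x ∈ S, ∀ g, θ g x ∈ S := fun x hx g =>
    ⟨hθ.maps g hx.1, fun h => hx.2 ((hθ.van_iff_of_inv hf.2 hx.1 g).2 h)⟩
  have hS₁ : S \ U₁ = S ∩ (X \ U₁) := by
    ext x
    exact ⟨fun h => ⟨h.1, h.1.1, h.2⟩, fun h => ⟨h.1, h.2.2⟩⟩
  have hS₂ : S \ U₂ = S ∩ (X \ U₂) := by
    ext x
    exact ⟨fun h => ⟨h.1, h.1.1, h.2⟩, fun h => ⟨h.1, h.2.2⟩⟩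
  obtain ⟨B, hB, hB₁, hB₂⟩ := hθ.exists_sep (A := S \ U₂) (C := S \ U₁)
    (by rw [hS₂]; exact hSc.inter (ho₂.isClosed_diff hX))
    (by rw [hS₁]; exact hSc.inter (ho₁.isClosed_diff hX)) (fun x hx => hx.1.1)
    (fun x hx g => ⟨hSi x hx.1 g, fun h => hx.2 ((hi₂ g x).2 h)⟩)
    (Set.disjoint_left.2 fun x hx hx' => (hU (hSU hx.1)).elim hx'.2 hx.2)
  set f₁ := cut (fst B (j + 1)) f with hf₁
  have hvan : ∀ x, x ∉ S → Van X f x := fun x hx => by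
    by_cases hxX : x ∈ X
    · by_contra h
      exact hx ⟨hxX, h⟩
    · exact van_of_notMem hX _ hxX
  have hfi : f₁ ∈ inv p θ (j + 1) := cut_mem_inv hf.2 fun g s => hB g _
  have hm₁ : f₁ ∈ K p X (U ∩ U₁) (j + 1) := by
    refine inf_mem_K (cut_mem_K _ hf.1) fun x hx => ?_
    by_cases hxS : x ∈ S
    · exact van_cut f (mem_nhdsWithin_of_mem_nhds (hB₂ x ⟨hxS, hx⟩))
    · exact (hvan x hxS).of_imp fun s h => cut_eq_zero _ h
  have hm₂ : f - f₁ ∈ K p X (U ∩ U₂) (j + 1) := by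
    refine inf_mem_K (sub_mem hf.1 (cut_mem_K _ hf.1)) fun x hx => ?_
    rw [← neg_sub]
    by_cases hxS : x ∈ S
    · exact (van_cut_sub f (hB₁ x ⟨hxS, hx⟩)).neg
    · exact (((hvan x hxS).of_imp fun s h => cut_eq_zero _ h).sub (hvan x hxS)).neg
  have hd₁ : d f₁ ∈ K p X (U ∩ U₁ ∩ U₂) (j + 2) := by
    refine inf_mem_K (d_mem_K hm₁) ?_
    have h3 : d f₁ = d f - d (f - f₁) := by
      rw [map_sub]
      abel
    rw [h3]
    exact sub_mem (K_empty_le hd) (K_le_sup Set.inter_subset_right _ (d_mem_K hm₂))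
  obtain ⟨w, hw, hw'⟩ := h₁ (U ∩ U₁ ∩ U₂) (fun x hx => hx.1.2) ((hUo.inter ho₁).inter ho₂)
    (fun g x => and_congr (and_congr (hUi g x) (hi₁ g x)) (hi₂ g x)) (j + 1) (by omega) (d f₁)
    ⟨hd₁, d_mem_inv hfi⟩ (by rw [d_d]; exact zero_mem _)
  rw [← map_sub] at hw'
  obtain ⟨u₁, hu₁, hu₁'⟩ := h₁ (U ∩ U₁) Set.inter_subset_right (hUo.inter ho₁)
    (fun g x => and_congr (hUi g x) (hi₁ g x)) j hj (f₁ - w)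
    ⟨sub_mem hm₁ (K_le_sup Set.inter_subset_left _ hw.1), sub_mem hfi hw.2⟩ hw'
  obtain ⟨u₂, hu₂, hu₂'⟩ := h₂ (U ∩ U₂) Set.inter_subset_right (hUo.inter ho₂)
    (fun g x => and_congr (hUi g x) (hi₂ g x)) j hj (f - f₁ + w)
    ⟨add_mem hm₂ (K_le_sup (Set.inter_subset_inter_left _ Set.inter_subset_left) _ hw.1),
      add_mem (sub_mem hf.2 hfi) hw.2⟩ (by
      have : d (f - f₁ + w) = d f - d (f₁ - w) := by
        simp only [map_sub, map_add]
        abel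
      rw [this]
      exact sub_mem hd hw')
  refine ⟨u₁ + u₂, ⟨add_mem (K_le_sup Set.inter_subset_left _ hu₁.1)
    (K_le_sup Set.inter_subset_left _ hu₂.1), add_mem hu₁.2 hu₂.2⟩, ?_⟩
  have : f - d (u₁ + u₂) = (f₁ - w - d u₁) + (f - f₁ + w - d u₂) := by
    rw [map_add]
    abel
  rw [this]
  exact add_mem hu₁' hu₂'

omit [CompactSpace M] [T2Space M] in
theorem Acts.exc_of_disjoint [T2Space M] (hθ : Acts θ X) (hX : IsClosed X) {c : ℕ}
    (hcd : CD p c X)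
    {V : Set M} (hVo : ROpen X V) (hVX : V ⊆ X) (hV : ∀ x ∈ V, ∀ g, g ≠ 1 → θ g x ∉ V) :
    Exc p θ X c {x | ∃ g, θ g x ∈ V} := by
  classical
  have := Fintype.ofFinite E
  have hmul : ∀ a b x, θ a (θ b x) = θ (a * b) x := fun a b x => by
    rw [map_mul, Equiv.Perm.mul_apply]
  intro U hU hUo hUi j hj f hf hd
  set f₁ := cut (fst V (j + 1)) f with hf₁
  have hnot : ∀ x ∈ X, x ∉ V → Van X f₁ x := by
    intro x hx hxV
    by_cases hxU : x ∈ U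
    · obtain ⟨g, hg⟩ := hU hxU
      refine van_cut f ?_
      have h1 := (hθ.cont g x hx).tendsto_nhdsWithin (hθ.maps g) (hVo _ (hVX hg) hg)
      refine Filter.mem_of_superset h1 fun y hy hyV => ?_
      refine hV y hyV g ?_ hy
      rintro rfl
      exact hxV (by simpa using hg)
    · exact (hf.1 x hxU).of_imp fun s h => cut_eq_zero _ h
  have hm : f₁ ∈ K p X (U ∩ V) (j + 1) := by
    refine inf_mem_K (cut_mem_K _ hf.1) fun x hx => ?_
    by_cases hxX : x ∈ X
    · exact hnot x hxX hx
    · exact van_of_notMem hX _ hxX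
  have hsub : ∀ x ∈ X, x ∈ V → Van X (f₁ - f) x := fun x hxX hx =>
    van_cut_sub f (hVo x hxX hx)
  have hd₁ : d f₁ ∈ K p X ∅ (j + 2) := by
    intro x _
    by_cases hxX : x ∈ X
    · by_cases hxV : x ∈ V
      · have h1 := (hsub x hxX hxV).d.add (hd x (Set.notMem_empty x))
        rwa [map_sub, sub_add_cancel] at h1
      · exact (hnot x hxX hxV).d
    · exact van_of_notMem hX _ hxX
  obtain ⟨u₁, hu₁, hu₁'⟩ := hcd _ (hUo.inter hVo) j hj f₁ hm hd₁
  have hpull : ∀ g {i : ℕ} (h : Fn p M i), h ∈ K p X U i → pull (θ g) h ∈ K p X U i :=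
    fun g i h hh => hθ.pull_mem_K hX (fun x _ => (hUi g x).2) hh
  refine ⟨∑ g, pull (θ g) u₁, ⟨sum_mem fun g _ => hpull g _
    (K_le_sup Set.inter_subset_left _ hu₁), fun a => ?_⟩, ?_⟩
  · rw [map_sum]
    refine Fintype.sum_equiv (Equiv.mulRight a) _ _ fun g => ?_
    funext s
    simp only [pull_apply, Equiv.coe_mulRight]
    congr 1
    funext i
    exact hmul _ _ _
  · have h1 : f - d (∑ g, pull (θ g) u₁) =
        (f - ∑ g, pull (θ g) f₁) + ∑ g, pull (θ g) (f₁ - d u₁) := by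
      simp only [map_sub, Finset.sum_sub_distrib, map_sum, pull_d]
      abel
    rw [h1]
    refine add_mem ?_ (sum_mem fun g _ => hθ.pull_mem_K hX (fun x _ h => h) hu₁')
    intro x _
    by_cases hxX : x ∈ X
    · by_cases hxU : x ∈ U
      · obtain ⟨b, hb⟩ := hU hxU
        have h2 : f - ∑ g, pull (θ g) f₁ =
            -pull (θ b) (f₁ - f) + -∑ g ∈ Finset.univ.erase b, pull (θ g) f₁ := by
          rw [← Finset.add_sum_erase _ _ (Finset.mem_univ b), map_sub, hf.2]
          abel
        rw [h2]
        refine Van.add ((hsub _ (hθ.maps b hxX) hb).pull (hθ.cont b) (hθ.maps b) hxX).neg ?_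
        refine Van.neg ?_
        refine Finset.sum_induction _ (fun h : Fn p M (j + 1) => Van X h x)
          (fun _ _ => Van.add) (Van.zero _ _ _) fun g hg => ?_
        refine (hnot _ (hθ.maps g hxX) fun h => ?_).pull (hθ.cont g) (hθ.maps g) hxX
        refine hV _ hb (g * b⁻¹) (fun h => (Finset.ne_of_mem_erase hg) ?_) ?_
        · exact mul_inv_eq_one.1 h
        · rwa [hmul, inv_mul_cancel_right]
      · refine (hf.1 x hxU).sub ?_
        refine Finset.sum_induction _ (fun h : Fn p M (j + 1) => Van X h x)
          (fun _ _ => Van.add) (Van.zero _ _ _) fun g _ => ?_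
        exact hpull g _ (K_le_sup Set.inter_subset_left _ hm) x hxU
    · exact van_of_notMem hX _ hxX

omit [CompactSpace M] in
theorem Acts.exists_disjoint (hθ : Acts θ X) {y : M} (hy : y ∈ X) (hfree : ∀ g, g ≠ 1 → θ g y ≠ y) :
    ∃ V, ROpen X V ∧ V ⊆ X ∧ y ∈ V ∧ ∀ x ∈ V, ∀ g, g ≠ 1 → θ g x ∉ V := by
  have h : ∀ g : {g : E // g ≠ 1}, ∃ P Q : Set M, IsOpen P ∧ IsOpen Q ∧ y ∈ P ∧ θ g y ∈ Q ∧
      Disjoint P Q := fun g => t2_separation (hfree g g.2).symm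
  choose P Q hP hQ hyP hyQ hPQ using h
  have hmem : (⋂ g : {g : E // g ≠ 1}, P g ∩ θ g ⁻¹' Q g) ∈ 𝓝[X] y :=
    Filter.iInter_mem.2 fun g => Filter.inter_mem
      (mem_nhdsWithin_of_mem_nhds ((hP g).mem_nhds (hyP g)))
      ((hθ.cont g y hy).tendsto_nhdsWithin (hθ.maps g)
        (mem_nhdsWithin_of_mem_nhds ((hQ g).mem_nhds (hyQ g))))
  obtain ⟨O, hO, hyO, hOX⟩ := mem_nhdsWithin.1 hmem
  refine ⟨O ∩ X, fun x _ hx => ?_, Set.inter_subset_right, ⟨hyO, hy⟩, fun x hx g hg hgx => ?_⟩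
  · exact mem_nhdsWithin.2 ⟨O, hO, hx.1, le_rfl⟩
  · have h1 := Set.mem_iInter.1 (hOX hx) ⟨g, hg⟩
    have h2 := Set.mem_iInter.1 (hOX hgx) ⟨g, hg⟩
    exact Set.disjoint_left.1 (hPQ ⟨g, hg⟩) h2.1 h1.2

theorem Acts.exc_of_free (hθ : Acts θ X) (hX : IsClosed X) {c : ℕ} (hcd : CD p c X) {S : Set M}
    (hS : IsClosed S) (hSX : S ⊆ X) (hfree : ∀ y ∈ S, ∀ g, g ≠ 1 → θ g y ≠ y) :
    ∃ O, S ⊆ O ∧ ROpen X O ∧ (∀ g x, x ∈ O ↔ θ g x ∈ O) ∧ Exc p θ X c O := by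
  refine hS.isCompact.induction_on
    (p := fun S => ∃ O, S ⊆ O ∧ ROpen X O ∧ (∀ g x, x ∈ O ↔ θ g x ∈ O) ∧ Exc p θ X c O)
    ⟨∅, le_rfl, fun _ _ h => absurd h (Set.notMem_empty _), fun _ _ => Iff.rfl, exc_empty θ X c⟩
    ?_ ?_ ?_
  · rintro s t hst ⟨O, h, h'⟩
    exact ⟨O, hst.trans h, h'⟩
  · rintro s t ⟨O, h, ho, hi, he⟩ ⟨O', h', ho', hi', he'⟩
    exact ⟨O ∪ O', Set.union_subset_union h h', ho.union ho',
      fun g x => or_congr (hi g x) (hi' g x), he.union hθ hX ho ho' hi hi' he'⟩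
  · intro y hy
    obtain ⟨V, hVo, hVX, hyV, hV⟩ := hθ.exists_disjoint (hSX hy) (hfree y hy)
    have hO : ROpen X {x | ∃ g, θ g x ∈ V} := by
      rintro x hx ⟨g, hg⟩
      refine Filter.mem_of_superset ((hθ.cont g x hx).tendsto_nhdsWithin (hθ.maps g)
        (hVo _ (hVX hg) hg)) fun z hz => ⟨g, hz⟩
    have hyO : y ∈ {x | ∃ g, θ g x ∈ V} := ⟨1, by simpa using hyV⟩
    refine ⟨{x | ∃ g, θ g x ∈ V} ∩ S, mem_nhdsWithin.2 ?_, {x | ∃ g, θ g x ∈ V},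
      Set.inter_subset_left, hO, fun a x => ?_, hθ.exc_of_disjoint hX hcd hVo hVX hV⟩
    · obtain ⟨W, hW, hyW, hWX⟩ := mem_nhdsWithin.1 (hO y (hSX hy) hyO)
      exact ⟨W, hW, hyW, fun z hz => ⟨hWX ⟨hz.1, hSX hz.2⟩, hz.2⟩⟩
    · constructor
      · rintro ⟨g, hg⟩
        refine ⟨g * a⁻¹, ?_⟩
        rwa [← Equiv.Perm.mul_apply, ← map_mul, inv_mul_cancel_right]
      · rintro ⟨g, hg⟩
        refine ⟨g * a, ?_⟩
        rwa [map_mul, Equiv.Perm.mul_apply]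

/-- Vanishing of the invariant relative cohomology of a free action. -/
theorem Acts.exc_rel (hθ : Acts θ X) (hX : IsClosed X) (hY : IsClosed Y) (hYX : Y ⊆ X)
    (hfix : ∀ x ∈ Y, ∀ g, θ g x = x) {c : ℕ} (hcd : CD p c X) {U : Set M} (hU : ROpen X U)
    (hUi : ∀ g x, x ∈ U ↔ θ g x ∈ U)
    (hfree : ∀ x ∈ X, x ∈ U → x ∉ Y → ∀ g, g ≠ 1 → θ g x ≠ x) {j : ℕ} (hj : c ≤ j)
    {f : Fn p M (j + 1)} (hf : f ∈ K p Y ∅ (j + 1) ⊓ K p X U (j + 1) ⊓ inv p θ (j + 1))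
    (hd : d f ∈ K p X ∅ (j + 2)) :
    ∃ u ∈ K p Y ∅ j ⊓ K p X U j ⊓ inv p θ j, f - d u ∈ K p X ∅ (j + 1) := by
  obtain ⟨v, hv, hvU, hv'⟩ := hθ.patch hX hY hYX hfix hU ⟨hf.1.1, hf.2⟩ hf.1.2
    fun x _ => hd x (Set.notMem_empty x)
  have hfv : f - d v ∈ K p X (U ∩ Yᶜ) (j + 1) := by
    refine inf_mem_K (sub_mem hf.1.2 (d_mem_K hvU)) fun x hx => ?_
    exact hv' x (Set.notMem_compl_iff.1 hx)
  set S := X \ {x | Van X (f - d v) x} with hS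
  have hSU : S ⊆ U ∩ Yᶜ := fun x hx => by
    by_contra h
    exact hx.2 (hfv x h)
  obtain ⟨O, hSO, hO, hOi, hex⟩ := hθ.exc_of_free hX hcd
    (hX.sdiff (isOpen_van X (f - d v))) Set.sdiff_subset fun y hy g hg =>
      hfree y hy.1 (hSU hy).1 (hSU hy).2 g hg
  have hYi : ∀ g x, x ∈ Y ↔ θ g x ∈ Y := by
    intro g x
    constructor
    · intro h
      rwa [hfix x h]
    · intro h
      have h1 := hfix _ h g⁻¹
      rw [← Equiv.Perm.mul_apply, ← map_mul] at h1
      simp only [inv_mul_cancel, map_one, Equiv.Perm.one_apply] at h1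
      rwa [h1]
  obtain ⟨u, hu, hu'⟩ := hex (O ∩ (U ∩ Yᶜ)) Set.inter_subset_left
    (hO.inter (hU.inter (ropen_of_isOpen hY.isOpen_compl)))
    (fun g x => and_congr (hOi g x) (and_congr (hUi g x) (not_congr (hYi g x)))) j hj (f - d v)
    ⟨inf_mem_K (fun x hx => by
      by_cases hxX : x ∈ X
      · by_contra h
        exact hx (hSO ⟨hxX, h⟩)
      · exact van_of_notMem hX _ hxX) hfv, sub_mem hf.2 (d_mem_inv hv.2)⟩ (by
      rw [map_sub, d_d, sub_zero]
      exact hd)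
  refine ⟨v + u, ⟨⟨add_mem hv.1 fun x _ => ?_, add_mem hvU
    (K_le_sup (fun x hx => hx.2.1) _ hu.1)⟩, add_mem hv.2 hu.2⟩, ?_⟩
  · by_cases hxY : x ∈ Y
    · exact (hu.1 x fun h => h.2.2 hxY).mono hYX
    · exact van_of_notMem hY _ hxY
  · rwa [map_add, ← sub_sub]

end Fn

theorem exists_dual_of_ker {k V W : Type*} [Field k] [AddCommGroup V] [Module k V]
    [AddCommGroup W] [Module k W] (P : Submodule k V) (D : V →ₗ[k] W) (Z : Submodule k W)
    (φ : Module.Dual k V) (h : ∀ x ∈ P, D x ∈ Z → φ x = 0) :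
    ∃ ψ ∈ Z.dualAnnihilator, ∀ x ∈ P, ψ (D x) = φ x := by
  let f : P →ₗ[k] W ⧸ Z := Z.mkQ ∘ₗ D ∘ₗ P.subtype
  have h1 : φ ∘ₗ P.subtype ∈ LinearMap.range f.dualMap := by
    rw [LinearMap.range_dualMap_eq_dualAnnihilator_ker, Submodule.mem_dualAnnihilator]
    intro x hx
    refine h x x.2 ?_
    simpa [f] using hx
  obtain ⟨ψ, hψ⟩ := h1
  refine ⟨ψ ∘ₗ Z.mkQ, ?_, fun x hx => ?_⟩
  · rw [Submodule.mem_dualAnnihilator]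
    intro w hw
    simp [(Submodule.Quotient.mk_eq_zero Z).2 hw]
  · exact LinearMap.congr_fun hψ ⟨x, hx⟩

namespace Cpx

variable {p : ℕ} [Fact p.Prime] {ι : Type}

/-- The underlying complex without automorphisms. -/
def forget (L : Cpx.{u} p ι) : Cpx.{u} p Empty where
  X := L.X
  d := L.d
  dd := L.dd
  g i := i.elim
  g_d i := i.elim
  g_comm i := i.elim
  g_pow i := i.elim

theorem forget_cyc (L : Cpx.{u} p ι) (N : ℕ) : L.forget.cyc N = L.cyc N := by
  cases N <;> rfl

theorem forget_h (L : Cpx.{u} p ι) : L.forget.h = L.h := by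
  funext N
  cases N <;> rfl

theorem forget_acyc (L : Cpx.{u} p ι) (N : ℕ) : L.forget.Acyc N ↔ L.Acyc N := by
  cases N <;> rfl

theorem forget_conc (L : Cpx.{u} p ι) (d : ℕ) (o : L.X d) : L.forget.Conc d o ↔ L.Conc d o := by
  constructor
  · rintro ⟨h1, h2, h3, h4⟩
    rw [forget_cyc] at h2 h4
    exact ⟨fun j hj => (L.forget_acyc j).1 (h1 j hj), h2, h3, h4⟩
  · rintro ⟨h1, h2, h3, h4⟩
    rw [← forget_cyc] at h2 h4
    exact ⟨fun j hj => (L.forget_acyc j).2 (h1 j hj), h2, h3, h4⟩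

end Cpx

namespace Fn

variable {p : ℕ} {M : Type u} [TopologicalSpace M]

/-- Cochains of `B` vanishing on `A` and supported in `U`. -/
abbrev KK (p : ℕ) (A B U : Set M) (j : ℕ) : Submodule (ZMod p) (Fn p M j) := K p A ∅ j ⊓ K p B U j

theorem KK_mono {A B U V : Set M} (h : ∀ x ∈ B, x ∈ U → x ∈ V) (hB : IsClosed B) (j : ℕ) :
    KK p A B U j ≤ KK p A B V j :=
  inf_le_inf_left _ (K_mono hB le_rfl h j)

theorem d_mem_KK {A B U : Set M} {j : ℕ} {f : Fn p M j} (hf : f ∈ KK p A B U j) :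
    d f ∈ KK p A B U (j + 1) := ⟨d_mem_K hf.1, d_mem_K hf.2⟩

/-- Functionals that vanish locally at a filter. -/
def LN (p : ℕ) (A B : Set M) (l : Filter M) (j : ℕ) :
    Submodule (ZMod p) (Module.Dual (ZMod p) (Fn p M j)) where
  carrier := {φ | ∃ U ∈ l, ∀ f ∈ KK p A B U j, φ f = 0}
  add_mem' := by
    rintro φ ψ ⟨U, hU, h⟩ ⟨V, hV, h'⟩
    refine ⟨U ∩ V, Filter.inter_mem hU hV, fun f hf => ?_⟩
    rw [LinearMap.add_apply, h f ⟨hf.1, K_le_sup Set.inter_subset_left _ hf.2⟩,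
      h' f ⟨hf.1, K_le_sup Set.inter_subset_right _ hf.2⟩, add_zero]
  zero_mem' := ⟨Set.univ, Filter.univ_mem, fun _ _ => rfl⟩
  smul_mem' := by
    rintro c φ ⟨U, hU, h⟩
    exact ⟨U, hU, fun f hf => by rw [LinearMap.smul_apply, h f hf, smul_zero]⟩

/-- Functionals on cochains of `B`. -/
abbrev LZ (p : ℕ) (B : Set M) (j : ℕ) :
    Submodule (ZMod p) (Module.Dual (ZMod p) (Fn p M j)) :=
  (K p B ∅ j).dualAnnihilator

theorem mem_LZ {B : Set M} {j : ℕ} {φ : Module.Dual (ZMod p) (Fn p M j)} :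
    φ ∈ LZ p B j ↔ ∀ f ∈ K p B ∅ j, φ f = 0 := Submodule.mem_dualAnnihilator φ

/-- Functionals on cochains of `B` that vanish locally at a filter. -/
def LC (p : ℕ) (A B : Set M) (l : Filter M) (j : ℕ) : Submodule (ZMod p) (LZ p B j) :=
  (LN p A B l j).comap (LZ p B j).subtype

/-- Chains. -/
def LX (p : ℕ) (A B : Set M) (l : Filter M) (j : ℕ) : Type u :=
  LZ p B j ⧸ LC p A B l j

instance (p : ℕ) (A B : Set M) (l : Filter M) (j : ℕ) : AddCommGroup (LX p A B l j) :=
  inferInstanceAs (AddCommGroup (LZ p B j ⧸ LC p A B l j))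

instance (p : ℕ) (A B : Set M) (l : Filter M) (j : ℕ) : Module (ZMod p) (LX p A B l j) :=
  inferInstanceAs (Module (ZMod p) (LZ p B j ⧸ LC p A B l j))

/-- The class of a functional. -/
def lmk (A : Set M) {B : Set M} (l : Filter M) {j : ℕ} (φ : LZ p B j) : LX p A B l j :=
  Submodule.Quotient.mk φ

theorem lmk_surj (A : Set M) {B : Set M} (l : Filter M) {j : ℕ} (x : LX p A B l j) :
    ∃ φ, lmk A l φ = x := Submodule.Quotient.mk_surjective _ x

theorem lmk_eq {A B : Set M} {l : Filter M} {j : ℕ} {φ ψ : LZ p B j} :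
    lmk A l φ = lmk A l ψ ↔ ∃ U ∈ l, ∀ f ∈ KK p A B U j, φ.1 f = ψ.1 f := by
  refine (Submodule.Quotient.eq _).trans ?_
  refine exists_congr fun U => and_congr_right fun _ => forall_congr' fun f =>
    forall_congr' fun _ => ?_
  exact sub_eq_zero

theorem lmk_eq_zero {A B : Set M} {l : Filter M} {j : ℕ} {φ : LZ p B j} :
    lmk A l φ = 0 ↔ ∃ U ∈ l, ∀ f ∈ KK p A B U j, φ.1 f = 0 :=
  Submodule.Quotient.mk_eq_zero _

/-- Maps of chains induced by operators on cochains. -/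
def lmap {A B A' B' : Set M} {l l' : Filter M} {i j : ℕ} (F : Fn p M j →ₗ[ZMod p] Fn p M i)
    (hZ : ∀ f ∈ K p B' ∅ j, F f ∈ K p B ∅ i)
    (hN : ∀ U ∈ l, ∃ V ∈ l', ∀ f ∈ KK p A' B' V j, F f ∈ KK p A B U i) :
    LX p A B l i →ₗ[ZMod p] LX p A' B' l' j :=
  Submodule.mapQ _ _ (LinearMap.restrict F.dualMap fun φ hφ => mem_LZ.2 fun f hf =>
    mem_LZ.1 hφ _ (hZ f hf)) (by
    rintro φ ⟨U, hU, h⟩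
    obtain ⟨V, hV, h'⟩ := hN U hU
    exact ⟨V, hV, fun f hf => h _ (h' f hf)⟩)

/-- The boundary map. -/
def Ld (A B : Set M) (l : Filter M) (j : ℕ) : LX p A B l (j + 1) →ₗ[ZMod p] LX p A B l j :=
  lmap d (fun _ => d_mem_K) fun U hU => ⟨U, hU, fun _ => d_mem_KK⟩

theorem Ld_Ld (A B : Set M) (l : Filter M) (j : ℕ) (x : LX p A B l (j + 2)) :
    Ld A B l j (Ld A B l (j + 1) x) = 0 := by
  obtain ⟨φ, rfl⟩ := lmk_surj A l x
  refine (lmk_eq_zero (A := A) (l := l)).2 ⟨Set.univ, Filter.univ_mem, fun f _ => ?_⟩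
  change φ.1 (d (d f)) = 0
  rw [d_d, map_zero]

/-- The group of an elementary abelian action. -/
abbrev EA (p : ℕ) (ι : Type) := Multiplicative (ι → ZMod p)

/-- The generators. -/
def gen (p : ℕ) {ι : Type} [DecidableEq ι] (i : ι) : EA p ι := Multiplicative.ofAdd (Pi.single i 1)

/-- A filter generated by invariant relatively open sets. -/
def Adm {E : Type*} [Group E] (θ : E →* Equiv.Perm M) (X : Set M) (l : Filter M) : Prop :=
  ∀ U ∈ l, ∃ V ∈ l, (∀ x ∈ X, x ∈ V → x ∈ U) ∧ (∀ g x, x ∈ V ↔ θ g x ∈ V) ∧ ROpen X V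

theorem Adm.mono {E : Type*} [Group E] {θ : E →* Equiv.Perm M} {X Y : Set M} {l : Filter M}
    (h : Adm θ X l) (hY : Y ⊆ X) : Adm θ Y l := by
  intro U hU
  obtain ⟨V, hV, h1, h2, h3⟩ := h U hU
  exact ⟨V, hV, fun x hx => h1 x (hY hx), h2, fun x hx hxV => nhdsWithin_mono x hY (h3 x (hY hx) hxV)⟩

variable {ι : Type} [DecidableEq ι]

/-- An action on a pair with an invariant filter. -/
structure LHyp (θ : EA p ι →* Equiv.Perm M) (A B : Set M) (l : Filter M) : Prop where
  closedA : IsClosed A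
  closed : IsClosed B
  actsA : Acts θ A
  acts : Acts θ B
  adm : Adm θ B l

variable {θ : EA p ι →* Equiv.Perm M} {A B : Set M} {l : Filter M}

omit [DecidableEq ι] in
theorem Acts.pull_mem_KK (hA : IsClosed A) (hAa : Acts θ A) (hB : IsClosed B) (hBa : Acts θ B)
    {U : Set M} (hU : ∀ g x, x ∈ U ↔ θ g x ∈ U) (g : EA p ι) {j : ℕ} {f : Fn p M j}
    (hf : f ∈ KK p A B U j) : pull (θ g) f ∈ KK p A B U j :=
  ⟨hAa.pull_mem_K hA (fun _ _ h => h) hf.1, hBa.pull_mem_K hB (fun x _ => (hU g x).2) hf.2⟩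

/-- The action on chains. -/
def LHyp.act (h : LHyp θ A B l) (g : EA p ι) (j : ℕ) : Module.End (ZMod p) (LX p A B l j) :=
  lmap (pull (θ g)) (fun _ hf => h.acts.pull_mem_K h.closed (fun _ _ h => h) hf) fun U hU => by
    obtain ⟨V, hV, h1, h2, h3⟩ := h.adm U hU
    exact ⟨V, hV, fun f hf => KK_mono h1 h.closed _
      (Acts.pull_mem_KK h.closedA h.actsA h.closed h.acts h2 g hf)⟩

omit [DecidableEq ι] in
theorem LHyp.act_mul (h : LHyp θ A B l) (g g' : EA p ι) (j : ℕ) :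
    h.act g j * h.act g' j = h.act (g' * g) j := by
  refine LinearMap.ext fun x => ?_
  obtain ⟨φ, rfl⟩ := lmk_surj A l x
  refine (lmk_eq (A := A) (l := l)).2 ⟨Set.univ, Filter.univ_mem, fun f _ => ?_⟩
  change φ.1 (pull (θ g') (pull (θ g) f)) = φ.1 (pull (θ (g' * g)) f)
  congr 1
  funext s
  simp only [pull_apply]
  rw [mul_comm, map_mul]
  rfl

omit [DecidableEq ι] in
theorem LHyp.act_one (h : LHyp θ A B l) (j : ℕ) : h.act 1 j = 1 := by
  refine LinearMap.ext fun x => ?_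
  obtain ⟨φ, rfl⟩ := lmk_surj A l x
  refine (lmk_eq (A := A) (l := l)).2 ⟨Set.univ, Filter.univ_mem, fun f _ => ?_⟩
  change φ.1 (pull (θ 1) f) = φ.1 f
  rw [map_one]
  rfl

omit [DecidableEq ι] in
theorem LHyp.act_pow (h : LHyp θ A B l) (g : EA p ι) (j m : ℕ) :
    h.act g j ^ m = h.act (g ^ m) j := by
  induction m with
  | zero => rw [pow_zero, pow_zero, h.act_one]
  | succ m ih => rw [pow_succ, ih, h.act_mul, pow_succ, mul_comm]

omit [DecidableEq ι] in
theorem EA_pow (g : EA p ι) : g ^ p = 1 := by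
  refine Multiplicative.toAdd.injective ?_
  rw [toAdd_pow, toAdd_one]
  funext i
  simp

variable [Fact p.Prime]

/-- The dual complex. -/
def L0 (p : ℕ) [Fact p.Prime] (A B : Set M) (l : Filter M) : Cpx.{u} p Empty where
  X := LX p A B l
  d := Ld A B l
  dd := Ld_Ld A B l
  g i := i.elim
  g_d i := i.elim
  g_comm i := i.elim
  g_pow i := i.elim

theorem mem_L0_cyc_succ {A B : Set M} {l : Filter M} {N : ℕ} {φ : LZ p B (N + 1)} :
    lmk A l φ ∈ (L0 p A B l).cyc (N + 1) ↔ ∃ U ∈ l, ∀ f ∈ KK p A B U N, φ.1 (d f) = 0 :=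
  lmk_eq_zero (A := A) (l := l)

theorem mem_L0_bd {A B : Set M} {l : Filter M} {N : ℕ} {φ : LZ p B N} :
    lmk A l φ ∈ (L0 p A B l).bd N ↔
      ∃ ψ : LZ p B (N + 1), ∃ U ∈ l, ∀ f ∈ KK p A B U N, φ.1 f = ψ.1 (d f) := by
  constructor
  · rintro ⟨y, hy⟩
    obtain ⟨ψ, rfl⟩ := lmk_surj A l y
    exact ⟨ψ, lmk_eq.1 hy.symm⟩
  · rintro ⟨ψ, h⟩
    exact ⟨lmk A l ψ, (lmk_eq.2 h).symm⟩

/-- The dual complex with its action. -/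
def LHyp.L (h : LHyp θ A B l) : Cpx.{u} p ι where
  X := LX p A B l
  d := Ld A B l
  dd := Ld_Ld A B l
  g i := h.act (gen p i)
  g_d i j x := by
    obtain ⟨φ, rfl⟩ := lmk_surj A l x
    rfl
  g_comm i i' j x := by
    change (h.act _ j * h.act _ j) x = (h.act _ j * h.act _ j) x
    rw [h.act_mul, h.act_mul, mul_comm]
  g_pow i j := by rw [h.act_pow, EA_pow, h.act_one]

variable {X Y : Set M}

/-- Inclusion of chains. -/
def LHyp.incl (hY : LHyp θ A Y l) (hX : LHyp θ A X l) (hYX : Y ⊆ X) : Cpx.Hom hY.L hX.L where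
  f j := lmap LinearMap.id (fun _ hf => K_mono hX.closed hYX (fun _ _ h => h) _ hf)
    fun U hU => ⟨U, hU, fun _ hf => ⟨hf.1, K_mono hX.closed hYX (fun _ _ h => h) _ hf.2⟩⟩
  f_d j x := by
    obtain ⟨φ, rfl⟩ := lmk_surj A l x
    exact lmk_eq.2 ⟨Set.univ, Filter.univ_mem, fun f _ => rfl⟩
  f_g i j x := by
    obtain ⟨φ, rfl⟩ := lmk_surj A l x
    exact lmk_eq.2 ⟨Set.univ, Filter.univ_mem, fun f _ => rfl⟩

/-- Restriction to relative chains. -/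
def LHyp.proj (hX : LHyp θ A X l) (hR : LHyp θ Y X l) (hAY : A ⊆ Y) : Cpx.Hom hX.L hR.L where
  f j := lmap LinearMap.id (fun _ hf => hf)
    fun U hU => ⟨U, hU, fun _ hf => ⟨K_mono hR.closedA hAY (fun _ _ h => h) _ hf.1, hf.2⟩⟩
  f_d j x := by
    obtain ⟨φ, rfl⟩ := lmk_surj A l x
    exact lmk_eq.2 ⟨Set.univ, Filter.univ_mem, fun f _ => rfl⟩
  f_g i j x := by
    obtain ⟨φ, rfl⟩ := lmk_surj A l x
    exact lmk_eq.2 ⟨Set.univ, Filter.univ_mem, fun f _ => rfl⟩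

theorem LHyp.ses (hY : LHyp θ A Y l) (hX : LHyp θ A X l) (hR : LHyp θ Y X l) (hAY : A ⊆ Y)
    (hYX : Y ⊆ X) : Cpx.SES (hY.incl hX hYX) (hX.proj hR hAY) where
  inj j := by
    refine (injective_iff_map_eq_zero _).2 fun x hx => ?_
    obtain ⟨φ, rfl⟩ := lmk_surj A l x
    obtain ⟨U, hU, h⟩ := (lmk_eq_zero (A := A) (l := l)).1 hx
    refine lmk_eq_zero.2 ⟨U, hU, fun f hf => ?_⟩
    obtain ⟨h1, h2⟩ := exists_ext (X := X) hf.2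
    set f₁ := cut {s | ∀ i, s i ∈ Y} f
    have h3 := h f₁ ⟨by
      have := sub_mem hf.1 (K_mono hY.closed hAY (fun _ _ h => h) _ h2)
      rwa [sub_sub_cancel] at this, h1⟩
    have h4 := mem_LZ.1 φ.2 _ h2
    rw [map_sub, sub_eq_zero] at h4
    rw [h4]
    exact h3
  surj j y := by
    obtain ⟨φ, rfl⟩ := lmk_surj Y l y
    exact ⟨lmk A l φ, rfl⟩
  exact j x := by
    obtain ⟨φ, rfl⟩ := lmk_surj A l x
    constructor
    · intro hx
      obtain ⟨U, hU, h⟩ := (lmk_eq_zero (A := Y) (l := l)).1 hx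
      have h1 : φ.1 ∈ (KK p Y X U j).dualAnnihilator :=
        (Submodule.mem_dualAnnihilator _).2 h
      rw [Subspace.dualAnnihilator_inf_eq] at h1
      obtain ⟨φ₁, hφ₁, φ₂, hφ₂, he⟩ := Submodule.mem_sup.1 h1
      refine ⟨lmk A l ⟨φ₁, hφ₁⟩, (lmk_eq (A := A) (l := l)).2 ⟨U, hU, fun f hf => ?_⟩⟩
      change φ₁ f = φ.1 f
      rw [← he, LinearMap.add_apply, (Submodule.mem_dualAnnihilator _).1 hφ₂ f hf.2, add_zero]
    · rintro ⟨a, ha⟩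
      obtain ⟨ψ, rfl⟩ := lmk_surj A l a
      obtain ⟨U, hU, h⟩ := (lmk_eq (A := A) (l := l)).1 ha
      refine (lmk_eq_zero (A := Y) (l := l)).2 ⟨U, hU, fun f hf => ?_⟩
      have h1 := h f ⟨K_mono hR.closedA hAY (fun _ _ h => h) _ hf.1, hf.2⟩
      change φ.1 f = 0
      rw [← h1]
      exact mem_LZ.1 ψ.2 f hf.1

end Fn

theorem exists_coord (E T : Type*) [Group E] [MulAction E T] :
    ∃ c : T → E, ∀ s : T, (∀ h : E, h • s = s → h = 1) → ∀ h : E, c (h • s) = h * c s := by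
  let r : T → T := fun s => Quotient.out (Quotient.mk (MulAction.orbitRel E T) s)
  have hr : ∀ s, ∃ h : E, h • r s = s := by
    intro s
    have : (MulAction.orbitRel E T).r (r s) s := Quotient.exact (Quotient.out_eq _)
    exact MulAction.mem_orbit_symm.1 this
  choose c hc using hr
  have hr' : ∀ s (h : E), r (h • s) = r s := by
    intro s h
    have : (Quotient.mk (MulAction.orbitRel E T) (h • s)) = Quotient.mk _ s :=
      Quotient.sound ⟨h, rfl⟩
    simp only [r, this]
  refine ⟨c, fun s hs h => ?_⟩
  have h1 : c (h • s) • r s = h • s := by rw [← hr' s h, hc]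
  have h2 : (h⁻¹ * c (h • s) * (c s)⁻¹) • s = s := by
    have h4 : (c s)⁻¹ • s = r s := by
      rw [inv_smul_eq_iff, hc]
    rw [mul_smul, h4, mul_smul, h1, inv_smul_smul]
  have h3 := hs _ h2
  rw [mul_inv_eq_one, inv_mul_eq_iff_eq_mul] at h3
  exact h3

namespace Fn

variable {p : ℕ} {M : Type u}

section

variable {E : Type*} [Group E]

/-- Tuples with trivial stabilizer. -/
def Fr (θ : E →* Equiv.Perm M) (j : ℕ) : Set (Fin (j + 1) → M) := {s | ∀ h, θ h ∘ s = s → h = 1}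

theorem mul_comp (θ : E →* Equiv.Perm M) {j : ℕ} (g h : E) (s : Fin (j + 1) → M) :
    θ g ∘ θ h ∘ s = θ (g * h) ∘ s := by
  rw [map_mul]
  rfl

theorem one_comp (θ : E →* Equiv.Perm M) {j : ℕ} (s : Fin (j + 1) → M) : θ 1 ∘ s = s := by
  rw [map_one]
  rfl

theorem mem_fr_comp (θ : E →* Equiv.Perm M) {j : ℕ} (g : E) (s : Fin (j + 1) → M) :
    θ g ∘ s ∈ Fr θ j ↔ s ∈ Fr θ j := by
  have key : ∀ (g : E) (s : Fin (j + 1) → M), s ∈ Fr θ j → θ g ∘ s ∈ Fr θ j := by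
    intro g s hs h hh
    rw [mul_comp] at hh
    have := hs (g⁻¹ * (h * g)) (by rw [← mul_comp, hh, mul_comp, inv_mul_cancel, one_comp])
    rw [inv_mul_eq_one] at this
    exact (mul_eq_right.1 this.symm)
  refine ⟨fun h => ?_, key g s⟩
  have := key g⁻¹ _ h
  rwa [mul_comp, inv_mul_cancel, one_comp] at this

theorem exists_cc (θ : E →* Equiv.Perm M) (j : ℕ) : ∃ c : (Fin (j + 1) → M) → E,
    ∀ s ∈ Fr θ j, ∀ h, c (θ h ∘ s) = h * c s := by
  let _ : MulAction E (Fin (j + 1) → M) :=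
    { smul := fun g s => θ g ∘ s
      one_smul := one_comp θ
      mul_smul := fun g h s => (mul_comp θ g h s).symm }
  obtain ⟨c, hc⟩ := exists_coord E (Fin (j + 1) → M)
  exact ⟨c, fun s hs h => hc s hs h⟩

/-- An equivariant coordinate on free tuples. -/
noncomputable def cc (θ : E →* Equiv.Perm M) (j : ℕ) : (Fin (j + 1) → M) → E :=
  (exists_cc θ j).choose

theorem cc_comp {θ : E →* Equiv.Perm M} {j : ℕ} {s : Fin (j + 1) → M} (hs : s ∈ Fr θ j) (h : E) :
    cc θ j (θ h ∘ s) = h * cc θ j s := (exists_cc θ j).choose_spec s hs h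

/-- The norm. -/
def nm (p : ℕ) [Fintype E] (θ : E →* Equiv.Perm M) (j : ℕ) : Fn p M j →ₗ[ZMod p] Fn p M j :=
  ∑ g, pull (θ g)

theorem nm_apply [Fintype E] (θ : E →* Equiv.Perm M) {j : ℕ} (f : Fn p M j)
    (s : Fin (j + 1) → M) : nm p θ j f s = ∑ g, f (θ g ∘ s) := by
  rw [nm, LinearMap.sum_apply, Finset.sum_apply]
  rfl

theorem nm_pull [Fintype E] (θ : E →* Equiv.Perm M) {j : ℕ} (f : Fn p M j) (h : E) :
    nm p θ j (pull (θ h) f) = nm p θ j f := by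
  funext s
  rw [nm_apply, nm_apply]
  refine Fintype.sum_equiv (Equiv.mulLeft h) _ _ fun g => ?_
  rw [pull_apply, mul_comp]
  rfl

theorem nm_mem_inv [Fintype E] (θ : E →* Equiv.Perm M) {j : ℕ} (f : Fn p M j) :
    nm p θ j f ∈ inv p θ j := by
  intro h
  funext s
  rw [pull_apply, nm_apply, nm_apply]
  refine Fintype.sum_equiv (Equiv.mulRight h) _ _ fun g => ?_
  rw [mul_comp]
  rfl

theorem nm_d [Fintype E] (θ : E →* Equiv.Perm M) {j : ℕ} (f : Fn p M j) :
    nm p θ (j + 1) (d f) = d (nm p θ j f) := by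
  simp only [nm, LinearMap.sum_apply, map_sum]
  exact Finset.sum_congr rfl fun g _ => pull_d _ f

variable [TopologicalSpace M]

theorem cut_fr_compl_mem {θ : E →* Equiv.Perm M} {X Y U : Set M} (hU : ROpen X U)
    (hX : IsClosed X)
    (hfree : ∀ x ∈ X, x ∈ U → x ∉ Y → ∀ g, g ≠ 1 → θ g x ≠ x) {j : ℕ} {f : Fn p M j}
    (hf : f ∈ KK p Y X U j) : f - cut (Fr θ j) f ∈ K p X ∅ j := by
  intro x _
  by_cases hxU : x ∈ U
  · by_cases hxX : x ∈ X
    · obtain ⟨V, hV, hxV, h⟩ := van_iff.1 (hf.1 x (Set.notMem_empty x))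
      refine ⟨V ∩ (X ∩ U), Filter.inter_mem (mem_nhdsWithin_of_mem_nhds (hV.mem_nhds hxV))
        (Filter.inter_mem self_mem_nhdsWithin (hU x hxX hxU)), fun s hs => ?_⟩
      rw [Pi.sub_apply]
      by_cases hsF : s ∈ Fr θ j
      · rw [cut_of_mem _ hsF, sub_self]
      · rw [cut_of_notMem _ hsF, sub_zero]
        refine h s fun i => ⟨(hs i).1, ?_⟩
        by_contra hi
        refine hsF fun g hg => ?_
        by_contra hg1
        exact hfree _ (hs i).2.1 (hs i).2.2 hi g hg1 (congrFun hg i)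
    · exact van_of_notMem hX _ hxX
  · exact (hf.2 x hxU).sub ((hf.2 x hxU).of_imp fun s hs => cut_eq_zero _ hs)

theorem cut_mem_KK (S : ∀ j, Set (Fin (j + 1) → M)) {A B U : Set M} {j : ℕ} {f : Fn p M j}
    (hf : f ∈ KK p A B U j) : cut (S j) f ∈ KK p A B U j :=
  ⟨cut_mem_K _ hf.1, cut_mem_K _ hf.2⟩

end

variable {ι : Type} [DecidableEq ι] [TopologicalSpace M]

theorem gen_pow (i : ι) (m : ℕ) : gen p i ^ m = Multiplicative.ofAdd (Pi.single i
    (m : ZMod p)) := by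
  rw [gen, ← ofAdd_nsmul]
  congr 1
  funext k
  by_cases h : k = i
  · subst h
    simp
  · simp [h]

variable {θ : EA p ι →* Equiv.Perm M} {X Y : Set M} {l : Filter M}

/-- The relative situation of a free action off the fixed subset. -/
structure RHyp (θ : EA p ι →* Equiv.Perm M) (Y X : Set M) (l : Filter M) : Prop extends
    LHyp θ Y X l where
  sub : Y ⊆ X
  fix : ∀ x ∈ Y, ∀ g, θ g x = x
  free : ∃ U ∈ l, ∀ x ∈ X, x ∈ U → x ∉ Y → ∀ g, g ≠ 1 → θ g x ≠ x

/-- Good neighbourhoods. -/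
def RHyp.Nice (θ : EA p ι →* Equiv.Perm M) (Y X : Set M) (U : Set M) : Prop :=
  ROpen X U ∧ (∀ g x, x ∈ U ↔ θ g x ∈ U) ∧ ∀ x ∈ X, x ∈ U → x ∉ Y → ∀ g, g ≠ 1 → θ g x ≠ x

omit [DecidableEq ι] in
theorem RHyp.exists_nice (h : RHyp θ Y X l) {U : Set M} (hU : U ∈ l) :
    ∃ V ∈ l, (∀ x ∈ X, x ∈ V → x ∈ U) ∧ Nice θ Y X V := by
  obtain ⟨U0, hU0, hf⟩ := h.free
  obtain ⟨V, hV, h1, h2, h3⟩ := h.adm (U ∩ U0) (Filter.inter_mem hU hU0)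
  exact ⟨V, hV, fun x hx hxV => (h1 x hx hxV).1, h3, h2,
    fun x hx hxV => hf x hx (h1 x hx hxV).2⟩

omit [DecidableEq ι] in
theorem RHyp.cut_fr (h : RHyp θ Y X l) {U : Set M} (hU : Nice θ Y X U) {j : ℕ}
    {φ : Module.Dual (ZMod p) (Fn p M j)} (hφ : φ ∈ LZ p X j) {f : Fn p M j}
    (hf : f ∈ KK p Y X U j) : φ (cut (Fr θ j) f) = φ f := by
  have := mem_LZ.1 hφ _ (cut_fr_compl_mem hU.1 h.closed hU.2.2 hf)
  rw [map_sub, sub_eq_zero] at this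
  exact this.symm

theorem lmk_sum {A B : Set M} {j : ℕ} {T : Type*} (t : Finset T) (F : T → LZ p B j) :
    ∑ m ∈ t, lmk A l (F m) = lmk A l (∑ m ∈ t, F m) := (map_sum (LC p A B l j).mkQ F t).symm

variable (p) in
/-- Tuples with a vanishing coordinate. -/
def Cz (θ : EA p ι →* Equiv.Perm M) (i : ι) (j : ℕ) : Set (Fin (j + 1) → M) :=
  {s | s ∈ Fr θ j ∧ (cc θ j s).toAdd i = 0}

/-- The cutoff operator. -/
noncomputable def eC (θ : EA p ι →* Equiv.Perm M) (Y X : Set M) (l : Filter M) (i : ι) (j : ℕ) :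
    Module.End (ZMod p) (LX p Y X l j) :=
  lmap (cut (Cz p θ i j)) (fun _ hf => cut_mem_K _ hf)
    fun U hU => ⟨U, hU, fun _ hf => cut_mem_KK (Cz p θ i) hf⟩

omit [TopologicalSpace M] in
theorem sum_cut [NeZero p] (θ : EA p ι →* Equiv.Perm M) (i : ι) {j : ℕ} (f : Fn p M j) :
    ∑ m ∈ Finset.range p, pull (θ (gen p i ^ (p - m))) (cut (Cz p θ i j)
      (pull (θ (gen p i ^ m)) f)) = cut (Fr θ j) f := by
  funext s
  rw [Finset.sum_apply]
  have h0 : ∀ m ∈ Finset.range p, θ (gen p i ^ m) ∘ θ (gen p i ^ (p - m)) ∘ s = s := by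
    intro m hm
    rw [mul_comp, ← pow_add, Nat.add_sub_cancel' (Finset.mem_range.1 hm).le, EA_pow, one_comp]
  by_cases hs : s ∈ Fr θ j
  · have h1 : ∀ m ∈ Finset.range p, θ (gen p i ^ (p - m)) ∘ s ∈ Cz p θ i j ↔
        (m : ZMod p) = (cc θ j s).toAdd i := by
      intro m hm
      rw [Cz, Set.mem_ofPred_eq, cc_comp hs, toAdd_mul, Pi.add_apply, gen_pow, toAdd_ofAdd,
        Pi.single_eq_same, Nat.cast_sub (Finset.mem_range.1 hm).le, ZMod.natCast_self, zero_sub,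
        neg_add_eq_zero, mem_fr_comp]
      exact and_iff_right hs
    rw [cut_of_mem _ hs, Finset.sum_eq_single ((cc θ j s).toAdd i).val]
    · have hm : ((cc θ j s).toAdd i).val ∈ Finset.range p := Finset.mem_range.2 (ZMod.val_lt _)
      rw [pull_apply, cut_of_mem _ ((h1 _ hm).2 (ZMod.natCast_zmod_val _)), pull_apply, h0 _ hm]
    · intro m hm hne
      rw [pull_apply, cut_of_notMem]
      rw [h1 m hm]
      intro h
      apply hne
      rw [← h, ZMod.val_natCast, Nat.mod_eq_of_lt (Finset.mem_range.1 hm)]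
    · exact fun h => absurd (Finset.mem_range.2 (ZMod.val_lt _)) h
  · rw [cut_of_notMem _ hs]
    refine Finset.sum_eq_zero fun m _ => ?_
    rw [pull_apply, cut_of_notMem]
    exact fun h => hs ((mem_fr_comp θ _ s).1 h.1)

theorem RHyp.sum_act [NeZero p] (h : RHyp θ Y X l) (i : ι) (j : ℕ) :
    ∑ m ∈ Finset.range p, h.act (gen p i) j ^ m * eC θ Y X l i j * h.act (gen p i) j ^ (p - m) =
      1 := by
  refine LinearMap.ext fun x => ?_
  obtain ⟨φ, rfl⟩ := lmk_surj Y l x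
  obtain ⟨U, hU, -, hn⟩ := h.exists_nice (Filter.univ_mem)
  have h1 : ∀ m, (h.act (gen p i) j ^ m * eC θ Y X l i j * h.act (gen p i) j ^ (p - m))
        (lmk Y l φ) = (lmk Y l ⟨φ.1 ∘ₗ (pull (θ (gen p i ^ (p - m))) ∘ₗ cut (Cz p θ i j) ∘ₗ
          pull (θ (gen p i ^ m))), mem_LZ.2 fun f hf => mem_LZ.1 φ.2 _
            (h.acts.pull_mem_K h.closed (fun _ _ h => h) (cut_mem_K _
              (h.acts.pull_mem_K h.closed (fun _ _ h => h) hf)))⟩) := by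
    intro m
    rw [LHyp.act_pow, LHyp.act_pow]
    rfl
  rw [LinearMap.sum_apply, Finset.sum_congr rfl fun m _ => h1 m, lmk_sum]
  refine lmk_eq.2 ⟨U, hU, fun f hf => ?_⟩
  rw [← h.cut_fr hn φ.2 hf, ← sum_cut θ i f, map_sum, AddSubmonoidClass.coe_finsetSum,
    LinearMap.sum_apply]
  rfl

theorem RHyp.act_comm (h : RHyp θ Y X l) {i i' : ι} (hi : i' ≠ i) (j : ℕ) :
    h.act (gen p i') j * eC θ Y X l i j = eC θ Y X l i j * h.act (gen p i') j := by
  refine LinearMap.ext fun x => ?_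
  obtain ⟨φ, rfl⟩ := lmk_surj Y l x
  refine lmk_eq.2 ⟨Set.univ, Filter.univ_mem, fun f _ => ?_⟩
  change φ.1 (cut (Cz p θ i j) (pull (θ (gen p i')) f)) =
    φ.1 (pull (θ (gen p i')) (cut (Cz p θ i j) f))
  congr 1
  funext s
  have hs : θ (gen p i') ∘ s ∈ Cz p θ i j ↔ s ∈ Cz p θ i j := by
    refine (and_congr_left' (mem_fr_comp θ _ s)).trans (and_congr_right fun hs => ?_)
    rw [cc_comp hs, toAdd_mul, Pi.add_apply]
    simp [gen, hi.symm]
  rw [pull_apply]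
  by_cases hsC : s ∈ Cz p θ i j
  · rw [cut_of_mem _ hsC, cut_of_mem _ (hs.2 hsC), pull_apply]
  · rw [cut_of_notMem _ hsC, cut_of_notMem _ (mt hs.1 hsC)]

/-- A fundamental domain. -/
def C1 {E : Type*} [Group E] (θ : E →* Equiv.Perm M) (j : ℕ) : Set (Fin (j + 1) → M) :=
  {s | s ∈ Fr θ j ∧ cc θ j s = 1}

omit [TopologicalSpace M] in
theorem sum_cut_one {E : Type*} [Group E] [Fintype E] (θ : E →* Equiv.Perm M) {j : ℕ}
    (f : Fn p M j) :
    ∑ g, pull (θ g⁻¹) (cut (C1 θ j) (pull (θ g) f)) = cut (Fr θ j) f := by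
  classical
  funext s
  rw [Finset.sum_apply]
  by_cases hs : s ∈ Fr θ j
  · have h1 : ∀ g, θ g⁻¹ ∘ s ∈ C1 θ j ↔ g = cc θ j s := by
      intro g
      rw [C1, Set.mem_ofPred_eq, cc_comp hs, mem_fr_comp, inv_mul_eq_one]
      exact and_iff_right hs
    rw [cut_of_mem _ hs, Finset.sum_eq_single (cc θ j s)]
    · rw [pull_apply, cut_of_mem _ ((h1 _).2 rfl), pull_apply, mul_comp, mul_inv_cancel, one_comp]
    · intro g _ hne
      rw [pull_apply, cut_of_notMem]
      rwa [h1]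
    · exact fun h => absurd (Finset.mem_univ _) h
  · rw [cut_of_notMem _ hs]
    refine Finset.sum_eq_zero fun m _ => ?_
    rw [pull_apply, cut_of_notMem]
    exact fun h => hs ((mem_fr_comp θ _ s).1 h.1)

variable [Fact p.Prime]

/-- The contraction for a generator. -/
noncomputable def RHyp.ctr (h : RHyp θ Y X l) (i : ι) : h.toLHyp.L.Ctr i where
  e := eC θ Y X l i
  sum := h.sum_act i
  comm _ j hi := h.act_comm hi j

theorem RHyp.inv_exact [CompactSpace M] [T2Space M] [Fintype ι] (h : RHyp θ Y X l) {c : ℕ}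
    (hcd : CD p c X) {N : ℕ}
    (hN : c ≤ N) {φ : LZ p X (N + 1)} (hinv : ∀ g, h.act g (N + 1) (lmk Y l φ) = lmk Y l φ)
    (hd : Ld Y X l N (lmk Y l φ) = 0) :
    ∃ ψ : LZ p X (N + 2), (∀ g, h.act g (N + 2) (lmk Y l ψ) = lmk Y l ψ) ∧
      Ld Y X l (N + 1) (lmk Y l ψ) = lmk Y l φ := by
  have h1 : ∀ g, ∃ U ∈ l, ∀ f ∈ KK p Y X U (N + 1), φ.1 (pull (θ g) f) = φ.1 f :=
    fun g => lmk_eq.1 (hinv g)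
  choose W hW hWf using h1
  obtain ⟨U, hU, hUd⟩ : ∃ U ∈ l, ∀ f ∈ KK p Y X U N, φ.1 (d f) = 0 := lmk_eq_zero.1 hd
  obtain ⟨V, hV, hVU, hn⟩ := h.exists_nice (Filter.inter_mem hU (Filter.iInter_mem.2 hW))
  have hpull : ∀ g {j : ℕ} {f : Fn p M j}, f ∈ KK p Y X V j → pull (θ g) f ∈ KK p Y X V j :=
    fun g j f hf => Acts.pull_mem_KK h.closedA h.actsA h.closed h.acts hn.2.1 g hf
  have hφ : ∀ g, ∀ f ∈ KK p Y X V (N + 1), φ.1 (pull (θ g) f) = φ.1 f := fun g f hf =>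
    hWf g f (KK_mono (fun x hx hxV => Set.mem_iInter.1 (hVU x hx hxV).2 g) h.closed _ hf)
  have hφd : ∀ f ∈ KK p Y X V N, φ.1 (d f) = 0 := fun f hf =>
    hUd f (KK_mono (fun x hx hxV => (hVU x hx hxV).1) h.closed _ hf)
  have hφn : ∀ f ∈ KK p Y X V (N + 1), φ.1 (cut (C1 θ _) (nm p θ _ f)) = φ.1 f := by
    intro f hf
    rw [← h.cut_fr hn φ.2 hf, ← sum_cut_one, nm, LinearMap.sum_apply, map_sum, map_sum, map_sum]
    exact Finset.sum_congr rfl fun g _ => (hφ _ _ (cut_mem_KK (C1 θ) (hpull g hf))).symm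
  have hnmem : ∀ {j : ℕ} {f : Fn p M j}, f ∈ KK p Y X V j → nm p θ j f ∈ KK p Y X V j := by
    intro j f hf
    rw [nm, LinearMap.sum_apply]
    exact Submodule.sum_mem _ fun g _ => hpull g hf
  have hnmemX : ∀ {j : ℕ} {f : Fn p M j}, f ∈ K p X ∅ j → nm p θ j f ∈ K p X ∅ j := by
    intro j f hf
    rw [nm, LinearMap.sum_apply]
    exact Submodule.sum_mem _ fun g _ => h.acts.pull_mem_K h.closed (fun _ _ h => h) hf
  obtain ⟨ψ, hψZ, hψ⟩ := exists_dual_of_ker (KK p Y X V (N + 1) ⊓ inv p θ (N + 1))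
    (d : Fn p M (N + 1) →ₗ[ZMod p] Fn p M (N + 2)) (K p X ∅ (N + 2))
    (φ.1 ∘ₗ cut (C1 θ (N + 1))) (by
    intro f hf hdf
    obtain ⟨u, hu, huf⟩ := h.acts.exc_rel h.closed h.closedA h.sub h.fix hcd hn.1 hn.2.1 hn.2.2
      hN hf hdf
    have h2 := mem_LZ.1 φ.2 _ (cut_mem_K (C1 θ (N + 1)) huf)
    rw [map_sub, map_sub, sub_eq_zero] at h2
    rw [LinearMap.comp_apply, h2]
    have h3 : nm p θ N (cut (C1 θ N) u) = cut (Fr θ N) u := by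
      rw [← sum_cut_one, nm, LinearMap.sum_apply]
      refine Fintype.sum_equiv (Equiv.inv _) _ _ fun g => ?_
      rw [Equiv.inv_apply, inv_inv, hu.2]
    have h4 : d u - nm p θ (N + 1) (d (cut (C1 θ N) u)) ∈ K p X ∅ (N + 1) := by
      rw [nm_d, h3, ← map_sub]
      exact d_mem_K (cut_fr_compl_mem hn.1 h.closed hn.2.2 hu.1)
    have h5 := mem_LZ.1 φ.2 _ (cut_mem_K (C1 θ (N + 1)) h4)
    rw [map_sub, map_sub, sub_eq_zero] at h5
    have h6 := cut_mem_KK (C1 θ) hu.1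
    rw [h5, hφn _ (d_mem_KK h6), hφd _ h6])
  refine ⟨⟨ψ ∘ₗ nm p θ (N + 2), mem_LZ.2 fun f hf => mem_LZ.1 hψZ _ (hnmemX hf)⟩, fun g => ?_, ?_⟩
  · refine lmk_eq.2 ⟨Set.univ, Filter.univ_mem, fun f _ => ?_⟩
    change ψ (nm p θ _ (pull (θ g) f)) = ψ (nm p θ _ f)
    rw [nm_pull]
  · refine lmk_eq.2 ⟨V, hV, fun f hf => ?_⟩
    change ψ (nm p θ _ (d f)) = φ.1 f
    rw [nm_d, hψ _ ⟨hnmem hf, nm_mem_inv θ f⟩, LinearMap.comp_apply, hφn f hf]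

theorem gen_induction [Fintype ι] {P : EA p ι → Prop} (h1 : P 1)
    (hmul : ∀ a b, P a → P b → P (a * b)) (hg : ∀ i, P (gen p i)) (g : EA p ι) : P g := by
  have hpow : ∀ i (m : ℕ), P (gen p i ^ m) := by
    intro i m
    induction m with
    | zero => simpa using h1
    | succ m ih => rw [pow_succ]; exact hmul _ _ ih (hg i)
  have hg : g = ∏ i, gen p i ^ (g.toAdd i).val := by
    refine Multiplicative.toAdd.injective ?_
    rw [toAdd_prod]
    simp only [gen_pow, toAdd_ofAdd, ZMod.natCast_zmod_val]
    exact (Finset.univ_sum_single _).symm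
  rw [hg]
  exact Finset.prod_induction _ P hmul h1 fun i _ => hpow i _

theorem RHyp.acyc_TT [CompactSpace M] [T2Space M] [Fintype ι] (h : RHyp θ Y X l) {c : ℕ}
    (hcd : CD p c X) {t : List ι}
    (ht : t.Nodup) (hmem : ∀ i, i ∈ t) {N : ℕ} (hN : c ≤ N) :
    (Cpx.TT t h.toLHyp.L).Acyc (N + 1) := by
  refine Cpx.ind_TT t ht _ (fun i _ => ⟨h.ctr i⟩) c (fun N hN x hx hd => ?_) N hN
  obtain ⟨φ, rfl⟩ := lmk_surj Y l x
  have hinv : ∀ g, h.act g (N + 1) (lmk Y l φ) = lmk Y l φ := by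
    refine gen_induction (by rw [h.act_one]; rfl) (fun a b ha hb => ?_) fun i => hx i (hmem i)
    rw [mul_comm, ← h.act_mul, Module.End.mul_apply, hb, ha]
  obtain ⟨ψ, h1, h2⟩ := h.inv_exact hcd hN hinv hd
  exact ⟨lmk Y l ψ, fun i _ => h1 _, h2⟩

end Fn

namespace Cpx

variable {p : ℕ} [Fact p.Prime] {ι : Type} {A B C : Cpx.{u} p ι}

/-- The tuple with a single entry. -/
def sgl (L : Cpx.{u} p ι) (N : ℕ) (e : Fin (N + 1)) : L.X e →ₗ[ZMod p] L.TX N :=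
  LinearMap.single (ZMod p) (fun j : Fin (N + 1) => L.X j) e

theorem sgl_same (L : Cpx.{u} p ι) {N : ℕ} (e : Fin (N + 1)) (x : L.X e) : L.sgl N e x e = x :=
  Pi.single_eq_same (M := fun j : Fin (N + 1) => L.X j) _ _

theorem sgl_ne (L : Cpx.{u} p ι) {N : ℕ} {e j : Fin (N + 1)} (x : L.X e) (h : j ≠ e) :
    L.sgl N e x j = 0 :=
  Pi.single_eq_of_ne (M := fun j : Fin (N + 1) => L.X j) h _

theorem Conc.of_cyc {L : Cpx.{u} p ι} {d e : ℕ} {o : L.X d} (h : L.Conc d o) {a : L.X e}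
    (ha : a ∈ L.cyc e) (hb : a ∉ L.bd e) : L.Conc e a := by
  obtain rfl : e = d := by
    by_contra hed
    exact hb (h.acyc e hed ha)
  refine ⟨h.acyc, ha, hb, fun z hz => ?_⟩
  obtain ⟨c, hc⟩ := h.span a ha
  obtain ⟨c', hc'⟩ := h.span z hz
  have hc0 : c ≠ 0 := by
    rintro rfl
    rw [zero_smul, sub_zero] at hc
    exact hb hc
  refine ⟨c' * c⁻¹, ?_⟩
  have : z - (c' * c⁻¹) • a = (z - c' • o) - (c' * c⁻¹) • (a - c • o) := by
    rw [smul_sub, smul_smul, mul_assoc, inv_mul_cancel₀ hc0, mul_one]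
    abel
  rw [this]
  exact sub_mem hc' ((L.bd e).smul_mem _ hc)

theorem Hom.tr_T (f : Hom A B) (b b' : ℕ) (i : ι) {N M : ℕ} (h : N ≤ M) (F : A.TX M) :
    B.tr h ((f.T b i).f M F) = (f.T b' i).f N (A.tr h F) := rfl

/-- If a class of the fixed part maps to a fundamental cycle then it is fundamental. -/
theorem Conc.of_image (f : Hom A B) {i : ι} (hA : ∀ j, A.g i j = 1)
    (hAc : ∃ e a, A.Conc e a) {d N : ℕ} {o : B.X d} (hB : B.Conc d o) (hd : d < N + 1)
    (e : Fin (N + 1)) {a : A.X e} (ha : a ∈ A.cyc e) {s : B.TX N}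
    (hs : ∀ k : Fin (N + 1), (k : ℕ) < d → s k = 0) (hsd : s ⟨d, hd⟩ = o)
    (h : s - (f.T 0 i).f N (A.sgl N e a) ∈ (T 0 i B).bd N) : A.Conc e a := by
  obtain ⟨e', a', hc⟩ := hAc
  refine hc.of_cyc ha fun hb => hB.nbd ?_
  have h1 : A.sgl N e a ∈ (T 0 i A).bd N := by
    rw [bd_T_of_trivial A hA]
    intro j
    by_cases hj : j = e
    · subst hj
      rwa [sgl_same]
    · rw [sgl_ne _ _ hj]
      exact zero_mem _
  have h2 := add_mem h ((f.T 0 i).map_bd N h1)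
  rw [sub_add_cancel] at h2
  have := hB.bd_of_T 0 i h2 hd hs
  rwa [hsd] at this

/-- The fixed part of a complex concentrated in a single degree. -/
theorem smith_cyclic {f : Hom A B} {q : Hom B C} (s : SES f q) {i : ι} (hA : ∀ j, A.g i j = 1)
    {c : ℕ} (hC : ∀ N, c ≤ N → (T 0 i C).Acyc (N + 1)) {d : ℕ} {o : B.X d} (hB : B.Conc d o) :
    (∃ e a, A.Conc e a) := by
  have hT : SES (f.T 0 i) (q.T 0 i) := s.T 0 i
  refine exists_conc A c (fun M hM => ?_) ?_
  · refine (sum_h_le_T A hA 0 M).trans ((hT.h_le_of_acyc (hC M hM)).trans ?_)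
    refine (h_T_le B 0 i M).trans ?_
    rw [hB.h_eq]
    exact sum_dl_le d M
  · by_contra! hno
    obtain ⟨t, ht, ht0, hto⟩ := hB.exists_cyc 0 i (c + 1)
    obtain ⟨F, hF, hFt⟩ := hT.surj_H (hC (d + c) (by omega)) ht
    have h1 : F ∈ (T 0 i A).bd (d + (c + 1)) :=
      (bd_T_of_trivial A hA 0).2 fun j => hno _ _ (cyc_T_of_trivial A hA 0 hF j)
    have h2 := add_mem hFt ((f.T 0 i).map_bd _ h1)
    rw [sub_add_cancel] at h2
    have := hB.bd_of_T 0 i h2 (by omega) ht0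
    rw [hto] at this
    exact hB.nbd this

theorem smith_cyclic_image {f : Hom A B} {q : Hom B C} (s : SES f q) {i : ι}
    (hA : ∀ j, A.g i j = 1)
    {c : ℕ} (hC : ∀ N, c ≤ N → (T 0 i C).Acyc (N + 1)) {d : ℕ} {o : B.X d} (hB : B.Conc d o) :
    ∃ N, ∃ hd : d < N + 1, ∃ e : Fin (N + 1), (e : ℕ) ≤ d ∧ ∃ a : A.X e, a ∈ A.cyc e ∧
      A.Conc e a ∧ ∃ t : B.TX N,
      (∀ k : Fin (N + 1), (k : ℕ) < d → t k = 0) ∧ t ⟨d, hd⟩ = o ∧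
      t - (f.T 0 i).f N (A.sgl N e a) ∈ (T 0 i B).bd N ∧
      (∀ he : (e : ℕ) = d, o - f.f d (he ▸ a) ∈ B.bd d) := by
  have hT : SES (f.T 0 i) (q.T 0 i) := s.T 0 i
  obtain ⟨e, a₀, hc⟩ := smith_cyclic s hA hC hB
  obtain ⟨t, ht, ht0, hto⟩ := hB.exists_cyc 0 i (c + 1)
  obtain ⟨F, hF, hFt⟩ := hT.surj_H (N := d + (c + 1)) (hC (d + c) (by omega)) ht
  have hFc := fun j => cyc_T_of_trivial A hA 0 hF j
  have htr : d ≤ d + (c + 1) := by omega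
  have hed : e ≤ d := by
    by_contra! hed
    have h1 : A.tr htr F ∈ (T (c + 1) i A).bd d := by
      rw [bd_T_of_trivial A hA]
      intro j
      exact hc.acyc j (by omega) (hFc ⟨j, by omega⟩)
    have h2 := (T (c + 1) i B).bd d |>.add_mem (tr_bd B i htr (b' := c + 1) (by omega) hFt)
      ((f.T (c + 1) i).map_bd _ h1)
    rw [map_sub, f.tr_T 0 (c + 1) i htr F, sub_add_cancel] at h2
    have := hB.bd_of_T _ i h2 (by omega) (fun k hk => ht0 ⟨k, by omega⟩ hk)
    rw [tr_apply, hto] at this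
    exact hB.nbd this
  have heN : e < d + (c + 1) + 1 := by omega
  have hF' : F - A.sgl _ ⟨e, heN⟩ (F ⟨e, heN⟩) ∈ (T 0 i A).bd _ := by
    rw [bd_T_of_trivial A hA]
    intro j
    rw [Pi.sub_apply]
    by_cases hj : j = ⟨e, heN⟩
    · subst hj
      rw [sgl_same, sub_self]
      exact zero_mem _
    · rw [sgl_ne _ _ hj, sub_zero]
      exact hc.acyc j (fun h => hj (Fin.ext h)) (hFc j)
  have hfin : t - (f.T 0 i).f _ (A.sgl _ ⟨e, heN⟩ (F ⟨e, heN⟩)) ∈ (T 0 i B).bd _ := by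
    have := add_mem hFt ((f.T 0 i).map_bd _ hF')
    rwa [map_sub, sub_add_sub_cancel] at this
  refine ⟨d + (c + 1), by omega, ⟨e, heN⟩, hed, F ⟨e, heN⟩, hFc _, ?_, t, ht0, hto, hfin, ?_⟩
  · exact Conc.of_image f hA ⟨e, a₀, hc⟩ hB (by omega) ⟨e, heN⟩ (hFc _) ht0 hto hfin
  · intro he
    obtain rfl : e = d := he
    have h1 := tr_bd B i htr (b' := c + 1) (by omega) hfin
    have h2 := hB.bd_of_T _ i h1 (by omega) (fun k hk => ?_)
    · rw [map_sub, Pi.sub_apply, tr_apply, tr_apply, hto] at h2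
      change o - f.f e (A.sgl _ ⟨e, heN⟩ (F ⟨e, heN⟩) ⟨e, heN⟩) ∈ _ at h2
      rwa [sgl_same] at h2
    · rw [map_sub, Pi.sub_apply, tr_apply, tr_apply, ht0 ⟨k, by omega⟩ hk, zero_sub, neg_eq_zero]
      change f.f k (A.sgl _ ⟨e, heN⟩ (F ⟨e, heN⟩) ⟨k, by omega⟩) = 0
      rw [sgl_ne, map_zero]
      intro h
      have := congrArg Fin.val h
      simp only at this
      omega

end Cpx

namespace Fn

variable {p : ℕ} [Fact p.Prime] {M : Type u} [TopologicalSpace M]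
  {ι : Type} [DecidableEq ι] {θ : EA p ι →* Equiv.Perm M} {A B X Y : Set M} {l l' : Filter M}

/-- Localization of chains. -/
def lres (A : Set M) {B : Set M} (l : Filter M) {j : ℕ} : LX p A B ⊤ j →ₗ[ZMod p] LX p A B l j :=
  lmap LinearMap.id (fun _ hf => hf) fun U hU => ⟨U, by
    rw [Filter.mem_top] at hU
    rw [hU]
    exact Filter.univ_mem, fun _ hf => hf⟩

theorem lres_surj {j : ℕ} (x : LX p A B l j) : ∃ y, lres A l y = x := by
  obtain ⟨φ, rfl⟩ := lmk_surj A l x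
  exact ⟨lmk A ⊤ φ, rfl⟩

theorem lres_Ld {j : ℕ} (x : LX p A B ⊤ (j + 1)) :
    lres A l (Ld A B ⊤ j x) = Ld A B l j (lres A l x) := by
  obtain ⟨φ, rfl⟩ := lmk_surj A ⊤ x
  exact lmk_eq.2 ⟨Set.univ, Filter.univ_mem, fun f _ => rfl⟩

theorem eventually_lres_zero {j : ℕ} {x : M} {z : LX p A B ⊤ j} (h : lres A (𝓝 x) z = 0) :
    ∀ᶠ y in 𝓝 x, lres A (𝓝 y) z = 0 := by
  obtain ⟨φ, rfl⟩ := lmk_surj A ⊤ z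
  obtain ⟨U, hU, h⟩ := (lmk_eq_zero (A := A) (l := 𝓝 x)).1 h
  filter_upwards [eventually_mem_nhds_iff.2 hU] with y hy
  exact (lmk_eq_zero (A := A) (l := 𝓝 y)).2 ⟨U, hy, h⟩

theorem eventually_lres_cyc {j : ℕ} {x : M} {z : LX p A B ⊤ j}
    (h : lres A (𝓝 x) z ∈ (L0 p A B (𝓝 x)).cyc j) :
    ∀ᶠ y in 𝓝 x, lres A (𝓝 y) z ∈ (L0 p A B (𝓝 y)).cyc j := by
  cases j with
  | zero => exact Filter.Eventually.of_forall fun _ => trivial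
  | succ j =>
    have h1 : lres A (𝓝 x) (Ld A B ⊤ j z) = 0 := by
      rw [lres_Ld]
      exact h
    filter_upwards [eventually_lres_zero h1] with y hy
    rw [lres_Ld] at hy
    exact hy

/-- Localization of complexes. -/
def LHyp.res (h : LHyp θ A B ⊤) (h' : LHyp θ A B l) : Cpx.Hom h.L h'.L where
  f _ := lres A l
  f_d _ := lres_Ld
  f_g i j x := by
    obtain ⟨φ, rfl⟩ := lmk_surj A ⊤ x
    exact lmk_eq.2 ⟨Set.univ, Filter.univ_mem, fun f _ => rfl⟩

theorem LHyp.conc_iff (h : LHyp θ A B l) {d : ℕ} {o : LX p A B l d} :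
    (L0 p A B l).Conc d o ↔ h.L.Conc d o := Cpx.forget_conc h.L d o

theorem LHyp.cyc_eq (h : LHyp θ A B l) (d : ℕ) : (L0 p A B l).cyc d = h.L.cyc d :=
  Cpx.forget_cyc h.L d

theorem LHyp.res_T_surj (h : LHyp θ A B ⊤) (h' : LHyp θ A B l) (b : ℕ) (i : ι) {N : ℕ}
    (F : h'.L.TX N) : ∃ F' : h.L.TX N, ((h.res h').T b i).f N F' = F := by
  choose F' hF' using fun k => lres_surj (A := A) (F k)
  exact ⟨F', funext hF'⟩

theorem LHyp.eventually_res_T (h : LHyp θ A B ⊤) {x : M} (hx : LHyp θ A B (𝓝 x)) (b : ℕ) (i : ι)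
    {N : ℕ} {F : h.L.TX N} (hF : ((h.res hx).T b i).f N F = 0) :
    ∀ᶠ y in 𝓝 x, ∀ hy : LHyp θ A B (𝓝 y), ((h.res hy).T b i).f N F = 0 := by
  have : ∀ᶠ y in 𝓝 x, ∀ k, lres A (𝓝 y) (F k) = 0 := by
    rw [Filter.eventually_all]
    exact fun k => eventually_lres_zero (congrFun hF k)
  filter_upwards [this] with y h hy using funext h

theorem LHyp.res_incl (hY : LHyp θ A Y ⊤) (hX : LHyp θ A X ⊤) (hY' : LHyp θ A Y l)
    (hX' : LHyp θ A X l) (hYX : Y ⊆ X) (j : ℕ) (z : hY.L.X j) :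
    (hX.res hX').f j ((hY.incl hX hYX).f j z) = (hY'.incl hX' hYX).f j ((hY.res hY').f j z) := by
  obtain ⟨φ, rfl⟩ := lmk_surj A ⊤ z
  exact lmk_eq.2 ⟨Set.univ, Filter.univ_mem, fun f _ => rfl⟩

/-- An action on `X`, near the filter `l` free outside the pointwise fixed subset `Y`. -/
structure SHyp (θ : EA p ι →* Equiv.Perm M) (Y X : Set M) (l : Filter M) : Prop where
  closed : IsClosed X
  closedY : IsClosed Y
  sub : Y ⊆ X
  acts : Acts θ X
  fix : ∀ x ∈ Y, ∀ g, θ g x = x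
  adm : Adm θ X l
  free : ∃ U ∈ l, ∀ x ∈ X, x ∈ U → x ∉ Y → ∀ g, g ≠ 1 → θ g x ≠ x

omit [DecidableEq ι] in
theorem acts_empty : Acts θ (∅ : Set M) :=
  ⟨fun _ _ h => h.elim, fun _ => continuousOn_empty _⟩

omit [DecidableEq ι] in
theorem SHyp.hX (h : SHyp θ Y X l) : LHyp θ ∅ X l :=
  ⟨isClosed_empty, h.closed, acts_empty, h.acts, h.adm⟩

omit [DecidableEq ι] in
theorem SHyp.actsY (h : SHyp θ Y X l) : Acts θ Y :=
  ⟨fun g x hx => by rwa [h.fix x hx g], fun g => (h.acts.cont g).mono h.sub⟩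

omit [DecidableEq ι] in
theorem SHyp.hY (h : SHyp θ Y X l) : LHyp θ ∅ Y l :=
  ⟨isClosed_empty, h.closedY, acts_empty, h.actsY, h.adm.mono h.sub⟩

omit [DecidableEq ι] in
theorem SHyp.hR (h : SHyp θ Y X l) : RHyp θ Y X l where
  toLHyp := ⟨h.closedY, h.closed, h.actsY, h.acts, h.adm⟩
  sub := h.sub
  fix := h.fix
  free := h.free

theorem SHyp.ses (h : SHyp θ Y X l) :
    Cpx.SES (h.hY.incl h.hX h.sub) (h.hX.proj h.hR.toLHyp (Set.empty_subset Y)) :=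
  LHyp.ses h.hY h.hX h.hR.toLHyp (Set.empty_subset Y) h.sub

theorem SHyp.trivial (h : SHyp θ Y X l) (i : ι) (j : ℕ) : h.hY.L.g i j = 1 := by
  refine LinearMap.ext fun x => ?_
  obtain ⟨φ, rfl⟩ := lmk_surj ∅ l x
  refine (lmk_eq (A := ∅) (l := l)).2 ⟨Set.univ, Filter.univ_mem, fun f _ => ?_⟩
  change φ.1 (pull (θ (gen p i)) f) = φ.1 f
  rw [← sub_eq_zero, ← map_sub]
  refine mem_LZ.1 φ.2 _ fun x _ => ⟨Y, self_mem_nhdsWithin, fun s hs => ?_⟩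
  rw [Pi.sub_apply, pull_apply, sub_eq_zero]
  congr 1
  funext k
  exact h.fix _ (hs k) _

variable [CompactSpace M] [T2Space M]

theorem SHyp.ineq [Fintype ι] (h : SHyp θ Y X l) {c : ℕ} (hcd : CD p c X) {N : ℕ} (hN : c ≤ N) :
    Cpx.Sop^[Fintype.card ι] (L0 p ∅ Y l).h N ≤ Cpx.Sop^[Fintype.card ι] (L0 p ∅ X l).h N := by
  obtain ⟨t, ht, hmem⟩ : ∃ t : List ι, t.Nodup ∧ ∀ i, i ∈ t :=
    ⟨Finset.univ.toList, Finset.nodup_toList _, fun i => by simp⟩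
  have hlen : t.length = Fintype.card ι := by
    have : t.toFinset = Finset.univ := by ext i; simp [hmem i]
    rw [← List.toFinset_card_of_nodup ht, this, Finset.card_univ]
  have h1 := (h.ses.TT t).h_le_of_acyc (h.hR.acyc_TT hcd ht hmem hN)
  have h2 := (Cpx.le_h_TT h.hY.L h.trivial t N).trans (h1.trans (Cpx.h_TT_le _ t N))
  rw [hlen, ← Cpx.forget_h h.hY.L, ← Cpx.forget_h h.hX.L] at h2
  exact h2

/-- `X` is a homology manifold of dimension `d` near `x`. -/
def Or (p : ℕ) [Fact p.Prime] (X : Set M) (x : M) (d : ℕ) : Prop :=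
  ∃ φ : LZ p X d, ∀ᶠ y in 𝓝 x, y ∈ X → (L0 p ∅ X (𝓝 y)).Conc d (lmk ∅ (𝓝 y) φ)

omit [CompactSpace M] [T2Space M] in
theorem Or.h_eq {x : M} {d : ℕ} (h : Or p X x d) (hx : x ∈ X) :
    (L0 p ∅ X (𝓝 x)).h = Cpx.dl d := by
  obtain ⟨φ, h⟩ := h
  exact (h.self_of_nhds hx).h_eq

omit [CompactSpace M] [T2Space M] in
theorem Or.unique {x : M} {d e : ℕ} (h : Or p X x d) (h' : Or p X x e) (hx : x ∈ X) : d = e := by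
  have := (h.h_eq hx).symm.trans (h'.h_eq hx)
  by_contra hne
  have := congrFun this d
  simp [Cpx.dl, hne] at this

omit [CompactSpace M] [T2Space M] in
theorem Or.eventually {x : M} {d : ℕ} (h : Or p X x d) : ∀ᶠ y in 𝓝 x, Or p X y d := by
  obtain ⟨φ, h⟩ := h
  filter_upwards [eventually_eventually_nhds.2 h] with y hy
  exact ⟨φ, hy⟩

omit [CompactSpace M] [T2Space M] [DecidableEq ι] in
theorem Adm.top : Adm θ X ⊤ := fun U hU => ⟨Set.univ, Filter.univ_mem, fun x _ _ => by
  rw [Filter.mem_top.1 hU]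
  trivial, fun _ _ => Iff.rfl, fun _ _ _ => Filter.univ_mem⟩

omit [CompactSpace M] [T2Space M] [DecidableEq ι] in
theorem Adm.nhds [Finite ι] (hX : Acts θ X) {x : M} (hx : x ∈ X) (hfix : ∀ g, θ g x = x) :
    Adm θ X (𝓝 x) := by
  have : NeZero p := ⟨(Fact.out : p.Prime).ne_zero⟩
  have hfin : Finite (EA p ι) := inferInstanceAs (Finite (ι → ZMod p))
  intro U hU
  have key : ∀ z ∈ X, (∀ g, θ g z ∈ interior U) →
      {z | z ∈ X → ∀ g, θ g z ∈ interior U} ∈ 𝓝[X] z := by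
    intro z hz h
    have : ∀ᶠ w in 𝓝[X] z, ∀ g, θ g w ∈ interior U := by
      rw [Filter.eventually_all]
      exact fun g => (hX.cont g z hz).eventually (isOpen_interior.mem_nhds (h g))
    filter_upwards [this] with w hw _ using hw
  refine ⟨{z | z ∈ X → ∀ g, θ g z ∈ interior U}, ?_, ?_, ?_, ?_⟩
  · have := key x hx fun g => by rw [hfix]; exact mem_interior_iff_mem_nhds.2 hU
    filter_upwards [mem_nhdsWithin_iff_eventually.1 this] with z hz h using hz h h
  · intro z hz h
    have := h hz 1
    rw [map_one] at this
    exact interior_subset this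
  · intro g z
    have hinv : ∀ g z, θ g⁻¹ (θ g z) = z := fun g z => by
      rw [← Equiv.Perm.mul_apply, ← map_mul, inv_mul_cancel, map_one]
      rfl
    have hm : θ g z ∈ X ↔ z ∈ X :=
      ⟨fun h => by simpa only [hinv] using hX.maps g⁻¹ h, fun h => hX.maps g h⟩
    simp only [Set.mem_ofPred_eq, hm]
    refine forall_congr' fun _ => ⟨fun h k => ?_, fun h k => ?_⟩
    · have := h (k * g)
      rwa [map_mul] at this
    · have := h (k * g⁻¹)
      rwa [map_mul, Equiv.Perm.mul_apply, hinv] at this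
  · exact fun z hz h => key z hz (h hz)

/-- Fixed point sets of cyclic groups inherit local homology. -/
theorem or_fixed {θ : EA p Unit →* Equiv.Perm M} {c : ℕ} (hcd : CD p c X)
    (hS : ∀ y ∈ Y, SHyp θ Y X (𝓝 y)) (hT : SHyp θ Y X ⊤) {x : M} (hx : x ∈ Y) {d : ℕ}
    (hd : Or p X x d) : ∃ e ≤ d, Or p Y x e ∧ (e = d → Y ∈ 𝓝[X] x) := by
  obtain ⟨φ, hφ⟩ := hd
  have hx' := hS x hx
  have hc := hx'.hX.conc_iff.1 (hφ.self_of_nhds (hx'.sub hx))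
  have hC : ∀ y (hy : y ∈ Y) N, c ≤ N → (Cpx.T 0 () (hS y hy).hR.toLHyp.L).Acyc (N + 1) :=
    fun y hy N hN => (hS y hy).hR.acyc_TT hcd (t := [()]) (by simp) (by simp) hN
  obtain ⟨N, hdN, e, hed, a, hac, haC, t, ht0, htd, ⟨w, hw⟩, hed'⟩ :=
    Cpx.smith_cyclic_image hx'.ses (hx'.trivial ()) (hC x hx) hc
  obtain ⟨ã, rfl⟩ := lres_surj (A := ∅) a
  obtain ⟨ψ, rfl⟩ := lmk_surj ∅ ⊤ ã
  refine ⟨e, hed, ⟨ψ, ?_⟩, ?_⟩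
  · obtain ⟨t', rfl⟩ := hT.hX.res_T_surj hx'.hX 0 () t
    obtain ⟨w', rfl⟩ := hT.hX.res_T_surj hx'.hX 0 () w
    have e1 : ∀ᶠ y in 𝓝 x, ∀ k : Fin (N + 1), (k : ℕ) < d → lres ∅ (𝓝 y) (t' k) = 0 := by
      rw [Filter.eventually_all]
      intro k
      by_cases hk : (k : ℕ) < d
      · filter_upwards [eventually_lres_zero (ht0 k hk)] with y hy _ using hy
      · exact Filter.Eventually.of_forall fun y h => absurd h hk
    have e2 : ∀ᶠ y in 𝓝 x, lres ∅ (𝓝 y) ((show LX p ∅ X ⊤ d from t' ⟨d, hdN⟩) - lmk ∅ ⊤ φ) = 0 := by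
      refine eventually_lres_zero ?_
      rw [map_sub, sub_eq_zero]
      exact htd
    have key : ∀ y (hy : y ∈ Y), ((hT.hX.res (hS y hy).hX).T 0 ()).f N
        (t' - ((hT.hY.incl hT.hX hT.sub).T 0 ()).f N (hT.hY.L.sgl N e (lmk ∅ ⊤ ψ)) -
          (Cpx.T 0 () hT.hX.L).d N w') = ((hT.hX.res (hS y hy).hX).T 0 ()).f N t' -
        (((hS y hy).hY.incl (hS y hy).hX hT.sub).T 0 ()).f N
          ((hS y hy).hY.L.sgl N e (lres ∅ (𝓝 y) (lmk ∅ ⊤ ψ))) - (Cpx.T 0 () (hS y hy).hX.L).d N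
            (((hT.hX.res (hS y hy).hX).T 0 ()).f (N + 1) w') := by
      intro y hy
      rw [map_sub, map_sub, Cpx.Hom.f_d]
      congr 2
      refine funext fun k => ?_
      refine (LHyp.res_incl hT.hY hT.hX (hS y hy).hY (hS y hy).hX hT.sub k
        (hT.hY.L.sgl N e (lmk ∅ ⊤ ψ) k)).trans
          (congrArg (((hS y hy).hY.incl (hS y hy).hX hT.sub).f k) ?_)
      by_cases hk : k = e
      · subst hk
        exact (congrArg (lres ∅ (𝓝 y)) (hT.hY.L.sgl_same k (lmk ∅ ⊤ ψ))).trans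
          ((hS y hy).hY.L.sgl_same k (lmk ∅ (𝓝 y) ψ)).symm
      · exact (congrArg (lres ∅ (𝓝 y)) (hT.hY.L.sgl_ne (lmk ∅ ⊤ ψ) hk)).trans
          (((hS y hy).hY.L.sgl_ne (lmk ∅ (𝓝 y) ψ) hk).trans (map_zero (lres ∅ (𝓝 y))).symm).symm
    have e3 := hT.hX.eventually_res_T hx'.hX 0 () (F := t' -
        ((hT.hY.incl hT.hX hT.sub).T 0 ()).f N (hT.hY.L.sgl N e (lmk ∅ ⊤ ψ)) -
          (Cpx.T 0 () hT.hX.L).d N w') (by rw [key x hx, hw, sub_self])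
    have e4 := eventually_lres_cyc (z := lmk ∅ ⊤ ψ) (x := x) (by rw [hx'.hY.cyc_eq]; exact hac)
    filter_upwards [e1, e2, e3, e4, hφ] with y e1 e2 e3 e4 e5 hy
    have hy' := hS y hy
    have hcy := hy'.hX.conc_iff.1 (e5 (hy'.sub hy))
    refine hy'.hY.conc_iff.2 ?_
    rw [hy'.hY.cyc_eq] at e4
    have e3' := e3 hy'.hX
    rw [key y hy, sub_eq_zero] at e3'
    refine Cpx.Conc.of_image (hy'.hY.incl hy'.hX hT.sub) (hy'.trivial ())
      (Cpx.smith_cyclic hy'.ses (hy'.trivial ()) (hC y hy) hcy) hcy hdN e e4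
      (s := ((hT.hX.res (hS y hy).hX).T 0 ()).f N t') e1 ?_ ?_
    · rw [map_sub, sub_eq_zero] at e2
      exact e2
    · exact ⟨_, e3'.symm⟩
  · intro he
    subst he
    have h1 : lmk ∅ (𝓝 x) (φ - ⟨ψ.1, mem_LZ.2 fun f hf => mem_LZ.1 ψ.2 f
        (K_mono hx'.closed hx'.sub (fun _ _ h => h) _ hf)⟩) ∈ (L0 p ∅ X (𝓝 x)).bd e := hed' rfl
    obtain ⟨χ, U, hU, h1⟩ := mem_L0_bd.1 h1
    refine mem_nhdsWithin_iff_eventually.2 ?_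
    filter_upwards [eventually_mem_nhds_iff.2 hU, hφ] with y hyU hy hyX
    by_contra hyY
    refine (hy hyX).nbd (mem_L0_bd.2 ⟨χ, U ∩ Yᶜ, Filter.inter_mem hyU
      (hx'.closedY.isOpen_compl.mem_nhds hyY), fun f hf => ?_⟩)
    rw [← h1 f (KK_mono (fun _ _ h => h.1) hx'.closed _ hf)]
    change φ.1 f = φ.1 f - ψ.1 f
    rw [mem_LZ.1 ψ.2 f (K_mono hx'.closedY le_rfl (fun z hz h => h.2 hz) _
      (K_mono hx'.closed hx'.sub (fun _ _ h => h) _ hf.2)), sub_zero]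

end Fn

namespace Cpx

variable {p : ℕ} [Fact p.Prime] {ι : Type} {A B C : Cpx.{u} p ι}

/-- The kernel of a map of complexes. -/
def Hom.ker (q : Hom B C) : Cpx.{u} p ι where
  X j := LinearMap.ker (q.f j)
  d j := (B.d j).restrict fun x hx => by
    rw [LinearMap.mem_ker, q.f_d, LinearMap.mem_ker.1 hx, map_zero]
  dd j x := Subtype.ext (B.dd j x)
  g i j := (B.g i j).restrict fun x hx => by
    rw [LinearMap.mem_ker, q.f_g, LinearMap.mem_ker.1 hx, map_zero]
  g_d i j x := Subtype.ext (B.g_d i j x)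
  g_comm i i' j x := Subtype.ext (B.g_comm i i' j x)
  g_pow i j := by
    rw [Module.End.pow_restrict]
    refine LinearMap.ext fun x => Subtype.ext ?_
    exact congrArg (fun f => f x.1) (B.g_pow i j)

/-- The inclusion of the kernel. -/
def Hom.kerι (q : Hom B C) : Hom q.ker B where
  f j := (LinearMap.ker (q.f j)).subtype
  f_d _ _ := rfl
  f_g _ _ _ := rfl

theorem Hom.ses_ker (q : Hom B C) (hq : ∀ j, Function.Surjective (q.f j)) : SES q.kerι q where
  inj _ := Subtype.val_injective
  surj := hq
  exact j x := ⟨fun h => ⟨⟨x, h⟩, rfl⟩, by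
    rintro ⟨a, rfl⟩
    exact a.2⟩

/-- The terms of the complex of a point. -/
def ptX (p : ℕ) [Fact p.Prime] : ℕ → Submodule (ZMod p) (ULift.{u} (ZMod p))
  | 0 => ⊤
  | _ + 1 => ⊥

/-- The complex of a point. -/
def pt (p : ℕ) [Fact p.Prime] (ι : Type) : Cpx.{u} p ι where
  X j := ptX p j
  d _ := 0
  dd _ _ := rfl
  g _ _ := 1
  g_d _ _ _ := rfl
  g_comm _ _ _ _ := rfl
  g_pow _ _ := one_pow p

theorem pt_acyc (N : ℕ) : (pt.{u} p ι).Acyc (N + 1) := fun x _ =>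
  ⟨0, Subtype.ext ((Submodule.mem_bot (ZMod p)).1 x.2).symm⟩

theorem pt_conc : (pt.{u} p ι).Conc 0 (⟨⟨1⟩, trivial⟩ : ptX p 0) where
  acyc j hj := by
    obtain ⟨j, rfl⟩ := Nat.exists_eq_succ_of_ne_zero hj
    exact pt_acyc j
  cyc := trivial
  nbd := by
    rintro ⟨y, hy⟩
    have : (0 : ZMod p) = 1 := congrArg (fun x : ptX p 0 => x.1.down) hy
    exact zero_ne_one this
  span z _ := ⟨z.1.down, 0, Subtype.ext (ULift.ext _ _ (by
    change (0 : ZMod p) = z.1.down - z.1.down • 1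
    simp))⟩

/-- The map to a point given by an augmentation. -/
def aug (L : Cpx.{u} p ι) (ε : L.X 0 →ₗ[ZMod p] ZMod p) (hd : ∀ x, ε (L.d 0 x) = 0)
    (hg : ∀ i x, ε (L.g i 0 x) = ε x) : Hom L (pt p ι) where
  f
    | 0 => { toFun x := ⟨⟨ε x⟩, trivial⟩
             map_add' x y := Subtype.ext (ULift.ext _ _ (map_add ε x y))
             map_smul' c x := Subtype.ext (ULift.ext _ _ (map_smul ε c x)) }
    | _ + 1 => 0
  f_d
    | 0, x => Subtype.ext (ULift.ext _ _ (hd x))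
    | _ + 1, _ => rfl
  f_g
    | i, 0, x => Subtype.ext (ULift.ext _ _ (hg i x))
    | _, _ + 1, _ => rfl

theorem sop_le_of_acyc (L : Cpx.{u} p ι) (ε : L.X 0 →ₗ[ZMod p] ZMod p)
    (hd : ∀ x, ε (L.d 0 x) = 0) (hg : ∀ i x, ε (L.g i 0 x) = ε x) (hε : ∃ x, ε x = 1)
    (t : List ι) {N : ℕ} (hN : (TT t L).Acyc (N + 1)) :
    Sop^[t.length] (dl.{u} 0) (N + 1) ≤ Sop^[t.length] L.h N := by
  obtain ⟨x₀, hx₀⟩ := hε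
  have s : SES (L.aug ε hd hg).kerι (L.aug ε hd hg) := Hom.ses_ker _ fun j => by
    cases j with
    | zero =>
      rintro ⟨⟨a⟩, _⟩
      refine ⟨a • x₀, Subtype.ext (ULift.ext _ _ ?_)⟩
      change ε (a • x₀) = a
      rw [map_smul, hx₀, smul_eq_mul, mul_one]
    | succ j => exact fun y => ⟨0, Subtype.ext ((Submodule.mem_bot (ZMod p)).1 y.2).symm⟩
  rw [← (pt_conc (p := p) (ι := ι)).h_eq]
  refine (le_h_TT _ (fun _ _ => rfl) t _).trans (((s.TT t).h_le_shift hN).trans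
    ((h_TT_le _ t N).trans (Sop_iter_mono (fun j => ?_) _ _)))
  exact s.h_le_of_acyc (pt_acyc j)

theorem Conc.of_bij {f : Hom A B} (hi : ∀ j, Function.Injective (f.f j))
    (hs : ∀ j, Function.Surjective (f.f j)) {d : ℕ} {a : A.X d} (h : B.Conc d (f.f d a)) :
    A.Conc d a := by
  have hc : ∀ N x, f.f N x ∈ B.cyc N → x ∈ A.cyc N := by
    intro N x hx
    cases N with
    | zero => trivial
    | succ N =>
      refine hi N ?_
      rw [f.f_d, map_zero]
      exact hx
  have hb : ∀ N x, f.f N x ∈ B.bd N → x ∈ A.bd N := by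
    rintro N x ⟨y, hy⟩
    obtain ⟨y, rfl⟩ := hs _ y
    exact ⟨y, hi N (by rw [f.f_d, hy])⟩
  exact ⟨fun j hj x hx => hb j x (h.acyc j hj (f.map_cyc j hx)), hc d a h.cyc,
    fun h' => h.nbd (f.map_bd d h'), fun z hz => by
      obtain ⟨c, hc⟩ := h.span _ (f.map_cyc d hz)
      exact ⟨c, hb d _ (by rwa [map_sub, map_smul])⟩⟩

end Cpx

namespace Fn

variable {p : ℕ} [Fact p.Prime] {M : Type u} [TopologicalSpace M]
  {ι : Type} {X Y W : Set M} {l : Filter M}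

theorem adm_one_nhds (x : M) (X : Set M) : Adm (1 : EA p Empty →* Equiv.Perm M) X (𝓝 x) := by
  intro U hU
  exact ⟨interior U, interior_mem_nhds.2 hU, fun _ _ h => interior_subset h, fun _ _ => Iff.rfl,
    ropen_of_isOpen isOpen_interior⟩

theorem Or.of_nhds (hX : IsClosed X) (hY : IsClosed Y) (hYX : Y ⊆ X) {x : M} (hx : Y ∈ 𝓝[X] x)
    {d : ℕ} (h : Or p X x d) : Or p Y x d := by
  obtain ⟨φ, hφ⟩ := h
  let θ : EA p Empty →* Equiv.Perm M := 1
  have HX : ∀ y, LHyp θ ∅ X (𝓝 y) := fun y =>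
    ⟨isClosed_empty, hX, Acts.one _, Acts.one _, adm_one_nhds y X⟩
  have HY : ∀ y, LHyp θ ∅ Y (𝓝 y) := fun y =>
    ⟨isClosed_empty, hY, Acts.one _, Acts.one _, adm_one_nhds y Y⟩
  have HR : ∀ y, LHyp θ Y X (𝓝 y) := fun y =>
    ⟨hY, hX, Acts.one _, Acts.one _, adm_one_nhds y X⟩
  have hz : ∀ y, Y ∈ 𝓝[X] y → ∀ j (z : (HR y).L.X j), z = 0 := by
    intro y hy j z
    obtain ⟨χ, rfl⟩ := lmk_surj Y (𝓝 y) z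
    obtain ⟨V, hV, hVY⟩ := mem_nhdsWithin_iff_exists_mem_nhds_inter.1 hy
    refine (lmk_eq_zero (A := Y) (l := 𝓝 y)).2 ⟨interior V, interior_mem_nhds.2 hV,
      fun f hf => mem_LZ.1 χ.2 f fun z _ => ?_⟩
    by_cases hzV : z ∈ interior V
    · obtain ⟨V', hV', h'⟩ := hf.1 z (Set.notMem_empty z)
      refine ⟨V', ?_, h'⟩
      have : Y ∈ 𝓝[X] z := Filter.mem_of_superset (Filter.inter_mem
        (mem_nhdsWithin_of_mem_nhds (isOpen_interior.mem_nhds hzV)) self_mem_nhdsWithin)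
        fun w hw => hVY ⟨interior_subset hw.1, hw.2⟩
      exact nhdsWithin_le_of_mem this hV'
    · exact hf.2 z hzV
  have hs : ∀ y, Y ∈ 𝓝[X] y → ∀ j, Function.Surjective (((HY y).incl (HX y) hYX).f j) :=
    fun y hy j z => (((HY y).ses (HX y) (HR y) (Set.empty_subset Y) hYX).exact j z).1 (hz y hy j _)
  obtain ⟨a, ha⟩ := hs x hx d (lmk ∅ (𝓝 x) φ)
  obtain ⟨ψ, rfl⟩ := lmk_surj ∅ (𝓝 x) a
  refine ⟨ψ, ?_⟩
  obtain ⟨U, hU, hUf⟩ := (lmk_eq (A := ∅) (l := 𝓝 x)).1 ha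
  filter_upwards [hφ, eventually_mem_nhds_iff.2 hU,
    eventually_nhdsWithin_iff.1 (eventually_eventually_nhdsWithin.2 hx)] with
    y h1 h2 h3 hy
  refine (HY y).conc_iff.2 (Cpx.Conc.of_bij (f := (HY y).incl (HX y) hYX)
    ((HY y).ses (HX y) (HR y) (Set.empty_subset Y) hYX).inj (hs y (h3 (hYX hy))) ?_)
  have : ((HY y).incl (HX y) hYX).f d (lmk ∅ (𝓝 y) ψ) = lmk ∅ (𝓝 y) φ :=
    (lmk_eq (A := ∅) (l := 𝓝 y)).2 ⟨U, h2, hUf⟩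
  rw [this]
  exact (HX y).conc_iff.1 (h1 (hYX hy))

variable [CompactSpace M] [T2Space M]

theorem Or.le {c : ℕ} (hcd : CD p c X) (hX : IsClosed X) {x : M} (hx : x ∈ X) {d : ℕ}
    (h : Or p X x d) : d ≤ c := by
  obtain ⟨φ, hφ⟩ := h
  have hc := hφ.self_of_nhds hx
  by_contra! hlt
  obtain ⟨N, rfl⟩ : ∃ N, d = N + 1 := ⟨d - 1, by omega⟩
  have HR : RHyp (1 : EA p Empty →* Equiv.Perm M) ∅ X (𝓝 x) :=
    { toLHyp := ⟨isClosed_empty, hX, Acts.one _, Acts.one _, adm_one_nhds x X⟩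
      sub := Set.empty_subset _
      fix := fun _ h => h.elim
      free := ⟨Set.univ, Filter.univ_mem, fun _ _ _ _ g hg => (hg (Subsingleton.elim _ _)).elim⟩ }
  have h1 : HR.toLHyp.L.Acyc (N + 1) :=
    HR.acyc_TT hcd (t := []) List.nodup_nil (fun i => i.elim) (by omega)
  rw [HR.toLHyp.conc_iff] at hc
  exact hc.nbd (h1 hc.cyc)

theorem SHyp.or_le {θ : EA p (Fin 2) →* Equiv.Perm M} {c : ℕ} (hcd : CD p c X) {x : M}
    (h : SHyp θ Y X (𝓝 x)) (hx : x ∈ Y) {d e : ℕ} (hd : Or p X x d) (he : Or p Y x e) : d ≤ e := by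
  have h1 := h.ineq hcd (N := c + d + e) (by omega)
  rw [hd.h_eq (h.sub hx), he.h_eq hx, Fintype.card_fin] at h1
  exact Cpx.le_of_Sop_two (by omega) (by omega) h1

omit [CompactSpace M] [T2Space M] in
/-- Bounded total Betti number. -/
def Bet (p : ℕ) [Fact p.Prime] (B : ℕ) (X : Set M) : Prop :=
  ∀ N, Cpx.Sop (L0 p ∅ X ⊤).h N ≤ B

theorem SHyp.bet {θ : EA p Unit →* Equiv.Perm M} {c B : ℕ} (hcd : CD p c X)
    (h : SHyp θ Y X ⊤) (hB : Bet p B X) : Bet p B Y := by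
  intro N
  refine (Cpx.Sop_le_Sop _ (le_max_left N c)).trans ?_
  have := h.ineq hcd (le_max_right N c)
  rw [Fintype.card_unit, Function.iterate_one] at this
  exact this.trans (hB _)

section clopen

omit [CompactSpace M] [T2Space M]

theorem d_cut_sub (hX : IsClosed X) (hW : ROpen X W) (hW' : ROpen X Wᶜ) {j : ℕ} (f : Fn p M j) :
    d (cut (fst W j) f) - cut (fst W (j + 1)) (d f) ∈ K p X ∅ (j + 1) := by
  intro x _
  by_cases hx : x ∈ X
  · by_cases hxW : x ∈ W
    · have h1 := (van_cut_sub f (hW x hx hxW)).d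
      have h2 := van_cut_sub (d f) (hW x hx hxW)
      have := h1.sub h2
      rwa [map_sub, sub_sub_sub_cancel_right] at this
    · have h1 := (van_cut (j := j) f (hW' x hx hxW)).d
      exact h1.sub (van_cut (d f) (hW' x hx hxW))
  · exact van_of_notMem hX _ hx

omit [Fact p.Prime] in
theorem cut_mem_K_of_clopen (hX : IsClosed X) (hW' : ROpen X Wᶜ) {j : ℕ} (f : Fn p M j) :
    cut (fst W j) f ∈ K p X W j := fun x hx => by
  by_cases hxX : x ∈ X
  · exact van_cut f (hW' x hxX hx)
  · exact van_of_notMem hX _ hxX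

theorem cut_sub_mem_K (hX : IsClosed X) (hW : ROpen X W) (hW' : ROpen X Wᶜ) {j : ℕ} {f : Fn p M j}
    (hf : f ∈ K p X W j) : cut (fst W j) f - f ∈ K p X ∅ j := fun x _ => by
  by_cases hxX : x ∈ X
  · by_cases hxW : x ∈ W
    · exact van_cut_sub f (hW x hxX hxW)
    · exact (van_cut f (hW' x hxX hxW)).sub (hf x hxW)
  · exact van_of_notMem hX _ hxX

omit [TopologicalSpace M] in
theorem d_one : d (1 : Fn p M 0) = 0 := by
  funext s
  rw [d_apply]
  simp [Fin.sum_univ_two]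

omit [Fact p.Prime] in
theorem mem_K_empty (U : Set M) {j : ℕ} (f : Fn p M j) : f ∈ K p ∅ U j :=
  fun _ _ => van_of_notMem isClosed_empty f (Set.notMem_empty _)

/-- Evaluation of chains on a clopen set. -/
noncomputable def evC (p : ℕ) [Fact p.Prime] (hX : IsClosed X) (hW' : ROpen X Wᶜ)
    (hl : ∀ U ∈ l, ∀ x ∈ X, x ∈ W → x ∈ U) : LX p ∅ X l 0 →ₗ[ZMod p] ZMod p :=
  Submodule.liftQ _ (Module.Dual.eval (ZMod p) _ (cut (fst W 0) 1) ∘ₗ (LZ p X 0).subtype) (by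
    rintro φ ⟨U, hU, h⟩
    exact h _ ⟨mem_K_empty _ _, K_mono hX le_rfl (hl U hU) _ (cut_mem_K_of_clopen hX hW' 1)⟩)

theorem evC_d (hX : IsClosed X) (hW : ROpen X W) (hW' : ROpen X Wᶜ)
    (hl : ∀ U ∈ l, ∀ x ∈ X, x ∈ W → x ∈ U) (x : LX p ∅ X l 1) :
    evC p hX hW' hl (Ld ∅ X l 0 x) = 0 := by
  obtain ⟨φ, rfl⟩ := lmk_surj ∅ l x
  refine mem_LZ.1 φ.2 _ ?_
  have := d_cut_sub hX hW hW' (1 : Fn p M 0)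
  rwa [d_one, map_zero, sub_zero] at this

/-- Evaluation at a point. -/
def pev (p : ℕ) {x : M} (hx : x ∈ X) : LZ p X 0 :=
  ⟨LinearMap.proj fun _ => x, mem_LZ.2 fun f hf => by
    obtain ⟨V, hV, h⟩ := hf x (Set.notMem_empty x)
    exact h _ fun _ => mem_of_mem_nhdsWithin hx hV⟩

theorem evC_pev_of_mem (hX : IsClosed X) (hW' : ROpen X Wᶜ)
    (hl : ∀ U ∈ l, ∀ x ∈ X, x ∈ W → x ∈ U) {x : M} (hx : x ∈ X) (hxW : x ∈ W) :
    evC p hX hW' hl (lmk ∅ l (pev p hx)) = 1 :=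
  cut_of_mem (p := p) 1 (s := fun _ => x) hxW

theorem evC_pev_of_notMem (hX : IsClosed X) (hW' : ROpen X Wᶜ)
    (hl : ∀ U ∈ l, ∀ x ∈ X, x ∈ W → x ∈ U) {x : M} (hx : x ∈ X) (hxW : x ∉ W) :
    evC p hX hW' hl (lmk ∅ l (pev p hx)) = 0 :=
  cut_of_notMem (p := p) 1 (s := fun _ => x) hxW

/-- The clopen subsets of a set. -/
def Clo (S : Set M) : Set (Set M) := {C | C ⊆ S ∧ IsClosed C ∧ IsClosed (S \ C)}

theorem clo_finite (hX : IsClosed X) {S : Set M} (hS : S ∈ Clo X) {B : ℕ} (hB : Bet p B X) :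
    (Clo S).Finite ∧ (Clo S).ncard ≤ p ^ B := by
  have hro : ∀ C ∈ Clo S, ROpen X C ∧ ROpen X Cᶜ := by
    intro C hC
    refine ⟨fun x _ hxC => ?_, fun x _ hxC => mem_nhdsWithin_of_mem_nhds
      (hC.2.1.isOpen_compl.mem_nhds hxC)⟩
    have h1 : (S \ C ∪ X \ S)ᶜ ∈ 𝓝 x := (hC.2.2.union hS.2.2).isOpen_compl.mem_nhds fun h =>
      h.elim (fun h => h.2 hxC) fun h => h.2 (hC.1 hxC)
    refine Filter.mem_of_superset (Filter.inter_mem (mem_nhdsWithin_of_mem_nhds h1)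
      self_mem_nhdsWithin) fun y hy => ?_
    by_contra hyC
    by_cases hyS : y ∈ S
    · exact hy.1 (Or.inl ⟨hyS, hyC⟩)
    · exact hy.1 (Or.inr ⟨hy.2, hyS⟩)
  let L := L0 p ∅ X ⊤
  have hr : Module.rank (ZMod p) (L.H 0) ≤ (B : Cardinal) := by
    have := hB 0
    unfold Cpx.Sop at this
    rwa [Finset.sum_range_one] at this
  have hfd : Module.Finite (ZMod p) (L.H 0) :=
    Module.rank_lt_aleph0_iff.1 (hr.trans_lt (Cardinal.natCast_lt_aleph0))
  have hfr : Module.finrank (ZMod p) (L.H 0) ≤ B := Module.finrank_le_of_rank_le hr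
  have hl : ∀ C : Set M, ∀ U ∈ (⊤ : Filter M), ∀ x ∈ X, x ∈ C → x ∈ U := fun C U hU x _ _ => by
    rw [Filter.mem_top.1 hU]
    trivial
  let F : Clo S → Module.Dual (ZMod p) (L.H 0) := fun C =>
    Submodule.liftQ _ (evC p hX (hro C C.2).2 (hl C) ∘ₗ (L.cyc 0).subtype) (by
      rintro x ⟨y, hy⟩
      rw [LinearMap.mem_ker]
      have : evC p hX (hro C C.2).2 (hl C) x.1 = 0 := by
        rw [← Submodule.coe_subtype, ← hy]
        exact evC_d hX (hro C C.2).1 (hro C C.2).2 (hl C) y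
      exact this)
  have hF : Function.Injective F := by
    have key : ∀ C C' : Clo S, F C = F C' → C.1 ⊆ C'.1 := by
      intro C C' h x hx
      by_contra hx'
      have hxX : x ∈ X := hS.1 (C.2.1 hx)
      have := congrArg (fun f => f (Submodule.Quotient.mk ⟨lmk ∅ ⊤ (pev p hxX), trivial⟩)) h
      have h1 := evC_pev_of_mem (p := p) hX (hro C C.2).2 (hl C) hxX hx
      have h2 := evC_pev_of_notMem (p := p) hX (hro C' C'.2).2 (hl C') hxX hx'
      exact zero_ne_one (h2.symm.trans (this.symm.trans h1))
    exact fun C C' h => Subtype.ext ((key C C' h).antisymm (key C' C h.symm))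
  have hfin : Finite (Module.Dual (ZMod p) (L.H 0)) := Module.finite_of_finite (ZMod p)
  have : Finite (Clo S) := Finite.of_injective F hF
  refine ⟨Set.toFinite _, ?_⟩
  rw [← Nat.card_coe_set_eq]
  refine (Nat.card_le_card_of_injective F hF).trans ?_
  rw [Module.natCard_eq_pow_finrank (K := ZMod p), Subspace.dual_finrank_eq, Nat.card_zmod]
  exact Nat.pow_le_pow_right (Fact.out : p.Prime).pos hfr

end clopen

/-- Rank bound for free actions on a clopen subset. -/
theorem free_rank {r : ℕ} {θ : EA p (Fin r) →* Equiv.Perm M} (hX : IsClosed X) (hθ : Acts θ X)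
    (hW : ROpen X W) (hW' : ROpen X Wᶜ) (hinv : ∀ g x, x ∈ W ↔ θ g x ∈ W)
    (hne : (X ∩ W).Nonempty) (hfree : ∀ x ∈ X, x ∈ W → ∀ g, g ≠ 1 → θ g x ≠ x) {c B : ℕ}
    (hcd : CD p c X) (hB : Bet p B X) : r ≤ B * (c + 1) := by
  have HR : RHyp θ ∅ X (Filter.principal W) :=
    { toLHyp := ⟨isClosed_empty, hX, acts_empty, hθ, fun U hU =>
        ⟨W, Filter.mem_principal_self W, fun _ _ h => hU h, hinv, hW⟩⟩
      sub := Set.empty_subset _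
      fix := fun _ h => h.elim
      free := ⟨W, Filter.mem_principal_self W, fun x hx hxW _ => hfree x hx hxW⟩ }
  have hl : ∀ U ∈ Filter.principal W, ∀ x ∈ X, x ∈ W → x ∈ U := fun U hU x _ h => hU h
  obtain ⟨x₀, hx₀, hx₀W⟩ := hne
  have h1 := HR.toLHyp.L.sop_le_of_acyc (evC p hX hW' hl) (evC_d hX hW hW' hl) (fun i x => by
      obtain ⟨φ, rfl⟩ := lmk_surj ∅ _ x
      change φ.1 (pull (θ (gen p i)) (cut (fst W 0) 1)) = φ.1 (cut (fst W 0) 1)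
      congr 1
      funext s
      rw [pull_apply]
      by_cases hs : s ∈ fst W 0
      · rw [cut_of_mem _ hs, cut_of_mem _ ((hinv (gen p i) (s 0)).1 hs)]
        rfl
      · rw [cut_of_notMem _ hs, cut_of_notMem]
        exact fun h => hs ((hinv (gen p i) (s 0)).2 h))
    ⟨lmk ∅ _ (pev p hx₀), evC_pev_of_mem hX hW' hl hx₀ hx₀W⟩
    (List.finRange r) (HR.acyc_TT hcd (List.nodup_finRange r) List.mem_finRange le_rfl)
  rw [List.length_finRange, ← Cpx.forget_h HR.toLHyp.L] at h1
  refine Cpx.rank_bound h1 ((Cpx.Sop_mono (fun j => ?_) c).trans (hB c))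
  refine Cpx.h_le_of_surj (L0 p ∅ X ⊤) (L0 p ∅ X (Filter.principal W)) j j
    (lres ∅ _ ∘ₗ (Submodule.subtype _)) ?_ ?_ ?_
  · rintro ⟨v, hv⟩
    cases j with
    | zero => trivial
    | succ j =>
      have hv : Ld ∅ X ⊤ j v = 0 := hv
      change Ld ∅ X _ j (lres ∅ _ v) = 0
      exact (lres_Ld (show LX p ∅ X ⊤ (j + 1) from v)).symm.trans
        ((congrArg (lres ∅ _) hv).trans (map_zero _))
  · rintro ⟨_, hv⟩ ⟨v, rfl⟩
    exact ⟨lres ∅ _ v, (lres_Ld v).symm⟩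
  · intro v hv
    obtain ⟨φ, rfl⟩ := lmk_surj ∅ _ v
    let φ' : LZ p X j := ⟨φ.1 ∘ₗ cut (fst W j), mem_LZ.2 fun f hf => mem_LZ.1 φ.2 _ (cut_mem_K _ hf)⟩
    refine ⟨⟨lmk ∅ ⊤ φ', ?_⟩, ?_⟩
    · cases j with
      | zero => trivial
      | succ j =>
        obtain ⟨U, hU, h⟩ := mem_L0_cyc_succ.1 hv
        refine mem_L0_cyc_succ.2 ⟨Set.univ, Filter.univ_mem, fun f _ => ?_⟩
        have e1 := h (cut (fst W j) f) ⟨mem_K_empty _ _,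
          K_mono hX le_rfl (hl U hU) _ (cut_mem_K_of_clopen hX hW' f)⟩
        have e2 := mem_LZ.1 φ.2 _ (d_cut_sub hX hW hW' f)
        rw [map_sub, e1, zero_sub, neg_eq_zero] at e2
        exact e2
    · have : lmk ∅ (Filter.principal W) φ = lmk ∅ (Filter.principal W) φ' := by
        refine lmk_eq.2 ⟨W, Filter.mem_principal_self W, fun f hf => ?_⟩
        have := mem_LZ.1 φ.2 _ (cut_sub_mem_K hX hW hW' hf.2)
        rw [map_sub, sub_eq_zero] at this
        exact this.symm
      change lmk ∅ (Filter.principal W) φ - lmk ∅ (Filter.principal W) φ' ∈ _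
      rw [this, sub_self]
      exact zero_mem _

end Fn

namespace Fn

variable {p : ℕ} {M : Type u}

section action

variable {V V' : Type} [AddCommGroup V] [Module (ZMod p) V] [AddCommGroup V'] [Module (ZMod p) V']
  (θ : Multiplicative V →* Equiv.Perm M)

/-- The permutation by which a vector acts. -/
def ac (v : V) : Equiv.Perm M := θ (Multiplicative.ofAdd v)

omit [Module (ZMod p) V] in
theorem ac_add (v w : V) (x : M) : ac θ (v + w) x = ac θ v (ac θ w x) := by
  simp [ac, ofAdd_add]

omit [Module (ZMod p) V] in
theorem ac_zero (x : M) : ac θ 0 x = x := by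
  simp [ac]

omit [Module (ZMod p) V] in
theorem ac_comm (v w : V) (x : M) : ac θ v (ac θ w x) = ac θ w (ac θ v x) := by
  rw [← ac_add, add_comm, ac_add]

/-- Pulling back an action along a linear map. -/
def rst (f : V' →ₗ[ZMod p] V) : Multiplicative V' →* Equiv.Perm M :=
  θ.comp f.toAddMonoidHom.toMultiplicative

/-- The vectors acting trivially along a filter. -/
def trivF (l : Filter M) : Submodule (ZMod p) V :=
  AddSubgroup.toZModSubmodule p
    { carrier := {v | ∀ᶠ y in l, ac θ v y = y}
      zero_mem' := Filter.Eventually.of_forall fun y => ac_zero θ y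
      add_mem' := fun {v w} hv hw => by
        filter_upwards [hv, hw] with y h1 h2
        rw [ac_add, h2, h1]
      neg_mem' := fun {v} hv => by
        filter_upwards [hv] with y h
        nth_rw 1 [← h, ← ac_add, neg_add_cancel, ac_zero] }

theorem mem_trivF {l : Filter M} {v : V} : v ∈ trivF (p := p) θ l ↔ ∀ᶠ y in l, ac θ v y = y :=
    Iff.rfl

theorem mem_trivF_principal {S : Set M} {v : V} :
    v ∈ trivF (p := p) θ (Filter.principal S) ↔ ∀ y ∈ S, ac θ v y = y := by
  rw [mem_trivF, Filter.eventually_principal]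

/-- The points of a set fixed by a vector. -/
def fx (Y : Set M) (v : V) : Set M := {y | y ∈ Y ∧ ac θ v y = y}

variable {θ} [TopologicalSpace M]

theorem Acts.rst {Y : Set M} (h : Acts θ Y) (f : V' →ₗ[ZMod p] V) : Acts (rst θ f) Y :=
  ⟨fun _ => h.maps _, fun _ => h.cont _⟩

omit [Module (ZMod p) V] in
theorem Acts.fx {Y : Set M} (h : Acts θ Y) (v : V) : Acts θ (fx θ Y v) :=
  ⟨fun g x hx => ⟨h.maps g hx.1, by
    have := ac_comm θ v (Multiplicative.toAdd g) x
    rw [hx.2] at this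
    exact this⟩, fun g => (h.cont g).mono fun _ h => h.1⟩

omit [Module (ZMod p) V] in
theorem isClosed_fx [T2Space M] {Y : Set M} (hY : IsClosed Y) (h : Acts θ Y) (v : V) :
    IsClosed (fx θ Y v) := by
  have h1 : ContinuousOn (fun y => (ac θ v y, y)) Y :=
    (h.cont (Multiplicative.ofAdd v)).prodMk continuousOn_id
  exact h1.preimage_isClosed_of_isClosed hY isClosed_diagonal

end action

variable [Fact p.Prime] [TopologicalSpace M]

/-- Compact spaces with the properties of homology manifolds inherited by fixed point sets. -/
structure Good (p : ℕ) [Fact p.Prime] (c B : ℕ) (Y : Set M) : Prop where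
  closed : IsClosed Y
  cd : CD p c Y
  or : ∀ x ∈ Y, ∃ d, Or p Y x d
  bet : Bet p B Y

open Classical in
/-- The local dimension. -/
noncomputable def dlt (p : ℕ) [Fact p.Prime] (Y : Set M) (x : M) : ℕ :=
  if h : ∃ d, Or p Y x d then h.choose else 0

theorem Or.dlt_eq {Y : Set M} {x : M} {d : ℕ} (h : Or p Y x d) (hx : x ∈ Y) : dlt p Y x = d := by
  have h' : ∃ d, Or p Y x d := ⟨d, h⟩
  rw [dlt, dif_pos h']
  exact h'.choose_spec.unique h hx

variable {c B : ℕ} {Y : Set M}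

theorem Good.or_dlt (h : Good p c B Y) {x : M} (hx : x ∈ Y) : Or p Y x (dlt p Y x) := by
  obtain ⟨d, hd⟩ := h.or x hx
  rwa [hd.dlt_eq hx]

theorem Good.eventually_dlt (h : Good p c B Y) {x : M} (hx : x ∈ Y) :
    ∀ᶠ y in 𝓝 x, y ∈ Y → dlt p Y y = dlt p Y x := by
  filter_upwards [(h.or_dlt hx).eventually] with y hy hyY using hy.dlt_eq hyY

variable [CompactSpace M] [T2Space M]

theorem Good.dlt_le (h : Good p c B Y) {x : M} (hx : x ∈ Y) : dlt p Y x ≤ c :=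
  (h.or_dlt hx).le h.cd h.closed hx

variable {V : Type} [AddCommGroup V] [Module (ZMod p) V] {θ : Multiplicative V →* Equiv.Perm M}

omit [CompactSpace M] in
theorem shyp_fx (hY : IsClosed Y) (hθ : Acts θ Y) (v : V) {l : Filter M}
    (hl : Adm (rst θ (Fintype.linearCombination (ZMod p) fun _ : Unit => v)) Y l) :
    SHyp (rst θ (Fintype.linearCombination (ZMod p) fun _ : Unit => v)) (fx θ Y v) Y l where
  closed := hY
  closedY := isClosed_fx hY hθ v
  sub := fun _ h => h.1
  acts := hθ.rst _
  fix := fun x hx g => by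
    have h1 : v ∈ trivF (p := p) θ (Filter.principal {x}) :=
      (mem_trivF_principal θ).2 fun y hy => by rw [hy, hx.2]
    have h2 := Submodule.smul_mem _ (Multiplicative.toAdd g ()) h1
    rw [mem_trivF_principal] at h2
    change ac θ (Fintype.linearCombination (ZMod p) (fun _ : Unit => v) (Multiplicative.toAdd g)) x = x
    rw [Fintype.linearCombination_apply, Fintype.sum_unique]
    exact h2 x rfl
  adm := hl
  free := ⟨Set.univ, Filter.univ_mem, fun x hx _ hxY g hg h => hxY ⟨hx, by
    have h1 : Multiplicative.toAdd g () • v ∈ trivF (p := p) θ (Filter.principal {x}) :=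
      (mem_trivF_principal θ).2 fun y hy => by
        rw [hy]
        change ac θ (Fintype.linearCombination (ZMod p) (fun _ : Unit => v)
          (Multiplicative.toAdd g)) x = x at h
        rwa [Fintype.linearCombination_apply, Fintype.sum_unique] at h
    have h0 : Multiplicative.toAdd g () ≠ 0 := fun h0 => hg <| by
      refine Multiplicative.toAdd.injective (funext fun _ => h0)
    have h2 := Submodule.smul_mem _ (Multiplicative.toAdd g ())⁻¹ h1
    rw [smul_smul, inv_mul_cancel₀ h0, one_smul, mem_trivF_principal] at h2
    exact h2 x rfl⟩⟩

theorem Good.fx_or (h : Good p c B Y) (hθ : Acts θ Y) (v : V) {x : M} (hx : x ∈ fx θ Y v) :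
    ∃ e ≤ dlt p Y x, Or p (fx θ Y v) x e ∧ (e = dlt p Y x → fx θ Y v ∈ 𝓝[Y] x) := by
  have hT := shyp_fx (p := p) h.closed hθ v Adm.top
  exact or_fixed h.cd (fun y hy => shyp_fx h.closed hθ v (Adm.nhds (hθ.rst _) hy.1 (hT.fix y hy))) hT
    hx (h.or_dlt hx.1)

theorem Good.fx (h : Good p c B Y) (hθ : Acts θ Y) (v : V) : Good p c B (fx θ Y v) where
  closed := isClosed_fx h.closed hθ v
  cd := CD.of_closed h.closed (isClosed_fx h.closed hθ v) (fun _ h => h.1) h.cd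
  or := fun x hx => by
    obtain ⟨e, -, he, -⟩ := h.fx_or hθ v hx
    exact ⟨e, he⟩
  bet := (shyp_fx (p := p) h.closed hθ v Adm.top).bet h.cd h.bet

theorem Good.dlt_fx_le (h : Good p c B Y) (hθ : Acts θ Y) (v : V) {x : M} (hx : x ∈ Fn.fx θ Y v) :
    dlt p (Fn.fx θ Y v) x ≤ dlt p Y x := by
  obtain ⟨e, h1, he, -⟩ := h.fx_or (θ := θ) hθ v hx
  rwa [he.dlt_eq hx]

omit [CompactSpace M] [T2Space M] in
theorem dlt_of_nhds {Z : Set M} (h : Good p c B Y) (hZ : IsClosed Z) (hZY : Z ⊆ Y) {x : M}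
    (hx : x ∈ Z) (hn : Z ∈ 𝓝[Y] x) : dlt p Z x = dlt p Y x :=
  ((h.or_dlt (hZY hx)).of_nhds h.closed hZ hZY hn).dlt_eq hx

theorem Good.dlt_fx_eq_iff (h : Good p c B Y) (hθ : Acts θ Y) (v : V) {x : M}
    (hx : x ∈ Fn.fx θ Y v) : dlt p (Fn.fx θ Y v) x = dlt p Y x ↔ Fn.fx θ Y v ∈ 𝓝[Y] x := by
  refine ⟨fun h' => ?_, dlt_of_nhds h (isClosed_fx h.closed hθ v) (fun _ h => h.1) hx⟩
  obtain ⟨e, -, he, h2⟩ := h.fx_or hθ v hx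
  exact h2 (by rw [← h', he.dlt_eq hx])

omit [CompactSpace M] [T2Space M] [Fact p.Prime] [Module (ZMod p) V] in
theorem fx_mem_nhds {x : M} {v : V} :
    Fn.fx θ Y v ∈ 𝓝[Y] x ↔ ∀ᶠ y in 𝓝[Y] x, ac θ v y = y := by
  refine ⟨fun h => Filter.mem_of_superset h fun _ h => h.2, fun h => ?_⟩
  filter_upwards [h, self_mem_nhdsWithin] with y h1 h2 using ⟨h2, h1⟩

/-- Local rank bound. -/
theorem Good.local_rank [Finite V] (h : Good p c B Y) (hθ : Acts θ Y) {x : M} (hx : x ∈ Y)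
    (hfix : ∀ v, ac θ v x = x) :
    Module.finrank (ZMod p) V ≤ dlt p Y x + Module.finrank (ZMod p) (trivF (p := p) θ (𝓝[Y] x)) := by
  induction hd : dlt p Y x using Nat.strong_induction_on generalizing Y with
  | _ d ih =>
  subst hd
  set T := trivF (p := p) θ (𝓝[Y] x) with hT
  by_cases hTtop : T = ⊤
  · rw [hTtop, finrank_top]
    omega
  have hxf : ∀ v, x ∈ Fn.fx θ Y v := fun v => ⟨hx, hfix v⟩
  obtain ⟨v, hv, hmax⟩ := Set.exists_max_image {v | v ∉ T} (fun v => dlt p (Fn.fx θ Y v) x)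
    (Set.toFinite _) (by
      by_contra! hne
      exact hTtop (Submodule.eq_top_iff'.2 fun v => by
        by_contra hv
        exact (hne ▸ hv : v ∈ (∅ : Set V))))
  have hve : dlt p (Fn.fx θ Y v) x < dlt p Y x := lt_of_le_of_ne (h.dlt_fx_le hθ v (hxf v)) fun he =>
    hv (fx_mem_nhds.1 ((h.dlt_fx_eq_iff hθ v (hxf v)).1 he))
  have hIH := ih _ hve (h.fx hθ v) (hθ.fx v) (hxf v) rfl
  set T' := trivF (p := p) θ (𝓝[Fn.fx θ Y v] x) with hT'
  have hTT' : T ≤ T' := fun w hw => nhdsWithin_mono x (fun _ h => h.1) hw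
  have hnear : ∀ w ∈ T', w ∉ T → ∀ᶠ y in 𝓝 x, y ∈ Y → (ac θ w y = y ↔ ac θ v y = y) := by
    intro w hw hwT
    have h1 : Fn.fx θ (Fn.fx θ Y v) w ∈ 𝓝[Fn.fx θ Y v] x := fx_mem_nhds.2 hw
    have e1 := dlt_of_nhds (h.fx hθ v) (isClosed_fx (isClosed_fx h.closed hθ v) (hθ.fx v) w)
      (fun _ h => h.1) ⟨hxf v, hfix w⟩ h1
    have e2 : Fn.fx θ (Fn.fx θ Y v) w = Fn.fx θ (Fn.fx θ Y w) v :=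
      Set.ext fun y => ⟨fun h => ⟨⟨h.1.1, h.2⟩, h.1.2⟩, fun h => ⟨⟨h.1.1, h.2⟩, h.1.2⟩⟩
    have e3 := (h.fx hθ w).dlt_fx_le (hθ.fx w) v ⟨hxf w, hfix v⟩
    have e4 : Fn.fx θ (Fn.fx θ Y w) v ∈ 𝓝[Fn.fx θ Y w] x := by
      refine ((h.fx hθ w).dlt_fx_eq_iff (hθ.fx w) v ⟨hxf w, hfix v⟩).1 (le_antisymm e3 ?_)
      rw [← e2, e1]
      exact hmax w hwT
    filter_upwards [mem_nhdsWithin_iff_eventually.1 h1, mem_nhdsWithin_iff_eventually.1 e4] with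
      y h1 h2 hy
    exact ⟨fun h => (h2 ⟨hy, h⟩).2, fun h => (h1 ⟨hy, h⟩).2⟩
  have claim : Module.finrank (ZMod p) T' ≤ 1 + Module.finrank (ZMod p) T := by
    by_contra! hlt
    have hq : 2 ≤ Module.finrank (ZMod p) (T' ⧸ T.submoduleOf T') := by
      have e1 := Submodule.finrank_quotient_add_finrank (T.submoduleOf T')
      rw [(Submodule.submoduleOfEquivOfLe hTT').finrank_eq] at e1
      omega
    obtain ⟨f, hf⟩ := exists_linearIndependent_of_le_finrank hq
    choose g hg using fun i => Submodule.Quotient.mk_surjective _ (f i)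
    let F : (Fin 2 → ZMod p) →ₗ[ZMod p] V := T'.subtype ∘ₗ Fintype.linearCombination (ZMod p) g
    have hF' : ∀ w, F w ∈ T' := fun w => Submodule.coe_mem _
    have hF : ∀ w, F w ∈ T → w = 0 := by
      intro w hw
      have h1 : Fintype.linearCombination (ZMod p) g w ∈ T.submoduleOf T' := hw
      rw [← Submodule.Quotient.mk_eq_zero, Fintype.linearCombination_apply,
        ← Submodule.mkQ_apply, map_sum] at h1
      refine funext fun i => Fintype.linearIndependent_iff.1 hf w ?_ i
      rw [← h1]
      refine Finset.sum_congr rfl fun i _ => ?_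
      rw [map_smul, Submodule.mkQ_apply, hg]
    have hev : ∀ᶠ y in 𝓝 x, ∀ w, w ≠ 0 → y ∈ Y → (ac θ (F w) y = y ↔ ac θ v y = y) := by
      rw [Filter.eventually_all]
      intro w
      by_cases hw : w = 0
      · exact Filter.Eventually.of_forall fun y h => absurd hw h
      · filter_upwards [hnear (F w) (hF' w) fun h => hw (hF w h)] with y hy _ using hy
    let Z : Set M := Fn.fx θ Y v ∩ ⋂ w, Fn.fx θ Y (F w)
    have hZc : IsClosed Z := (isClosed_fx h.closed hθ v).inter
      (isClosed_iInter fun w => isClosed_fx h.closed hθ (F w))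
    have hxZ : x ∈ Z := ⟨hxf v, Set.mem_iInter.2 fun w => hxf (F w)⟩
    have hZn : Z ∈ 𝓝[Fn.fx θ Y v] x := by
      filter_upwards [mem_nhdsWithin_of_mem_nhds hev, self_mem_nhdsWithin] with y h1 h2
      refine ⟨h2, Set.mem_iInter.2 fun w => ⟨h2.1, ?_⟩⟩
      by_cases hw : w = 0
      · rw [hw, map_zero, ac_zero]
      · exact (h1 w hw h2.1).2 h2.2
    have hS : SHyp (p := p) (ι := Fin 2) (rst θ F) Z Y (𝓝 x) :=
      { closed := h.closed
        closedY := hZc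
        sub := fun _ h => h.1.1
        acts := hθ.rst F
        fix := fun y hy g => (Set.mem_iInter.1 hy.2 (Multiplicative.toAdd g)).2
        adm := Adm.nhds (hθ.rst F) hx fun g => hfix _
        free := ⟨_, hev, fun y hy hyU hyZ g hg hgy => hyZ (by
          have h1 : Multiplicative.toAdd g ≠ 0 := fun h => hg (Multiplicative.toAdd.injective h)
          have h2 := (hyU _ h1 hy).1 hgy
          refine ⟨⟨hy, h2⟩, Set.mem_iInter.2 fun w => ⟨hy, ?_⟩⟩
          by_cases hw : w = 0
          · rw [hw, map_zero, ac_zero]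
          · exact (hyU w hw hy).2 h2)⟩ }
    have := hS.or_le h.cd hxZ (h.or_dlt hx)
      (((h.fx hθ v).or_dlt (hxf v)).of_nhds (h.fx hθ v).closed hZc (fun _ h => h.1) hZn)
    omega
  omega

end Fn

namespace Fn

section clopen

variable {M : Type u} [TopologicalSpace M] {S C D : Set M}

theorem Clo.trans (hC : C ∈ Clo S) (hD : D ∈ Clo C) : D ∈ Clo S := by
  refine ⟨hD.1.trans hC.1, hD.2.1, ?_⟩
  have : S \ D = S \ C ∪ C \ D := by
    ext x
    refine ⟨fun h => ?_, fun h => ?_⟩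
    · by_cases hx : x ∈ C
      · exact Or.inr ⟨hx, h.2⟩
      · exact Or.inl ⟨h.1, hx⟩
    · exact h.elim (fun h => ⟨h.1, fun h' => h.2 (hD.1 h')⟩) fun h => ⟨hC.1 h.1, h.2⟩
  rw [this]
  exact hC.2.2.union hD.2.2

theorem Clo.compl (hC : C ∈ Clo S) : S \ C ∈ Clo S :=
  ⟨Set.sdiff_subset, hC.2.2, by rw [Set.sdiff_sdiff_right_self, Set.inter_eq_right.2 hC.1]; exact hC.2.1⟩

theorem clo_self (hS : IsClosed S) : S ∈ Clo S :=
  ⟨le_rfl, hS, by rw [Set.sdiff_self]; exact isClosed_empty⟩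

theorem clo_empty (hS : IsClosed S) : ∅ ∈ Clo S :=
  ⟨Set.empty_subset _, isClosed_empty, by rwa [Set.sdiff_empty]⟩

theorem Clo.union (hC : C ∈ Clo S) (hD : D ∈ Clo S) : C ∪ D ∈ Clo S :=
  ⟨Set.union_subset hC.1 hD.1, hC.2.1.union hD.2.1, by
    rw [← Set.sdiff_inter_sdiff]
    exact hC.2.2.inter hD.2.2⟩

theorem clo_ncard_lt (hf : (Clo S).Finite) (hS : IsClosed S) (hC : C ∈ Clo S) (hne : C ≠ S) :
    (Clo C).ncard < (Clo S).ncard := by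
  refine Set.ncard_lt_ncard ?_ hf
  refine ⟨fun D hD => Clo.trans hC hD, fun h => hne ?_⟩
  exact hC.1.antisymm (h (clo_self hS)).1

theorem mem_clo_of_eventually {P : M → Prop} (hS : IsClosed S)
    (h : ∀ x ∈ S, ∀ᶠ y in 𝓝 x, y ∈ S → (P y ↔ P x)) : {x | x ∈ S ∧ P x} ∈ Clo S := by
  refine ⟨fun _ h => h.1, ?_, ?_⟩
  · rw [← isOpen_compl_iff, isOpen_iff_mem_nhds]
    intro x hx
    by_cases hxS : x ∈ S
    · filter_upwards [h x hxS] with y hy hyP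
      exact hx ⟨hxS, (hy hyP.1).1 hyP.2⟩
    · filter_upwards [hS.isOpen_compl.mem_nhds hxS] with y hy hyP using hy hyP.1
  · rw [← isOpen_compl_iff, isOpen_iff_mem_nhds]
    intro x hx
    by_cases hxS : x ∈ S
    · filter_upwards [h x hxS] with y hy hyP
      refine hx ⟨hxS, fun hxP => hyP.2 ⟨hyP.1, (hy hyP.1).2 hxP.2⟩⟩
    · filter_upwards [hS.isOpen_compl.mem_nhds hxS] with y hy hyP using hy hyP.1

theorem ropen_of_clo {Y : Set M} (hS : S ∈ Clo Y) : ROpen Y S ∧ ROpen Y Sᶜ := by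
  refine ⟨fun x hx hxS => ?_, fun x _ hx =>
    mem_nhdsWithin_of_mem_nhds (hS.2.1.isOpen_compl.mem_nhds hx)⟩
  filter_upwards [mem_nhdsWithin_of_mem_nhds (hS.2.2.isOpen_compl.mem_nhds fun h => h.2 hxS),
    self_mem_nhdsWithin] with y h1 h2
  by_contra h3
  exact h1 ⟨h2, h3⟩

end clopen

variable {p : ℕ} [Fact p.Prime] {M : Type u} [TopologicalSpace M] {c B : ℕ} {Y : Set M}

/-- The points of given local dimension. -/
def lev (p : ℕ) [Fact p.Prime] (Y : Set M) (i : ℕ) : Set M := {x | x ∈ Y ∧ dlt p Y x = i}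

theorem Good.lev_mem_clo (h : Good p c B Y) (i : ℕ) : lev p Y i ∈ Clo Y :=
  mem_clo_of_eventually h.closed fun x hx => by
    filter_upwards [h.eventually_dlt hx] with y hy hyY
    rw [hy hyY]

/-- The complexity of a space, strictly decreasing along fixed point sets. -/
noncomputable def cpl (p : ℕ) [Fact p.Prime] (c B : ℕ) (Y : Set M) : ℕ :=
  ∑ i ∈ Finset.range (c + 1), (Clo (lev p Y i)).ncard * (p ^ B + 1) ^ i

theorem sum_lt_pow {K : ℕ} {a : ℕ → ℕ} (ha : ∀ j, a j ≤ K) (i : ℕ) :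
    ∑ j ∈ Finset.range i, a j * (K + 1) ^ j < (K + 1) ^ i := by
  induction i with
  | zero => simp
  | succ i ih =>
    rw [Finset.sum_range_succ, pow_succ]
    have := Nat.mul_le_mul_right ((K + 1) ^ i) (ha i)
    linarith

theorem sum_lt_of_top {K c i : ℕ} {a b : ℕ → ℕ} (hi : i < c) (ha : ∀ j, a j ≤ K) (hab : a i < b i)
    (htop : ∀ j, i < j → j < c → a j = b j) :
    ∑ j ∈ Finset.range c, a j * (K + 1) ^ j < ∑ j ∈ Finset.range c, b j * (K + 1) ^ j := by
  have h1 : ∀ m, i + 1 + m ≤ c → ∑ j ∈ Finset.range (i + 1 + m), a j * (K + 1) ^ j <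
      ∑ j ∈ Finset.range (i + 1 + m), b j * (K + 1) ^ j := by
    intro m
    induction m with
    | zero =>
      intro _
      rw [add_zero, Finset.sum_range_succ, Finset.sum_range_succ]
      have := sum_lt_pow ha i
      have := Nat.mul_le_mul_right ((K + 1) ^ i) (Nat.succ_le_of_lt hab)
      rw [Nat.succ_mul] at this
      omega
    | succ m ih =>
      intro hm
      rw [← add_assoc, Finset.sum_range_succ, Finset.sum_range_succ _ (i + 1 + m),
        htop (i + 1 + m) (by omega) (by omega)]
      have := ih (by omega)
      omega
  have := h1 (c - (i + 1)) (by omega)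
  rwa [show i + 1 + (c - (i + 1)) = c by omega] at this

theorem Good.clo_finite (h : Good p c B Y) {S : Set M} (hS : S ∈ Clo Y) :
    (Clo S).Finite ∧ (Clo S).ncard ≤ p ^ B :=
  Fn.clo_finite h.closed hS h.bet

theorem Good.cpl_lt (h : Good p c B Y) : cpl p c B Y < (p ^ B + 1) ^ (c + 1) :=
  sum_lt_pow (fun j => (h.clo_finite (h.lev_mem_clo j)).2) _

variable [CompactSpace M] [T2Space M] {V : Type} [AddCommGroup V] [Module (ZMod p) V]
    {θ : Multiplicative V →* Equiv.Perm M}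

theorem Good.cpl_fx_lt (h : Good p c B Y) (hθ : Acts θ Y) (v : V) (hne : Fn.fx θ Y v ≠ Y) :
    cpl p c B (Fn.fx θ Y v) < cpl p c B Y := by
  have hF := h.fx hθ v
  let W : Set M := {x | x ∈ Fn.fx θ Y v ∧ dlt p (Fn.fx θ Y v) x = dlt p Y x}
  have hWF : W ∈ Clo (Fn.fx θ Y v) := mem_clo_of_eventually hF.closed fun x hx => by
    filter_upwards [hF.eventually_dlt hx, h.eventually_dlt hx.1] with y h1 h2 hy
    rw [h1 hy, h2 hy.1]
  have hW : W ∈ Clo Y := by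
    refine ⟨fun x hx => hx.1.1, hWF.2.1, ?_⟩
    rw [← isOpen_compl_iff, isOpen_iff_mem_nhds]
    intro x hx
    by_cases hxY : x ∈ Y
    · have hxW : x ∈ W := by
        by_contra hxW
        exact hx ⟨hxY, hxW⟩
      have hev := mem_nhdsWithin_iff_eventually.1 ((h.dlt_fx_eq_iff hθ v hxW.1).1 hxW.2)
      filter_upwards [hev, hF.eventually_dlt hxW.1, h.eventually_dlt hxY] with y h1 h2 h3 hy
      refine hy.2 ⟨h1 hy.1, ?_⟩
      rw [h2 (h1 hy.1), h3 hy.1, hxW.2]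
    · filter_upwards [h.closed.isOpen_compl.mem_nhds hxY] with y hy hy' using hy hy'.1
  have hex : ∃ i ≤ c, ¬ lev p Y i ⊆ W := by
    by_contra! hall
    refine hne (Set.Subset.antisymm (fun _ h => h.1) fun x hx => ?_)
    exact (hall _ (h.dlt_le hx) ⟨hx, rfl⟩).1
  classical
  obtain ⟨i, ⟨hic, hi⟩, hmax⟩ : ∃ i, (i ≤ c ∧ ¬ lev p Y i ⊆ W) ∧
      ∀ j, i < j → j ≤ c → lev p Y j ⊆ W := by
    obtain ⟨i₀, h0, h1⟩ := hex
    refine ⟨Nat.findGreatest (fun i => ¬ lev p Y i ⊆ W) c, ⟨Nat.findGreatest_le c,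
      Nat.findGreatest_spec (P := fun i => ¬ lev p Y i ⊆ W) h0 h1⟩, fun j h2 h3 => ?_⟩
    by_contra h4
    exact Nat.findGreatest_is_greatest h2 h3 h4
  have hsub : ∀ j, i ≤ j → j ≤ c → lev p (Fn.fx θ Y v) j = lev p Y j ∩ W := by
    intro j hij hjc
    ext x
    refine ⟨fun hx => ?_, fun hx => ⟨hx.2.1, hx.2.2.trans hx.1.2⟩⟩
    have h1 : j ≤ dlt p Y x := hx.2 ▸ h.dlt_fx_le hθ v hx.1
    rcases h1.eq_or_lt with h1 | h1
    · exact ⟨⟨hx.1.1, h1.symm⟩, hx.1, hx.2.trans h1⟩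
    · have := hmax _ (lt_of_le_of_lt hij h1) (h.dlt_le hx.1.1) ⟨hx.1.1, rfl⟩
      have h2 := this.2
      rw [hx.2] at h2
      omega
  refine sum_lt_of_top (i := i) (by omega)
    (fun j => (hF.clo_finite (hF.lev_mem_clo j)).2) ?_ fun j h1 h2 => ?_
  · rw [hsub i le_rfl hic]
    have hl := h.lev_mem_clo i
    refine clo_ncard_lt (h.clo_finite hl).1 hl.2.1 ?_ fun he => hi (Set.inter_eq_left.1 he)
    refine ⟨Set.inter_subset_left, hl.2.1.inter hW.2.1, ?_⟩
    rw [Set.sdiff_self_inter]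
    have : lev p Y i \ W = lev p Y i ∩ (Y \ W) := by
      ext x
      exact ⟨fun h => ⟨h.1, h.1.1, h.2⟩, fun h => ⟨h.1, h.2.2⟩⟩
    rw [this]
    exact hl.2.1.inter hW.2.2
  · rw [hsub j h1.le (by omega), Set.inter_eq_left.2 (hmax j h1 (by omega))]

theorem Good.germ_mem_clo [Finite V] (h : Good p c B Y) (hθ : Acts θ Y) :
    {x | x ∈ Y ∧ ∀ v, ∀ᶠ y in 𝓝[Y] x, ac θ v y = y} ∈ Clo Y := by
  refine mem_clo_of_eventually h.closed fun x hx => ?_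
  suffices ∀ v, ∀ᶠ y in 𝓝 x, y ∈ Y →
      ((∀ᶠ z in 𝓝[Y] y, ac θ v z = z) ↔ ∀ᶠ z in 𝓝[Y] x, ac θ v z = z) by
    filter_upwards [Filter.eventually_all.2 this] with y hy hyY
    exact forall_congr' fun v => hy v hyY
  intro v
  by_cases hxv : x ∈ Fn.fx θ Y v
  · by_cases hg : ∀ᶠ z in 𝓝[Y] x, ac θ v z = z
    · filter_upwards [eventually_nhdsWithin_iff.1 (eventually_eventually_nhdsWithin.2 hg)] with
        y hy hyY
      exact iff_of_true (hy hyY) hg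
    · filter_upwards [(h.fx hθ v).eventually_dlt hxv, h.eventually_dlt hx] with y h1 h2 hyY
      refine iff_of_false (fun hy => hg ?_) hg
      have hyv : y ∈ Fn.fx θ Y v := ⟨hyY, hy.self_of_nhdsWithin hyY⟩
      rw [← fx_mem_nhds, ← h.dlt_fx_eq_iff hθ v hxv, ← h1 hyv, ← h2 hyY, h.dlt_fx_eq_iff hθ v hyv,
        fx_mem_nhds]
      exact hy
  · filter_upwards [(isClosed_fx h.closed hθ v).isOpen_compl.mem_nhds hxv] with y hy hyY
    exact iff_of_false (fun h => hy ⟨hyY, h.self_of_nhdsWithin hyY⟩)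
      fun h => hxv ⟨hx, h.self_of_nhdsWithin hx⟩

theorem exists_rank_bound_aux (M : Type u) [TopologicalSpace M] [CompactSpace M] [T2Space M]
    (p c B : ℕ) [Fact p.Prime] (m k : ℕ) : ∃ R : ℕ, ∀ (V : Type)
    [AddCommGroup V] [Module (ZMod p) V] [Finite V] (θ : Multiplicative V →* Equiv.Perm M)
    (Y Y₀ : Set M), Good p c B Y → Acts θ Y → Y₀ ∈ Clo Y → (∀ v, ∀ y ∈ Y₀, ac θ v y = y) →
    (∀ v, (∀ y ∈ Y, ac θ v y = y) → v = 0) → cpl p c B Y < m → (Clo (Y \ Y₀)).ncard ≤ k →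
    Module.finrank (ZMod p) V ≤ R := by
  induction m generalizing k with
  | zero => exact ⟨0, fun V _ _ _ θ Y Y₀ _ _ _ _ _ h => by omega⟩
  | succ m ihm =>
    induction k with
    | zero =>
      refine ⟨0, fun V _ _ _ θ Y Y₀ h _ hY _ _ _ hk => ?_⟩
      have := (Set.ncard_eq_zero (h.clo_finite (Clo.compl hY)).1).1 (by omega)
      exact (Set.eq_empty_iff_forall_notMem.1 this _ (clo_self hY.2.2)).elim
    | succ k ihk =>
      obtain ⟨R₁, hR₁⟩ := ihm (p ^ B)
      obtain ⟨R₂, hR₂⟩ := ihk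
      refine ⟨B * (c + 1) + (R₁ + c + R₂), fun V _ _ _ θ Y Y₀ h hθ hY h0 heff hm hk => ?_⟩
      by_cases hYY : Y \ Y₀ = ∅
      · have : Subsingleton V := ⟨fun v w => by
          have key : ∀ v : V, v = 0 := fun v => heff v fun y hy => h0 v y (by
            by_contra hy0
            exact (Set.eq_empty_iff_forall_notMem.1 hYY y) ⟨hy, hy0⟩)
          rw [key v, key w]⟩
        rw [Module.finrank_zero_of_subsingleton]
        exact Nat.zero_le _
      by_cases hfree : ∀ x ∈ Y \ Y₀, ∀ v, ac θ v x = x → v = 0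
      · let b := Module.finBasis (ZMod p) V
        have hro := ropen_of_clo (Clo.compl hY)
        have hinv : ∀ v x, x ∈ Y \ Y₀ → ac θ v x ∈ Y \ Y₀ := fun v x hx => ⟨hθ.maps _ hx.1, fun hc => by
          have h1 := h0 v _ hc
          have h2 := (ac θ v).injective h1
          rw [h2] at hc
          exact hx.2 hc⟩
        have hinv' : ∀ v x, x ∈ Y \ Y₀ ↔ ac θ v x ∈ Y \ Y₀ := fun v x => ⟨hinv v x, fun hx => by
          have := hinv (-v) _ hx
          rwa [← ac_add, neg_add_cancel, ac_zero] at this⟩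
        obtain ⟨x₀, hx₀⟩ := Set.nonempty_iff_ne_empty.2 hYY
        refine le_trans (free_rank (p := p) (θ := rst θ b.equivFun.symm.toLinearMap) h.closed
          (hθ.rst _) hro.1 hro.2 (fun g x => hinv' _ x) ⟨x₀, hx₀.1, hx₀⟩ ?_ h.cd h.bet)
          (Nat.le_add_right _ _)
        intro x _ hx g hg hgx
        have := hfree x hx _ hgx
        exact hg (Multiplicative.toAdd.injective ((map_eq_zero_iff _ b.equivFun.symm.injective).1 this))
      · push Not at hfree
        obtain ⟨x, hx, v, hvx, hv⟩ := hfree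
        have hne : Fn.fx θ Y v ≠ Y := fun he => hv (heff v fun y hy => (he.symm.subset hy).2)
        have hlt := h.cpl_fx_lt hθ v hne
        have hxF : x ∈ Fn.fx θ Y v := ⟨hx.1, hvx⟩
        let K : Submodule (ZMod p) V := trivF θ (Filter.principal (Fn.fx θ Y v))
        obtain ⟨C, hC⟩ := Submodule.exists_isCompl K
        have e1 := Submodule.finrank_add_eq_of_isCompl hC
        have e2 : Module.finrank (ZMod p) C ≤ R₁ := by
          have hF := h.fx hθ v
          refine hR₁ C (rst θ C.subtype) (Fn.fx θ Y v) ∅ hF ((hθ.fx v).rst _) (clo_empty hF.closed)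
            (fun _ _ h => h.elim) (fun w hw => ?_) (by omega) ?_
          · have : (w : V) ∈ K := (mem_trivF_principal θ).2 hw
            have := hC.disjoint.le_bot ⟨this, w.2⟩
            exact Subtype.ext ((Submodule.mem_bot _).1 this)
          · rw [Set.sdiff_empty]
            exact (hF.clo_finite (clo_self hF.closed)).2
        have hKx : ∀ w : K, ac (rst θ K.subtype) w x = x := fun w =>
          (mem_trivF_principal θ).1 w.2 x hxF
        have e3 := h.local_rank (hθ.rst K.subtype) hx.1 hKx
        have e4 := h.dlt_le hx.1
        let T := trivF (p := p) (rst θ K.subtype) (𝓝[Y] x)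
        let θ' := rst (rst θ K.subtype) T.subtype
        have hθ' : Acts θ' Y := (hθ.rst _).rst _
        have hW := h.germ_mem_clo hθ'
        set W := {x | x ∈ Y ∧ ∀ v, ∀ᶠ y in 𝓝[Y] x, ac θ' v y = y} with hWdef
        have hxW : x ∈ W := ⟨hx.1, fun w => w.2⟩
        have e5 : Module.finrank (ZMod p) T ≤ R₂ := by
          refine hR₂ T θ' Y (Y₀ ∪ W) h hθ' (Clo.union hY hW) (fun w y hy => ?_) (fun w hw => ?_) hm ?_
          · rcases hy with hy | hy
            · exact h0 _ y hy
            · exact (hy.2 w).self_of_nhdsWithin hy.1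
          · exact Subtype.ext (Subtype.ext (heff _ hw))
          · have hc := Clo.compl hY
            have : (Clo (Y \ (Y₀ ∪ W))).ncard < (Clo (Y \ Y₀)).ncard := by
              refine clo_ncard_lt (h.clo_finite hc).1 hc.2.1 ⟨fun y hy => ⟨hy.1, fun h => hy.2 (Or.inl h)⟩,
                (Clo.union hY hW).2.2, ?_⟩ fun he => ?_
              · have : (Y \ Y₀) \ (Y \ (Y₀ ∪ W)) = (Y \ Y₀) ∩ W := by
                  ext y
                  simp only [Set.mem_sdiff, Set.mem_union, Set.mem_inter_iff]
                  tauto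
                rw [this]
                exact hc.2.1.inter hW.2.1
              · have : x ∈ Y \ (Y₀ ∪ W) := he ▸ hx
                exact this.2 (Or.inr hxW)
            omega
        change _ ≤ _ + Module.finrank (ZMod p) T at e3
        omega

/-- Elementary abelian groups acting effectively have bounded rank. -/
theorem exists_rank_bound (M : Type u) [TopologicalSpace M] [CompactSpace M] [T2Space M]
    (p c B : ℕ) [Fact p.Prime] : ∃ R : ℕ, ∀ (V : Type)
    [AddCommGroup V] [Module (ZMod p) V] [Finite V] (θ : Multiplicative V →* Equiv.Perm M)
    (Y : Set M), Good p c B Y → Acts θ Y → (∀ v, (∀ y ∈ Y, ac θ v y = y) → v = 0) →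
    Module.finrank (ZMod p) V ≤ R := by
  obtain ⟨R, hR⟩ := exists_rank_bound_aux M p c B ((p ^ B + 1) ^ (c + 1)) (p ^ B)
  refine ⟨R, fun V _ _ _ θ Y h hθ heff => hR V θ Y ∅ h hθ (clo_empty h.closed)
    (fun _ _ h => h.elim) heff h.cpl_lt ?_⟩
  rw [Set.sdiff_empty]
  exact (h.clo_finite (clo_self h.closed)).2

end Fn

namespace Grp

open scoped commutatorElement

variable {G : Type*} [Group G]

/-- The exponent used for large abelian normal subgroups. -/
def ex (p : ℕ) : ℕ := if p = 2 then 4 else p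

theorem dvd_ex (p : ℕ) : p ∣ ex p := by
  rw [ex]
  split_ifs with h
  · rw [h]; norm_num
  · rfl

theorem ex_dvd (p : ℕ) : ex p ∣ p * p := by
  rw [ex]
  split_ifs with h
  · rw [h]
  · exact dvd_mul_right p p

theorem class_two_pow {u v z : G} (hu : Commute z u) (hv : Commute z v) (h : v * u = u * v * z)
    (k : ℕ) :
    (u * v) ^ k = u ^ k * v ^ k * z ^ (k.choose 2) := by
  have h1 : ∀ k : ℕ, v ^ k * u = u * v ^ k * z ^ k := by
    intro k
    induction k with
    | zero => simp
    | succ k ih =>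
      rw [pow_succ v, mul_assoc, h, ← mul_assoc, ← mul_assoc, ih, mul_assoc (u * v ^ k),
        (hv.pow_left k).eq, ← mul_assoc, mul_assoc, ← pow_succ, mul_assoc u]
  induction k with
  | zero => simp
  | succ k ih =>
    have h2 : (k + 1).choose 2 = k + k.choose 2 := by
      rw [Nat.choose_succ_succ' k 1, Nat.choose_one_right]
    have h3 := ((hu.pow_left (k.choose 2)).mul_right (hv.pow_left (k.choose 2))).eq
    have h4 := (hv.pow_left k).eq
    calc (u * v) ^ (k + 1) = u ^ k * v ^ k * (z ^ k.choose 2 * (u * v)) := by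
          rw [pow_succ, ih, mul_assoc]
      _ = u ^ k * (v ^ k * u) * v * z ^ k.choose 2 := by
          rw [h3]
          simp only [mul_assoc]
      _ = u ^ k * u * v ^ k * (z ^ k * v) * z ^ k.choose 2 := by
          rw [h1]
          simp only [mul_assoc]
      _ = u ^ (k + 1) * v ^ (k + 1) * z ^ (k + 1).choose 2 := by
          rw [h4, h2, pow_add z, pow_succ u, pow_succ v]
          simp only [mul_assoc]

/-- A noncyclic finite `p`-group has a proper normal subgroup containing a given element. -/
theorem exists_lt {p : ℕ} [Fact p.Prime] [Finite G] (hG : IsPGroup p G) (K : Subgroup G) {u : G}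
    (hu : u ∈ K) (hne : Subgroup.zpowers u ≠ K) :
    ∃ L < K, u ∈ L ∧ ∀ h ∈ K, h⁻¹ * u * h ∈ L := by
  let u' : K := ⟨u, hu⟩
  have hnil : Group.IsNilpotent K := (hG.to_subgroup K).isNilpotent
  have hz : Subgroup.zpowers u' ≠ ⊤ := by
    intro h
    have := congrArg (Subgroup.map K.subtype) h
    rw [MonoidHom.map_zpowers, ← MonoidHom.range_eq_map, Subgroup.range_subtype] at this
    exact hne this
  obtain ⟨L, hL, hle⟩ := (eq_top_or_exists_le_coatom (Subgroup.zpowers u')).resolve_left hz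
  have hLn : L.Normal := Subgroup.NormalizerCondition.normal_of_coatom L
    Group.normalizerCondition_of_isNilpotent hL
  have huL : u' ∈ L := hle (Subgroup.mem_zpowers u')
  refine ⟨L.map K.subtype, lt_of_le_of_ne (Subgroup.map_subtype_le L) fun h => hL.1 ?_,
    ⟨u', huL, rfl⟩, fun h hh => ⟨(⟨h, hh⟩ : K)⁻¹ * u' * ⟨h, hh⟩, ?_, rfl⟩⟩
  · have h2 : L.map K.subtype = (⊤ : Subgroup K).map K.subtype := by
      rw [h, ← MonoidHom.range_eq_map, Subgroup.range_subtype]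
    exact Subgroup.map_injective K.subtype_injective h2
  · have := hLn.conj_mem u' huL (⟨h, hh⟩ : K)⁻¹
    rwa [inv_inv] at this

variable {p : ℕ} [Fact p.Prime] [Finite G]

theorem mem_of_pow_eq (hG : IsPGroup p G) {N A D : Subgroup G}
    (hc : ∀ a ∈ A, ∀ n ∈ N, Commute a n) (hA : ∀ a ∈ A, a ^ ex p = 1)
    (hD : ∀ y ∈ D, y ^ ex p = 1 → y ∈ A) (hND : ∀ u ∈ N, ∀ h ∈ N, u⁻¹ * (h⁻¹ * u * h) ∈ D) {u v : G}
    (hu : u ∈ N) (hv : v ∈ N) (huv : u ^ ex p = v ^ ex p) (h : u⁻¹ * v ∈ D) : u⁻¹ * v ∈ A := by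
  induction hn : Nat.card (Subgroup.closure {u, v}) using Nat.strong_induction_on generalizing v with
  | _ n ih =>
  subst hn
  set K := Subgroup.closure {u, v} with hK
  have huK : u ∈ K := Subgroup.subset_closure (by simp)
  have hvK : v ∈ K := Subgroup.subset_closure (by simp)
  have hKN : K ≤ N := (Subgroup.closure_le _).2 (by
    rintro x (rfl | rfl)
    exacts [hu, hv])
  by_cases hcomm : Commute u v
  · refine hD _ h ?_
    rw [(hcomm.inv_left).mul_pow, inv_pow, huv, inv_mul_cancel]
  have hne : Subgroup.zpowers u ≠ K := by
    intro he
    obtain ⟨k, rfl⟩ := Subgroup.mem_zpowers_iff.1 (he.symm ▸ hvK)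
    exact hcomm ((Commute.refl u).zpow_right k)
  obtain ⟨L, hLK, huL, hL⟩ := exists_lt hG K huK hne
  have hcen : ∀ h ∈ K, Commute (u ^ ex p) h := by
    intro h hh
    refine Subgroup.closure_induction (p := fun h _ => Commute (u ^ ex p) h) ?_ (Commute.one_right _)
      (fun _ _ _ _ h1 h2 => h1.mul_right h2) (fun _ _ h1 => h1.inv_right) hh
    rintro x (rfl | rfl)
    · exact (Commute.refl _).pow_left _
    · rw [huv]
      exact (Commute.refl _).pow_left _
  have hz : u⁻¹ * (v⁻¹ * u * v) ∈ A := by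
    refine ih _ ?_ (N.mul_mem (N.mul_mem (N.inv_mem hv) hu) hv) ?_ (hND u hu v hv) rfl
    · have h1 : Subgroup.closure {u, v⁻¹ * u * v} ≤ L := (Subgroup.closure_le _).2 (by
        rintro x (rfl | rfl)
        exacts [huL, hL v hvK])
      have h2 : Subgroup.closure {u, v⁻¹ * u * v} < K := lt_of_le_of_lt h1 hLK
      exact Set.ncard_lt_ncard h2 (Set.toFinite _)
    · have := conj_pow (a := v⁻¹) (b := u) (i := ex p)
      rw [inv_inv] at this
      rw [this, mul_assoc, (hcen v hvK).eq, inv_mul_cancel_left]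
  set z := u⁻¹ * (v⁻¹ * u * v) with hzdef
  have hzu : Commute z u := hc z hz u hu
  have hzv : Commute z v := hc z hz v hv
  have hrel : v * u⁻¹ = u⁻¹ * v * z := by
    have h1 : z = v⁻¹ * u * v * u⁻¹ := by
      have h2 : u * z * u⁻¹ = z := by rw [← hzu.eq, mul_inv_cancel_right]
      rw [← h2, hzdef]
      group
    rw [h1]
    group
  have hw := class_two_pow hzu.inv_right hzv hrel
  have hwz : (u⁻¹ * v) ^ ex p = z ^ ((ex p).choose 2) := by
    rw [hw, inv_pow, huv, inv_mul_cancel, one_mul]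
  have hz1 := hA z hz
  refine hD _ h ?_
  by_cases hp : p = 2
  · rw [ex, if_pos hp] at *
    have h46 : Nat.choose 4 2 = 6 := rfl
    rw [h46] at hwz
    have h8 : (u⁻¹ * v) ^ 2 ∈ A := by
      refine hD _ (D.pow_mem h 2) ?_
      rw [← pow_mul, mul_comm, pow_mul, hwz, ← pow_mul, show 6 * 2 = 4 * 3 by rfl, pow_mul, hz1,
        one_pow]
    have hcu := (hc _ h8 u hu).inv_right.eq
    have hzw : Commute z (u⁻¹ * v) := hzu.inv_right.mul_right hzv
    have h2 : (u⁻¹ * v) * u⁻¹ = u⁻¹ * (u⁻¹ * v) * z := by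
      rw [mul_assoc, hrel]
      simp only [mul_assoc]
    clear_value z
    have h3 : (u⁻¹ * v) ^ 2 * u⁻¹ = u⁻¹ * (u⁻¹ * v) ^ 2 * z ^ 2 := by
      generalize u⁻¹ * v = w at h2 hzw ⊢
      calc w ^ 2 * u⁻¹ = w * (w * u⁻¹) := by rw [pow_two, mul_assoc]
        _ = w * (u⁻¹ * w * z) := by rw [h2]
        _ = w * u⁻¹ * (w * z) := by simp only [mul_assoc]
        _ = u⁻¹ * w * (z * w) * z := by
          rw [h2]
          simp only [mul_assoc]
        _ = u⁻¹ * w ^ 2 * z ^ 2 := by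
          rw [hzw.eq, pow_two, pow_two]
          simp only [mul_assoc]
    rw [hcu] at h3
    have h4 : z ^ 2 = 1 := by simpa using h3
    rw [hwz, show 6 = 2 * 3 by rfl, pow_mul, h4, one_pow]
  · rw [ex, if_neg hp] at *
    have hpr : p.Prime := Fact.out
    obtain ⟨k, hk⟩ : p ∣ p.choose 2 :=
      hpr.dvd_choose_self two_ne_zero (lt_of_le_of_ne hpr.two_le (Ne.symm hp))
    rw [hwz, hk, pow_mul, hz1, one_pow]

/-- A proper inclusion of normal subgroups of a `p`-group has a proper commutator. -/
theorem commutator_sup_ne (hG : IsPGroup p G) {N A : Subgroup G} (hA : A.Normal)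
    (hAN : ¬ N ≤ A) : ¬ N ≤ ⁅N, ⊤⁆ ⊔ A := by
  intro hN
  have hnil : Group.IsNilpotent G := hG.isNilpotent
  obtain ⟨n, hn⟩ := Subgroup.nilpotent_iff_lowerCentralSeries.1 hnil
  have key : ∀ k, N ≤ (⊤ : Subgroup G).lowerCentralSeries k ⊔ A := by
    intro k
    induction k with
    | zero =>
      rw [Subgroup.lowerCentralSeries_zero, top_sup_eq]
      exact le_top
    | succ k ih =>
      refine hN.trans (sup_le ?_ le_sup_right)
      rw [Subgroup.commutator_le]
      intro x hx g hg
      obtain ⟨l, hl, a, ha, rfl⟩ := Subgroup.mem_sup_of_normal_right.1 (ih hx)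
      have h1 : ⁅l * a, g⁆ = l * (a * (g * a⁻¹ * g⁻¹)) * l⁻¹ * ⁅l, g⁆ := by
        simp only [commutatorElement_def]
        group
      rw [h1]
      refine Subgroup.mul_mem _ (Subgroup.mem_sup_right (hA.conj_mem _ ?_ l))
        (Subgroup.mem_sup_left ?_)
      · exact A.mul_mem ha (hA.conj_mem _ (A.inv_mem ha) g)
      · exact Subgroup.commutator_mem_commutator hl hg
  have := key n
  rw [hn, bot_sup_eq] at this
  exact hAN this

/-- Elements of small order centralizing a suitable abelian normal subgroup. -/
theorem exists_abelian (hG : IsPGroup p G) : ∃ A : Subgroup G, A.Normal ∧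
    (∀ a ∈ A, ∀ b ∈ A, Commute a b) ∧ (∀ a ∈ A, a ^ ex p = 1) ∧
    ∀ x ∈ Subgroup.centralizer (A : Set G), x ^ ex p = 1 → x ∈ A := by
  obtain ⟨A, ⟨hAn, hAc, hAe⟩, hmax⟩ := Set.exists_max_image
    {A : Subgroup G | A.Normal ∧ (∀ a ∈ A, ∀ b ∈ A, Commute a b) ∧ ∀ a ∈ A, a ^ ex p = 1}
    (fun A => Nat.card A) (Set.toFinite _) ⟨⊥, inferInstance, by
      intro a ha b _
      rw [Subgroup.mem_bot.1 ha]
      exact Commute.one_left b, by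
      intro a ha
      rw [Subgroup.mem_bot.1 ha, one_pow]⟩
  refine ⟨A, hAn, hAc, hAe, ?_⟩
  by_contra! hbad
  set C := Subgroup.centralizer (A : Set G) with hC
  have hCn : C.Normal := inferInstance
  let Nx : G → Subgroup G := fun x => Subgroup.normalClosure {x} ⊔ A
  obtain ⟨x, ⟨hxC, hx1, hxA⟩, hmin⟩ := Set.exists_min_image
    {x : G | x ∈ C ∧ x ^ ex p = 1 ∧ x ∉ A} (fun x => Nat.card (Nx x)) (Set.toFinite _)
    (by obtain ⟨x, h⟩ := hbad; exact ⟨x, h⟩)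
  have hAC : A ≤ C := fun a ha => Subgroup.mem_centralizer_iff.2 fun b hb => (hAc b hb a ha).eq
  set N := Nx x with hN
  have hxN : x ∈ N := Subgroup.mem_sup_left (Subgroup.subset_normalClosure rfl)
  have hNC : N ≤ C := sup_le (Subgroup.normalClosure_le_normal (by
    rintro _ rfl
    exact hxC)) hAC
  have hNn : N.Normal := Subgroup.sup_normal _ _
  set D := ⁅N, (⊤ : Subgroup G)⁆ ⊔ A with hD
  have hDn : D.Normal := Subgroup.sup_normal _ _
  have hDN : D ≤ N := sup_le (Subgroup.commutator_le_left _ _) le_sup_right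
  have hDlt : D < N := lt_of_le_of_ne hDN fun he =>
    commutator_sup_ne hG hAn (fun h => hxA (h hxN)) he.ge
  have hDA : ∀ y ∈ D, y ^ ex p = 1 → y ∈ A := by
    intro y hy hy1
    by_contra hyA
    have h1 := hmin y ⟨hNC (hDN hy), hy1, hyA⟩
    have h2 : Nx y ≤ D := sup_le (Subgroup.normalClosure_le_normal (by
      rintro _ rfl
      exact hy)) le_sup_right
    have h3 : Nx y < N := lt_of_le_of_lt h2 hDlt
    have h4 : Nat.card (Nx y) < Nat.card N := Set.ncard_lt_ncard h3 (Set.toFinite _)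
    exact absurd h1 (not_le.2 h4)
  have hcomm : ∀ u ∈ N, ∀ h : G, u⁻¹ * (h⁻¹ * u * h) ∈ D := by
    intro u hu h
    refine Subgroup.mem_sup_left ?_
    have := Subgroup.commutator_mem_commutator (N.inv_mem hu) (Subgroup.mem_top h⁻¹)
    rwa [commutatorElement_def, inv_inv, inv_inv, mul_assoc, mul_assoc, ← mul_assoc h⁻¹] at this
  have hconj : ∀ g : G, x⁻¹ * (g⁻¹ * x * g) ∈ A := fun g => by
    refine mem_of_pow_eq hG (N := N) (D := D) (fun a ha n hn =>
      (Subgroup.mem_centralizer_iff.1 (hNC hn) a ha)) hAe hDA (fun u hu h _ => hcomm u hu h) hxN ?_ ?_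
      (hcomm x hxN g)
    · have := hNn.conj_mem x hxN g⁻¹
      rwa [inv_inv] at this
    · have := conj_pow (a := g⁻¹) (b := x) (i := ex p)
      rw [inv_inv] at this
      rw [this, hx1, mul_one, inv_mul_cancel]
  have hxa : ∀ a ∈ A, Commute a x := fun a ha => Subgroup.mem_centralizer_iff.1 hxC a ha
  set A' := Subgroup.zpowers x ⊔ A with hA'
  have hmem : ∀ y ∈ A', ∃ k : ℤ, ∃ a ∈ A, x ^ k * a = y := by
    intro y hy
    obtain ⟨z, hz, a, ha, rfl⟩ := Subgroup.mem_sup_of_normal_right.1 hy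
    obtain ⟨k, rfl⟩ := Subgroup.mem_zpowers_iff.1 hz
    exact ⟨k, a, ha, rfl⟩
  have hxA' : x ∈ A' := Subgroup.mem_sup_left (Subgroup.mem_zpowers x)
  have hgood : A'.Normal ∧ (∀ a ∈ A', ∀ b ∈ A', Commute a b) ∧ ∀ a ∈ A', a ^ ex p = 1 := by
    refine ⟨⟨fun y hy g => ?_⟩, fun y hy y' hy' => ?_, fun y hy => ?_⟩
    · obtain ⟨k, a, ha, rfl⟩ := hmem y hy
      have h1 : g * x * g⁻¹ ∈ A' := by
        have := A'.mul_mem hxA' (Subgroup.mem_sup_right (hconj g⁻¹))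
        rwa [mul_inv_cancel_left, inv_inv] at this
      have h2 : g * (x ^ k * a) * g⁻¹ = (g * x * g⁻¹) ^ k * (g * a * g⁻¹) := by
        rw [conj_zpow]
        group
      rw [h2]
      exact A'.mul_mem (A'.zpow_mem h1 k) (Subgroup.mem_sup_right (hAn.conj_mem a ha g))
    · obtain ⟨k, a, ha, rfl⟩ := hmem y hy
      obtain ⟨k', a', ha', rfl⟩ := hmem y' hy'
      have h1 := hxa a ha
      have h2 := hxa a' ha'
      exact ((((Commute.refl x).zpow_zpow k k').mul_right (h2.symm.zpow_left k))).mul_left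
        ((h1.zpow_right k').mul_right (hAc a ha a' ha'))
    · obtain ⟨k, a, ha, rfl⟩ := hmem y hy
      have h1 := hxa a ha
      rw [(h1.symm.zpow_left k).mul_pow, hAe a ha, mul_one, ← zpow_natCast, ← zpow_mul, mul_comm,
        zpow_mul, zpow_natCast, hx1, one_zpow]
  have h1 := hmax A' hgood
  have h2 : A < A' := lt_of_le_of_ne le_sup_right fun h => hxA (h ▸ hxA')
  have h3 : Nat.card A < Nat.card A' := Set.ncard_lt_ncard h2 (Set.toFinite _)
  exact absurd h1 (not_le.2 h3)

/-- Fibres of the `p`-power map on the centralizer. -/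
theorem mem_of_pow_eq_pow (hG : IsPGroup p G) {A : Subgroup G} (hA : ∀ a ∈ A, a ^ ex p = 1)
    (hCA : ∀ x ∈ Subgroup.centralizer (A : Set G), x ^ ex p = 1 → x ∈ A) {u v : G}
    (hu : u ∈ Subgroup.centralizer (A : Set G)) (hv : v ∈ Subgroup.centralizer (A : Set G))
    (huv : u ^ p = v ^ p) : u⁻¹ * v ∈ A := by
  set C := Subgroup.centralizer (A : Set G)
  refine mem_of_pow_eq hG (N := C) (D := C) (fun a ha n hn => Subgroup.mem_centralizer_iff.1 hn a ha)
    hA hCA (fun u hu h hh => C.mul_mem (C.inv_mem hu) (C.mul_mem (C.mul_mem (C.inv_mem hh) hu) hh))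
    hu hv ?_ (C.mul_mem (C.inv_mem hu) hv)
  obtain ⟨k, hk⟩ := dvd_ex p
  rw [hk, pow_mul, pow_mul, huv]

end Grp

namespace Grp

variable {G : Type*} [Group G] [Finite G]

/-- Counting through a map whose fibres lie in cosets of a subgroup. -/
theorem ncard_le_image_mul {S : Set G} {A : Subgroup G} (f : G → G)
    (h : ∀ u ∈ S, ∀ v ∈ S, f u = f v → u⁻¹ * v ∈ A) : S.ncard ≤ (f '' S).ncard * Nat.card A := by
  choose! s hs hsf using fun (y : G) (hy : y ∈ f '' S) => hy
  rw [← Nat.card_coe_set_eq, ← Nat.card_coe_set_eq, ← Nat.card_prod]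
  have hm : ∀ x : S, f x ∈ f '' S := fun x => ⟨x, x.2, rfl⟩
  refine Nat.card_le_card_of_injective (fun x : S => ((⟨f x, hm x⟩ : f '' S),
    (⟨(s (f x))⁻¹ * x, h _ (hs _ (hm x)) _ x.2 (hsf _ (hm x))⟩ : A))) ?_
  intro x y hxy
  have h1 : f x = f y := congrArg (fun z => (z.1 : G)) hxy
  have h2 : (s (f x))⁻¹ * (x : G) = (s (f y))⁻¹ * y := congrArg (fun z => (z.2 : G)) hxy
  rw [h1] at h2
  exact Subtype.ext (mul_left_cancel h2)

theorem index_centralizer_le (A : Subgroup G) [A.Normal] :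
    (Subgroup.centralizer (A : Set G)).index ≤ Nat.card A ^ Nat.card A := by
  have h1 : (Subgroup.centralizer (A : Set G)).index ≤ Nat.card (A → A) := by
    refine Nat.card_le_card_of_injective (fun x : G ⧸ Subgroup.centralizer (A : Set G) =>
      fun a : A => (⟨x.out * a * x.out⁻¹, Subgroup.Normal.conj_mem inferInstance _ a.2 _⟩ : A)) ?_
    intro x y hxy
    rw [← x.out_eq', ← y.out_eq']
    refine QuotientGroup.eq.2 (Subgroup.mem_centralizer_iff.2 fun a ha => ?_)
    have h2 : x.out * a * x.out⁻¹ = y.out * a * y.out⁻¹ :=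
      congrArg (fun z : A → A => (z ⟨a, ha⟩ : G)) hxy
    rw [mul_inv_eq_iff_eq_mul] at h2
    calc a * (x.out⁻¹ * y.out) = x.out⁻¹ * (x.out * a) * x.out⁻¹ * y.out := by group
      _ = x.out⁻¹ * y.out * a := by rw [h2]; group
  refine h1.trans ?_
  rw [Nat.card_fun]

variable {p : ℕ} [Fact p.Prime]

theorem card_centralizer_le (hG : IsPGroup p G) {A : Subgroup G} (hA : ∀ a ∈ A, a ^ ex p = 1)
    (hCA : ∀ x ∈ Subgroup.centralizer (A : Set G), x ^ ex p = 1 → x ∈ A) (k : ℕ) :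
    Nat.card (Subgroup.centralizer (A : Set G)) ≤
      ((fun g : G => g ^ p ^ k) '' (Subgroup.centralizer (A : Set G))).ncard * Nat.card A ^ k := by
  induction k with
  | zero => simp [← Nat.card_coe_set_eq]
  | succ k ih =>
    have h1 := ncard_le_image_mul (S := (fun g : G => g ^ p ^ k) '' (Subgroup.centralizer (A : Set G)))
      (A := A) (fun g => g ^ p) (by
        rintro _ ⟨u, hu, rfl⟩ _ ⟨v, hv, rfl⟩ h
        exact mem_of_pow_eq_pow hG hA hCA (Subgroup.pow_mem _ hu _) (Subgroup.pow_mem _ hv _) h)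
    rw [Set.image_image] at h1
    simp only [← pow_mul, ← pow_succ] at h1
    refine ih.trans ((Nat.mul_le_mul_right _ h1).trans_eq ?_)
    rw [mul_assoc, ← pow_succ']

theorem pow_mem_of_index_le (hG : IsPGroup p G) {H : Subgroup G} {C : ℕ} (hC : H.index ≤ C)
    (g : G) :
    g ^ p ^ C ∈ H := by
  obtain ⟨j, hj, hjle, hmem⟩ := Subgroup.exists_pow_mem_of_index_ne_zero
    (H := H) Subgroup.index_ne_zero_of_finite g
  have hp : p.Prime := Fact.out
  obtain ⟨a, b, hb, rfl⟩ := Nat.exists_eq_pow_mul_and_not_dvd hj.ne' p hp.ne_one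
  have hbp : 0 < b := Nat.pos_of_ne_zero fun h => hb (h ▸ dvd_zero p)
  have haC : a ≤ C := ((Nat.lt_pow_self hp.one_lt).le.trans (Nat.le_mul_of_pos_right _ hbp)).trans
    (hjle.trans hC)
  obtain ⟨n, hn⟩ := IsPGroup.iff_orderOf.1 hG (g ^ p ^ a)
  have hco : b.Coprime (orderOf (g ^ p ^ a)) := by
    rw [hn]
    exact (Nat.Coprime.pow_left n ((Nat.Prime.coprime_iff_not_dvd hp).2 hb)).symm
  obtain ⟨m, hm⟩ := exists_pow_eq_self_of_coprime hco
  have h1 : g ^ p ^ a ∈ H := by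
    rw [← hm, ← pow_mul g]
    exact H.pow_mem hmem m
  obtain ⟨c, rfl⟩ := Nat.exists_eq_add_of_le haC
  rw [pow_add, pow_mul]
  exact H.pow_mem h1 _

/-- Shrinking a subgroup of bounded index to a characteristic one. -/
theorem exists_characteristic (hG : IsPGroup p G) {A : Subgroup G} [A.Normal]
    (hA : ∀ a ∈ A, a ^ ex p = 1)
    (hCA : ∀ x ∈ Subgroup.centralizer (A : Set G), x ^ ex p = 1 → x ∈ A)
    {H : Subgroup G} (hZ : Subgroup.center G ≤ H) {C N : ℕ} (hC : H.index ≤ C) (hN : Nat.card A ≤ N) :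
    ∃ H' : Subgroup G, H'.Characteristic ∧ Subgroup.center G ≤ H' ∧ H' ≤ H ∧
      H'.index ≤ N ^ C * N ^ N := by
  let S : Set G := Set.range fun g : G => g ^ p ^ C
  refine ⟨Subgroup.center G ⊔ Subgroup.closure S, ?_, le_sup_left, sup_le hZ ?_, ?_⟩
  · rw [Subgroup.characteristic_iff_map_le]
    intro φ
    rw [Subgroup.map_sup]
    refine sup_le_sup (Subgroup.characteristic_iff_map_le.1 inferInstance φ) ?_
    rw [MonoidHom.map_closure, Subgroup.closure_le]
    rintro _ ⟨_, ⟨g, rfl⟩, rfl⟩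
    refine Subgroup.subset_closure ⟨φ g, ?_⟩
    simp
  · rw [Subgroup.closure_le]
    rintro _ ⟨g, rfl⟩
    exact pow_mem_of_index_le hG hC g
  · set H' := Subgroup.center G ⊔ Subgroup.closure S with hH'
    have h1 := card_centralizer_le hG hA hCA C
    have h2 : ((fun g : G => g ^ p ^ C) '' (Subgroup.centralizer (A : Set G))).ncard ≤ Nat.card H' := by
      refine Set.ncard_le_ncard (t := (H' : Set G)) ?_ (Set.toFinite _)
      rintro _ ⟨g, -, rfl⟩
      exact Subgroup.mem_sup_right (Subgroup.subset_closure ⟨g, rfl⟩)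
    have h3 := index_centralizer_le A
    have hA1 : 1 ≤ Nat.card A := Nat.card_pos
    have hN1 : 1 ≤ N := hA1.trans hN
    have h4 : Nat.card A ^ Nat.card A ≤ N ^ N :=
      (Nat.pow_le_pow_left hN _).trans (Nat.pow_le_pow_right hN1 hN)
    refine le_of_mul_le_mul_left (a := Nat.card H') ?_ (Nat.card_pos (α := H'))
    rw [Subgroup.card_mul_index, ← Subgroup.card_mul_index (Subgroup.centralizer (A : Set G)),
      ← mul_assoc]
    exact Nat.mul_le_mul (h1.trans (Nat.mul_le_mul h2 (Nat.pow_le_pow_left hN _))) (h3.trans h4)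

/-- The elements of order dividing `n` in an abelian subgroup. -/
def tor (A : Subgroup G) (hA : ∀ a ∈ A, ∀ b ∈ A, Commute a b) (n : ℕ) : Subgroup G where
  carrier := {a | a ∈ A ∧ a ^ n = 1}
  mul_mem' := fun {a b} ha hb => ⟨A.mul_mem ha.1 hb.1, by
    rw [(hA a ha.1 b hb.1).mul_pow, ha.2, hb.2, one_mul]⟩
  one_mem' := ⟨A.one_mem, one_pow n⟩
  inv_mem' := fun {a} ha => ⟨A.inv_mem ha.1, by rw [inv_pow, ha.2, inv_one]⟩

omit [Fact p.Prime] in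
theorem card_le_tor {A : Subgroup G} (hA : ∀ a ∈ A, ∀ b ∈ A, Commute a b)
    (hAe : ∀ a ∈ A, a ^ ex p = 1) : Nat.card A ≤ Nat.card (tor A hA p) ^ 2 := by
  have h1 := ncard_le_image_mul (S := A) (A := tor A hA p) (fun g => g ^ p) (by
    intro u hu v hv h
    refine ⟨A.mul_mem (A.inv_mem hu) hv, ?_⟩
    rw [(hA _ (A.inv_mem hu) v hv).mul_pow, inv_pow]
    exact inv_mul_eq_one.2 h)
  have h2 : ((fun g => g ^ p) '' (A : Set G)).ncard ≤ (tor A hA p : Set G).ncard := by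
    refine Set.ncard_le_ncard ?_ (Set.toFinite _)
    rintro _ ⟨a, ha, rfl⟩
    refine ⟨A.pow_mem ha p, ?_⟩
    obtain ⟨k, hk⟩ := ex_dvd p
    change (a ^ p) ^ p = 1
    rw [← pow_mul, hk, pow_mul, hAe a ha, one_pow]
  rw [pow_two]
  exact h1.trans (Nat.mul_le_mul_right _ h2)

end Grp

namespace Fn

section stab

variable {G : Type*} [Group G] {M : Type*} (θ : G →* Equiv.Perm M)

/-- The stabilizer of a point in a subgroup, as a subgroup of the ambient group. -/
def st (H : Subgroup G) (x : M) : Subgroup G where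
  carrier := {g | g ∈ H ∧ θ g x = x}
  mul_mem' := fun {a b} ha hb => ⟨H.mul_mem ha.1 hb.1, by
    rw [map_mul, Equiv.Perm.mul_apply, hb.2, ha.2]⟩
  one_mem' := ⟨H.one_mem, by simp⟩
  inv_mem' := fun {a} ha => ⟨H.inv_mem ha.1, by
    rw [map_inv, Equiv.Perm.inv_eq_iff_eq, ha.2]⟩

variable {θ}

theorem mem_st {H : Subgroup G} {x : M} {g : G} : g ∈ st θ H x ↔ g ∈ H ∧ θ g x = x := Iff.rfl

theorem st_of_le {H H' : Subgroup G} (h : H' ≤ H) (x : M) : st θ H' x = st θ H x ⊓ H' := by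
  ext g
  rw [Subgroup.mem_inf, mem_st, mem_st]
  exact ⟨fun hg => ⟨⟨h hg.1, hg.2⟩, hg.1⟩, fun hg => ⟨hg.2, hg.1.2⟩⟩

theorem image_st_of_le {H H' : Subgroup G} (h : H' ≤ H) (Y : Set M) :
    (st θ H') '' Y = (fun K => K ⊓ H') '' (st θ H '' Y) := by
  rw [Set.image_image]
  exact Set.image_congr fun x _ => st_of_le h x

variable [Finite G]

theorem ncard_st_le {H H' : Subgroup G} (h : H' ≤ H) (Y : Set M) :
    ((st θ H') '' Y).ncard ≤ (st θ H '' Y).ncard := by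
  rw [image_st_of_le h]
  exact Set.ncard_image_le (Set.toFinite _)

variable [TopologicalSpace M]

/-- An action on an invariant set factors through an effective action. -/
theorem Acts.exists_quotient {G : Type} [Group G] {θ : G →* Equiv.Perm M} {Y : Set M}
    (hθ : Acts θ Y) : ∃ N : Subgroup G, ∃ _ : N.Normal, ∃ θ' : G ⧸ N →* Equiv.Perm M,
      Acts θ' Y ∧ (∀ g, ∀ y ∈ Y, θ' (QuotientGroup.mk g) y = θ g y) ∧
      ∀ q, (∀ y ∈ Y, θ' q y = y) → q = 1 := by
  classical
  have hmaps : ∀ g x, θ g x ∈ Y ↔ x ∈ Y := fun g x => ⟨fun h => by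
    have := hθ.maps g⁻¹ h
    simpa using this, fun h => hθ.maps g h⟩
  let ρ : G →* Equiv.Perm Y :=
    { toFun := fun g => (θ g).subtypePerm (hmaps g)
      map_one' := by
        ext y
        simp
      map_mul' := fun g h => Equiv.Perm.ext fun y => Subtype.ext (by
        change θ (g * h) y = θ g (θ h y)
        rw [map_mul, Equiv.Perm.mul_apply]) }
  have hval : ∀ g, ∀ y ∈ Y, Equiv.Perm.ofSubtype (ρ g) y = θ g y := fun g y hy =>
    Equiv.Perm.ofSubtype_apply_of_mem (ρ g) hy
  have hval' : ∀ g, ∀ y ∈ Y, (Equiv.Perm.ofSubtype.comp (QuotientGroup.kerLift ρ))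
      (QuotientGroup.mk g) y = θ g y := hval
  refine ⟨ρ.ker, inferInstance, Equiv.Perm.ofSubtype.comp (QuotientGroup.kerLift ρ), ⟨?_, ?_⟩, hval', ?_⟩
  · intro q y hy
    obtain ⟨g, rfl⟩ := QuotientGroup.mk_surjective q
    rw [hval' g y hy]
    exact hθ.maps g hy
  · intro q
    obtain ⟨g, rfl⟩ := QuotientGroup.mk_surjective q
    exact (hθ.cont g).congr fun y hy => hval' g y hy
  · intro q hq
    obtain ⟨g, rfl⟩ := QuotientGroup.mk_surjective q
    refine (QuotientGroup.eq_one_iff g).2 ?_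
    rw [MonoidHom.mem_ker]
    ext y
    have h := hq y y.2
    rw [hval' g y y.2] at h
    exact h

end stab

variable {p : ℕ} [Fact p.Prime] {M : Type u} [TopologicalSpace M] [CompactSpace M] [T2Space M]
  {c B : ℕ} {Y : Set M} {G : Type} [Group G] {θ : G →* Equiv.Perm M}

/-- The fixed set of an element of prime order is simpler than the space. -/
theorem Good.fixed (h : Good p c B Y) (hθ : Acts θ Y) {a : G} (ha : a ^ p = 1) :
    Good p c B {y | y ∈ Y ∧ θ a y = y} ∧
      ({y | y ∈ Y ∧ θ a y = y} ≠ Y → cpl p c B {y | y ∈ Y ∧ θ a y = y} < cpl p c B Y) := by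
  let f : Multiplicative (ZMod p) →* G := AddMonoidHom.toMultiplicativeLeft
    (ZMod.lift p ⟨zmultiplesHom (Additive G) (Additive.ofMul a), by
      simp [← ofMul_pow, ha]⟩)
  have hf : f (Multiplicative.ofAdd 1) = a := by
    have := ZMod.lift_coe p (⟨zmultiplesHom (Additive G) (Additive.ofMul a), by
      simp [← ofMul_pow, ha]⟩ : {f : ℤ →+ Additive G // f p = 0}) 1
    simp only [Int.cast_one] at this
    simp [f, this]
  have hY : Acts (θ.comp f) Y := ⟨fun _ => hθ.maps _, fun _ => hθ.cont _⟩
  have hac : ac (θ.comp f) 1 = θ a := by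
    rw [ac, MonoidHom.comp_apply, hf]
  have hfx : Fn.fx (θ.comp f) Y 1 = {y | y ∈ Y ∧ θ a y = y} := by
    rw [Fn.fx, hac]
  rw [← hfx]
  exact ⟨h.fx hY 1, h.cpl_fx_lt hY 1⟩

theorem exists_card_bound (M : Type u) [TopologicalSpace M] [CompactSpace M] [T2Space M]
    (p c B : ℕ) [Fact p.Prime] : ∃ N : ℕ, ∀ (G : Type) [Group G] [Finite G] (θ : G →* Equiv.Perm M)
    (Y : Set M), Good p c B Y → Acts θ Y → (∀ g, (∀ y ∈ Y, θ g y = y) → g = 1) →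
    ∀ A : Subgroup G, (∀ a ∈ A, ∀ b ∈ A, Commute a b) → (∀ a ∈ A, a ^ Grp.ex p = 1) →
    Nat.card A ≤ N := by
  obtain ⟨R, hR⟩ := exists_rank_bound M p c B
  refine ⟨(p ^ R) ^ 2, fun G _ _ θ Y h hθ heff A hA hAe => ?_⟩
  refine (Grp.card_le_tor hA hAe).trans (Nat.pow_le_pow_left ?_ 2)
  let Ω := Grp.tor A hA p
  let : CommGroup Ω := { (inferInstance : Group Ω) with
    mul_comm := fun a b => Subtype.ext (hA a a.2.1 b b.2.1) }
  let : Module (ZMod p) (Additive Ω) := AddCommGroup.zmodModule (n := p) fun x => by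
    refine Additive.toMul.injective (Subtype.ext ?_)
    exact (Additive.toMul x).2.2
  let f : Multiplicative (Additive Ω) →* G :=
    Ω.subtype.comp (MulEquiv.multiplicativeAdditive Ω).toMonoidHom
  have hY : Acts (θ.comp f) Y := ⟨fun _ => hθ.maps _, fun _ => hθ.cont _⟩
  have h1 := hR (Additive Ω) (θ.comp f) Y h hY (fun v hv => by
    have := heff _ hv
    exact Additive.toMul.injective (Subtype.ext this))
  have : Finite (Additive Ω) := inferInstanceAs (Finite Ω)
  have h2 : p ^ Module.finrank (ZMod p) (Additive Ω) = Nat.card Ω :=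
    FiniteField.pow_finrank_eq_natCard p (Additive Ω)
  change Nat.card Ω ≤ p ^ R
  rw [← h2]
  exact Nat.pow_le_pow_right (Fact.out : p.Prime).pos h1


theorem exists_stab_bound_succ {p c B : ℕ} [Fact p.Prime] {N C m : ℕ}
    (hN : ∀ (G : Type) [Group G] [Finite G] (θ : G →* Equiv.Perm M)
      (Y : Set M), Good p c B Y → Acts θ Y → (∀ g, (∀ y ∈ Y, θ g y = y) → g = 1) →
      ∀ A : Subgroup G, (∀ a ∈ A, ∀ b ∈ A, Commute a b) → (∀ a ∈ A, a ^ Grp.ex p = 1) →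
      Nat.card A ≤ N)
    (hC : ∀ (G : Type) [Group G] [Finite G] (θ : G →* Equiv.Perm M) (Y : Set M), IsPGroup p G →
      Good p c B Y → Acts θ Y → cpl p c B Y < m → ∃ H : Subgroup G, Subgroup.center G ≤ H ∧
        H.index ≤ C ∧ (st θ H '' Y).ncard ≤ C)
    (hC1 : 1 ≤ C) {G : Type} [Group G] [Finite G] {θ : G →* Equiv.Perm M} {Y : Set M}
    (hG : IsPGroup p G) (h : Good p c B Y) (hθ : Acts θ Y)
    (heff : ∀ g, (∀ y ∈ Y, θ g y = y) → g = 1) (hm : cpl p c B Y < m + 1) :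
    ∃ H : Subgroup G, Subgroup.center G ≤ H ∧ H.index ≤ C ^ N * N ^ N ∧
      (st θ H '' Y).ncard ≤ 1 + N * C := by
  classical
  have := Fintype.ofFinite G
  obtain ⟨A, hAn, hAc, hAe, hCA⟩ := Grp.exists_abelian hG
  have hAN := hN G θ Y h hθ heff A hAc hAe
  set H₀ := Subgroup.centralizer (A : Set G) with hH₀
  let θ₀ : H₀ →* Equiv.Perm M := θ.comp H₀.subtype
  let F : G → Set M := fun a => {y | y ∈ Y ∧ θ a y = y}
  have key : ∀ a : A, ∃ H : Subgroup H₀, Subgroup.center H₀ ≤ H ∧ H.index ≤ C ∧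
      ((a : G) ^ p = 1 → a ≠ 1 → (st θ₀ H '' F a).ncard ≤ C) := by
    intro a
    by_cases ha : (a : G) ^ p = 1 ∧ a ≠ 1
    · obtain ⟨h1, h2⟩ := h.fixed hθ ha.1
      have h3 : Acts θ₀ (F a) := by
        refine ⟨fun g y hy => ⟨hθ.maps g hy.1, ?_⟩, fun g => (hθ.cont g).mono fun _ hy => hy.1⟩
        have h4 : (a : G) * g = g * a := Subgroup.mem_centralizer_iff.1 g.2 a a.2
        change θ a (θ g y) = θ g y
        rw [← Equiv.Perm.mul_apply, ← map_mul, h4, map_mul, Equiv.Perm.mul_apply, hy.2]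
      have h4 : F a ≠ Y := fun he => ha.2 (Subtype.ext (heff a fun y hy => by
        rw [← he] at hy
        exact hy.2))
      obtain ⟨H, hH1, hH2, hH3⟩ := hC H₀ θ₀ (F a) (hG.to_subgroup H₀) h1 h3
        (lt_of_lt_of_le (h2 h4) (Nat.lt_succ_iff.1 hm))
      exact ⟨H, hH1, hH2, fun _ _ => hH3⟩
    · refine ⟨⊤, le_top, by rwa [Subgroup.index_top], fun h1 h2 => (ha ⟨h1, h2⟩).elim⟩
  choose f hf1 hf2 hf3 using key
  have hN1 : Nat.card A ^ Nat.card A ≤ N ^ N :=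
    (Nat.pow_le_pow_left hAN _).trans (Nat.pow_le_pow_right (Nat.card_pos.trans_le hAN) hAN)
  refine ⟨(⨅ a, f a).map H₀.subtype, ?_, ?_, ?_⟩
  · intro z hz
    have hz0 : z ∈ H₀ := Subgroup.center_le_centralizer _ hz
    refine ⟨⟨z, hz0⟩, (le_iInf hf1) (Subgroup.mem_center_iff.2 fun g => Subtype.ext ?_), rfl⟩
    exact Subgroup.mem_center_iff.1 hz g
  · rw [Subgroup.index_map_subtype]
    refine Nat.mul_le_mul ((Subgroup.index_iInf_le f).trans ?_)
      ((Grp.index_centralizer_le A).trans hN1)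
    refine (Finset.prod_le_pow_card _ _ C fun a _ => hf2 a).trans ?_
    rw [Finset.card_univ, ← Nat.card_eq_fintype_card]
    exact Nat.pow_le_pow_right hC1 hAN
  · set H := (⨅ a, f a).map H₀.subtype with hH
    have hHC : H ≤ H₀ := Subgroup.map_subtype_le _
    let S : A → Set (Subgroup G) := fun a =>
      if (a : G) ^ p = 1 ∧ a ≠ 1 then st θ H '' F a else ∅
    have hS : ∀ a, (S a).ncard ≤ C := by
      intro a
      by_cases ha : (a : G) ^ p = 1 ∧ a ≠ 1
      · simp only [S, if_pos ha]
        have h1 : st θ H '' F a = (fun K => (K ⊓ ⨅ a, f a).map H₀.subtype) '' (st θ₀ (f a) '' F a) := by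
          rw [Set.image_image]
          refine Set.image_congr fun x _ => ?_
          rw [← st_of_le (iInf_le f a) x]
          ext g
          constructor
          · rintro ⟨⟨g, hg, rfl⟩, hgx⟩
            exact ⟨g, ⟨hg, hgx⟩, rfl⟩
          · rintro ⟨g, ⟨hg, hgx⟩, rfl⟩
            exact ⟨⟨g, hg, rfl⟩, hgx⟩
        rw [h1]
        exact (Set.ncard_image_le (Set.toFinite _)).trans (hf3 a ha.1 ha.2)
      · simp only [S, if_neg ha, Set.ncard_empty, Nat.zero_le]
    have hsub : st θ H '' Y ⊆ {⊥} ∪ ⋃ a, S a := by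
      rintro _ ⟨x, hx, rfl⟩
      by_cases hbot : st θ H x = ⊥
      · exact Or.inl hbot
      right
      have hpp : p.Prime := Fact.out
      have h1 : IsPGroup p (st θ H x) := hG.to_subgroup _
      have h2 : Nontrivial (st θ H x) := (Subgroup.nontrivial_iff_ne_bot _).2 hbot
      obtain ⟨k, hk, hcard⟩ := (IsPGroup.nontrivial_iff_card h1).1 h2
      obtain ⟨g, hg⟩ := exists_prime_orderOf_dvd_card' (G := st θ H x) p
        (hcard ▸ dvd_pow_self p hk.ne')
      have hgp : (g : G) ^ p = 1 := by
        have := pow_orderOf_eq_one g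
        rw [hg] at this
        exact congrArg Subtype.val this
      have hg1 : (g : G) ≠ 1 := fun h => hpp.one_lt.ne' (by
        rw [← hg, orderOf_eq_one_iff]
        exact Subtype.ext h)
      have hgA : (g : G) ∈ A := hCA _ (hHC g.2.1) (by
        obtain ⟨e, he⟩ := Grp.dvd_ex p
        rw [he, pow_mul, hgp, one_pow])
      refine Set.mem_iUnion.2 ⟨⟨g, hgA⟩, ?_⟩
      have h3 : ((⟨g, hgA⟩ : A) : G) ^ p = 1 ∧ (⟨g, hgA⟩ : A) ≠ 1 :=
        ⟨hgp, fun h => hg1 (congrArg Subtype.val h)⟩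
      simp only [S, if_pos h3]
      exact ⟨x, ⟨hx, g.2.2⟩, rfl⟩
    refine (Set.ncard_le_ncard hsub (Set.toFinite _)).trans ((Set.ncard_union_le _ _).trans ?_)
    rw [Set.ncard_singleton]
    refine Nat.add_le_add_left ?_ 1
    have h5 : (⋃ a, S a).ncard ≤ ∑ a, (S a).ncard := by
      have := Set.ncard_iUnion_le_of_fintype S
      exact this
    refine h5.trans ((Finset.sum_le_card_nsmul _ _ C fun a _ => hS a).trans ?_)
    rw [Finset.card_univ, ← Nat.card_eq_fintype_card, smul_eq_mul]
    exact Nat.mul_le_mul_right C hAN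

theorem exists_stab_bound (M : Type u) [TopologicalSpace M] [CompactSpace M] [T2Space M]
    (p c B m : ℕ) [Fact p.Prime] : ∃ C : ℕ, ∀ (G : Type) [Group G] [Finite G]
    (θ : G →* Equiv.Perm M) (Y : Set M), IsPGroup p G →
      Good p c B Y → Acts θ Y → cpl p c B Y < m → ∃ H : Subgroup G, Subgroup.center G ≤ H ∧
        H.index ≤ C ∧ (st θ H '' Y).ncard ≤ C := by
  obtain ⟨N, hN⟩ := exists_card_bound M p c B
  induction m with
  | zero => exact ⟨0, fun G _ _ θ Y _ _ _ h => by omega⟩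
  | succ m ih =>
    obtain ⟨C, hC⟩ := ih
    have hC' : ∀ (G : Type) [Group G] [Finite G] (θ : G →* Equiv.Perm M) (Y : Set M), IsPGroup p G →
      Good p c B Y → Acts θ Y → cpl p c B Y < m → ∃ H : Subgroup G, Subgroup.center G ≤ H ∧
        H.index ≤ max C 1 ∧ (st θ H '' Y).ncard ≤ max C 1 := by
      intro G _ _ θ Y hG h hθ hm
      obtain ⟨H, h1, h2, h3⟩ := hC G θ Y hG h hθ hm
      exact ⟨H, h1, h2.trans (le_max_left _ _), h3.trans (le_max_left _ _)⟩
    refine ⟨max (max C 1 ^ N * N ^ N) (1 + N * max C 1), fun G _ _ θ Y hG h hθ hm => ?_⟩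
    obtain ⟨K, hK, θ', hθ', hval, heff⟩ := hθ.exists_quotient
    obtain ⟨H, h1, h2, h3⟩ := exists_stab_bound_succ hN hC' (le_max_right _ _) (hG.to_quotient K) h
      hθ' heff hm
    have hsurj : Function.Surjective (QuotientGroup.mk' K) := QuotientGroup.mk'_surjective K
    refine ⟨H.comap (QuotientGroup.mk' K), ?_, ?_, ?_⟩
    · intro z hz
      refine h1 (Subgroup.mem_center_iff.2 fun q => ?_)
      obtain ⟨g, rfl⟩ := hsurj q
      rw [← map_mul, ← map_mul, Subgroup.mem_center_iff.1 hz g]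
    · rw [Subgroup.index_comap_of_surjective _ hsurj]
      exact h2.trans (le_max_left _ _)
    · have h4 : st θ (H.comap (QuotientGroup.mk' K)) '' Y =
          (fun L => L.comap (QuotientGroup.mk' K)) '' (st θ' H '' Y) := by
        rw [Set.image_image]
        refine Set.image_congr fun y hy => ?_
        ext g
        rw [Subgroup.mem_comap, mem_st, mem_st, Subgroup.mem_comap]
        exact and_congr_right fun _ => by
          rw [← hval g y hy]
          rfl
      rw [h4]
      exact (Set.ncard_image_le (Set.toFinite _)).trans (h3.trans (le_max_right _ _))

/-- Stabilizers of actions of finite `p`-groups on good spaces. -/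
theorem exists_bound (M : Type u) [TopologicalSpace M] [CompactSpace M] [T2Space M]
    (p c B : ℕ) [Fact p.Prime] (hM : Good p c B (Set.univ : Set M)) : ∃ C : ℕ,
    ∀ (G : Type) [Group G] [Finite G] [MulAction G M], IsPGroup p G →
      (∀ g : G, Continuous fun x : M => g • x) → (∀ g : G, (∀ x : M, g • x = x) → g = 1) →
      ∃ H : Subgroup G, H.Characteristic ∧ Subgroup.center G ≤ H ∧ H.index ≤ C ∧
        (Set.range fun x : M => MulAction.stabilizer H x).Finite ∧
        (Set.range fun x : M => MulAction.stabilizer H x).ncard ≤ C := by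
  obtain ⟨C, hC⟩ := exists_stab_bound M p c B (cpl p c B (Set.univ : Set M) + 1)
  obtain ⟨N, hN⟩ := exists_card_bound M p c B
  refine ⟨max C (N ^ C * N ^ N), fun G _ _ _ hG hcont heff => ?_⟩
  let θ := MulAction.toPermHom G M
  have hθ : Acts θ Set.univ := ⟨fun _ _ _ => trivial, fun g => (hcont g).continuousOn⟩
  obtain ⟨H, h1, h2, h3⟩ := hC G θ Set.univ hG hM hθ (Nat.lt_succ_self _)
  obtain ⟨A, hAn, hAc, hAe, hCA⟩ := Grp.exists_abelian hG
  have hAN := hN G θ Set.univ hM hθ (fun g hg => heff g fun x => hg x trivial) A hAc hAe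
  obtain ⟨H', h4, h5, h6, h7⟩ := Grp.exists_characteristic hG hAe hCA h1 h2 hAN
  refine ⟨H', h4, h5, h7.trans (le_max_right _ _), Set.toFinite _, ?_⟩
  have h8 : (Set.range fun x : M => MulAction.stabilizer H' x) =
      (fun K : Subgroup G => K.subgroupOf H') '' ((st θ H') '' Set.univ) := by
    rw [Set.image_image, ← Set.image_univ]
    refine Set.image_congr fun x _ => ?_
    ext g
    rw [MulAction.mem_stabilizer_iff, Subgroup.mem_subgroupOf, mem_st]
    exact ⟨fun h => ⟨g.2, h⟩, fun h => h.2⟩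
  rw [h8]
  exact ((Set.ncard_image_le (Set.toFinite _)).trans
    ((ncard_st_le h6 _).trans h3)).trans (le_max_left _ _)

end Fn

namespace Fn

variable {p : ℕ} {M : Type*} [TopologicalSpace M]

/-- Coboundaries of cochains of `X` supported in `U`. -/
def Dd (p : ℕ) (X U : Set M) : ∀ j, Submodule (ZMod p) (Fn p M j)
  | 0 => ⊥
  | j + 1 => (K p X U j).map d

/-- Cochains whose germs on `X` are coboundaries supported in `U`. -/
def Bd (p : ℕ) (X U : Set M) (j : ℕ) : Submodule (ZMod p) (Fn p M j) := K p X ∅ j ⊔ Dd p X U j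

/-- Cochains whose germs on `X` are cocycles supported in `U`. -/
def Cy (p : ℕ) (X U : Set M) (j : ℕ) : Submodule (ZMod p) (Fn p M j) :=
  K p X U j ⊓ (K p X ∅ (j + 1)).comap d

theorem mem_Bd_zero {X U : Set M} {f : Fn p M 0} : f ∈ Bd p X U 0 ↔ f ∈ K p X ∅ 0 := by
  unfold Bd Dd
  rw [sup_bot_eq]

theorem mem_Bd_succ {X U : Set M} {j : ℕ} {f : Fn p M (j + 1)} :
    f ∈ Bd p X U (j + 1) ↔ ∃ u ∈ K p X U j, f - d u ∈ K p X ∅ (j + 1) := by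
  unfold Bd Dd
  rw [Submodule.mem_sup]
  constructor
  · rintro ⟨a, ha, _, ⟨u, hu, rfl⟩, rfl⟩
    exact ⟨u, hu, by simpa using ha⟩
  · rintro ⟨u, hu, h⟩
    exact ⟨_, h, _, ⟨u, hu, rfl⟩, by abel⟩

theorem Dd_mono {X Y U V : Set M} (h : ∀ j, K p X U j ≤ K p Y V j) (j : ℕ) :
    Dd p X U j ≤ Dd p Y V j := by
  cases j with
  | zero => exact le_rfl
  | succ j => exact Submodule.map_mono (h j)

theorem d_Dd {X U : Set M} {j : ℕ} {f : Fn p M j} (hf : f ∈ Dd p X U j) : d f = 0 := by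
  cases j with
  | zero => rw [(Submodule.mem_bot _).1 hf, map_zero]
  | succ j =>
    obtain ⟨u, -, rfl⟩ := hf
    exact d_d u

theorem Dd_le_K {X U : Set M} {j : ℕ} : Dd p X U j ≤ K p X U j := by
  cases j with
  | zero => exact bot_le
  | succ j =>
    rintro _ ⟨u, hu, rfl⟩
    exact d_mem_K hu

theorem Bd_mono {X Y U V : Set M} (hX : IsClosed X) (hYX : Y ⊆ X)
    (hUV : ∀ x ∈ X, x ∈ U → x ∈ V) (j : ℕ) : Bd p X U j ≤ Bd p Y V j :=
  sup_le_sup (K_mono hX hYX (fun _ _ h => h) j) (Dd_mono (K_mono hX hYX hUV) j)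

theorem Cy_mono {X Y U V : Set M} (hX : IsClosed X) (hYX : Y ⊆ X)
    (hUV : ∀ x ∈ X, x ∈ U → x ∈ V) (j : ℕ) : Cy p X U j ≤ Cy p Y V j :=
  inf_le_inf (K_mono hX hYX hUV j) (Submodule.comap_mono (K_mono hX hYX (fun _ _ h => h) (j + 1)))

theorem K_empty_le_Bd {X U : Set M} {j : ℕ} : K p X ∅ j ≤ Bd p X U j := le_sup_left

theorem Dd_le_Bd {X U : Set M} {j : ℕ} : Dd p X U j ≤ Bd p X U j := le_sup_right

theorem Bd_le_Cy {X U : Set M} {j : ℕ} : Bd p X U j ≤ Cy p X U j := by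
  refine sup_le (fun f hf => ⟨K_empty_le hf, d_mem_K hf⟩) fun f hf => ⟨Dd_le_K hf, ?_⟩
  change d f ∈ K p X ∅ (j + 1)
  rw [d_Dd hf]
  exact zero_mem _

/-- The cohomology of `X` with supports in `U` vanishes in degree `j`. -/
def Ex (p : ℕ) (X U : Set M) (j : ℕ) : Prop := Cy p X U j ≤ Bd p X U j

theorem ex_of_disjoint {X U : Set M} (hX : IsClosed X) (h : ∀ x ∈ X, x ∉ U) (j : ℕ) :
    Ex p X U j := fun _ hf =>
  K_empty_le_Bd (K_mono hX le_rfl (fun x hx hU => absurd hU (h x hx)) j hf.1)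

theorem van_zero_of_d {X : Set M} {f : Fn p M 0} {x : M} (hx : x ∈ X) (hd : Van X (d f) x)
    (h0 : f (fun _ => x) = 0) : Van X f x := by
  obtain ⟨V, hV, hxV, h⟩ := van_iff.1 hd
  refine van_iff.2 ⟨V, hV, hxV, fun s hs => ?_⟩
  have h1 := h (Fin.cons x s) fun i => Fin.cases ⟨hxV, hx⟩ (fun k => hs k) i
  rw [d_cons_zero, h0] at h1
  simpa using h1

theorem Van.apply_eq_zero {X : Set M} {j : ℕ} {f : Fn p M j} {x : M} (h : Van X f x)
    (hx : x ∈ X) : f (fun _ => x) = 0 := by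
  obtain ⟨V, hV, hxV, h⟩ := van_iff.1 h
  exact h _ fun _ => ⟨hxV, hx⟩

/-- Excision. -/
theorem bd_of_excision {X Y U : Set M} (hX : IsClosed X) (hn : ∀ x ∈ X, x ∈ U → Y ∈ 𝓝[X] x) {j : ℕ}
    {f : Fn p M j} (hf : f ∈ K p X U j)
    (h : f ∈ Bd p Y U j) : f ∈ Bd p X U j := by
  have key : ∀ {i : ℕ} {g : Fn p M i}, g ∈ K p X U i → g ∈ K p Y ∅ i → g ∈ K p X ∅ i := by
    intro i g hg hg' x _
    by_cases hxU : x ∈ U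
    · by_cases hx : x ∈ X
      · obtain ⟨V, hV, h⟩ := hg' x (Set.notMem_empty _)
        refine ⟨V, ?_, h⟩
        have := hn x hx hxU
        exact nhdsWithin_le_of_mem this hV
      · exact van_of_notMem hX _ hx
    · exact hg x hxU
  cases j with
  | zero => exact mem_Bd_zero.2 (key hf (mem_Bd_zero.1 h))
  | succ j =>
    obtain ⟨u, hu, h⟩ := mem_Bd_succ.1 h
    obtain ⟨h1, h2⟩ := exists_ext (X := X) hu
    refine mem_Bd_succ.2 ⟨_, h1, key (sub_mem hf (d_mem_K h1)) ?_⟩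
    have := add_mem h (d_mem_K h2)
    rwa [map_sub, sub_add_sub_cancel] at this

theorem Ex.of_excision {X Y U : Set M} (hX : IsClosed X) (hYX : Y ⊆ X)
    (hn : ∀ x ∈ X, x ∈ U → Y ∈ 𝓝[X] x) {j : ℕ} (h : Ex p Y U j) : Ex p X U j :=
  fun _ hf => bd_of_excision hX hn hf.1 (h (Cy_mono hX hYX (fun _ _ h => h) j hf))

variable {X Y U : Set M}

theorem mem_K_diff {j : ℕ} {f : Fn p M j} (hf : f ∈ K p X U j) (h : ∀ x ∈ Y, Van X f x) :
    f ∈ K p X (U \ Y) j := fun x hx => by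
  by_cases hxY : x ∈ Y
  · exact h x hxY
  · exact hf x fun hxU => hx ⟨hxU, hxY⟩

theorem bd_union_zero {X₁ X₂ : Set M} {f : Fn p M 0} (hf : f ∈ Cy p (X₁ ∪ X₂) U 0)
    (hf₁ : f ∈ Bd p X₁ U 0) (hf₂ : f ∈ Bd p X₂ U 0) (h₁ : IsClosed (X₁ ∪ X₂)) :
    f ∈ Bd p (X₁ ∪ X₂) U 0 := by
  refine mem_Bd_zero.2 fun x _ => ?_
  by_cases hx : x ∈ X₁ ∪ X₂
  · refine van_zero_of_d hx (hf.2 x (Set.notMem_empty _)) ?_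
    rcases hx with hx | hx
    · exact (mem_Bd_zero.1 hf₁ x (Set.notMem_empty _)).apply_eq_zero hx
    · exact (mem_Bd_zero.1 hf₂ x (Set.notMem_empty _)).apply_eq_zero hx
  · exact van_of_notMem h₁ _ hx

variable [CompactSpace M] [T2Space M]

theorem exists_primitive (hX : IsClosed X) (hY : IsClosed Y) (hYX : Y ⊆ X) (hU : ROpen X U) {j : ℕ}
    {f : Fn p M (j + 1)} (hf : f ∈ K p X U (j + 1)) {u : Fn p M j} (hu : u ∈ K p Y U j)
    (hfu : f - d u ∈ K p Y ∅ (j + 1)) (hd : ∀ x ∈ Y, Van X (d f) x) :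
    ∃ v ∈ K p X U j, v - u ∈ K p Y ∅ j ∧ f - d v ∈ K p X (U \ Y) (j + 1) := by
  obtain ⟨h1, h2⟩ := exists_ext (X := X) hu
  have h3 := add_mem hfu (d_mem_K h2)
  rw [map_sub, sub_add_sub_cancel] at h3
  obtain ⟨v, hv, hvU, h4⟩ := (Acts.one (E := Unit) X).patch hX hY hYX (fun _ _ _ => rfl) hU
    ⟨h3, mem_inv_one _⟩ (sub_mem hf (d_mem_K h1)) fun x hx => by
      rw [map_sub, d_d, sub_zero]
      exact hd x hx
  have h5 := mem_K_diff (sub_mem (sub_mem hf (d_mem_K h1)) (d_mem_K hvU)) h4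
  refine ⟨_, add_mem h1 hvU, ?_, ?_⟩
  · have := sub_mem hv.1 h2
    convert this using 1
    abel
  · convert h5 using 1
    rw [map_add]
    abel

/-- Classes vanishing on `Y` come from the complement of `Y`. -/
theorem exists_push (hX : IsClosed X) (hY : IsClosed Y) (hYX : Y ⊆ X) (hU : ROpen X U) {j : ℕ}
    {f : Fn p M j} (hf : f ∈ K p X U j) (hfY : f ∈ Bd p Y U j) (hd : ∀ x ∈ Y, Van X (d f) x) :
    ∃ f' ∈ K p X (U \ Y) j, f - f' ∈ Dd p X U j := by
  cases j with
  | zero =>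
    rw [mem_Bd_zero] at hfY
    refine ⟨f, mem_K_diff hf fun x hx => van_zero_of_d (hYX hx) (hd x hx) ?_, by simp⟩
    exact (hfY x (Set.notMem_empty _)).apply_eq_zero hx
  | succ j =>
    obtain ⟨u, hu, h⟩ := mem_Bd_succ.1 hfY
    obtain ⟨v, hv, -, h'⟩ := exists_primitive hX hY hYX hU hf hu h hd
    exact ⟨_, h', v, hv, by abel⟩

theorem bd_diff_of_sub_d (hX : IsClosed X) (hY : IsClosed Y) (hYX : Y ⊆ X) (hU : ROpen X U) {j : ℕ}
    {f : Fn p M (j + 1)} (hf : f ∈ K p X (U \ Y) (j + 1)) {w : Fn p M j} (hw : w ∈ K p X U j)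
    (h : f - d w ∈ K p X ∅ (j + 1)) (hwY : w ∈ Bd p Y U j) : f ∈ Bd p X (U \ Y) (j + 1) := by
  obtain ⟨w', hw', h'⟩ := exists_push hX hY hYX hU hw hwY fun x hx => by
    simpa using (hf x fun h => h.2 hx).sub (h x (Set.notMem_empty _))
  have := d_Dd h'
  rw [map_sub, sub_eq_zero] at this
  exact mem_Bd_succ.2 ⟨w', hw', this ▸ h⟩

theorem bd_diff (hX : IsClosed X) (hY : IsClosed Y) (hYX : Y ⊆ X) (hU : ROpen X U) {j : ℕ}
    {f : Fn p M j} (hf : f ∈ K p X (U \ Y) j) (h : f ∈ Bd p X U j)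
    (hE : ∀ i, i + 1 = j → Ex p Y U i) : f ∈ Bd p X (U \ Y) j := by
  cases j with
  | zero => exact mem_Bd_zero.2 (mem_Bd_zero.1 h)
  | succ j =>
    obtain ⟨w, hw, h⟩ := mem_Bd_succ.1 h
    have hK := K_mono (p := p) hX hYX (fun _ _ h => h) (U := U)
    refine bd_diff_of_sub_d hX hY hYX hU hf hw h (hE j rfl ⟨hK j hw, fun x _ => ?_⟩)
    by_cases hx : x ∈ Y
    · simpa using ((hf x fun h => h.2 hx).mono hYX).sub ((h x (Set.notMem_empty _)).mono hYX)
    · exact van_of_notMem hY _ hx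

theorem Ex.diff (hX : IsClosed X) (hY : IsClosed Y) (hYX : Y ⊆ X) (hU : ROpen X U) {j : ℕ}
    (h : Ex p X U j) (hE : ∀ i, i + 1 = j → Ex p Y U i) : Ex p X (U \ Y) j := fun _ hf =>
  bd_diff hX hY hYX hU hf.1 (h (Cy_mono hX le_rfl (fun _ _ h => h.1) j hf)) hE

/-- Classes vanishing on `Y` are trivial if the complement of `Y` has no cohomology. -/
theorem bd_of_ex_diff (hX : IsClosed X) (hY : IsClosed Y) (hYX : Y ⊆ X) (hU : ROpen X U) {j : ℕ}
    (hE : Ex p X (U \ Y) j) {f : Fn p M j} (hf : f ∈ Cy p X U j) (hfY : f ∈ Bd p Y U j) :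
    f ∈ Bd p X U j := by
  obtain ⟨f', hf', h⟩ := exists_push hX hY hYX hU hf.1 hfY fun x _ => hf.2 x (Set.notMem_empty _)
  have h1 : f' ∈ Bd p X (U \ Y) j := hE ⟨hf', by
    have := d_Dd h
    rw [map_sub, sub_eq_zero] at this
    change d f' ∈ K p X ∅ (j + 1)
    rw [← this]
    exact hf.2⟩
  have := add_mem (Dd_le_Bd h) (Bd_mono hX le_rfl (fun _ _ h => h.1) j h1)
  rwa [sub_add_cancel] at this

/-- Mayer–Vietoris. -/
theorem bd_union {X₁ X₂ : Set M} (h₁ : IsClosed X₁) (h₂ : IsClosed X₂) (hU : ROpen (X₁ ∪ X₂) U)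
    {j : ℕ} {f : Fn p M (j + 1)} (hf : f ∈ Cy p (X₁ ∪ X₂) U (j + 1)) {u₁ u₂ : Fn p M j}
    (hu₁ : u₁ ∈ K p X₁ U j) (hu₂ : u₂ ∈ K p X₂ U j) (hf₁ : f - d u₁ ∈ K p X₁ ∅ (j + 1))
    (hf₂ : f - d u₂ ∈ K p X₂ ∅ (j + 1)) (hu : u₂ - u₁ ∈ Bd p (X₁ ∩ X₂) U j) :
    f ∈ Bd p (X₁ ∪ X₂) U (j + 1) := by
  have hX := h₁.union h₂
  obtain ⟨v, hv, hvu, h⟩ := exists_primitive hX h₁ Set.subset_union_left hU hf.1 hu₁ hf₁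
    fun x _ => hf.2 x (Set.notMem_empty _)
  have hK : ∀ {V W : Set M} {i : ℕ}, (∀ x, x ∈ V → x ∈ W) →
      K p (X₁ ∪ X₂) V i ≤ K p X₂ W i :=
    fun h => K_mono hX Set.subset_union_right (fun x _ => h x) _
  have h3 : f - d v ∈ Bd p X₂ (U \ (X₁ ∩ X₂)) (j + 1) := by
    refine bd_diff_of_sub_d h₂ (h₁.inter h₂) Set.inter_subset_right (fun x hx hxU =>
        nhdsWithin_mono x Set.subset_union_right (hU x (Set.mem_union_right _ hx) hxU))
      (hK (V := U \ X₁) (W := U \ (X₁ ∩ X₂)) (fun x hx => ⟨hx.1, fun h => hx.2 h.1⟩) h)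
      (w := u₂ - v)
      (sub_mem hu₂ (hK (fun _ h => h) hv)) ?_ ?_
    · convert hf₂ using 1
      rw [map_sub]
      abel
    · have := sub_mem hu (K_empty_le_Bd (U := U)
        (K_mono h₁ (Y := X₁ ∩ X₂) Set.inter_subset_left (fun _ _ h => h) j hvu))
      convert this using 1
      abel
  have h4 := bd_of_excision (U := U \ X₁) hX (fun x hx hxU => ?_) h
    (Bd_mono (V := U \ X₁) h₂ le_rfl
      (fun x hx hxU => ⟨hxU.1, fun h => hxU.2 ⟨h, hx⟩⟩) _ h3)
  · have h5 : d v ∈ Dd p (X₁ ∪ X₂) U (j + 1) := ⟨v, hv, rfl⟩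
    have := add_mem (Bd_mono (V := U) hX le_rfl (fun _ _ h => h.1) _ h4) (Dd_le_Bd h5)
    rwa [sub_add_cancel] at this
  · filter_upwards [mem_nhdsWithin_of_mem_nhds (h₁.isOpen_compl.mem_nhds hxU.2),
      self_mem_nhdsWithin] with y hy hy'
    exact hy'.resolve_left hy

end Fn

namespace Fn

variable {p : ℕ} {M : Type*} [TopologicalSpace M] {X U : Set M}

theorem ROpen.mono {Y : Set M} (hU : ROpen X U) (hYX : Y ⊆ X) : ROpen Y U :=
  fun x hx h => nhdsWithin_mono x hYX (hU x (hYX hx) h)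

variable [CompactSpace M] [T2Space M]

theorem exists_slab (hX : IsClosed X) {q : M → ℝ} (hq : ContinuousOn q X) (hU : ROpen X U) {j : ℕ}
    {f : Fn p M j} (hf : f ∈ Cy p X U j) {c : ℝ} (hc : f ∈ Bd p (X ∩ q ⁻¹' {c}) U j) :
    ∃ ε > 0, f ∈ Bd p (X ∩ q ⁻¹' Set.Icc (c - ε) (c + ε)) U j := by
  have hS := fun s hs => hq.preimage_isClosed_of_isClosed (t := s) hX hs
  obtain ⟨f', hf', h⟩ := exists_push hX (hS _ isClosed_singleton) Set.inter_subset_left hU hf.1 hc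
    fun x _ => hf.2 x (Set.notMem_empty _)
  have hO := isOpen_van X f'
  have hC : IsCompact (q '' (X \ {x | Van X f' x})) :=
    (hX.sdiff hO).isCompact.image_of_continuousOn (hq.mono Set.sdiff_subset)
  have hcC : c ∉ q '' (X \ {x | Van X f' x}) := by
    rintro ⟨x, hx, rfl⟩
    exact hx.2 (hf' x fun h => h.2 ⟨hx.1, rfl⟩)
  obtain ⟨ε, hε, hb⟩ := Metric.nhds_basis_closedBall.mem_iff.1
    (hC.isClosed.isOpen_compl.mem_nhds hcC)
  rw [Real.closedBall_eq_Icc] at hb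
  refine ⟨ε, hε, ?_⟩
  have h1 : f' ∈ K p (X ∩ q ⁻¹' Set.Icc (c - ε) (c + ε)) ∅ j := fun x _ => by
    by_cases hx : x ∈ X ∩ q ⁻¹' Set.Icc (c - ε) (c + ε)
    · by_contra hv
      exact hb hx.2 ⟨x, ⟨hx.1, fun hv' => hv (hv'.mono Set.inter_subset_left)⟩, rfl⟩
    · exact van_of_notMem (hS _ isClosed_Icc) _ hx
  have := add_mem (Dd_le_Bd (Dd_mono (fun i => K_mono hX Set.inter_subset_left
    (fun _ _ h => h) i) j h)) (K_empty_le_Bd (U := U) h1)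
  rwa [sub_add_cancel] at this

/-- Cohomology vanishes if it vanishes on slices and classes of slices extend. -/
theorem Ex.of_slices (hX : IsClosed X) {q : M → ℝ} (hq : ContinuousOn q X) (hU : ROpen X U)
    {j : ℕ} (h : ∀ t, Ex p (X ∩ q ⁻¹' {t}) U j)
    (hs : ∀ i, i + 1 = j → ∀ s t, s ≤ t → ∀ g ∈ Cy p (X ∩ q ⁻¹' {s}) U i,
      ∃ e ∈ Cy p (X ∩ q ⁻¹' Set.Icc s t) U i, g - e ∈ Bd p (X ∩ q ⁻¹' {s}) U i) : Ex p X U j := by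
  intro f hf
  have hS := fun s hs => hq.preimage_isClosed_of_isClosed (t := s) hX hs
  obtain ⟨r, hr, hXr⟩ := (hX.isCompact.image_of_continuousOn hq).isBounded.subset_closedBall_lt 0 0
  rw [Real.closedBall_eq_Icc, zero_sub, zero_add] at hXr
  choose ε hε hfε using fun c => exists_slab hX hq hU hf
    (h c (Cy_mono hX Set.inter_subset_left (fun _ _ h => h) j hf))
  obtain ⟨t, ht0, htm, ⟨m, hm⟩, ht⟩ := exists_monotone_Icc_subset_open_cover_Icc
    (show -r ≤ r by linarith) (c := fun c : ℝ => {x | (x : ℝ) ∈ Set.Ioo (c - ε c) (c + ε c)})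
    (fun c => isOpen_Ioo.preimage continuous_subtype_val) fun x _ =>
      Set.mem_iUnion.2 ⟨x, by constructor <;> linarith [hε x]⟩
  have hn : ∀ n, f ∈ Bd p (X ∩ q ⁻¹' Set.Icc (t n : ℝ) (t (n + 1))) U j := fun n => by
    obtain ⟨c, hc⟩ := ht n
    refine Bd_mono (hS _ isClosed_Icc) (Set.inter_subset_inter_right _ (Set.preimage_mono ?_))
      (fun _ _ h => h) j (hfε c)
    have h1 := hc (Set.left_mem_Icc.2 (htm (Nat.le_succ n)))
    have h2 := hc (Set.right_mem_Icc.2 (htm (Nat.le_succ n)))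
    exact Set.Icc_subset_Icc h1.1.le h2.2.le
  have key : ∀ n, f ∈ Bd p (X ∩ q ⁻¹' Set.Icc (t 0 : ℝ) (t n)) U j := by
    intro n
    induction n with
    | zero =>
      rw [Set.Icc_self]
      exact h _ (Cy_mono hX Set.inter_subset_left (fun _ _ h => h) j hf)
    | succ n ih =>
      have h0 : (t 0 : ℝ) ≤ t n := htm (Nat.zero_le n)
      have h1 : (t n : ℝ) ≤ t (n + 1) := htm (Nat.le_succ n)
      have h2 : X ∩ q ⁻¹' Set.Icc (t 0 : ℝ) (t (n + 1)) = X ∩ q ⁻¹' Set.Icc (t 0 : ℝ) (t n) ∪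
          X ∩ q ⁻¹' Set.Icc (t n : ℝ) (t (n + 1)) := by
        rw [← Set.inter_union_distrib_left, ← Set.preimage_union, Set.Icc_union_Icc_eq_Icc h0 h1]
      have h3 : X ∩ q ⁻¹' Set.Icc (t 0 : ℝ) (t n) ∩ (X ∩ q ⁻¹' Set.Icc (t n : ℝ) (t (n + 1))) =
          X ∩ q ⁻¹' {(t n : ℝ)} := by
        rw [← Set.inter_inter_distrib_left, ← Set.preimage_inter,
          Set.Icc_inter_Icc_eq_singleton h0 h1]
      have hf' := Cy_mono (p := p) (Y := X ∩ q ⁻¹' Set.Icc (t 0 : ℝ) (t (n + 1))) hX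
        Set.inter_subset_left (fun _ _ h => h) j hf
      rw [h2] at hf' ⊢
      have hc1 := hS _ (isClosed_Icc (a := (t 0 : ℝ)) (b := t n))
      have hc2 := hS _ (isClosed_Icc (a := (t n : ℝ)) (b := t (n + 1)))
      cases j with
      | zero => exact bd_union_zero hf' ih (hn n) (hc1.union hc2)
      | succ j =>
        obtain ⟨u₁, hu₁, hf₁⟩ := mem_Bd_succ.1 ih
        obtain ⟨u₂, hu₂, hf₂⟩ := mem_Bd_succ.1 (hn n)
        obtain ⟨e, he, hue⟩ := hs j rfl (t n) (t (n + 1)) h1 (u₁ - u₂) (by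
          rw [← h3]
          refine ⟨sub_mem (K_mono hc1 Set.inter_subset_left (fun _ _ h => h) j hu₁)
            (K_mono hc2 Set.inter_subset_right (fun _ _ h => h) j hu₂), ?_⟩
          have := sub_mem (K_mono hc2 Set.inter_subset_right (fun _ _ h => h) _ hf₂)
            (K_mono hc1 Set.inter_subset_left (fun _ _ h => h) _ hf₁)
          rw [sub_sub_sub_cancel_left, ← map_sub] at this
          exact this)
        refine bd_union hc1 hc2 (hU.mono (Set.union_subset Set.inter_subset_left
          Set.inter_subset_left)) hf' hu₁ (add_mem hu₂ he.1) hf₁ ?_ ?_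
        · have := sub_mem hf₂ he.2
          rwa [sub_sub, ← map_add] at this
        · rw [h3]
          convert neg_mem hue using 1
          abel
  have := key m
  rw [ht0, hm m le_rfl] at this
  have h5 : X ∩ q ⁻¹' Set.Icc (-r) r = X :=
    Set.inter_eq_left.2 fun x hx => hXr (Set.mem_image_of_mem q hx)
  rwa [h5] at this

theorem Ex.of_fibres {m : ℕ} {j₀ : ℕ} : ∀ {X : Set M} (_ : IsClosed X) {q : Fin m → M → ℝ}
    (_ : ∀ i, ContinuousOn (q i) X) (_ : ROpen X U)
    (_ : ∀ t : Fin m → ℝ, ∀ j, j₀ ≤ j → Ex p (X ∩ {x | ∀ i, q i x = t i}) U j) (j : ℕ)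
    (_ : j₀ = 0 ∨ j₀ + m ≤ j), Ex p X U j := by
  induction m with
  | zero =>
    intro X hX q hq hU h j hj
    have := h Fin.elim0 j (by omega)
    rwa [Set.inter_eq_left.2 fun x _ i => i.elim0] at this
  | succ m ih =>
    intro X hX q hq hU h j hj
    have hs : ∀ t j, (j₀ = 0 ∨ j₀ + m ≤ j) → Ex p (X ∩ q 0 ⁻¹' {t}) U j := fun t j hj => by
      refine ih ((hq 0).preimage_isClosed_of_isClosed hX isClosed_singleton)
        (q := fun i => q i.succ) (fun i => (hq i.succ).mono Set.inter_subset_left)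
        (hU.mono Set.inter_subset_left) (fun t' j hj => ?_) j hj
      have := h (Fin.cons t t') j hj
      convert this using 1
      ext x
      simp [Fin.forall_fin_succ, and_assoc]
    refine Ex.of_slices hX (hq 0) hU (fun t => hs t j (by omega)) fun i hi s t _ g hg => ?_
    exact ⟨0, zero_mem _, by simpa using hs s i (by omega) hg⟩

end Fn

namespace Fn

variable {p : ℕ} {M : Type*} [TopologicalSpace M] {X U : Set M}

theorem smul_one_mem_Cy [Fact p.Prime] (hX : IsClosed X) (h : X ⊆ U) (c : ZMod p) :
    c • (1 : Fn p M 0) ∈ Cy p X U 0 := by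
  refine Submodule.smul_mem _ c ⟨fun x hx => van_of_notMem hX _ fun hxX => hx (h hxX), ?_⟩
  change d (1 : Fn p M 0) ∈ K p X ∅ 1
  rw [d_one]
  exact zero_mem _

theorem mem_Bd_zero_of_apply (hX : IsClosed X) {f : Fn p M 0} (hf : f ∈ Cy p X U 0)
    (h : ∀ x ∈ X, f (fun _ => x) = 0) : f ∈ Bd p X U 0 := by
  refine mem_Bd_zero.2 fun x _ => ?_
  by_cases hx : x ∈ X
  · exact van_zero_of_d hx (hf.2 x (Set.notMem_empty _)) (h x hx)
  · exact van_of_notMem hX _ hx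

theorem ex_of_subsingleton (hX : IsClosed X) (h : X.Subsingleton) (j : ℕ) : Ex p X U (j + 1) := by
  intro f hf
  by_cases hU : ∀ x ∈ X, x ∉ U
  · exact ex_of_disjoint hX hU _ hf
  push Not at hU
  obtain ⟨x, hx, hxU⟩ := hU
  refine mem_Bd_succ.2 ⟨con x f, fun y hy => van_of_notMem hX _ fun hyX => hy (h hx hyX ▸ hxU),
    fun y _ => ?_⟩
  by_cases hy : y ∈ X
  · obtain rfl := h hx hy
    obtain ⟨V, hV, hxV, hV'⟩ := van_iff.1 (hf.2 x (Set.notMem_empty _))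
    refine van_iff.2 ⟨V, hV, hxV, fun s hs => ?_⟩
    have := hV' (Fin.cons x s) fun i => Fin.cases ⟨hxV, hx⟩ (fun k => hs k) i
    rwa [d_cons] at this
  · exact van_of_notMem hX _ hy

theorem apply_eq_of_preconnected (hX : IsPreconnected X) {f : Fn p M 0}
    (hf : f ∈ Cy p X U 0) {x y : M} (hx : x ∈ X) (hy : y ∈ X) :
    f (fun _ => x) = f (fun _ => y) := by
  have := isPreconnected_iff_preconnectedSpace.1 hX
  have h : IsLocallyConstant fun x : X => f fun _ => (x : M) := by
    rw [IsLocallyConstant.iff_eventually_eq]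
    intro x
    obtain ⟨V, hV, hxV, hV'⟩ := van_iff.1 (hf.2 x (Set.notMem_empty _))
    filter_upwards [(hV.preimage continuous_subtype_val).mem_nhds hxV] with y hy
    have := hV' (Fin.cons (x : M) fun _ => (y : M)) fun i =>
      Fin.cases ⟨hxV, x.2⟩ (fun _ => ⟨hy, y.2⟩) i
    rwa [d_cons_zero, sub_eq_zero] at this
  exact h.apply_eq_of_preconnectedSpace ⟨x, hx⟩ ⟨y, hy⟩

theorem ex_zero_of_preconnected (hX : IsClosed X) (hc : IsPreconnected X) {x : M} (hx : x ∈ X)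
    (hxU : x ∉ U) : Ex p X U 0 := fun _ hf => mem_Bd_zero_of_apply hX hf fun _ hy =>
  (apply_eq_of_preconnected hc hf hy hx).trans ((hf.1 x hxU).apply_eq_zero hx)

variable [CompactSpace M] [T2Space M]

omit [T2Space M] in
theorem isPreconnected_of_bijOn {E : Type*} [TopologicalSpace E] [T2Space E] (hX : IsClosed X)
    {r : M → E} (hr : ContinuousOn r X) {S : Set E} (hb : Set.BijOn r X S)
    (hS : IsPreconnected S) : IsPreconnected X := by
  have := isCompact_iff_compactSpace.1 hX.isCompact
  have h1 : Continuous (X.domRestrict r) := hr.domRestrict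
  have h2 := hS.preimage_of_isClosedMap (f := X.domRestrict r)
    (Set.injOn_iff_injective.1 hb.injOn) h1.isClosedMap
    (by rw [Set.range_domRestrict]; exact hb.image_eq.ge)
  have h3 : X.domRestrict r ⁻¹' S = Set.univ := Set.eq_univ_of_forall fun x => hb.mapsTo x.2
  rw [h3] at h2
  exact isPreconnected_iff_preconnectedSpace.2 ⟨h2⟩

/-- A half-open interval has no cohomology. -/
theorem ex_of_halfOpen [Fact p.Prime] (hX : IsClosed X) {r : M → ℝ} (hr : ContinuousOn r X)
    {α β : ℝ}
    (hb : Set.BijOn r X (Set.Icc α β)) (hU : ROpen X U) (hXU : ∀ x ∈ X, x ∈ U ↔ α < r x) (j : ℕ) :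
    Ex p X U j := by
  have hS := fun s hs => hr.preimage_isClosed_of_isClosed (t := s) hX hs
  have hss : ∀ t, (X ∩ r ⁻¹' {t}).Subsingleton := fun t x hx y hy =>
    hb.injOn hx.1 hy.1 (hx.2.trans hy.2.symm)
  cases j with
  | zero =>
    rcases Set.eq_empty_or_nonempty X with rfl | ⟨x, hx⟩
    · exact ex_of_disjoint hX (fun x hx => absurd hx (Set.notMem_empty x)) 0
    · have := hb.mapsTo hx
      obtain ⟨x₀, hx₀, h0⟩ := hb.surjOn (Set.left_mem_Icc.2 (this.1.trans this.2))
      exact ex_zero_of_preconnected hX (isPreconnected_of_bijOn hX hr hb isPreconnected_Icc) hx₀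
        fun h => ((hXU _ hx₀).1 h).ne h0.symm
  | succ j =>
    refine Ex.of_slices hX hr hU (fun t => ex_of_subsingleton (hS _ isClosed_singleton) (hss t) j)
      fun i hi s t _ g hg => ?_
    have h0 : ∀ h : g ∈ Bd p (X ∩ r ⁻¹' {s}) U i,
        ∃ e ∈ Cy p (X ∩ r ⁻¹' Set.Icc s t) U i, g - e ∈ Bd p (X ∩ r ⁻¹' {s}) U i :=
      fun h => ⟨0, zero_mem _, by rwa [sub_zero]⟩
    obtain rfl : i = j := by omega
    cases i with
    | succ i => exact h0 (ex_of_subsingleton (hS _ isClosed_singleton) (hss s) i hg)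
    | zero =>
      rcases le_or_gt s α with hsα | hsα
      · exact h0 (ex_of_disjoint (hS _ isClosed_singleton)
          (fun x hx hxU => (((hXU x hx.1).1 hxU).trans_eq hx.2).not_ge hsα) 0 hg)
      rcases Set.eq_empty_or_nonempty (X ∩ r ⁻¹' {s}) with he | ⟨x, hx⟩
      · exact h0 (ex_of_disjoint (hS _ isClosed_singleton)
          (fun x hx => absurd hx (he ▸ Set.notMem_empty x)) 0 hg)
      refine ⟨g (fun _ => x) • 1, smul_one_mem_Cy (hS _ isClosed_Icc)
        (fun y hy => (hXU y hy.1).2 (hsα.trans_le hy.2.1)) _, ?_⟩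
      refine mem_Bd_zero_of_apply (hS _ isClosed_singleton) (sub_mem hg (smul_one_mem_Cy
        (hS _ isClosed_singleton) (fun y hy => (hXU y hy.1).2 (hsα.trans_eq hy.2.symm)) _))
        fun y hy => ?_
      rw [hss s hy hx]
      simp

/-- Cohomology vanishes if the fibres of a map to a cube are half-open intervals. -/
theorem ex_of_halfOpen_fibres [Fact p.Prime] (hX : IsClosed X) {r : M → ℝ} (hr : ContinuousOn r X)
    {m : ℕ}
    {q : Fin m → M → ℝ} (hq : ∀ i, ContinuousOn (q i) X) (hU : ROpen X U) {α β : ℝ}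
    (h : ∀ t : Fin m → ℝ, (∀ x ∈ X, (∀ i, q i x = t i) → x ∉ U) ∨
      Set.BijOn r (X ∩ {x | ∀ i, q i x = t i}) (Set.Icc α β) ∧
        ∀ x ∈ X, (∀ i, q i x = t i) → (x ∈ U ↔ α < r x)) (j : ℕ) : Ex p X U j := by
  refine Ex.of_fibres (j₀ := 0) hX hq hU (fun t j _ => ?_) j (_root_.Or.inl rfl)
  have hF : IsClosed (X ∩ {x | ∀ i, q i x = t i}) := by
    have : X ∩ {x | ∀ i, q i x = t i} = X ∩ (fun x i => q i x) ⁻¹' {t} := by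
      ext x
      simp [funext_iff]
    rw [this]
    exact (continuousOn_pi.2 hq).preimage_isClosed_of_isClosed hX isClosed_singleton
  rcases h t with h | ⟨h1, h2⟩
  · exact ex_of_disjoint hF (fun x hx => h x hx.1 hx.2) j
  · exact ex_of_halfOpen hF (hr.mono Set.inter_subset_left) h1 (hU.mono Set.inter_subset_left)
      (fun x hx => h2 x hx.1 hx.2) j

/-- Cohomological dimension of subspaces of a cube. -/
theorem ex_of_injOn (hX : IsClosed X) {m : ℕ} {q : Fin m → M → ℝ}
    (hq : ∀ i, ContinuousOn (q i) X) (hi : Set.InjOn (fun x i => q i x) X) (hU : ROpen X U) {j : ℕ}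
    (hj : m ≤ j) : Ex p X U (j + 1) := by
  refine Ex.of_fibres (j₀ := 1) hX hq hU (fun t i hi' => ?_) (j + 1) (by omega)
  obtain ⟨i, rfl⟩ := Nat.exists_eq_add_of_le' hi'
  have : X ∩ {x | ∀ i, q i x = t i} = X ∩ (fun x i => q i x) ⁻¹' {t} := by
    ext x
    simp [funext_iff]
  rw [this]
  exact ex_of_subsingleton
    ((continuousOn_pi.2 hq).preimage_isClosed_of_isClosed hX isClosed_singleton)
    (fun x hx y hy => hi hx.1 hy.1 (hx.2.trans hy.2.symm)) i

end Fn

namespace Fn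

variable {p : ℕ} {M : Type*} [TopologicalSpace M] {X Y U V : Set M}

theorem K_congr (hX : IsClosed X) (h : ∀ x ∈ X, x ∈ U ↔ x ∈ V) (j : ℕ) : K p X U j = K p X V j :=
  le_antisymm (K_mono hX le_rfl (fun x hx => (h x hx).1) j)
    (K_mono hX le_rfl (fun x hx => (h x hx).2) j)

theorem Bd_congr (hX : IsClosed X) (h : ∀ x ∈ X, x ∈ U ↔ x ∈ V) (j : ℕ) :
    Bd p X U j = Bd p X V j :=
  le_antisymm (Bd_mono hX le_rfl (fun x hx => (h x hx).1) j)
    (Bd_mono hX le_rfl (fun x hx => (h x hx).2) j)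

theorem Cy_congr (hX : IsClosed X) (h : ∀ x ∈ X, x ∈ U ↔ x ∈ V) (j : ℕ) :
    Cy p X U j = Cy p X V j :=
  le_antisymm (Cy_mono hX le_rfl (fun x hx => (h x hx).1) j)
    (Cy_mono hX le_rfl (fun x hx => (h x hx).2) j)

theorem Ex.congr (hX : IsClosed X) (h : ∀ x ∈ X, x ∈ U ↔ x ∈ V) {j : ℕ} (hE : Ex p X U j) :
    Ex p X V j := by
  unfold Ex
  rw [← Cy_congr hX h, ← Bd_congr hX h]
  exact hE

/-- The cohomology of `X` with supports in `U` is that of a sphere of dimension `n`. -/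
structure Gen (p : ℕ) (X U : Set M) (n : ℕ) (f₀ : Fn p M n) : Prop where
  ex : ∀ j, j ≠ n → Ex p X U j
  cyc : f₀ ∈ Cy p X U n
  nbd : f₀ ∉ Bd p X U n
  span : ∀ f ∈ Cy p X U n, ∃ c : ZMod p, f - c • f₀ ∈ Bd p X U n

theorem Gen.congr (hX : IsClosed X) (h : ∀ x ∈ X, x ∈ U ↔ x ∈ V) {n : ℕ} {f₀ : Fn p M n}
    (hG : Gen p X U n f₀) : Gen p X V n f₀ where
  ex j hj := (hG.ex j hj).congr hX h
  cyc := Cy_congr (p := p) hX h n ▸ hG.cyc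
  nbd := Bd_congr (p := p) hX h n ▸ hG.nbd
  span := by
    rw [← Cy_congr hX h, ← Bd_congr hX h]
    exact hG.span

theorem Gen.of_excision (hX : IsClosed X) (hYX : Y ⊆ X)
    (hn : ∀ x ∈ X, x ∈ U → Y ∈ 𝓝[X] x)
    {n : ℕ} {f₀ : Fn p M n} (hG : Gen p Y U n f₀) : ∃ f₁, Gen p X U n f₁ := by
  obtain ⟨h1, h2⟩ := exists_ext (X := X) hG.cyc.1
  set f₁ := cut {s | ∀ i, s i ∈ Y} f₀
  have h3 : f₁ ∈ Cy p Y U n := by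
    rw [← sub_sub_cancel f₀ f₁]
    exact sub_mem hG.cyc (Bd_le_Cy (K_empty_le_Bd h2))
  refine ⟨f₁, fun j hj => (hG.ex j hj).of_excision hX hYX hn, ⟨h1, fun x _ => ?_⟩, fun h => ?_,
    fun f hf => ?_⟩
  · by_cases hxU : x ∈ U
    · by_cases hx : x ∈ X
      · obtain ⟨V, hV, h⟩ := h3.2 x (Set.notMem_empty _)
        exact ⟨V, nhdsWithin_le_of_mem (hn x hx hxU) hV, h⟩
      · exact van_of_notMem hX _ hx
    · exact (h1 x hxU).d
  · refine hG.nbd ?_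
    rw [← sub_add_cancel f₀ f₁]
    exact add_mem (K_empty_le_Bd h2) (Bd_mono hX hYX (fun _ _ h => h) n h)
  · obtain ⟨c, hc⟩ := hG.span f (Cy_mono hX hYX (fun _ _ h => h) n hf)
    refine ⟨c, bd_of_excision hX hn (sub_mem hf.1 (Submodule.smul_mem _ c h1)) ?_⟩
    have := add_mem hc (Submodule.smul_mem _ c (K_empty_le_Bd (U := U) h2))
    convert this using 1
    module

theorem gen_zero [Fact p.Prime] (hX : IsClosed X) {x : M} (hx : x ∈ X) (hs : X.Subsingleton)
    (hU : X ⊆ U) : Gen p X U 0 1 where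
  ex j hj := by
    obtain ⟨i, rfl⟩ := Nat.exists_eq_succ_of_ne_zero hj
    exact ex_of_subsingleton hX hs i
  cyc := by simpa using smul_one_mem_Cy (p := p) hX hU 1
  nbd h := one_ne_zero ((mem_Bd_zero.1 h x (Set.notMem_empty _)).apply_eq_zero hx)
  span f hf := by
    refine ⟨f fun _ => x, mem_Bd_zero_of_apply hX (sub_mem hf (smul_one_mem_Cy hX hU _))
      fun y hy => ?_⟩
    rw [hs hy hx]
    simp

/-- A closed subset identified with a cube. -/
structure Box {n : ℕ} (X : Set M) (q : Fin n → M → ℝ) (a b : Fin n → ℝ) : Prop where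
  closed : IsClosed X
  cont : ∀ i, ContinuousOn (q i) X
  bij : Set.BijOn (fun x i => q i x) X (Set.Icc a b)

/-- Open boxes. -/
def Wbox {n : ℕ} (q : Fin n → M → ℝ) (a b : Fin n → ℝ) : Set M :=
  {x | ∀ i, q i x ∈ Set.Ioo (a i) (b i)}

namespace Box

variable {n : ℕ} {q : Fin n → M → ℝ} {a b c e : Fin n → ℝ}

theorem ropen (h : Box X q a b) {O : Set (Fin n → ℝ)} (hO : IsOpen O) :
    ROpen X {x | (fun i => q i x) ∈ O} := fun x hx hxO =>
  (continuousOn_pi.2 h.cont x hx).preimage_mem_nhdsWithin (hO.mem_nhds hxO)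

theorem ropen_wbox (h : Box X q a b) (c e : Fin n → ℝ) : ROpen X (Wbox q c e) := by
  convert h.ropen (isOpen_set_pi Set.finite_univ
    fun i _ => isOpen_Ioo (a := c i) (b := e i)) using 1
  ext x
  simp [Wbox]

theorem sub (h : Box X q a b) (hac : a ≤ c) (heb : e ≤ b) :
    Box (X ∩ (fun x i => q i x) ⁻¹' Set.Icc c e) q c e where
  closed := (continuousOn_pi.2 h.cont).preimage_isClosed_of_isClosed h.closed isClosed_Icc
  cont i := (h.cont i).mono Set.inter_subset_left
  bij := by
    refine ⟨fun x hx => hx.2, h.bij.injOn.mono Set.inter_subset_left, fun t ht => ?_⟩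
    obtain ⟨x, hx, rfl⟩ := h.bij.surjOn (Set.Icc_subset_Icc hac heb ht)
    exact ⟨x, ⟨hx, ht⟩, rfl⟩

theorem neg (h : Box X q a b) : Box X (fun i x => -q i x) (-b) (-a) where
  closed := h.closed
  cont i := (h.cont i).neg
  bij := by
    refine ⟨fun x hx => ?_, fun x hx y hy hxy => h.bij.injOn hx hy ?_, fun t ht => ?_⟩
    · have := h.bij.mapsTo hx
      exact ⟨neg_le_neg this.2, neg_le_neg this.1⟩
    · funext i
      exact neg_injective (congrFun hxy i)
    · obtain ⟨x, hx, h⟩ := h.bij.surjOn (show -t ∈ Set.Icc a b from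
        ⟨le_neg_of_le_neg ht.2, neg_le_of_neg_le ht.1⟩)
      refine ⟨x, hx, funext fun i => ?_⟩
      have := congrFun h i
      simp only [Pi.neg_apply] at this ⊢
      rw [this, neg_neg]

theorem tail {q : Fin (n + 1) → M → ℝ} {a b : Fin (n + 1) → ℝ} (h : Box X q a b) {t : ℝ}
    (ht : t ∈ Set.Icc (a 0) (b 0)) :
    Box (X ∩ q 0 ⁻¹' {t}) (fun i => q i.succ) (fun i => a i.succ) (fun i => b i.succ) where
  closed := (h.cont 0).preimage_isClosed_of_isClosed h.closed isClosed_singleton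
  cont i := (h.cont i.succ).mono Set.inter_subset_left
  bij := by
    refine ⟨fun x hx => ?_, fun x hx y hy hxy => h.bij.injOn hx.1 hy.1 ?_, fun s hs => ?_⟩
    · have := h.bij.mapsTo hx.1
      exact ⟨fun i => this.1 i.succ, fun i => this.2 i.succ⟩
    · funext i
      exact Fin.cases (hx.2.trans hy.2.symm) (fun i => congrFun hxy i) i
    · obtain ⟨x, hx, h⟩ := h.bij.surjOn (show (Fin.cons t s : Fin (n + 1) → ℝ) ∈ Set.Icc a b from
        ⟨fun i => Fin.cases ht.1 (fun i => hs.1 i) i, fun i => Fin.cases ht.2 (fun i => hs.2 i) i⟩)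
      exact ⟨x, ⟨hx, congrFun h 0⟩, funext fun i => congrFun h i.succ⟩

end Box

variable [CompactSpace M] [T2Space M]

/-- Coboundary of a generator. -/
theorem Gen.suspend (hX : IsClosed X) (hY : IsClosed Y) (hYX : Y ⊆ X) (hU : ROpen X U) {n : ℕ}
    {g₀ : Fn p M n} (hG : Gen p Y U n g₀) (hE : ∀ j, Ex p X U j) :
    ∃ f₀, Gen p X (U \ Y) (n + 1) f₀ := by
  have hXY : ∀ i, K p X U i ≤ K p Y U i := fun i => K_mono hX hYX (fun _ _ h => h) i
  obtain ⟨v, hv, hvg, h⟩ := exists_primitive hX hY hYX hU (f := 0) (zero_mem _) hG.cyc.1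
    (by rw [zero_sub]; exact neg_mem hG.cyc.2) (fun x _ => by rw [map_zero]; exact Van.zero X _ x)
  rw [zero_sub, neg_mem_iff] at h
  refine ⟨d v, fun j hj => (hE j).diff hX hY hYX hU fun i hi => hG.ex i (by omega),
    ⟨h, ?_⟩, fun hb => ?_, fun f hf => ?_⟩
  · change d (d v) ∈ K p X ∅ _
    rw [d_d]
    exact zero_mem _
  · obtain ⟨w, hw, hvw⟩ := mem_Bd_succ.1 hb
    rw [← map_sub] at hvw
    have h1 := Bd_mono (V := U) hX hYX (fun _ _ h => h) n
      (hE n ⟨sub_mem hv (K_mono hX le_rfl (fun _ _ h => h.1) _ hw), hvw⟩)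
    have h2 : w ∈ K p Y ∅ n := by
      rw [← K_congr (U := U \ Y) hY fun x hx => by simp [hx]]
      exact K_mono hX hYX (fun _ _ h => h) n hw
    refine hG.nbd ?_
    have := sub_mem (add_mem h1 (K_empty_le_Bd h2)) (K_empty_le_Bd (U := U) hvg)
    convert this using 1
    abel
  · obtain ⟨w, hw, hfw⟩ := mem_Bd_succ.1 (hE (n + 1) (Cy_mono hX le_rfl (fun _ _ h => h.1) _ hf))
    obtain ⟨c, hc⟩ := hG.span w ⟨hXY n hw, fun x _ => by
      by_cases hx : x ∈ Y
      · simpa using ((hf.1 x fun h => h.2 hx).mono hYX).sub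
          ((hfw x (Set.notMem_empty _)).mono hYX)
      · exact van_of_notMem hY _ hx⟩
    refine ⟨c, bd_diff_of_sub_d hX hY hYX hU (sub_mem hf.1 (Submodule.smul_mem _ c h))
      (w := w - c • v) (sub_mem hw (Submodule.smul_mem _ c hv)) ?_ ?_⟩
    · convert hfw using 1
      rw [map_sub, map_smul]
      abel
    · have := sub_mem hc (Submodule.smul_mem _ c (K_empty_le_Bd (U := U) hvg))
      convert this using 1
      module

namespace Box

variable {n : ℕ} {q : Fin n → M → ℝ} {a b : Fin n → ℝ}

/-- Half-open boxes have no cohomology. -/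
theorem ex_half [Fact p.Prime] (h : Box X q a b) (k : Fin n) (hU : ROpen X U) {I : Fin n → Set ℝ}
    (hXU : ∀ x ∈ X, x ∈ U ↔ (∀ i, i ≠ k → q i x ∈ I i) ∧ a k < q k x) (j : ℕ) : Ex p X U j := by
  classical
  refine ex_of_halfOpen_fibres (α := a k) (β := b k) h.closed (h.cont k)
    (q := fun i => if i = k then 0 else q i)
    (fun i => ?_) hU (fun t => ?_) j
  · split_ifs
    · exact continuousOn_const
    · exact h.cont i
  by_cases ht : t k = 0 ∧ ∀ i, i ≠ k → t i ∈ I i ∧ t i ∈ Set.Icc (a i) (b i)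
  · refine _root_.Or.inr ⟨⟨fun x hx => ?_, fun x hx y hy hxy => h.bij.injOn hx.1 hy.1 ?_,
      fun s hs => ?_⟩, fun x hx hxt => ?_⟩
    · have := h.bij.mapsTo hx.1
      exact ⟨this.1 k, this.2 k⟩
    · funext i
      by_cases hi : i = k
      · rw [hi]
        exact hxy
      · have := (hx.2 i).trans (hy.2 i).symm
        rwa [if_neg hi] at this
    · obtain ⟨x, hx, hxs⟩ := h.bij.surjOn (show Function.update t k s ∈ Set.Icc a b by
        constructor
        · intro i
          by_cases hi : i = k
          · subst hi
            simpa using hs.1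
          · simpa [hi] using (ht.2 i hi).2.1
        · intro i
          by_cases hi : i = k
          · subst hi
            simpa using hs.2
          · simpa [hi] using (ht.2 i hi).2.2)
      refine ⟨x, ⟨hx, fun i => ?_⟩, ?_⟩
      · have := congrFun hxs i
        by_cases hi : i = k
        · subst hi
          simpa using ht.1.symm
        · simpa [hi] using this
      · have := congrFun hxs k
        simpa using this
    · rw [hXU x hx, and_iff_right]
      intro i hi
      have := hxt i
      rw [if_neg hi] at this
      rw [this]
      exact (ht.2 i hi).1
  · refine _root_.Or.inl fun x hx hxt hxU => ht ⟨?_, fun i hi => ?_⟩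
    · simpa using (hxt k).symm
    · have := hxt i
      rw [if_neg hi] at this
      rw [← this]
      have h1 := h.bij.mapsTo hx
      exact ⟨((hXU x hx).1 hxU).1 i hi, h1.1 i, h1.2 i⟩

theorem exists_gen [Fact p.Prime] : ∀ {n : ℕ} {X : Set M} {q : Fin n → M → ℝ} {a b : Fin n → ℝ}
    (_ : Box X q a b) (_ : ∀ i, a i < b i), ∃ f₀, Gen p X (Wbox q a b) n f₀ := by
  intro n
  induction n with
  | zero =>
    intro X q a b h _
    obtain ⟨x, hx, -⟩ := h.bij.surjOn (show a ∈ Set.Icc a b from ⟨le_rfl, fun i => i.elim0⟩)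
    exact ⟨1, gen_zero h.closed hx (fun y hy z hz => h.bij.injOn hy hz (Subsingleton.elim _ _))
      fun y _ i => i.elim0⟩
  | succ n ih =>
    intro X q a b h hab
    have hY := h.tail (t := b 0) ⟨(hab 0).le, le_rfl⟩
    obtain ⟨g₀, hg⟩ := ih hY fun i => hab i.succ
    set U : Set M := {x | (∀ i, i ≠ 0 → q i x ∈ Set.Ioo (a i) (b i)) ∧ a 0 < q 0 x} with hU
    have hUo : ROpen X U := by
      have h1 : IsOpen ((⋂ i : Fin (n + 1), ⋂ (_ : i ≠ 0),
          (fun t : Fin (n + 1) → ℝ => t i) ⁻¹' Set.Ioo (a i) (b i)) ∩ {t | a 0 < t 0}) :=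
        (isOpen_iInter_of_finite fun i => isOpen_iInter_of_finite fun _ =>
          isOpen_Ioo.preimage (continuous_apply i)).inter
            (isOpen_lt continuous_const (continuous_apply 0))
      convert h.ropen h1 using 1
      ext x
      simp [hU]
    obtain ⟨f₀, hf⟩ := (hg.congr (V := U) hY.closed fun x hx => by
      have h0 : q 0 x = b 0 := hx.2
      simp only [Wbox, hU, Set.mem_ofPred_eq, Fin.forall_fin_succ, h0, hab 0]
      simp).suspend h.closed hY.closed Set.inter_subset_left hUo
      (h.ex_half 0 hUo fun x _ => Iff.rfl)
    refine ⟨f₀, hf.congr h.closed fun x hx => ?_⟩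
    have h1 := (h.bij.mapsTo hx).2 0
    simp only at h1
    simp only [Wbox, hU, Set.mem_ofPred_eq, Fin.forall_fin_succ, Set.mem_sdiff, Set.mem_inter_iff, hx,
      Set.mem_preimage, Set.mem_singleton_iff, Set.mem_Ioo]
    simp only [ne_eq, not_true_eq_false, false_imp_iff, Fin.succ_ne_zero, not_false_eq_true,
      true_imp_iff, true_and]
    constructor
    · rintro ⟨⟨h2, h3⟩, h4⟩
      exact ⟨⟨h3, lt_of_le_of_ne h1 h4⟩, h2⟩
    · rintro ⟨⟨h2, h3⟩, h4⟩
      exact ⟨⟨h4, h2⟩, h3.ne⟩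

end Box

end Fn

namespace Fn

theorem mem_cyc_iff {p : ℕ} [Fact p.Prime] {M : Type u} [TopologicalSpace M] {X : Set M}
    {l : Filter M} {N : ℕ} {φ : LZ p X N} :
    lmk ∅ l φ ∈ (L0 p ∅ X l).cyc N ↔ ∃ U ∈ l, ∀ f ∈ Bd p X U N, φ.1 f = 0 := by
  cases N with
  | zero =>
    refine iff_of_true trivial ⟨Set.univ, Filter.univ_mem, fun f hf => ?_⟩
    exact mem_LZ.1 φ.2 f (mem_Bd_zero.1 hf)
  | succ N =>
    rw [mem_L0_cyc_succ]
    refine exists_congr fun U => and_congr_right fun _ => ⟨fun h f hf => ?_, fun h f hf => ?_⟩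
    · obtain ⟨u, hu, hfu⟩ := mem_Bd_succ.1 hf
      have := mem_LZ.1 φ.2 _ hfu
      rwa [map_sub, h u ⟨mem_K_empty _ _, hu⟩, sub_zero] at this
    · exact h _ (mem_Bd_succ.2 ⟨f, hf.2, by rw [sub_self]; exact zero_mem _⟩)

theorem mem_bd_iff {p : ℕ} [Fact p.Prime] {M : Type u} [TopologicalSpace M] {X : Set M}
    {l : Filter M} {N : ℕ} {φ : LZ p X N} :
    lmk ∅ l φ ∈ (L0 p ∅ X l).bd N ↔ ∃ U ∈ l, ∀ f ∈ Cy p X U N, φ.1 f = 0 := by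
  rw [mem_L0_bd]
  constructor
  · rintro ⟨ψ, U, hU, h⟩
    refine ⟨U, hU, fun f hf => ?_⟩
    rw [h f ⟨mem_K_empty _ _, hf.1⟩]
    exact mem_LZ.1 ψ.2 _ hf.2
  · rintro ⟨U, hU, h⟩
    obtain ⟨ψ, hψ, h'⟩ := exists_dual_of_ker (K p X U N)
      (d : Fn p M N →ₗ[ZMod p] Fn p M (N + 1)) (K p X ∅ (N + 1)) φ.1 fun f hf hd => h f ⟨hf, hd⟩
    exact ⟨⟨ψ, hψ⟩, U, hU, fun f hf => (h' f hf.2).symm⟩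

variable {p : ℕ} [Fact p.Prime] {M : Type u} [TopologicalSpace M]

theorem conc_of_gen {X : Set M} (hX : IsClosed X) {l : Filter M} {n : ℕ} (φ : LZ p X n)
    {U₀ : Set M} (hU₀ : U₀ ∈ l) (hφ : ∀ f ∈ Bd p X U₀ n, φ.1 f = 0)
    (h : ∀ U ∈ l, ∃ V ∈ l, V ⊆ U ∧ ∃ f₁, Gen p X V n f₁ ∧ φ.1 f₁ ≠ 0) :
    (L0 p ∅ X l).Conc n (lmk ∅ l φ) where
  acyc j hj x hx := by
    obtain ⟨ψ, rfl⟩ := lmk_surj _ l x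
    obtain ⟨U, hU, hψ⟩ := mem_cyc_iff.1 hx
    obtain ⟨V, hV, hVU, f₁, hf, -⟩ := h U hU
    exact mem_bd_iff.2 ⟨V, hV, fun f hf' =>
      hψ f (Bd_mono hX le_rfl (fun _ _ h => hVU h) j (hf.ex j hj hf'))⟩
  cyc := mem_cyc_iff.2 ⟨U₀, hU₀, hφ⟩
  nbd hb := by
    obtain ⟨U, hU, hψ⟩ := mem_bd_iff.1 hb
    obtain ⟨V, hV, hVU, f₁, hf, h1⟩ := h U hU
    exact h1 (hψ f₁ (Cy_mono hX le_rfl (fun _ _ h => hVU h) n hf.cyc))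
  span x hx := by
    obtain ⟨ψ, rfl⟩ := lmk_surj _ l x
    obtain ⟨U, hU, hψ⟩ := mem_cyc_iff.1 hx
    obtain ⟨V, hV, hVU, f₁, hf, h1⟩ := h _ (Filter.inter_mem hU hU₀)
    refine ⟨ψ.1 f₁ / φ.1 f₁, ?_⟩
    refine (mem_bd_iff (φ := ψ - (ψ.1 f₁ / φ.1 f₁) • φ)).2 ⟨V, hV, fun f hf' => ?_⟩
    obtain ⟨c, hc⟩ := hf.span f hf'
    have h2 := hψ _ (Bd_mono hX le_rfl (fun _ _ h => (hVU h).1) n hc)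
    have h3 := hφ _ (Bd_mono hX le_rfl (fun _ _ h => (hVU h).2) n hc)
    rw [map_sub, map_smul, sub_eq_zero] at h2 h3
    change ψ.1 f - (ψ.1 f₁ / φ.1 f₁) • φ.1 f = 0
    rw [h2, h3]
    simp only [smul_eq_mul]
    field_simp
    ring

namespace Box

variable {X : Set M} {n : ℕ} {q : Fin n → M → ℝ} {a b c c' e : Fin n → ℝ}

omit [TopologicalSpace M] in
theorem wbox_neg (q : Fin n → M → ℝ) (c e : Fin n → ℝ) :
    Wbox (fun i x => -q i x) (-e) (-c) = Wbox q c e := by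
  ext x
  simp [Wbox, and_comm]

omit [TopologicalSpace M] in
theorem wbox_mono {e' : Fin n → ℝ} (hc : c ≤ c') (he : e' ≤ e) : Wbox q c' e' ⊆ Wbox q c e :=
  fun _ hx i => ⟨(hc i).trans_lt (hx i).1, (hx i).2.trans_le (he i)⟩

variable [CompactSpace M] [T2Space M]

theorem bd_update (h : Box X q a b) (hac : a ≤ c) (k : Fin n) {s : ℝ} (hcs : c k ≤ s)
    (hse : s < e k) (hsb : s ≤ b k) {j : ℕ} {f : Fn p M j}
    (hf : f ∈ K p X (Wbox q (Function.update c k s) e) j) (hfc : f ∈ Bd p X (Wbox q c e) j) :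
    f ∈ Bd p X (Wbox q (Function.update c k s) e) j := by
  have hX := h.closed
  have hY : IsClosed (X ∩ q k ⁻¹' Set.Iic s) :=
    (h.cont k).preimage_isClosed_of_isClosed hX isClosed_Iic
  have hW : ∀ x ∈ X, x ∈ Wbox q c e \ (X ∩ q k ⁻¹' Set.Iic s) ↔
      x ∈ Wbox q (Function.update c k s) e := by
    intro x hx
    simp only [Wbox, Set.mem_sdiff, Set.mem_inter_iff, hx, true_and, Set.mem_preimage, Set.mem_Iic,
      not_le, Set.mem_ofPred_eq]
    constructor
    · rintro ⟨h1, h2⟩ i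
      by_cases hi : i = k
      · subst hi
        simpa using ⟨h2, (h1 i).2⟩
      · simpa [hi] using h1 i
    · refine fun h1 => ⟨fun i => ?_, ?_⟩
      · have := h1 i
        by_cases hi : i = k
        · subst hi
          rw [Function.update_self] at this
          exact ⟨hcs.trans_lt this.1, this.2⟩
        · simpa [hi] using this
      · simpa using (h1 k).1
  rw [← K_congr hX hW] at hf
  rw [← Bd_congr hX hW]
  refine bd_diff hX hY Set.inter_subset_left (h.ropen_wbox c e) hf hfc fun i _ => ?_
  have hZ := h.sub (c := Function.update a k (c k)) (e := Function.update b k s)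
    (le_update_iff.2 ⟨hac k, fun _ _ => le_rfl⟩) (update_le_iff.2 ⟨hsb, fun _ _ => le_rfl⟩)
  refine (hZ.ex_half k (hZ.ropen_wbox c e) (I := fun i => Set.Ioo (c i) (e i))
    (fun x hx => ⟨fun hx' => ⟨fun i _ => hx' i, ?_⟩, fun hx' i => ?_⟩) i).of_excision hY ?_ ?_
  · simpa using (hx' k).1
  · by_cases hi : i = k
    · subst hi
      have h1 := hx.2.2 i
      have h2 := hx'.2
      simp only [Function.update_self] at h1 h2
      exact ⟨h2, h1.trans_lt hse⟩
    · exact hx'.1 i hi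
  · refine fun x hx => ⟨hx.1, ?_⟩
    have h1 := hx.2.2 k
    simp only [Function.update_self] at h1
    exact h1
  · intro x hx hxW
    have h1 : q k ⁻¹' Set.Ioi (c k) ∈ 𝓝[X ∩ q k ⁻¹' Set.Iic s] x :=
      ((h.cont k).mono Set.inter_subset_left x hx).preimage_mem_nhdsWithin
        (isOpen_Ioi.mem_nhds (hxW k).1)
    filter_upwards [h1, self_mem_nhdsWithin] with y hy hyY
    have h2 := h.bij.mapsTo hyY.1
    refine ⟨hyY.1, update_le_iff.2 ⟨le_of_lt hy, fun i _ => h2.1 i⟩,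
      le_update_iff.2 ⟨hyY.2, fun i _ => h2.2 i⟩⟩

theorem bd_lower (h : Box X q a b) (hac : a ≤ c) (hcc : c ≤ c') (hce : ∀ i, c' i < e i)
    (hcb : c' ≤ b) {j : ℕ} {f : Fn p M j} (hf : f ∈ K p X (Wbox q c' e) j)
    (hfc : f ∈ Bd p X (Wbox q c e) j) : f ∈ Bd p X (Wbox q c' e) j := by
  classical
  have key : ∀ S : Finset (Fin n), f ∈ Bd p X (Wbox q (S.piecewise c' c) e) j := by
    intro S
    induction S using Finset.induction_on with
    | empty => simpa using hfc
    | insert k S hk ih =>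
      have h1 : S.piecewise c' c ≤ c' := S.piecewise_le_of_le_of_le le_rfl hcc
      have h2 : (insert k S).piecewise c' c ≤ c' :=
        Finset.piecewise_le_of_le_of_le _ le_rfl hcc
      rw [Finset.piecewise_insert] at h2 ⊢
      exact h.bd_update (hac.trans (S.le_piecewise_of_le_of_le hcc le_rfl)) k (h1 k) (hce k) (hcb k)
        (K_le_sup (wbox_mono h2 le_rfl) j hf) ih
  simpa using key Finset.univ

theorem bd_nested (h : Box X q a b) (hac : a ≤ c) (hce : ∀ i, c i < e i) (heb : e ≤ b) {j : ℕ}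
    {f : Fn p M j} (hf : f ∈ K p X (Wbox q c e) j) (hfa : f ∈ Bd p X (Wbox q a b) j) :
    f ∈ Bd p X (Wbox q c e) j := by
  have h1 : f ∈ Bd p X (Wbox q c b) j :=
    h.bd_lower le_rfl hac (fun i => (hce i).trans_le (heb i)) (fun i => (hce i).le.trans (heb i))
      (K_le_sup (wbox_mono le_rfl heb) j hf) hfa
  rw [← wbox_neg] at h1 hf ⊢
  exact h.neg.bd_lower le_rfl (neg_le_neg heb) (fun i => neg_lt_neg (hce i))
    (fun i => neg_le_neg ((hac i).trans (hce i).le)) hf h1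

omit [T2Space M] in
theorem exists_wbox (h : Box X q a b) {y : M} (hy : y ∈ X) (hyW : y ∈ Wbox q a b) {U : Set M}
    (hU : U ∈ 𝓝 y) : ∃ c e, a ≤ c ∧ e ≤ b ∧ (∀ i, c i < e i) ∧ y ∈ Wbox q c e ∧
      X ∩ Wbox q c e ⊆ U := by
  have hQ := continuousOn_pi.2 h.cont
  have hC : IsCompact ((fun x i => q i x) '' (X \ interior U)) :=
    (h.closed.sdiff isOpen_interior).isCompact.image_of_continuousOn (hQ.mono Set.sdiff_subset)
  have hyC : (fun i => q i y) ∉ (fun x i => q i x) '' (X \ interior U) := by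
    rintro ⟨x, hx, hxy⟩
    have := h.bij.injOn hx.1 hy hxy
    subst this
    exact hx.2 (mem_interior_iff_mem_nhds.2 hU)
  have hO := (isOpen_set_pi Set.finite_univ fun i _ => isOpen_Ioo (a := a i) (b := b i)).inter
    hC.isClosed.isOpen_compl
  obtain ⟨ε, hε, hb⟩ := Metric.nhds_basis_closedBall.mem_iff.1
    (hO.mem_nhds ⟨fun i _ => hyW i, hyC⟩)
  have hm : ∀ t : Fin n → ℝ, (∀ i, |t i - q i y| ≤ ε) → t ∈ Metric.closedBall (fun i => q i y) ε :=
    fun t ht => (dist_pi_le_iff hε.le).2 ht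
  refine ⟨fun i => q i y - ε, fun i => q i y + ε, fun i => ?_, fun i => ?_, fun i => by linarith,
    fun i => by constructor <;> linarith, fun x hx => ?_⟩
  · exact ((hb (hm (fun i => q i y - ε) fun i => by simp [abs_of_pos hε])).1 i trivial).1.le
  · exact ((hb (hm (fun i => q i y + ε) fun i => by simp [abs_of_pos hε])).1 i trivial).2.le
  · by_contra hxU
    refine (hb (hm (fun i => q i x) fun i => ?_)).2
      ⟨x, ⟨hx.1, fun h => hxU (interior_subset h)⟩, rfl⟩
    have := hx.2 i
    exact abs_le.2 ⟨by linarith [this.1], by linarith [this.2]⟩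

/-- Manifolds are locally orientable. -/
theorem or (h : Box X q a b) (hab : ∀ i, a i < b i) (hX : ∀ x ∈ X, x ∈ Wbox q a b → X ∈ 𝓝 x)
    {x : M} (hx : x ∈ X) (hxW : x ∈ Wbox q a b) : Or p (Set.univ : Set M) x n := by
  have hn : ∀ c e, a ≤ c → e ≤ b → ∀ x ∈ X, x ∈ Wbox q c e → X ∈ 𝓝 x := fun c e hc he x hx hxW =>
    hX x hx (wbox_mono hc he hxW)
  have hV : ∀ c e, a ≤ c → e ≤ b → ∀ x ∈ X, x ∈ Wbox q c e → X ∩ Wbox q c e ∈ 𝓝 x := by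
    intro c e hc he x hx hxW
    have h1 := hn c e hc he x hx hxW
    have h2 := h.ropen_wbox c e x hx hxW
    rw [nhdsWithin_eq_nhds.2 h1] at h2
    exact Filter.inter_mem h1 h2
  have hG : ∀ c e, a ≤ c → e ≤ b → (∀ i, c i < e i) →
      ∃ f₁, Gen p Set.univ (X ∩ Wbox q c e) n f₁ := by
    intro c e hc he hce
    obtain ⟨f₀, hf⟩ := (h.sub hc he).exists_gen (p := p) hce
    obtain ⟨f₁, hf⟩ := hf.of_excision h.closed Set.inter_subset_left fun x hx hxW => by
      filter_upwards [h.ropen_wbox c e x hx hxW, self_mem_nhdsWithin] with y hy hyX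
      exact ⟨hyX, fun i => (hy i).1.le, fun i => (hy i).2.le⟩
    exact (hf.congr (V := X ∩ Wbox q c e) h.closed fun x hx => by simp [hx]).of_excision
      isClosed_univ (Set.subset_univ _) fun x _ hx =>
        mem_nhdsWithin_of_mem_nhds (hn c e hc he x hx.1 hx.2)
  obtain ⟨f₀, hf₀⟩ := hG a b le_rfl le_rfl hab
  obtain ⟨φ, hφ1, hφ⟩ := Submodule.exists_le_ker_of_notMem hf₀.nbd
  have hφ' : ∀ f ∈ Bd p Set.univ (X ∩ Wbox q a b) n, φ f = 0 := fun f hf => hφ hf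
  refine ⟨⟨φ, mem_LZ.2 fun f hf => hφ' f (K_empty_le_Bd hf)⟩, ?_⟩
  filter_upwards [hV a b le_rfl le_rfl x hx hxW] with y hy _
  refine conc_of_gen isClosed_univ _ (hV a b le_rfl le_rfl y hy.1 hy.2) hφ' fun U hU => ?_
  obtain ⟨c, e, hac, heb, hce, hyW, hU⟩ := h.exists_wbox hy.1 hy.2 hU
  obtain ⟨f₁, hf₁⟩ := hG c e hac heb hce
  refine ⟨_, hV c e hac heb y hy.1 hyW, hU, f₁, hf₁, fun h0 => hf₁.nbd ?_⟩
  have hW : ∀ x, x ∈ X ∩ Wbox q c e → x ∈ X ∩ Wbox q a b := fun x hx =>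
    ⟨hx.1, wbox_mono hac heb hx.2⟩
  obtain ⟨t, ht⟩ := hf₀.span f₁ (Cy_mono isClosed_univ le_rfl (fun x _ => hW x) n hf₁.cyc)
  have h1 := hφ' _ ht
  change φ f₁ = 0 at h0
  rw [map_sub, map_smul, h0, zero_sub, neg_eq_zero, smul_eq_mul] at h1
  rw [(mul_eq_zero.1 h1).resolve_right hφ1, zero_smul, sub_zero] at ht
  have h2 : f₁ ∈ Bd p X (Wbox q a b) n :=
    Bd_mono isClosed_univ (Set.subset_univ X) (fun x _ hx => hx.2) n ht
  have h3 := h.bd_nested hac hce heb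
    (K_mono isClosed_univ (Set.subset_univ X) (fun x _ hx => hx.2) n hf₁.cyc.1) h2
  refine bd_of_excision isClosed_univ (fun x _ hx => mem_nhdsWithin_of_mem_nhds
    (hn c e hac heb x hx.1 hx.2)) hf₁.cyc.1 ?_
  exact Bd_mono (V := X ∩ Wbox q c e) h.closed le_rfl (fun x hx hxW => ⟨hx, hxW⟩) n h3

end Box

end Fn

namespace Fn

section Fdm

variable {k : Type*} [Field k] {V V' : Type*} [AddCommGroup V] [Module k V] [AddCommGroup V']
    [Module k V']

/-- `S` is finite-dimensional modulo `T`. -/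
def Fdm (S T : Submodule k V) : Prop :=
  ∃ N : Submodule k V, FiniteDimensional k (V ⧸ N) ∧ ∀ v ∈ S, v ∈ N → v ∈ T

variable {S S' T T' : Submodule k V}

theorem Fdm.of_map {W : Type*} [AddCommGroup W] [Module k W] [FiniteDimensional k W] (g : V →ₗ[k] W)
    (h : ∀ v ∈ S, g v = 0 → v ∈ T) : Fdm S T :=
  ⟨LinearMap.ker g, Module.Finite.equiv g.quotKerEquivRange.symm, h⟩

theorem fdm_of_le (h : S ≤ T) : Fdm S T := ⟨⊤, inferInstance, fun _ hv _ => h hv⟩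

theorem Fdm.mono (h : Fdm S T) (hS : S' ≤ S) (hT : T ≤ T') : Fdm S' T' := by
  obtain ⟨N, hN, h⟩ := h
  exact ⟨N, hN, fun v hv hvN => hT (h v (hS hv) hvN)⟩

theorem Fdm.comap {S' T' : Submodule k V'} (h : Fdm S' T') (F : V →ₗ[k] V') (hS : S ≤ S'.comap F) :
    Fdm S (S ⊓ T'.comap F) := by
  obtain ⟨N, hN, h⟩ := h
  exact .of_map (N.mkQ ∘ₗ F) fun v hv h0 =>
    ⟨hv, h _ (hS hv) ((Submodule.Quotient.mk_eq_zero N).1 h0)⟩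

theorem Fdm.trans (h : Fdm S S') (h' : Fdm S' T) : Fdm S T := by
  obtain ⟨N, hN, h⟩ := h
  obtain ⟨N', hN', h'⟩ := h'
  refine .of_map (N.mkQ.prod N'.mkQ) fun v hv h0 => ?_
  rw [LinearMap.prod_apply, Function.prod_apply, Prod.mk_eq_zero] at h0
  exact h' v (h v hv ((Submodule.Quotient.mk_eq_zero N).1 h0.1))
    ((Submodule.Quotient.mk_eq_zero N').1 h0.2)

theorem Fdm.exists_le_sup (h : Fdm S T) : ∃ R ≤ S, FiniteDimensional k R ∧ S ≤ R ⊔ T := by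
  obtain ⟨N, hN, h⟩ := h
  obtain ⟨s, hs⟩ := (N.mkQ ∘ₗ S.subtype).rangeRestrict.exists_rightInverse_of_surjective
    (LinearMap.range_rangeRestrict _)
  refine ⟨LinearMap.range (S.subtype ∘ₗ s), ?_, inferInstance, fun v hv => ?_⟩
  · rintro _ ⟨x, rfl⟩
    exact (s x).2
  · set r := s ((N.mkQ ∘ₗ S.subtype).rangeRestrict ⟨v, hv⟩) with hr
    have h1 : N.mkQ r.1 = N.mkQ v := by
      have := LinearMap.congr_fun hs ((N.mkQ ∘ₗ S.subtype).rangeRestrict ⟨v, hv⟩)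
      exact congrArg Subtype.val this
    refine Submodule.mem_sup.2 ⟨r.1, ⟨_, rfl⟩, v - r.1, h _ (sub_mem hv r.2) ?_, by abel⟩
    rw [← Submodule.Quotient.mk_eq_zero, Submodule.Quotient.mk_sub, sub_eq_zero]
    exact h1.symm

theorem fdm_of_le_sup {R : Submodule k V} [FiniteDimensional k R] (h : S ≤ R ⊔ T) : Fdm S T := by
  obtain ⟨g, hg⟩ := (R.map T.mkQ).subtype.exists_leftInverse_of_injective
    (LinearMap.ker_eq_bot.2 Subtype.val_injective)
  refine .of_map (g ∘ₗ T.mkQ) fun v hv h0 => ?_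
  obtain ⟨r, hr, t, ht, rfl⟩ := Submodule.mem_sup.1 (h hv)
  have h1 : T.mkQ (r + t) = T.mkQ r := by
    rw [map_add, show T.mkQ t = 0 from (Submodule.Quotient.mk_eq_zero T).2 ht, add_zero]
  have h2 := LinearMap.congr_fun hg ⟨T.mkQ r, r, hr, rfl⟩
  rw [LinearMap.comp_apply, h1] at h0
  have h3 := congrArg Subtype.val (h2.symm.trans h0)
  refine add_mem ((Submodule.Quotient.mk_eq_zero T).1 h3) ht

theorem Fdm.map (h : Fdm S T) (F : V →ₗ[k] V') : Fdm (S.map F) (T.map F) := by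
  obtain ⟨R, -, hR, h⟩ := h.exists_le_sup
  exact fdm_of_le_sup (R := R.map F) ((Submodule.map_mono h).trans (Submodule.map_sup R T F).le)

theorem Fdm.inf (h : Fdm S T) (h' : Fdm S T') : Fdm S (S ⊓ (T ⊓ T')) := by
  obtain ⟨N, hN, h⟩ := h
  obtain ⟨N', hN', h'⟩ := h'
  refine .of_map (N.mkQ.prod N'.mkQ) fun v hv h0 => ?_
  rw [LinearMap.prod_apply, Function.prod_apply, Prod.mk_eq_zero] at h0
  exact ⟨hv, h v hv ((Submodule.Quotient.mk_eq_zero N).1 h0.1),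
    h' v hv ((Submodule.Quotient.mk_eq_zero N').1 h0.2)⟩

end Fdm

variable {p : ℕ} [Fact p.Prime] {M : Type*} [TopologicalSpace M] [CompactSpace M] [T2Space M]

theorem Box.fdm : ∀ {n : ℕ} {X : Set M} {q : Fin n → M → ℝ} {a b : Fin n → ℝ} (_ : Box X q a b)
    (_ : a ≤ b) (j : ℕ), Fdm (Cy p X Set.univ j) (Bd p X Set.univ j) := by
  intro n
  induction n with
  | zero =>
    intro X q a b h hab j
    have hs : X.Subsingleton := fun x hx y hy => h.bij.injOn hx hy (Subsingleton.elim _ _)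
    cases j with
    | zero =>
      obtain ⟨x, hx, -⟩ := h.bij.surjOn (Set.left_mem_Icc.2 hab)
      refine .of_map (LinearMap.proj fun _ => x : Fn p M 0 →ₗ[ZMod p] ZMod p) fun f hf h0 => ?_
      refine mem_Bd_zero_of_apply h.closed hf fun y hy => ?_
      rw [hs hy hx]
      exact h0
    | succ j => exact fdm_of_le (ex_of_subsingleton h.closed hs j)
  | succ n ih =>
    intro X q a b h hab j
    have ht := h.tail (t := a 0) ⟨le_rfl, hab 0⟩
    refine ((ih ht (fun i => hab i.succ) j).comap LinearMap.id
      (Cy_mono h.closed Set.inter_subset_left (fun _ _ h => h) j)).mono le_rfl fun f hf => ?_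
    refine bd_of_ex_diff h.closed ht.closed Set.inter_subset_left (ropen_of_isOpen isOpen_univ)
      (h.ex_half 0 (I := fun _ => Set.univ) ?_ (fun x hx => ?_) j) hf.1 hf.2
    · refine ROpen.mono (ropen_of_isOpen (X := Set.univ) ?_) (Set.subset_univ _)
      exact isOpen_univ.sdiff ht.closed
    · have h1 : a 0 ≤ q 0 x := (h.bij.mapsTo hx).1 0
      have h2 : a 0 < q 0 x ↔ q 0 x ≠ a 0 := lt_iff_le_and_ne.trans
        ⟨fun h => h.2.symm, fun h => ⟨h1, h.symm⟩⟩
      rw [h2]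
      simp [hx]

theorem fdm_union_succ {A₁ A₂ B₁ B₂ C : Set M} (h₁ : IsClosed A₁) (h₂ : IsClosed A₂)
    (h₁' : IsClosed B₁)
    (h₂' : IsClosed B₂) (hC : IsClosed C) (hBA₁ : B₁ ⊆ A₁) (hBA₂ : B₂ ⊆ A₂) (hAC₁ : A₁ ⊆ C)
    (hAC₂ : A₂ ⊆ C) {j : ℕ} (hf₁ : Fdm (Cy p C Set.univ (j + 1)) (Bd p A₁ Set.univ (j + 1)))
    (hf₂ : Fdm (Cy p C Set.univ (j + 1)) (Bd p A₂ Set.univ (j + 1)))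
    (hj : Fdm (Cy p (A₁ ∩ A₂) Set.univ j) (Bd p (B₁ ∩ B₂) Set.univ j)) :
    Fdm (Cy p C Set.univ (j + 1)) (Bd p (B₁ ∪ B₂) Set.univ (j + 1)) := by
  set V := Fn p M (j + 1) × Fn p M j × Fn p M j
  let π : V →ₗ[ZMod p] Fn p M (j + 1) := LinearMap.fst _ _ _
  let π₁ : V →ₗ[ZMod p] Fn p M j := LinearMap.fst _ _ _ ∘ₗ LinearMap.snd _ _ _
  let π₂ : V →ₗ[ZMod p] Fn p M j := LinearMap.snd _ _ _ ∘ₗ LinearMap.snd _ _ _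
  set Γ : Submodule (ZMod p) V := (Cy p C Set.univ (j + 1)).comap π ⊓
    ((K p A₁ ∅ (j + 1)).comap (π - d ∘ₗ π₁) ⊓ (K p A₂ ∅ (j + 1)).comap (π - d ∘ₗ π₂)) with hΓ
  have hA : IsClosed (A₁ ∩ A₂) := h₁.inter h₂
  have huniv : ∀ {X : Set M} (f : Fn p M j), f ∈ K p X Set.univ j := fun f x hx =>
    absurd (Set.mem_univ x) hx
  have hF : Γ ≤ (Cy p (A₁ ∩ A₂) Set.univ j).comap (π₂ - π₁) := by
    rintro ⟨f, u₁, u₂⟩ ⟨-, hu₁, hu₂⟩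
    refine ⟨huniv _, ?_⟩
    change d (u₂ - u₁) ∈ K p (A₁ ∩ A₂) ∅ (j + 1)
    have := sub_mem (K_mono h₁ Set.inter_subset_left (fun _ _ h => h) (j + 1) hu₁)
      (K_mono h₂ Set.inter_subset_right (fun _ _ h => h) (j + 1) hu₂)
    convert this using 1
    change _ = (f - d u₁) - (f - d u₂)
    rw [map_sub]
    abel
  refine (hf₁.inf hf₂).trans (((hj.comap _ hF).map π).mono ?_ ?_)
  · rintro f ⟨hf, hf1, hf2⟩
    obtain ⟨u₁, -, hu₁⟩ := mem_Bd_succ.1 hf1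
    obtain ⟨u₂, -, hu₂⟩ := mem_Bd_succ.1 hf2
    exact ⟨(f, u₁, u₂), ⟨hf, hu₁, hu₂⟩, rfl⟩
  · rintro _ ⟨⟨f, u₁, u₂⟩, ⟨⟨hf, hu₁, hu₂⟩, hu⟩, rfl⟩
    exact bd_union h₁' h₂' (ropen_of_isOpen isOpen_univ)
      (Cy_mono hC (Set.union_subset (hBA₁.trans hAC₁) (hBA₂.trans hAC₂)) (fun _ _ h => h) _ hf)
      (huniv _) (huniv _) (K_mono h₁ hBA₁ (fun _ _ h => h) (j + 1) hu₁)
      (K_mono h₂ hBA₂ (fun _ _ h => h) (j + 1) hu₂) hu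

omit [CompactSpace M] [T2Space M] in
theorem fdm_union_zero {A₁ A₂ C : Set M} (h₁ : IsClosed A₁) (h₂ : IsClosed A₂)
    (hC : IsClosed C) (hAC₁ : A₁ ⊆ C) (hAC₂ : A₂ ⊆ C)
    (hf₁ : Fdm (Cy p C Set.univ 0) (Bd p A₁ Set.univ 0))
    (hf₂ : Fdm (Cy p C Set.univ 0) (Bd p A₂ Set.univ 0)) :
    Fdm (Cy p C Set.univ 0) (Bd p (A₁ ∪ A₂) Set.univ 0) :=
  (hf₁.inf hf₂).mono le_rfl fun _ hf => bd_union_zero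
    (Cy_mono hC (Set.union_subset hAC₁ hAC₂) (fun _ _ h => h) 0 hf.1) hf.2.1 hf.2.2 (h₁.union h₂)

end Fn

namespace Fn

/-- Every point of `M` has arbitrarily small `n`-dimensional box neighbourhoods. -/
def Boxes (n : ℕ) (M : Type*) [TopologicalSpace M] : Prop :=
  ∀ (x : M), ∀ U ∈ 𝓝 x, ∃ (X : Set M) (q : Fin n → M → ℝ) (a b : Fin n → ℝ), Box X q a b ∧ X ⊆ U ∧
    (∀ i, a i < b i) ∧ x ∈ X ∧ x ∈ Wbox q a b ∧ ∀ y ∈ X, y ∈ Wbox q a b → X ∈ 𝓝 y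

section

variable {p : ℕ} [Fact p.Prime] {M : Type*} [TopologicalSpace M] [CompactSpace M] [T2Space M]
    {n : ℕ}

theorem Boxes.fdm_cover (hB : Boxes n M) {j : ℕ} {C : Set M} (hC : IsClosed C)
    (hU : ∀ A₁ A₂ : Set M, IsClosed A₁ → IsClosed A₂ → A₁ ⊆ C → A₂ ⊆ C →
      Fdm (Cy p C Set.univ j) (Bd p A₁ Set.univ j) → Fdm (Cy p C Set.univ j) (Bd p A₂ Set.univ j) →
      ∀ B₁ B₂ : Set M, IsClosed B₁ → IsClosed B₂ → B₁ ⊆ interior A₁ → B₂ ⊆ interior A₂ →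
      Fdm (Cy p C Set.univ j) (Bd p (B₁ ∪ B₂) Set.univ j))
    {X : Set M} (hX : IsClosed X) (hXC : X ⊆ interior C) :
    Fdm (Cy p C Set.univ j) (Bd p X Set.univ j) := by
  obtain ⟨A, hA, hXA, -, h⟩ := hX.isCompact.induction_on
    (p := fun s => ∃ A, IsClosed A ∧ closure s ⊆ interior A ∧ A ⊆ C ∧
      Fdm (Cy p C Set.univ j) (Bd p A Set.univ j))
    ⟨∅, isClosed_empty, by simp, Set.empty_subset _, fdm_of_le fun f _ => K_empty_le_Bd
      fun x _ => van_of_notMem isClosed_empty f (Set.notMem_empty x)⟩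
    (fun s t hst ⟨A, hA, h⟩ => ⟨A, hA, (closure_mono hst).trans h.1, h.2⟩)
    (fun s t ⟨A₁, hA₁, hs₁, hC₁, h₁⟩ ⟨A₂, hA₂, hs₂, hC₂, h₂⟩ => by
      obtain ⟨u₁, ho₁, hu₁, hc₁⟩ := normal_exists_closure_subset isClosed_closure isOpen_interior hs₁
      obtain ⟨u₂, ho₂, hu₂, hc₂⟩ := normal_exists_closure_subset isClosed_closure isOpen_interior hs₂
      refine ⟨closure u₁ ∪ closure u₂, isClosed_closure.union isClosed_closure, ?_, ?_,
        hU A₁ A₂ hA₁ hA₂ hC₁ hC₂ h₁ h₂ _ _ isClosed_closure isClosed_closure hc₁ hc₂⟩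
      · rw [closure_union]
        exact (Set.union_subset_union hu₁ hu₂).trans (interior_maximal
          (Set.union_subset_union subset_closure subset_closure) (ho₁.union ho₂))
      · exact Set.union_subset (hc₁.trans (interior_subset.trans hC₁))
          (hc₂.trans (interior_subset.trans hC₂)))
    (fun x hx => by
      obtain ⟨A, q, a, b, hQ, hAC, hab, hxA, hxW, hn⟩ := hB x C (mem_interior_iff_mem_nhds.1 (hXC hx))
      obtain ⟨t, ht, htc, htA⟩ := exists_mem_nhds_isClosed_subset
        (interior_mem_nhds.2 (hn x hxA hxW))
      exact ⟨t, mem_nhdsWithin_of_mem_nhds ht, A, hQ.closed, htc.closure_eq.subset.trans htA, hAC,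
        (hQ.fdm (fun i => (hab i).le) j).mono (Cy_mono hC hAC (fun _ _ h => h) j) le_rfl⟩)
  exact h.mono le_rfl (Bd_mono hA (subset_closure.trans (hXA.trans interior_subset))
    (fun _ _ h => h) j)

theorem Boxes.fdm (hB : Boxes n M) : ∀ (j : ℕ) {C X : Set M}, IsClosed C → IsClosed X →
    X ⊆ interior C → Fdm (Cy p C Set.univ j) (Bd p X Set.univ j) := by
  intro j
  induction j with
  | zero =>
    intro C X hC hX hXC
    refine hB.fdm_cover hC (fun A₁ A₂ hA₁ hA₂ hC₁ hC₂ h₁ h₂ B₁ B₂ hB₁ hB₂ hc₁ hc₂ => ?_) hX hXC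
    exact (fdm_union_zero hA₁ hA₂ hC hC₁ hC₂ h₁ h₂).mono le_rfl
      (Bd_mono (hA₁.union hA₂) (Set.union_subset_union (hc₁.trans interior_subset)
        (hc₂.trans interior_subset)) (fun _ _ h => h) 0)
  | succ j ih =>
    intro C X hC hX hXC
    refine hB.fdm_cover hC (fun A₁ A₂ hA₁ hA₂ hC₁ hC₂ h₁ h₂ B₁ B₂ hB₁ hB₂ hc₁ hc₂ => ?_) hX hXC
    refine fdm_union_succ hA₁ hA₂ hB₁ hB₂ hC (hc₁.trans interior_subset)
      (hc₂.trans interior_subset) hC₁ hC₂ h₁ h₂ (ih (hA₁.inter hA₂) (hB₁.inter hB₂) ?_)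
    rw [interior_inter]
    exact Set.inter_subset_inter hc₁ hc₂

omit [Fact p.Prime] in
theorem Boxes.cd (hB : Boxes n M) : CD p n (Set.univ : Set M) := by
  refine cd_of_exc ?_
  obtain ⟨V, -, hV, h⟩ := isCompact_univ.induction_on
    (p := fun s : Set M => ∃ V, IsOpen V ∧ s ⊆ V ∧
      Exc p (1 : Unit →* Equiv.Perm M) Set.univ n V)
    ⟨∅, isOpen_empty, le_rfl, exc_empty _ _ _⟩
    (fun s t hst ⟨V, hV, h⟩ => ⟨V, hV, hst.trans h.1, h.2⟩)
    (fun s t ⟨V₁, ho₁, hs₁, h₁⟩ ⟨V₂, ho₂, hs₂, h₂⟩ => ⟨V₁ ∪ V₂, ho₁.union ho₂,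
      Set.union_subset_union hs₁ hs₂, Exc.union (Acts.one _) isClosed_univ (ropen_of_isOpen ho₁)
        (ropen_of_isOpen ho₂) (fun _ _ => Iff.rfl) (fun _ _ => Iff.rfl) h₁ h₂⟩)
    (fun x _ => by
      obtain ⟨A, q, a, b, hQ, -, hab, hxA, hxW, hn⟩ := hB x Set.univ Filter.univ_mem
      refine ⟨interior A, mem_nhdsWithin_of_mem_nhds (interior_mem_nhds.2 (hn x hxA hxW)),
        interior A, isOpen_interior, le_rfl, fun U hU hUo _ j hj f hf hd => ?_⟩
      have h1 : Ex p A U (j + 1) := ex_of_injOn hQ.closed hQ.cont hQ.bij.injOn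
        (hUo.mono (Set.subset_univ _)) hj
      have h2 : Ex p Set.univ U (j + 1) := h1.of_excision isClosed_univ (Set.subset_univ _)
        fun y _ hyU => mem_nhdsWithin_of_mem_nhds (mem_interior_iff_mem_nhds.1 (hU hyU))
      obtain ⟨u, hu, hfu⟩ := mem_Bd_succ.1 (h2 ⟨hf.1, hd⟩)
      exact ⟨u, ⟨hu, mem_inv_one u⟩, hfu⟩)
  rwa [Set.univ_subset_iff.1 hV] at h

end

variable {p : ℕ} [Fact p.Prime] {M : Type u} [TopologicalSpace M] {n : ℕ}

theorem finite_H {X : Set M} {N : ℕ} (h : Fdm (Cy p X Set.univ N) (Bd p X Set.univ N)) :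
    Module.Finite (ZMod p) ((L0 p ∅ X ⊤).H N) := by
  obtain ⟨R, hRS, hR, h⟩ := h.exists_le_sup
  let Z : Submodule (ZMod p) (LZ p X N) :=
    { carrier := {φ | ∀ f ∈ Bd p X Set.univ N, φ.1 f = 0}
      add_mem' := fun {φ ψ} hφ hψ f hf => by
        change φ.1 f + ψ.1 f = 0
        rw [hφ f hf, hψ f hf, add_zero]
      zero_mem' := fun _ _ => rfl
      smul_mem' := fun c φ hφ f hf => by
        change c • φ.1 f = 0
        rw [hφ f hf, smul_zero] }
  let α : Z →ₗ[ZMod p] (L0 p ∅ X ⊤).cyc N :=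
    { toFun := fun φ => ⟨lmk ∅ ⊤ φ.1, mem_cyc_iff.2 ⟨Set.univ, Filter.univ_mem, φ.2⟩⟩
      map_add' := fun _ _ => rfl
      map_smul' := fun _ _ => rfl }
  let β : Z →ₗ[ZMod p] (L0 p ∅ X ⊤).H N := Submodule.mkQ _ ∘ₗ α
  let res : Z →ₗ[ZMod p] Module.Dual (ZMod p) R :=
    { toFun := fun φ => φ.1.1 ∘ₗ R.subtype
      map_add' := fun _ _ => rfl
      map_smul' := fun _ _ => rfl }
  have hk : LinearMap.ker res ≤ LinearMap.ker β := by
    intro φ hφ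
    rw [LinearMap.mem_ker]
    refine (Submodule.Quotient.mk_eq_zero _).2 ?_
    refine (mem_bd_iff (φ := φ.1)).2 ⟨Set.univ, Filter.univ_mem, fun f hf => ?_⟩
    obtain ⟨r, hr, t, ht, rfl⟩ := Submodule.mem_sup.1 (h hf)
    rw [map_add, φ.2 t ht, add_zero]
    exact LinearMap.congr_fun (LinearMap.mem_ker.1 hφ) ⟨r, hr⟩
  have : Module.Finite (ZMod p) (Z ⧸ LinearMap.ker res) :=
    Module.Finite.equiv res.quotKerEquivRange.symm
  refine Module.Finite.of_surjective ((LinearMap.ker res).liftQ β hk) fun y => ?_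
  obtain ⟨⟨x, hx⟩, rfl⟩ := Submodule.Quotient.mk_surjective _ y
  obtain ⟨φ, rfl⟩ := lmk_surj ∅ ⊤ x
  obtain ⟨U, hU, hφ⟩ := mem_cyc_iff.1 hx
  rw [Filter.mem_top] at hU
  subst hU
  exact ⟨Submodule.Quotient.mk ⟨φ, hφ⟩, rfl⟩

theorem acyc_of_ex {X : Set M} {N : ℕ} (h : Ex p X Set.univ N) : (L0 p ∅ X ⊤).Acyc N := by
  intro x hx
  obtain ⟨φ, rfl⟩ := lmk_surj ∅ ⊤ x
  obtain ⟨U, hU, hφ⟩ := mem_cyc_iff.1 hx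
  rw [Filter.mem_top] at hU
  subst hU
  exact mem_bd_iff.2 ⟨Set.univ, Filter.univ_mem, fun f hf => hφ f (h hf)⟩

variable [CompactSpace M] [T2Space M]

theorem Boxes.exists_bet (hB : Boxes n M) : ∃ B, Bet p B (Set.univ : Set M) := by
  have hfin : ∀ N, ∃ k : ℕ, (L0 p ∅ (Set.univ : Set M) ⊤).h N = k := fun N => by
    have := finite_H (hB.fdm (p := p) N isClosed_univ isClosed_univ (by rw [interior_univ]))
    exact ⟨_, (Module.finrank_eq_rank _ _).symm⟩
  choose k hk using hfin
  have h0 : ∀ N, n < N → k N = 0 := fun N hN => by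
    obtain ⟨j, rfl⟩ : ∃ j, N = j + 1 := ⟨N - 1, by omega⟩
    have h1 : Ex p (Set.univ : Set M) Set.univ (j + 1) := fun f hf => mem_Bd_succ.2
      (hB.cd Set.univ (ropen_of_isOpen isOpen_univ) j (by omega) f hf.1 hf.2)
    have h2 := (acyc_of_ex h1).h_eq
    rw [hk] at h2
    exact_mod_cast h2
  refine ⟨∑ j ∈ Finset.range (n + 1), k j, fun N => ?_⟩
  unfold Cpx.Sop
  simp_rw [hk]
  norm_cast
  rw [← Finset.sum_filter_ne_zero]
  refine Finset.sum_le_sum_of_subset fun j hj => ?_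
  rw [Finset.mem_filter] at hj
  rw [Finset.mem_range]
  by_contra h
  exact hj.2 (h0 j (by omega))

theorem Boxes.exists_good (hB : Boxes n M) : ∃ B, Good p n B (Set.univ : Set M) := by
  obtain ⟨B, h⟩ := hB.exists_bet (p := p)
  refine ⟨B, isClosed_univ, hB.cd, fun x _ => ?_, h⟩
  obtain ⟨A, q, a, b, hQ, -, hab, hxA, hxW, hn⟩ := hB x Set.univ Filter.univ_mem
  exact ⟨n, hQ.or hab hn hxA hxW⟩

theorem boxes_of_charted (n : ℕ) (M : Type*) [TopologicalSpace M] [T2Space M]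
    [ChartedSpace (EuclideanSpace ℝ (Fin n)) M] : Boxes n M := by
  intro x U hU
  let e := chartAt (EuclideanSpace ℝ (Fin n)) x
  let T := EuclideanSpace.equiv (Fin n) ℝ
  let E := e.trans T.toHomeomorph.toOpenPartialHomeomorph
  have hx : x ∈ E.source := by simp [E, e]
  have h1 : E.target ∩ E.symm ⁻¹' U ∈ 𝓝 (E x) := by
    refine Filter.inter_mem (E.open_target.mem_nhds (E.map_source hx)) ?_
    refine (E.continuousAt_symm (E.map_source hx)).preimage_mem_nhds ?_
    rwa [E.left_inv hx]
  obtain ⟨ε, hε, hb⟩ := Metric.nhds_basis_closedBall.mem_iff.1 h1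
  set a : Fin n → ℝ := fun i => E x i - ε with ha
  set b : Fin n → ℝ := fun i => E x i + ε with hb'
  have hI : Set.Icc a b ⊆ E.target ∩ E.symm ⁻¹' U := by
    refine subset_trans (fun t ht => ?_) hb
    rw [Metric.mem_closedBall, dist_pi_le_iff hε.le]
    intro i
    have := ht.1 i
    have := ht.2 i
    rw [Real.dist_eq, abs_le]
    constructor <;> simp only [ha, hb'] at * <;> linarith
  have hIt : Set.Icc a b ⊆ E.target := fun t ht => (hI ht).1
  refine ⟨E.symm '' Set.Icc a b, fun i z => E z i, a, b, ⟨?_, fun i => ?_, ?_⟩, ?_, fun i => ?_, ?_,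
    fun i => ?_, ?_⟩
  · exact (isCompact_Icc.image_of_continuousOn (E.continuousOn_symm.mono hIt)).isClosed
  · refine (continuous_apply i).comp_continuousOn (E.continuousOn.mono ?_)
    rintro _ ⟨t, ht, rfl⟩
    exact E.map_target (hIt ht)
  · refine ⟨?_, ?_, fun t ht => ⟨_, ⟨t, ht, rfl⟩, E.right_inv (hIt ht)⟩⟩
    · rintro _ ⟨t, ht, rfl⟩
      change E (E.symm t) ∈ _
      rwa [E.right_inv (hIt ht)]
    · rintro _ ⟨t, ht, rfl⟩ _ ⟨s, hs, rfl⟩ hst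
      change E (E.symm t) = E (E.symm s) at hst
      rw [hst.symm.trans (E.right_inv (hIt ht)) |>.symm.trans (E.right_inv (hIt hs))]
  · rintro _ ⟨t, ht, rfl⟩
    exact (hI ht).2
  · simp only [ha, hb']
    linarith
  · refine ⟨E x, ⟨fun i => ?_, fun i => ?_⟩, E.left_inv hx⟩ <;> simp only [ha, hb'] <;> linarith
  · constructor <;> simp only [ha, hb'] <;> linarith
  · rintro _ ⟨t, ht, rfl⟩ hW
    have hs := E.map_target (hIt ht)
    have hO : Set.pi Set.univ (fun i => Set.Ioo (a i) (b i)) ∈ 𝓝 (E (E.symm t)) :=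
      (isOpen_set_pi Set.finite_univ fun i _ => isOpen_Ioo).mem_nhds fun i _ => hW i
    filter_upwards [E.open_source.mem_nhds hs, (E.continuousAt hs).preimage_mem_nhds hO] with z hz hzO
    exact ⟨E z, ⟨fun i => (hzO i trivial).1.le, fun i => (hzO i trivial).2.le⟩, E.left_inv hz⟩

end Fn

/-- For a compact topological `n`-manifold `M` and a natural number `P`, there is a
constant `C` such that for every prime `p ≤ P`, every finite `p`-group `G` acting
continuously and effectively on `M` has a characteristic subgroup `H` of index at most
`C`, containing the center `Z(G)`, whose action on `M` has at most `C` stabilizer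
subgroups. -/
theorem bounded_stabilizers_for_small_primes
    (n P : ℕ) (M : Type*) [TopologicalSpace M] [T2Space M]
    [SecondCountableTopology M] [ChartedSpace (EuclideanSpace ℝ (Fin n)) M]
    [CompactSpace M] :
    ∃ C : ℕ, ∀ (p : ℕ), p.Prime → p ≤ P →
      ∀ (G : Type) [Group G] [Finite G] [MulAction G M],
        IsPGroup p G →
        (∀ g : G, Continuous fun x : M => g • x) →
        (∀ g : G, (∀ x : M, g • x = x) → g = 1) →
        ∃ H : Subgroup G, H.Characteristic ∧ Subgroup.center G ≤ H ∧ H.index ≤ C ∧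
          (Set.range fun x : M => MulAction.stabilizer H x).Finite ∧
          (Set.range fun x : M => MulAction.stabilizer H x).ncard ≤ C := by
  classical
  have h : ∀ p : ℕ, ∃ C : ℕ, p.Prime → ∀ (G : Type) [Group G] [Finite G] [MulAction G M],
      IsPGroup p G → (∀ g : G, Continuous fun x : M => g • x) →
      (∀ g : G, (∀ x : M, g • x = x) → g = 1) →
      ∃ H : Subgroup G, H.Characteristic ∧ Subgroup.center G ≤ H ∧ H.index ≤ C ∧
        (Set.range fun x : M => MulAction.stabilizer H x).Finite ∧
        (Set.range fun x : M => MulAction.stabilizer H x).ncard ≤ C := fun p => by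
    by_cases hp : p.Prime
    · have : Fact p.Prime := ⟨hp⟩
      obtain ⟨B, hB⟩ := (Fn.boxes_of_charted n M).exists_good (p := p)
      obtain ⟨C, hC⟩ := Fn.exists_bound M p n B hB
      exact ⟨C, fun _ => hC⟩
    · exact ⟨0, fun h => absurd h hp⟩
  choose C hC using h
  refine ⟨(Finset.range (P + 1)).sup C, fun p hp hpP G _ _ _ hG hcont heff => ?_⟩
  have hle : C p ≤ (Finset.range (P + 1)).sup C :=
    Finset.le_sup (Finset.mem_range.2 (Nat.lt_succ_of_le hpP))
  obtain ⟨H, hH, hZ, hi, hf, hn⟩ := hC p hp G hG hcont heff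
  exact ⟨H, hH, hZ, hi.trans hle, hf, hn.trans hle⟩
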